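/- Let Q be a finite quiver without oriented cycles and T an indecomposable rigid representation of Q over F_q (that is, T is indecomposable and Ext^1_Q(T,T) = 0) of dimension vector alpha. Then for every dimension vector gamma, there exists a polynomial P in Z[t] with non-negative coefficients such that for every finite field F_{q'}, P(q') equals the number of F_{q'}-points of the quiver Grassmannian Gr_gamma(T'), where T' is the (unique up to isomorphism) indecomposable rigid representation of dimension vector alpha over F_{q'}; in particular |Gr_gamma(T)| = P(q), and P is the Poincare polynomial of Gr_gamma(T). -/

import Mathlib

/- Common setup: finite quivers, finite-dimensional representations over a
finite field, subrepresentations, quotients, Hall numbers, quiver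
Grassmannians and flags, extensions, and the (completed) Hall algebra,
following J. Fei, "Counting using Hall algebras I. Quivers". -/

open scoped BigOperators

attribute [local instance] Classical.propDecidable

namespace HallPaper

/-- A finite quiver: finitely many vertices and arrows. -/
structure FinQuiver where
  V : Type
  A : Type
  [fV : Fintype V]
  [fA : Fintype A]
  src : A → V
  tgt : A → V

attribute [instance] FinQuiver.fV FinQuiver.fA

/-- The additive Euler form `⟨α,β⟩_a = ∑_v α(v)β(v) - ∑_a α(ta)β(ha)`. -/
def eulerForm (Q : FinQuiver) (α β : Q.V → ℤ) : ℤ :=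
  (∑ v, α v * β v) - ∑ a, α (Q.src a) * β (Q.tgt a)

/-- The additive Euler form on dimension vectors. -/
def eulerFormN (Q : FinQuiver) (α β : Q.V → ℕ) : ℤ :=
  eulerForm Q (fun v => (α v : ℤ)) (fun v => (β v : ℤ))

/-- `Q` has no oriented cycles. -/
def NoCycles (Q : FinQuiver) : Prop :=
  ¬ ∃ (n : ℕ) (c : Fin (n + 1) → Q.A),
      (∀ i : Fin n, Q.tgt (c i.castSucc) = Q.src (c i.succ)) ∧
      Q.tgt (c (Fin.last n)) = Q.src (c 0)

/-- A finite-dimensional representation of a finite quiver `Q` over `k`. -/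
structure QRep (Q : FinQuiver) (k : Type) [Field k] where
  space : Q.V → Type
  [acg : ∀ v, AddCommGroup (space v)]
  [mod : ∀ v, Module k (space v)]
  [fd : ∀ v, FiniteDimensional k (space v)]
  map : ∀ a : Q.A, space (Q.src a) →ₗ[k] space (Q.tgt a)

attribute [instance] QRep.acg QRep.mod QRep.fd

namespace QRep

variable {Q : FinQuiver} {k : Type} [Field k]

/-- The dimension vector of a representation. -/
noncomputable def dimVec (M : QRep Q k) : Q.V → ℕ :=
  fun v => Module.finrank k (M.space v)

/-- A morphism of quiver representations. -/
structure Hom (M N : QRep Q k) where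
  app : ∀ v, M.space v →ₗ[k] N.space v
  comm : ∀ (a : Q.A) (x : M.space (Q.src a)),
    app (Q.tgt a) (M.map a x) = N.map a (app (Q.src a) x)

/-- The identity morphism. -/
def Hom.id (M : QRep Q k) : Hom M M :=
  ⟨fun _ => LinearMap.id, fun _ _ => rfl⟩

/-- Composition of morphisms. -/
def Hom.comp {M N P : QRep Q k} (g : Hom N P) (f : Hom M N) : Hom M P :=
  ⟨fun v => (g.app v).comp (f.app v), fun a x => by
    simp only [LinearMap.comp_apply, f.comm, g.comm]⟩

/-- An isomorphism of quiver representations. -/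
structure Iso (M N : QRep Q k) where
  app : ∀ v, M.space v ≃ₗ[k] N.space v
  comm : ∀ (a : Q.A) (x : M.space (Q.src a)),
    app (Q.tgt a) (M.map a x) = N.map a (app (Q.src a) x)

/-- Two representations are isomorphic. -/
def IsIsomorphic (M N : QRep Q k) : Prop := Nonempty (Iso M N)

/-- `a_M`, the number of automorphisms of `M`. -/
noncomputable def autCard (M : QRep Q k) : ℕ := Nat.card (Iso M M)

/-- `|Hom_Q(M,N)|`. -/
noncomputable def homCard (M N : QRep Q k) : ℕ := Nat.card (Hom M N)

/-- A subrepresentation: a family of subspaces stable under all arrow maps. -/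
structure SubRep (M : QRep Q k) where
  sub : ∀ v, Submodule k (M.space v)
  stable : ∀ (a : Q.A) (x : M.space (Q.src a)),
    x ∈ sub (Q.src a) → M.map a x ∈ sub (Q.tgt a)

namespace SubRep

variable {M : QRep Q k}

/-- A subrepresentation as a representation in its own right. -/
def toRep (L : SubRep M) : QRep Q k where
  space := fun v => L.sub v
  acg := fun _ => inferInstance
  mod := fun _ => inferInstance
  fd := fun _ => inferInstance
  map := fun a => (M.map a).restrict (fun x hx => L.stable a x hx)

/-- The quotient representation `M/L`. -/
def quotRep (L : SubRep M) : QRep Q k where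
  space := fun v => M.space v ⧸ L.sub v
  acg := fun _ => inferInstance
  mod := fun _ => inferInstance
  fd := fun _ => inferInstance
  map := fun a => Submodule.mapQ _ _ (M.map a) (fun x hx => L.stable a x hx)

/-- The dimension vector of a subrepresentation. -/
noncomputable def dim (L : SubRep M) : Q.V → ℕ :=
  fun v => Module.finrank k (L.sub v)

/-- The zero subrepresentation predicate. -/
def IsZero (L : SubRep M) : Prop := ∀ v, L.sub v = ⊥

/-- The full subrepresentation predicate. -/
def IsFull (L : SubRep M) : Prop := ∀ v, L.sub v = ⊤

/-- Containment of subrepresentations. -/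
def le (L L' : SubRep M) : Prop := ∀ v, L.sub v ≤ L'.sub v

/-- The subquotient `L'/L` of two nested subrepresentations. -/
def subquot (L L' : SubRep M) (h : L.le L') : QRep Q k where
  space := fun v => (L'.sub v) ⧸ ((L.sub v).comap (L'.sub v).subtype)
  acg := fun _ => inferInstance
  mod := fun _ => inferInstance
  fd := fun _ => inferInstance
  map := fun a =>
    Submodule.mapQ _ _ ((M.map a).restrict (fun x hx => L'.stable a x hx))
      (fun x hx => by
        have hx' : (x : M.space (Q.src a)) ∈ L.sub (Q.src a) := hx
        have := L.stable a x hx'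
        simpa [Submodule.mem_comap] using this)

end SubRep

/-- The number of points of the quiver Grassmannian `Gr_γ(M)`. -/
noncomputable def grCard (γ : Q.V → ℕ) (M : QRep Q k) : ℕ :=
  Nat.card {L : SubRep M // L.dim = γ}

/-- The Hall number `F_{UV}^W`: the number of subrepresentations `L ⊆ W`
with `L ≅ V` and `W/L ≅ U`. -/
noncomputable def hallNum (U V W : QRep Q k) : ℕ :=
  Nat.card {L : SubRep W // IsIsomorphic L.toRep V ∧ IsIsomorphic L.quotRep U}

/-- The number of points of the quiver flag variety `Fl_{α_t ⋯ α_1}(M)`;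
here `α i` is the dimension vector of the subquotient `L_{i+1}/L_i`. -/
noncomputable def flCard {t : ℕ} (α : Fin t → (Q.V → ℕ)) (M : QRep Q k) : ℕ :=
  Nat.card {L : Fin (t + 1) → SubRep M //
    (L 0).IsZero ∧ (L (Fin.last t)).IsFull ∧
    (∀ i : Fin t, (L i.castSucc).le (L i.succ)) ∧
    (∀ i : Fin t, ∀ v, (L i.succ).dim v = (L i.castSucc).dim v + α i v)}

/-- Cochains: the space whose quotient by coboundaries is `Ext¹_Q(U,V)`. -/
abbrev Cochain (U V : QRep Q k) :=
  ∀ a : Q.A, U.space (Q.src a) →ₗ[k] V.space (Q.tgt a)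

/-- The coboundary of a family of linear maps. -/
def coboundary {U V : QRep Q k} (f : ∀ v, U.space v →ₗ[k] V.space v) :
    Cochain U V :=
  fun a => (V.map a).comp (f (Q.src a)) - (f (Q.tgt a)).comp (U.map a)

/-- Two cochains define the same class in `Ext¹_Q(U,V)`. -/
def extRel (U V : QRep Q k) (z z' : Cochain U V) : Prop :=
  ∃ f, z' = z + coboundary f

/-- `|Ext¹_Q(U,V)|`. -/
noncomputable def ext1Card (U V : QRep Q k) : ℕ := Nat.card (Quot (extRel U V))

/-- The middle term of the extension of `U` by `V` defined by a cochain. -/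
def middle {U V : QRep Q k} (z : Cochain U V) : QRep Q k where
  space := fun v => V.space v × U.space v
  acg := fun _ => inferInstance
  mod := fun _ => inferInstance
  fd := fun _ => inferInstance
  map := fun a =>
    LinearMap.prod
      ((V.map a).comp (LinearMap.fst k _ _) + (z a).comp (LinearMap.snd k _ _))
      ((U.map a).comp (LinearMap.snd k _ _))

/-- `|Ext_Q(U,V)_W|`: the number of classes in `Ext¹_Q(U,V)` of extensions
with middle term isomorphic to `W`. -/
noncomputable def extWCard (U V W : QRep Q k) : ℕ :=
  Nat.card {e : Quot (extRel U V) //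
    ∃ z : Cochain U V, Quot.mk _ z = e ∧ IsIsomorphic (middle z) W}

/-- `T` is rigid, i.e. `Ext¹_Q(T,T) = 0`. -/
def IsRigid (T : QRep Q k) : Prop :=
  ∀ z : Cochain T T, ∃ f, z = coboundary f

/-- Direct sum of two representations. -/
def dsum (M N : QRep Q k) : QRep Q k where
  space := fun v => M.space v × N.space v
  acg := fun _ => inferInstance
  mod := fun _ => inferInstance
  fd := fun _ => inferInstance
  map := fun a => (M.map a).prodMap (N.map a)

/-- Finite direct sums of representations. -/
def dsumFin {ι : Type} [Fintype ι] (f : ι → QRep Q k) : QRep Q k where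
  space := fun v => ∀ i, (f i).space v
  acg := fun _ => inferInstance
  mod := fun _ => inferInstance
  fd := fun _ => inferInstance
  map := fun a => LinearMap.pi (fun i => ((f i).map a).comp (LinearMap.proj i))

/-- A simple representation. -/
def IsSimple (M : QRep Q k) : Prop :=
  M.dimVec ≠ 0 ∧ ∀ L : SubRep M, L.IsZero ∨ L.IsFull

/-- An indecomposable representation. -/
def Indecomposable (M : QRep Q k) : Prop :=
  M.dimVec ≠ 0 ∧
    ∀ A B : QRep Q k, IsIsomorphic M (dsum A B) → A.dimVec = 0 ∨ B.dimVec = 0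

end QRep

open QRep

/-- The affine space of `α`-dimensional representations: one matrix per arrow. -/
def StdRep (Q : FinQuiver) (k : Type) [Field k] (α : Q.V → ℕ) :=
  ∀ a : Q.A, Matrix (Fin (α (Q.tgt a))) (Fin (α (Q.src a))) k

instance (Q : FinQuiver) (k : Type) [Field k] [Fintype k] (α : Q.V → ℕ) :
    Finite (StdRep Q k α) := by
  unfold StdRep; infer_instance

/-- A point of `Rep_α(Q)` as an abstract representation. -/
def StdRep.toQRep {Q : FinQuiver} {k : Type} [Field k] {α : Q.V → ℕ}
    (W : StdRep Q k α) : QRep Q k where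
  space := fun v => Fin (α v) → k
  acg := fun _ => inferInstance
  mod := fun _ => inferInstance
  fd := fun _ => inferInstance
  map := fun a => Matrix.mulVecLin (W a)

/-- Isomorphism relation on `α`-dimensional representations. -/
def isoRel (Q : FinQuiver) (k : Type) [Field k] (α : Q.V → ℕ)
    (W W' : StdRep Q k α) : Prop :=
  IsIsomorphic W.toQRep W'.toQRep

/-- Isomorphism classes of `α`-dimensional representations of `Q` over `k`. -/
def IsoClass (Q : FinQuiver) (k : Type) [Field k] (α : Q.V → ℕ) :=
  Quot (isoRel Q k α)

/-- A representative representation of an isomorphism class. -/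
noncomputable def IsoClass.rep {Q : FinQuiver} {k : Type} [Field k]
    {α : Q.V → ℕ} (c : IsoClass Q k α) : QRep Q k :=
  (Quot.out c).toQRep

/-- Isomorphism classes of representations of all dimension vectors. -/
abbrev TotalClass (Q : FinQuiver) (k : Type) [Field k] :=
  Σ α : Q.V → ℕ, IsoClass Q k α

/-- A representative of a class in `TotalClass`. -/
noncomputable def TotalClass.rep {Q : FinQuiver} {k : Type} [Field k]
    (c : TotalClass Q k) : QRep Q k :=
  c.2.rep

section Counting

variable (Q : FinQuiver) (k : Type) [Field k] [Fintype k]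

/-- `|Rep_α(Q)(F_q)|`. -/
noncomputable def repCard (α : Q.V → ℕ) : ℕ := Nat.card (StdRep Q k α)

/-- `|GL_α(F_q)|`. -/
noncomputable def glCard (α : Q.V → ℕ) : ℕ :=
  Nat.card (∀ v : Q.V, Matrix.GeneralLinearGroup (Fin (α v)) k)

/-- `r_α(q) = |Rep_α(Q)| / |GL_α|`. -/
noncomputable def rFun (α : Q.V → ℕ) : ℚ :=
  (repCard Q k α : ℚ) / (glCard Q k α : ℚ)

end Counting

section Slope

variable {Q : FinQuiver}

/-- The value of a weight (`ℤ`-linear functional) on a dimension vector. -/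
def wt (σ : Q.V → ℤ) (α : Q.V → ℕ) : ℤ := ∑ v, σ v * α v

/-- The slope `μ(α) = σ(α)/θ(α)`. -/
noncomputable def slope (σ θ : Q.V → ℤ) (α : Q.V → ℕ) : ℚ :=
  (wt σ α : ℚ) / (wt θ α : ℚ)

/-- `θ` is positive on all nonzero dimension vectors (so `σ/θ` is a slope
function). -/
def SlopeOK (θ : Q.V → ℤ) : Prop :=
  ∀ α : Q.V → ℕ, α ≠ 0 → 0 < wt θ α

variable {k : Type} [Field k]

/-- `μ`-semistability. -/
def IsSemistable (σ θ : Q.V → ℤ) (M : QRep Q k) : Prop :=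
  ∀ L : SubRep M, ¬ L.IsZero → ¬ L.IsFull →
    slope σ θ L.dim ≤ slope σ θ M.dimVec

/-- `μ`-stability. -/
def IsStable (σ θ : Q.V → ℤ) (M : QRep Q k) : Prop :=
  ∀ L : SubRep M, ¬ L.IsZero → ¬ L.IsFull →
    slope σ θ L.dim < slope σ θ M.dimVec

/-- `μ` is coprime to `α`: `μ(γ) ≠ μ(α)` for all `0 < γ < α`. -/
def Coprime (σ θ : Q.V → ℤ) (α : Q.V → ℕ) : Prop :=
  ∀ γ : Q.V → ℕ, γ ≠ 0 → γ ≤ α → γ ≠ α → slope σ θ γ ≠ slope σ θ α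

end Slope

section Decomp

variable {Q : FinQuiver}

/-- Ordered decompositions `α = α_1 + ⋯ + α_s` into nonzero dimension vectors
with strictly increasing slopes (Harder–Narasimhan type). -/
structure HNDecomp (σ θ : Q.V → ℤ) (α : Q.V → ℕ) where
  s : ℕ
  pos : 0 < s
  d : Fin s → (Q.V → ℕ)
  nonzero : ∀ i, d i ≠ 0
  total : ∑ i, d i = α
  incr : ∀ i j : Fin s, i < j → slope σ θ (d i) < slope σ θ (d j)

/-- Ordered decompositions `α = α_1 + ⋯ + α_s` into nonzero dimension vectors
with `μ(α_1 + ⋯ + α_k) < μ(α)` for all `k < s`. -/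
structure StarDecomp (σ θ : Q.V → ℤ) (α : Q.V → ℕ) where
  s : ℕ
  pos : 0 < s
  d : Fin s → (Q.V → ℕ)
  nonzero : ∀ i, d i ≠ 0
  total : ∑ i, d i = α
  partial_lt : ∀ kk : Fin s, (kk : ℕ) + 1 < s →
    slope σ θ (∑ i ∈ Finset.Iic kk, d i) < slope σ θ α

end Decomp

section Hall

variable (Q : FinQuiver) (k : Type) [Field k]

/-- The underlying space of the completed Hall algebra: formal (possibly
infinite) linear combinations of isomorphism classes. -/
abbrev HallAlg := TotalClass Q k → ℚ

/-- The Hall product `[U][V] = ∑_{[W]} F_{UV}^W [W]`, written on coefficient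
functions. -/
noncomputable def hallMul (x y : HallAlg Q k) : HallAlg Q k :=
  fun W => ∑ᶠ (U : TotalClass Q k) (V : TotalClass Q k),
    x U * y V * (hallNum U.rep V.rep W.rep : ℚ)

/-- The unit `[0]` of the Hall algebra. -/
noncomputable def hallOne : HallAlg Q k :=
  fun c => if c.1 = 0 then 1 else 0

/-- Iterated Hall product of a list. -/
noncomputable def hallProd (l : List (HallAlg Q k)) : HallAlg Q k :=
  l.foldr (hallMul Q k) (hallOne Q k)

/-- The twisted Hall product `[U][V] = ∑_{[W]} q^{⟨dim U, dim V⟩} F_{UV}^W [W]`. -/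
noncomputable def hallMulTw [Fintype k] (x y : HallAlg Q k) : HallAlg Q k :=
  fun W => ∑ᶠ (U : TotalClass Q k) (V : TotalClass Q k),
    x U * y V * ((Fintype.card k : ℚ) ^ eulerFormN Q U.rep.dimVec V.rep.dimVec) *
      (hallNum U.rep V.rep W.rep : ℚ)

/-- `χ_α`, the sum of all `[M]` with `dim M = α`. -/
noncomputable def chiElt (α : Q.V → ℕ) : HallAlg Q k :=
  fun c => if c.1 = α then 1 else 0

/-- `χ_α^{ss}`, the sum of all semistable `[M]` with `dim M = α`. -/
noncomputable def chiSS (σ θ : Q.V → ℤ) (α : Q.V → ℕ) : HallAlg Q k :=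
  fun c => if c.1 = α ∧ IsSemistable σ θ c.rep then 1 else 0

/-- The completed quantum polynomial algebra `P_{⟨Q⟩}` (coefficient functions
on monomials `t^α`). -/
abbrev QPoly := (Q.V → ℕ) → ℚ

/-- Multiplication `t^α t^β = q^{-⟨α,β⟩_a} t^{α+β}` of `P_{⟨Q⟩}`. -/
noncomputable def qpolyMul [Fintype k] (x y : QPoly Q) : QPoly Q :=
  fun α => ∑ᶠ (β : Q.V → ℕ) (γ : Q.V → ℕ),
    if β + γ = α then
      ((Fintype.card k : ℚ) ^ (-(eulerFormN Q β γ))) * x β * y γ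
    else 0

/-- The unit of `P_{⟨Q⟩}`. -/
noncomputable def qpolyOne : QPoly Q :=
  fun α => if α = 0 then 1 else 0

/-- The integration map `∫ : H(Q) → P_{⟨Q⟩}`, `[M] ↦ a_M⁻¹ t^{dim M}`. -/
noncomputable def intChar (x : HallAlg Q k) : QPoly Q :=
  fun α => ∑ᶠ c : IsoClass Q k α, x ⟨α, c⟩ / (autCard (IsoClass.rep c) : ℚ)

end Hall

section Chains

variable {Q : FinQuiver} {k : Type} [Field k]

/-- The number of strict chains `0 = W_0 < W_1 < ⋯ < W_i = W` of
subrepresentations. -/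
noncomputable def chainCount (M : QRep Q k) (i : ℕ) : ℕ :=
  Nat.card {L : Fin (i + 1) → SubRep M //
    (L 0).IsZero ∧ (L (Fin.last i)).IsFull ∧
    ∀ j : Fin i, (L j.castSucc).le (L j.succ) ∧
      (L j.castSucc).sub ≠ (L j.succ).sub}

/-- `F_W = ∑_i (-1)^i F_i(W)`, the alternating sum of numbers of strict
chains of subrepresentations. -/
noncomputable def FW (M : QRep Q k) : ℚ :=
  ∑ᶠ i : ℕ, (-1 : ℚ) ^ i * (chainCount M i : ℚ)

end Chains

set_option linter.all false
open Equiv (swap swap_apply_def swap_apply_of_ne_of_ne swap_apply_self ofBijective Perm sigmaFiberEquiv 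
 swap_apply_left swap_apply_right swap_comm)
open Finset (univ sum_congr disjoint_sdiff mem_powerset mem_filter disjoint_left mem_univ range 
 mem_product sdiff_subset mul_sum union_sdiff_of_subset mem_sdiff exists_ne_zero_of_sum_ne_zero 
 subset_univ sum_add_distrib prod_mul_distrib add_sum_erase sum_eq_zero cons_induction prod_congr 
 sum_eq_single_of_mem card_le_card mem_union mem_range card_filter card_union_of_disjoint prod_bij' 
 prod_ne_zero_iff sum_mul sum_sub_distrib card_lt_card sum_map sum_filter mem_sigma union_subset_union 
 sum_cons mem_erase ssubset_iff_of_subset prod_union sum_comm sum_div sum_union disjoint_right sum_product 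
 mul_prod_erase sum_bij' card_bij' card_range card_eq_zero prod_cons subset_empty sum_const card_univ 
 sum_nonneg prod_pos)
open Function (Injective comp Surjective iterate_succ_apply' Bijective)
open Module (finrank End finrank_fin_fun Basis)
open ENNReal (ofReal pow_ne_top ofReal_ne_top mul_ne_top toReal_mul toReal_ofReal toReal_pow toReal_prod 
 toReal toReal_sum)
open LinearMap (ker comp_apply mem_ker mulLeft finrank_range_add_finrank_ker ker_eq_bot toMatrix 
 injective_iff_surjective toMatrix' mulLeft_apply range_eq_top exists_extend snd inl toMatrix_comp 
 inr fst)
open Submodule (span mem_sup mem_bot subset_span smul_mem add_mem_sup mem_sup_right add_mem span_le 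
 mem_sup_left span_induction neg_mem finrank_map_subtype_eq finrank_mono mem_iInf finrank_le)
open Matrix (GeneralLinearGroup mulVecLin)
open Subtype (val mk)
open Nat (card_congr card_prod)
open Set (mem_setOf_eq)
open IsFractionRing (injective)
open Multiset (count_map)
open Fintype (ofFinite card_pos card_coe)
open LinearEquiv (symm_apply_apply ofFinrankEq apply_symm_apply skewProd_apply finrank_map_eq ofInjectiveEndo)
section A1
open MvPolynomial

variable {Ω : Type}

/-- The polynomial ring. -/
abbrev PS (Ω : Type) := MvPolynomial Ω ℚ
/-- Its fraction field. -/
abbrev PF (Ω : Type) := FractionRing (MvPolynomial Ω ℚ)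

noncomputable def lin (i j : Ω) : PS Ω := X j - X i

/-- substitution `X j ↦ X i` -/
noncomputable def collapse (i j : Ω) : PS Ω →ₐ[ℚ] PS Ω :=
  aeval (fun k => if k = j then X i else X k)

lemma lin_dvd_sub_collapse (i j : Ω) (f : PS Ω) : lin i j ∣ f - collapse i j f := by
  induction f using MvPolynomial.induction_on with
  | C a => simp [collapse]
  | add p q hp hq =>
    have : p + q - collapse i j (p + q) = (p - collapse i j p) + (q - collapse i j q) := by
      rw [map_add]; ring
    rw [this]; exact dvd_add hp hq
  | mul_X p k hp =>
    have : p * X k - collapse i j (p * X k)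
        = (p - collapse i j p) * X k + collapse i j p * (X k - collapse i j (X k)) := by
      rw [map_mul]; ring
    rw [this]
    refine dvd_add (hp.mul_right _) (Dvd.dvd.mul_left ?_ _)
    by_cases h : k = j
    · subst h; simp [collapse, lin]
    · simp [collapse, h]

lemma collapse_lin (i j : Ω) : collapse i j (lin i j) = 0 := by
  by_cases h : i = j <;> simp [collapse, lin, h]

lemma lin_dvd_iff (i j : Ω) (f : PS Ω) : lin i j ∣ f ↔ collapse i j f = 0 := by
  constructor
  · rintro ⟨g, rfl⟩; rw [map_mul, collapse_lin, zero_mul]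
  · intro h; have := lin_dvd_sub_collapse i j f; rwa [h, sub_zero] at this

lemma lin_ne_zero {i j : Ω} (h : i ≠ j) : lin i j ≠ 0 := by
  intro h0
  have : (X j : PS Ω) = X i := sub_eq_zero.mp h0
  exact h (X_injective (R := ℚ) this).symm

lemma lin_prime {i j : Ω} (h : i ≠ j) : Prime (lin i j) := by
  refine ⟨lin_ne_zero h, ?_, ?_⟩
  · intro hu
    have := (lin_dvd_iff i j 1).1 hu.dvd
    simp at this
  · intro a b hab
    rw [lin_dvd_iff, map_mul, mul_eq_zero] at hab
    simpa only [lin_dvd_iff] using hab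

lemma lin_dvd_lin {i j k l : Ω} (hkl : k ≠ l) (h : lin i j ∣ lin k l) :
    (k = i ∧ l = j) ∨ (k = j ∧ l = i) := by
  rw [lin_dvd_iff] at h
  simp only [collapse, lin, map_sub, aeval_X, sub_eq_zero] at h
  have hinj := X_injective (R := ℚ) (σ := Ω)
  by_cases h1 : l = j <;> by_cases h2 : k = j <;> simp [h1, h2, hinj.eq_iff] at h
  · exact absurd (h2.trans h1.symm) hkl
  · exact Or.inl ⟨h.symm, h1⟩
  · exact Or.inr ⟨h2, h⟩
  · exact absurd h.symm hkl

lemma lin_swap (i j : Ω) : lin j i = - lin i j := by simp [lin]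

/-- the swap automorphism -/
noncomputable def sw (i j : Ω) : PS Ω →ₐ[ℚ] PS Ω := rename (swap i j)

@[simp] lemma sw_X (i j k : Ω) : sw i j (X k) = X (swap i j k) := by
  simp [sw]

@[simp] lemma sw_lin (i j a b : Ω) :
    sw i j (lin a b) = lin (swap i j a) (swap i j b) := by
  simp [lin]

lemma sw_sw (i j : Ω) (f : PS Ω) : sw i j (sw i j f) = f := by
  have : swap i j * swap i j = 1 := Equiv.swap_mul_self i j
  simp only [sw, rename_rename]
  have h2 : (⇑(swap i j) ∘ ⇑(swap i j)) = id := by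
    funext x; simp
  rw [h2, rename_id]; rfl

lemma lin_dvd_sub_sw (i j : Ω) (f : PS Ω) : lin i j ∣ f - sw i j f := by
  rw [lin_dvd_iff, map_sub, sub_eq_zero]
  have : (collapse i j) = (collapse i j).comp (sw i j) := by
    apply MvPolynomial.algHom_ext
    intro k
    simp only [AlgHom.comp_apply, sw_X, collapse, aeval_X]
    by_cases h : k = i
    · subst h; simp
    · grind
  conv_lhs => rw [this]
  rfl

/-! ### regularity -/

/-- regular along `π` -/
def Rg (π : PS Ω) (a : PF Ω) : Prop :=
  ∃ n d : PS Ω, ¬ π ∣ d ∧ a * algebraMap _ _ d = algebraMap _ _ n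

/-- vanishing along `π` -/
def Cg (π : PS Ω) (a : PF Ω) : Prop :=
  ∃ n d : PS Ω, ¬ π ∣ d ∧ a * algebraMap _ _ d = algebraMap _ _ (π * n)

lemma Rg.add {π : PS Ω} (hπ : Prime π) {a b : PF Ω} (ha : Rg π a) (hb : Rg π b) :
    Rg π (a + b) := by
  obtain ⟨n, d, hd, h⟩ := ha
  obtain ⟨n', d', hd', h'⟩ := hb
  refine ⟨n * d' + n' * d, d * d', fun hh => (hπ.dvd_or_dvd hh).elim hd hd', ?_⟩
  grind

lemma Cg.add {π : PS Ω} (hπ : Prime π) {a b : PF Ω} (ha : Cg π a) (hb : Cg π b) :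
    Cg π (a + b) := by
  obtain ⟨n, d, hd, h⟩ := ha
  obtain ⟨n', d', hd', h'⟩ := hb
  refine ⟨n * d' + n' * d, d * d', fun hh => (hπ.dvd_or_dvd hh).elim hd hd', ?_⟩
  grind

lemma Rg.zero {π : PS Ω} (hπ : Prime π) : Rg π (0 : PF Ω) :=
  ⟨0, 1, fun h => hπ.not_isUnit (isUnit_of_dvd_one h), by simp⟩
lemma Cg.zero {π : PS Ω} (hπ : Prime π) : Cg π (0 : PF Ω) :=
  ⟨0, 1, fun h => hπ.not_isUnit (isUnit_of_dvd_one h), by simp⟩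

lemma Rg.sum {π : PS Ω} (hπ : Prime π) {ι : Type*} (s : Finset ι) (f : ι → PF Ω)
    (h : ∀ i ∈ s, Rg π (f i)) : Rg π (∑ i ∈ s, f i) := by
  induction s using cons_induction with
  | empty => simpa using Rg.zero hπ
  | cons a s ha ih =>
    rw [sum_cons]
    exact (h a (by simp)).add hπ (ih fun i hi => h i (by simp [hi]))
lemma Cg.sum {π : PS Ω} (hπ : Prime π) {ι : Type*} (s : Finset ι) (f : ι → PF Ω)
    (h : ∀ i ∈ s, Cg π (f i)) : Cg π (∑ i ∈ s, f i) := by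
  induction s using cons_induction with
  | empty => simpa using Cg.zero hπ
  | cons a s ha ih =>
    rw [sum_cons]
    exact (h a (by simp)).add hπ (ih fun i hi => h i (by simp [hi]))

lemma Rg.div {π : PS Ω} (n d : PS Ω) (hd : ¬ π ∣ d) :
    Rg π (algebraMap _ (PF Ω) n / algebraMap _ (PF Ω) d) := by
  refine ⟨n, d, hd, ?_⟩
  have : algebraMap _ (PF Ω) d ≠ 0 := by
    intro h; apply hd
    rw [(injective (PS Ω) (PF Ω)).eq_iff' (map_zero _) |>.1 h]
    exact dvd_zero _
  field_simp

lemma Cg.dvd {π : PS Ω} (hπ : Prime π) {f : PS Ω} (h : Cg π (algebraMap _ (PF Ω) f)) :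
    π ∣ f := by
  obtain ⟨n, d, hd, h⟩ := h
  rw [← map_mul] at h
  have := injective (PS Ω) (PF Ω) h
  exact (hπ.dvd_or_dvd (this ▸ dvd_mul_right π n : π ∣ f * d)).resolve_right hd

/-- polynomiality -/
def IsPoly (a : PF Ω) : Prop := ∃ f : PS Ω, algebraMap _ _ f = a

lemma isPoly_of_Rg (a : PF Ω) (P : PS Ω)
    (haP : IsPoly (a * algebraMap _ _ P))
    (hPr : ∀ π : PS Ω, Prime π → π ∣ P → Rg π a) : IsPoly a := by
  obtain ⟨f, hf⟩ := haP
  -- reduce to lowest terms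
  obtain ⟨n, d, hrel, ha⟩ := IsFractionRing.exists_reduced_fraction (A := PS Ω) a
  have hd0 : (d : PS Ω) ≠ 0 := nonZeroDivisors.coe_ne_zero d
  have hinj := injective (PS Ω) (PF Ω)
  have hadn : a * algebraMap _ (PF Ω) (d : PS Ω) = algebraMap _ _ n := by
    rw [← ha, IsLocalization.mk'_spec]
  have e1 : n * P = f * d := by
    apply hinj
    rw [map_mul, map_mul, ← hadn, hf]; ring
  have hdP : (d : PS Ω) ∣ P := hrel.symm.dvd_of_dvd_mul_left ⟨f, by rw [e1]; ring⟩
  have hu : IsUnit (d : PS Ω) := by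
    by_contra hnu
    obtain ⟨π, hπi, hπd⟩ := WfDvdMonoid.exists_irreducible_factor hnu hd0
    have hπ : Prime π := UniqueFactorizationMonoid.irreducible_iff_prime.1 hπi
    obtain ⟨n', d', hd', h'⟩ := hPr π hπ (hπd.trans hdP)
    have e2 : n * d' = n' * d := by
      apply hinj
      rw [map_mul, map_mul, ← hadn, ← h']; ring
    have hπn : π ∣ n :=
      (hπ.dvd_or_dvd (e2 ▸ hπd.mul_left n' : π ∣ n * d')).resolve_right hd'
    exact hπ.not_isUnit (hrel hπn hπd)
  obtain ⟨u, hu⟩ := hu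
  refine ⟨n * (↑u⁻¹ : PS Ω), ?_⟩
  rw [map_mul, ← hadn, mul_assoc, ← map_mul, ← hu]
  simp

end A1
section A2
open MvPolynomial

variable {Ω V : Type} (v : Ω → V)

/-- vertex product -/
noncomputable def vt (A B : Finset Ω) : PS Ω :=
  ∏ p ∈ A ×ˢ B, if v p.1 = v p.2 then lin p.1 p.2 else 1

/-- image of a finset under a permutation -/
def pm (σ : Perm Ω) (A : Finset Ω) : Finset Ω := A.map σ.toEmbedding

lemma mem_pm (σ : Perm Ω) (A : Finset Ω) (x : Ω) : x ∈ pm σ A ↔ σ.symm x ∈ A := by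
  simp [pm, Finset.mem_map_equiv]

lemma mem_pm_swap (i j : Ω) (A : Finset Ω) (x : Ω) :
    x ∈ pm (swap i j) A ↔ swap i j x ∈ A := by
  simp [mem_pm]

lemma pm_pm_swap (i j : Ω) (A : Finset Ω) :
    pm (swap i j) (pm (swap i j) A) = A := by
  ext x; simp [mem_pm_swap]

lemma pm_sdiff (σ : Perm Ω) (A B : Finset Ω) : pm σ (A \ B) = pm σ A \ pm σ B := by
  ext x; simp [mem_pm]

lemma pm_subset (σ : Perm Ω) {A B : Finset Ω} : pm σ A ⊆ pm σ B ↔ A ⊆ B := by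
  simp [pm]

lemma swap_mem_iff {i j : Ω} {Z : Finset Ω} (h : i ∈ Z ↔ j ∈ Z) (x : Ω) :
    swap i j x ∈ Z ↔ x ∈ Z := by
  grind

lemma pm_swap_eq {i j : Ω} {Z : Finset Ω} (h : i ∈ Z ↔ j ∈ Z) :
    pm (swap i j) Z = Z := by
  ext x; rw [mem_pm_swap, swap_mem_iff h]

lemma v_swap {i j : Ω} (h : v i = v j) (x : Ω) : v (swap i j x) = v x := by
  grind

lemma sw_vt {i j : Ω} (h : v i = v j) (A B : Finset Ω) :
    sw i j (vt v A B) = vt v (pm (swap i j) A) (pm (swap i j) B) := by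
  unfold vt
  rw [map_prod]
  refine prod_bij' (fun p _ => (swap i j p.1, swap i j p.2))
    (fun p _ => (swap i j p.1, swap i j p.2)) ?_ ?_ ?_ ?_ ?_
  · intro p hp; simpa [mem_pm_swap] using hp
  · intro p hp; simpa [mem_pm_swap] using hp
  · intro p _; simp
  · intro p _; simp
  · intro p _
    simp only [v_swap v h]
    split_ifs <;> simp

lemma vt_prime_dvd {A B : Finset Ω} (hAB : Disjoint A B) {π : PS Ω} (hπ : Prime π)
    (h : π ∣ vt v A B) : ∃ i ∈ A, ∃ j ∈ B, v i = v j ∧ i ≠ j ∧ π ∣ lin i j := by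
  obtain ⟨p, hp, hd⟩ := hπ.exists_mem_finset_dvd h
  rw [mem_product] at hp
  split_ifs at hd with hv
  · exact ⟨p.1, hp.1, p.2, hp.2, hv,
      fun he => (disjoint_left.1 hAB hp.1) (he ▸ hp.2), hd⟩
  · exact absurd (isUnit_of_dvd_one hd) hπ.not_isUnit

lemma lin_dvd_vt {A B : Finset Ω} (hAB : Disjoint A B) {i j : Ω} (hij : i ≠ j)
    (h : lin i j ∣ vt v A B) : (i ∈ A ∧ j ∈ B) ∨ (j ∈ A ∧ i ∈ B) := by
  obtain ⟨a, ha, b, hb, hv, hab, hd⟩ := vt_prime_dvd v hAB (lin_prime hij) h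
  rcases lin_dvd_lin hab hd with ⟨rfl, rfl⟩ | ⟨rfl, rfl⟩
  · exact Or.inl ⟨ha, hb⟩
  · exact Or.inr ⟨ha, hb⟩

lemma vt_ne_zero {A B : Finset Ω} (hAB : Disjoint A B) : vt v A B ≠ 0 := by
  unfold vt
  rw [prod_ne_zero_iff]
  intro p hp
  rw [mem_product] at hp
  split_ifs
  · exact lin_ne_zero fun he => (disjoint_left.1 hAB hp.1) (he ▸ hp.2)
  · exact one_ne_zero

lemma amap_ne_zero {f : PS Ω} (h : f ≠ 0) : algebraMap (PS Ω) (PF Ω) f ≠ 0 := by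
  simp_all

lemma amap_inj {f g : PS Ω} (h : algebraMap (PS Ω) (PF Ω) f = algebraMap (PS Ω) (PF Ω) g) :
    f = g := injective (PS Ω) (PF Ω) h

lemma vt_split {A B : Finset Ω} (hAB : Disjoint A B) {i j : Ω} (hi : i ∈ A) (hj : j ∈ B)
    (hv : v i = v j) : ∃ u : PS Ω, vt v A B = lin i j * u ∧ ¬ lin i j ∣ u := by
  have hij : i ≠ j := fun he => (disjoint_left.1 hAB hi) (he ▸ hj)
  have hmem : (i, j) ∈ A ×ˢ B := Finset.mk_mem_product hi hj
  refine ⟨∏ p ∈ (A ×ˢ B).erase (i, j), if v p.1 = v p.2 then lin p.1 p.2 else 1, ?_, ?_⟩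
  · unfold vt
    rw [← mul_prod_erase _ _ hmem]
    simp [hv]
  · intro h
    obtain ⟨p, hp, hd⟩ := (lin_prime hij).exists_mem_finset_dvd h
    rw [mem_erase, mem_product] at hp
    split_ifs at hd with hv
    · have hab : p.1 ≠ p.2 := fun he => (disjoint_left.1 hAB hp.2.1) (he ▸ hp.2.2)
      rcases lin_dvd_lin hab hd with ⟨h1, h2⟩ | ⟨h1, h2⟩
      · exact hp.1 (Prod.ext h1 h2)
      · exact (disjoint_left.1 hAB hi) (h2 ▸ hp.2.2)
    · exact (lin_prime hij).not_isUnit (isUnit_of_dvd_one hd)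

/-- a term of the localization integral -/
noncomputable def Iterm (Z : Finset Ω) (F : Finset Ω → PS Ω) (T : Finset Ω) : PF Ω :=
  algebraMap _ _ (F T) / algebraMap _ _ (vt v T (Z \ T))

/-- the localization integral in the fraction field -/
noncomputable def intF (Z : Finset Ω) (F : Finset Ω → PS Ω) : PF Ω :=
  ∑ T ∈ Z.powerset, Iterm v Z F T

/-- the GKM condition -/
def GKM (Z : Finset Ω) (F : Finset Ω → PS Ω) : Prop :=
  ∀ T ⊆ Z, ∀ i ∈ Z, ∀ j ∈ Z, v i = v j → lin i j ∣ F T - F (pm (swap i j) T)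

lemma Rg.half {π : PS Ω} {a : PF Ω} (h : Rg π (a + a)) : Rg π a := by
  obtain ⟨n, d, hd, h⟩ := h
  refine ⟨C (1/2) * n, d, hd, ?_⟩
  have e : algebraMap (PS Ω) (PF Ω) (C (1/2)) * 2 = 1 := by
    rw [← map_ofNat (algebraMap (PS Ω) (PF Ω)) 2, ← map_mul]
    have : (C (1/2) : PS Ω) * 2 = 1 := by
      rw [← map_ofNat (C : ℚ →+* PS Ω) 2, ← map_mul]; norm_num
    rw [this, map_one]
  rw [map_mul, ← h]
  grind

lemma sum_pm_swap {M : Type*} [AddCommMonoid M] {Z Z' : Finset Ω} {i j : Ω}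
    (h : pm (swap i j) Z = Z') (f : Finset Ω → M) :
    ∑ T ∈ Z'.powerset, f T = ∑ T ∈ Z.powerset, f (pm (swap i j) T) := by
  subst h
  refine sum_bij' (fun T _ => pm (swap i j) T)
    (fun T _ => pm (swap i j) T) ?_ ?_ ?_ ?_ ?_
  · intro T hT
    rw [mem_powerset] at *
    rw [← pm_subset (swap i j), pm_pm_swap]; exact hT
  · intro T hT
    rw [mem_powerset] at *
    rwa [pm_subset]
  · intro T _; exact pm_pm_swap i j T
  · intro T _; exact pm_pm_swap i j T
  · intro T _; rw [pm_pm_swap]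

lemma Iterm_pair {Z : Finset Ω} {F : Finset Ω → PS Ω} (hF : GKM v Z F) {T : Finset Ω}
    (hT : T ⊆ Z) {i j : Ω} (hi : i ∈ T) (hj : j ∈ Z \ T) (hv : v i = v j) :
    Rg (lin i j) (Iterm v Z F T + Iterm v Z F (pm (swap i j) T)) := by
  have hdis : Disjoint T (Z \ T) := disjoint_sdiff
  have hij : i ≠ j := fun he => (disjoint_left.1 hdis hi) (he ▸ hj)
  have hπ := lin_prime hij
  obtain ⟨u, hu, hnu⟩ := vt_split v hdis hi hj hv
  have hiZ : i ∈ Z := hT hi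
  have hjZ : j ∈ Z := (mem_sdiff.1 hj).1
  have hZ : pm (swap i j) Z = Z := pm_swap_eq (by simp [hiZ, hjZ])
  have hu' : vt v (pm (swap i j) T) (Z \ pm (swap i j) T)
      = - lin i j * sw i j u := by
    have := sw_vt v hv T (Z \ T)
    rw [pm_sdiff, hZ] at this
    rw [← this, hu, map_mul, sw_lin]; simp [lin]
  have hnu' : ¬ lin i j ∣ sw i j u := by
    intro h
    have := lin_dvd_sub_sw i j u
    exact hnu ((dvd_sub_left h).1 this)
  obtain ⟨a, ha⟩ := hF T hT i hiZ j hjZ hv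
  obtain ⟨b, hb⟩ := lin_dvd_sub_sw i j u
  refine ⟨a * u - F T * b, u * sw i j u, fun h => (hπ.dvd_or_dvd h).elim hnu hnu', ?_⟩
  unfold Iterm
  rw [hu, hu']
  have n1 : algebraMap (PS Ω) (PF Ω) (lin i j) ≠ 0 := amap_ne_zero (lin_ne_zero hij)
  have n2 : algebraMap (PS Ω) (PF Ω) u ≠ 0 :=
    amap_ne_zero (fun h => hnu (h ▸ dvd_zero _))
  have n3 : algebraMap (PS Ω) (PF Ω) (sw i j u) ≠ 0 :=
    amap_ne_zero (fun h => hnu' (h ▸ dvd_zero _))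
  have ha' := congrArg (algebraMap (PS Ω) (PF Ω)) ha
  have hb' := congrArg (algebraMap (PS Ω) (PF Ω)) hb
  simp only [map_mul, map_sub, map_neg] at ha' hb' ⊢
  field_simp
  linear_combination (algebraMap (PS Ω) (PF Ω) u) * ha' - (algebraMap (PS Ω) (PF Ω) (F T)) * hb'

lemma intF_Rg {Z : Finset Ω} {F : Finset Ω → PS Ω} (hF : GKM v Z F) {i j : Ω} (hij : i ≠ j) :
    Rg (lin i j) (intF v Z F) := by
  have hπ := lin_prime hij
  by_cases hc : (v i = v j ∧ i ∈ Z ∧ j ∈ Z)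
  · obtain ⟨hv, hi, hj⟩ := hc
    apply Rg.half
    have hZ : pm (swap i j) Z = Z := pm_swap_eq (by simp [hi, hj])
    have : intF v Z F + intF v Z F =
        ∑ T ∈ Z.powerset, (Iterm v Z F T + Iterm v Z F (pm (swap i j) T)) := by
      rw [sum_add_distrib]
      congr 1
      exact sum_pm_swap hZ _
    rw [this]
    apply Rg.sum hπ
    intro T hT
    rw [mem_powerset] at hT
    by_cases h1 : i ∈ T <;> by_cases h2 : j ∈ T
    · have hn : ¬ lin i j ∣ vt v T (Z \ T) := fun h => by
        rcases lin_dvd_vt v disjoint_sdiff hij h with h | h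
        · exact (mem_sdiff.1 h.2).2 h2
        · exact (mem_sdiff.1 h.2).2 h1
      rw [pm_swap_eq (by simp [h1, h2])]
      exact (Rg.div _ _ hn).add hπ (Rg.div _ _ hn)
    · exact Iterm_pair v hF hT h1 (mem_sdiff.2 ⟨hj, h2⟩) hv
    · have hT' : pm (swap i j) T ⊆ Z := by
        rw [← hZ, pm_subset]; exact hT
      have := Iterm_pair v hF hT' (i := i) (j := j) (by simp [mem_pm_swap, h2])
        (mem_sdiff.2 ⟨hj, by simp [mem_pm_swap, h1]⟩) hv
      rwa [pm_pm_swap, add_comm] at this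
    · have hn : ¬ lin i j ∣ vt v T (Z \ T) := fun h => by
        rcases lin_dvd_vt v disjoint_sdiff hij h with h | h
        · exact h1 h.1
        · exact h2 h.1
      rw [pm_swap_eq (by simp [h1, h2])]
      exact (Rg.div _ _ hn).add hπ (Rg.div _ _ hn)
  · apply Rg.sum hπ
    intro T hT
    rw [mem_powerset] at hT
    apply Rg.div
    intro h
    obtain ⟨a, ha, b, hb, hv, hab, hd⟩ := vt_prime_dvd v disjoint_sdiff hπ h
    rcases lin_dvd_lin hab hd with ⟨rfl, rfl⟩ | ⟨rfl, rfl⟩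
    · grind
    grind

lemma IsPoly.sum {ι : Type*} (s : Finset ι) (f : ι → PF Ω) (h : ∀ i ∈ s, IsPoly (f i)) :
    IsPoly (∑ i ∈ s, f i) := by
  choose! g hg using h
  exact ⟨∑ i ∈ s, g i, by rw [map_sum]; exact sum_congr rfl hg⟩

/-- INT (i) -/
lemma intF_isPoly {Z : Finset Ω} {F : Finset Ω → PS Ω} (hF : GKM v Z F) :
    IsPoly (intF v Z F) := by
  refine isPoly_of_Rg _ (∏ T ∈ Z.powerset, vt v T (Z \ T)) ?_ ?_
  · unfold intF
    rw [sum_mul]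
    apply IsPoly.sum
    intro T hT
    refine ⟨F T * ∏ S ∈ Z.powerset.erase T, vt v S (Z \ S), ?_⟩
    rw [← mul_prod_erase _ _ hT]
    have := amap_ne_zero (vt_ne_zero v (A := T) (B := Z \ T) disjoint_sdiff)
    unfold Iterm
    simp only [map_mul]
    field_simp
  · intro π hπ h
    obtain ⟨T, hT, h⟩ := hπ.exists_mem_finset_dvd h
    obtain ⟨a, ha, b, hb, hv, hab, hd⟩ := vt_prime_dvd v disjoint_sdiff hπ h
    obtain ⟨n, d, hnd, h2⟩ := intF_Rg v hF hab
    have hass := (hπ.dvd_prime_iff_associated (lin_prime hab)).1 hd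
    exact ⟨n, d, fun h => hnd (hass.symm.dvd.trans h), h2⟩

/-- the localization integral as a polynomial -/
noncomputable def intP (Z : Finset Ω) (F : Finset Ω → PS Ω) : PS Ω :=
  if h : IsPoly (intF v Z F) then h.choose else 0

lemma intP_spec {Z : Finset Ω} {F : Finset Ω → PS Ω} (h : IsPoly (intF v Z F)) :
    algebraMap _ _ (intP v Z F) = intF v Z F := by
  unfold intP; rw [dif_pos h]; exact h.choose_spec

lemma intP_gkm {Z : Finset Ω} {F : Finset Ω → PS Ω} (h : GKM v Z F) :
    algebraMap _ _ (intP v Z F) = intF v Z F := intP_spec v (intF_isPoly v h)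

/-- INT (ii) -/
lemma intP_cong {Z : Finset Ω} {F F' : Finset Ω → PS Ω} {i j : Ω} (hij : i ≠ j) (hv : v i = v j)
    (hZ : ¬ (i ∈ Z ∧ j ∈ Z)) (hF : GKM v Z F) (hF' : GKM v (pm (swap i j) Z) F')
    (h : ∀ T ⊆ Z, lin i j ∣ F T - F' (pm (swap i j) T)) :
    lin i j ∣ intP v Z F - intP v (pm (swap i j) Z) F' := by
  have hπ := lin_prime hij
  apply Cg.dvd hπ
  rw [map_sub, intP_gkm v hF, intP_gkm v hF']
  unfold intF
  rw [sum_pm_swap rfl, ← sum_sub_distrib]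
  apply Cg.sum hπ
  intro T hT
  rw [mem_powerset] at hT
  have hu' := sw_vt v hv T (Z \ T)
  rw [pm_sdiff] at hu'
  unfold Iterm
  rw [← hu']
  have hnu : ¬ lin i j ∣ vt v T (Z \ T) := fun h => by
    rcases lin_dvd_vt v disjoint_sdiff hij h with h | h
    · exact hZ ⟨hT h.1, (mem_sdiff.1 h.2).1⟩
    grind
  generalize vt v T (Z \ T) = u at hnu
  have hnu' : ¬ lin i j ∣ sw i j u := by
    intro h
    have := lin_dvd_sub_sw i j u
    exact hnu ((dvd_sub_left h).1 this)
  obtain ⟨a, ha⟩ := h T hT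
  obtain ⟨b, hb⟩ := lin_dvd_sub_sw i j u
  refine ⟨a * u - F T * b, u * sw i j u, fun h => (hπ.dvd_or_dvd h).elim hnu hnu', ?_⟩
  have n2 : algebraMap (PS Ω) (PF Ω) u ≠ 0 :=
    amap_ne_zero (fun h => hnu (h ▸ dvd_zero _))
  have n3 : algebraMap (PS Ω) (PF Ω) (sw i j u) ≠ 0 :=
    amap_ne_zero (fun h => hnu' (h ▸ dvd_zero _))
  have ha' := congrArg (algebraMap (PS Ω) (PF Ω)) ha
  have hb' := congrArg (algebraMap (PS Ω) (PF Ω)) hb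
  simp only [map_mul, map_sub, map_neg] at ha' hb' ⊢
  grind

/-- INT (iii) -/
lemma dvd_intP {Z : Finset Ω} {F : Finset Ω → PS Ω} (hF : GKM v Z F) {d : PS Ω}
    (hd : ∀ i j, i ≠ j → v i = v j → ¬ lin i j ∣ d) (h : ∀ T ⊆ Z, d ∣ F T) :
    d ∣ intP v Z F := by
  choose! G hG using h
  have hGK : GKM v Z G := by
    intro T hT i hi j hj hv
    by_cases hij : i = j
    · subst hij
      simp [pm]
    have hT' : pm (swap i j) T ⊆ Z := by
      rw [← pm_swap_eq (Z := Z) (i := i) (j := j) (by simp [hi, hj]), pm_subset]; exact hT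
    have := hF T hT i hi j hj hv
    rw [hG T hT, hG _ hT', ← mul_sub] at this
    exact ((lin_prime hij).dvd_or_dvd this).resolve_left (hd i j hij hv)
  refine ⟨intP v Z G, amap_inj ?_⟩
  rw [map_mul, intP_gkm v hF, intP_gkm v hGK]
  unfold intF
  rw [mul_sum]
  refine sum_congr rfl fun T hT => ?_
  rw [mem_powerset] at hT
  unfold Iterm
  rw [hG T hT, map_mul, mul_div_assoc]

end A2
section A3
open MvPolynomial

variable {Ω V : Type} [Fintype Ω] (v : Ω → V) (e : V → V → ℕ) (rk : Ω → ℕ)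

/-- arrow product of a labelling -/
noncomputable def PP (l : Ω → ℕ) : PS Ω :=
  ∏ p : Ω × Ω, if 0 < l p.1 ∧ l p.1 < l p.2 ∧ rk p.2 < rk p.1
    then lin p.1 p.2 ^ e (v p.1) (v p.2) else 1

/-- the leading value of a labelling -/
noncomputable def leadL (l : Ω → ℕ) : PS Ω :=
  ∏ p : Ω × Ω, if 0 < l p.1 ∧ l p.1 < l p.2 then
    (if rk p.2 < rk p.1 then lin p.1 p.2 ^ e (v p.1) (v p.2)
      else if v p.1 = v p.2 then lin p.1 p.2 else 1) else 1

/-- label families -/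
structure LFam (K : (Ω → ℕ) → PS Ω) : Prop where
  div : ∀ l, PP v e rk l ∣ K l
  gkm : ∀ l i j, v i = v j → 0 < l i → 0 < l j → lin i j ∣ K l - K (l ∘ swap i j)

/-- dominance counts -/
noncomputable def Dmn (l : Ω → ℕ) (k m : ℕ) : ℕ :=
  (univ.filter fun x => 0 < l x ∧ l x ≤ k ∧ m ≤ rk x).card

/-- the support condition -/
structure LSup (l0 l : Ω → ℕ) : Prop where
  zero : ∀ x, l x = 0 ↔ l0 x = 0
  cnt : ∀ w c, (univ.filter fun x => v x = w ∧ l x = c).card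
    = (univ.filter fun x => v x = w ∧ l0 x = c).card
  dom : ∀ k m, Dmn rk l k m ≤ Dmn rk l0 k m

lemma sw_PP {i j : Ω} (h : v i = v j) (l : Ω → ℕ) :
    sw i j (PP v e rk l) = PP v e (rk ∘ swap i j) (l ∘ swap i j) := by
  unfold PP
  rw [map_prod]
  refine Fintype.prod_equiv ((swap i j).prodCongr (swap i j)) _ _ ?_
  intro p
  simp only [Equiv.prodCongr_apply, Prod.map, comp, swap_apply_self, v_swap v h]
  split_ifs <;> simp

variable {e} in
lemma lin_not_dvd_PP (he : ∀ w, e w w = 0) {i j : Ω} (hij : i ≠ j) (h : v i = v j) (l : Ω → ℕ) :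
    ¬ lin i j ∣ PP v e rk l := by
  intro hd
  obtain ⟨p, hp, hd⟩ := (lin_prime hij).exists_mem_finset_dvd hd
  split_ifs at hd with hc
  · have hd' := (lin_prime hij).dvd_of_dvd_pow hd
    have hne : p.1 ≠ p.2 := fun h => by rw [h] at hc; omega
    have : v p.1 = v p.2 := by
      rcases lin_dvd_lin hne hd' with ⟨h1, h2⟩ | ⟨h1, h2⟩ <;> rw [h1, h2, h]
    rw [this, he, pow_zero] at hd
    exact (lin_prime hij).not_isUnit (isUnit_of_dvd_one hd)
  · exact (lin_prime hij).not_isUnit (isUnit_of_dvd_one hd)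

lemma Dmn_swap (l : Ω → ℕ) (i j : Ω) (k m : ℕ) :
    Dmn rk (l ∘ swap i j) k m = Dmn (rk ∘ swap i j) l k m := by
  unfold Dmn
  refine card_bij' (fun x _ => swap i j x) (fun x _ => swap i j x) ?_ ?_ ?_ ?_
  · intro x hx; simpa using hx
  · intro x hx; simpa using hx
  · intro x hx; simp
  · intro x hx; simp

lemma swap_swap_comp {α : Type*} (i j : Ω) (f : Ω → α) :
    (f ∘ swap i j) ∘ swap i j = f := by
  funext x; simp

variable {rk} in
lemma Dmn_eq_of {i j : Ω} (hji : rk j < rk i) (l : Ω → ℕ) (k m : ℕ)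
    (hm : m ≤ rk j ∨ rk i < m) :
    Dmn (rk ∘ swap i j) l k m = Dmn rk l k m := by
  unfold Dmn
  congr 1
  ext x
  simp only [mem_filter, mem_univ, true_and]
  simp only [comp, swap_apply_def]
  split_ifs with h1 h2
  · subst h1; constructor <;> rintro ⟨a, b, c⟩ <;> refine ⟨a, b, ?_⟩ <;> omega
  · subst h2; constructor <;> rintro ⟨a, b, c⟩ <;> refine ⟨a, b, ?_⟩ <;> omega
  · rfl

lemma Dmn_mono (l : Ω → ℕ) (k : ℕ) {m m' : ℕ} (h : m ≤ m') : Dmn rk l k m' ≤ Dmn rk l k m := by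
  apply card_le_card
  intro x
  simp only [mem_filter, mem_univ, true_and]
  rintro ⟨a, b, c⟩; exact ⟨a, b, h.trans c⟩

variable {rk}

lemma Dmn_le_swap {i j : Ω} (hji : rk j < rk i) {l0 : Ω → ℕ} (hl0 : 0 < l0 i) (hl : l0 i < l0 j)
    (k m : ℕ) : Dmn (rk ∘ swap i j) l0 k m ≤ Dmn rk l0 k m := by
  by_cases hm : m ≤ rk j ∨ rk i < m
  · rw [Dmn_eq_of hji _ _ _ hm]
  unfold Dmn
  by_cases hk : l0 j ≤ k
  · refine le_of_eq (card_bij' (fun x _ => swap i j x)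
      (fun x _ => swap i j x) ?_ ?_ ?_ ?_)
    · intro x
      simp only [mem_filter, mem_univ, true_and]
      simp only [comp, swap_apply_def]
      split_ifs with h1 h2
      · subst h1; omega
      · subst h2; omega
      · exact id
    · intro x
      simp only [mem_filter, mem_univ, true_and, comp,
        swap_apply_self]
      rw [swap_apply_def]
      split_ifs with h1 h2
      · subst h1; omega
      · subst h2; omega
      · exact id
    · intro x _; simp
    · intro x _; simp
  · apply card_le_card
    intro x
    simp only [mem_filter, mem_univ, true_and]
    simp only [comp, swap_apply_def]
    split_ifs with h1 h2
    · subst h1; omega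
    · subst h2; omega
    · exact id

lemma Dmn_step (hrk : Injective rk) {i j : Ω} (hji : rk j < rk i) {l0 l : Ω → ℕ}
    (hl0 : 0 < l0 i) (hl : l0 i < l0 j)
    (hadj : ∀ x, 0 < l0 x → ¬ (rk j < rk x ∧ rk x < rk i))
    (hz : ∀ x, l x = 0 ↔ l0 x = 0)
    (hd : ∀ k m, Dmn (rk ∘ swap i j) l k m ≤ Dmn (rk ∘ swap i j) l0 k m) (k m : ℕ) :
    Dmn rk l k m ≤ Dmn rk l0 k m := by
  by_cases hm : m ≤ rk j ∨ rk i < m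
  · have := hd k m
    rwa [Dmn_eq_of hji _ _ _ hm, Dmn_eq_of hji _ _ _ hm] at this
  push Not at hm
  by_cases hk : l0 i ≤ k
  · have h1 := hd k (rk i + 1)
    rw [Dmn_eq_of hji _ _ _ (by omega), Dmn_eq_of hji _ _ _ (by omega)] at h1
    have h2 : Dmn rk l k m ≤ Dmn rk l k (rk i + 1) + 1 := by
      unfold Dmn
      refine le_trans (card_le_card ?_) (Finset.card_insert_le i _)
      intro x
      simp only [mem_filter, mem_univ, true_and, Finset.mem_insert]
      rintro ⟨a, b, c⟩
      by_cases hx : x = i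
      · exact Or.inl hx
      · have hx' : rk x ≠ rk i := fun h => hx (hrk h)
        have h0 : 0 < l0 x := Nat.pos_of_ne_zero fun h => by rw [(hz x).2 h] at a; omega
        have := hadj x h0
        refine Or.inr ⟨a, b, by omega⟩
    have h3 : Dmn rk l0 k (rk i + 1) + 1 ≤ Dmn rk l0 k m := by
      unfold Dmn
      rw [← Finset.card_insert_of_notMem (a := i) (by simp)]
      apply card_le_card
      intro x
      simp only [mem_filter, mem_univ, true_and, Finset.mem_insert]
      rintro (rfl | ⟨a, b, c⟩)
      · exact ⟨hl0, hk, hm.2⟩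
      · exact ⟨a, b, by omega⟩
    omega
  · have h1 := hd k (rk j)
    rw [Dmn_eq_of hji _ _ _ (by omega), Dmn_eq_of hji _ _ _ (by omega)] at h1
    have h2 : Dmn rk l k m ≤ Dmn rk l k (rk j) := Dmn_mono _ _ _ hm.1.le
    have h3 : Dmn rk l0 k (rk j) ≤ Dmn rk l0 k m := by
      apply card_le_card
      intro x
      simp only [mem_filter, mem_univ, true_and]
      rintro ⟨a, b, c⟩
      have := hadj x a
      have hxi : x ≠ i := fun h => by subst h; omega
      have hxj : x ≠ j := fun h => by subst h; omega
      have hx' : rk x ≠ rk i := fun h => hxi (hrk h)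
      have hx'' : rk x ≠ rk j := fun h => hxj (hrk h)
      exact ⟨a, b, by omega⟩
    omega

lemma order_swap (hrk : Injective rk) {i j : Ω} (hji : rk j < rk i) {a b : Ω}
    (ha : ¬ (rk j < rk a ∧ rk a < rk i)) (hb : ¬ (rk j < rk b ∧ rk b < rk i))
    (h1 : ¬ (a = i ∧ b = j)) (h2 : ¬ (a = j ∧ b = i)) :
    rk (swap i j b) < rk (swap i j a) ↔ rk b < rk a := by
  have hai : a ≠ i → rk a ≠ rk i := fun h h' => h (hrk h')
  have haj : a ≠ j → rk a ≠ rk j := fun h h' => h (hrk h')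
  have hbi : b ≠ i → rk b ≠ rk i := fun h h' => h (hrk h')
  have hbj : b ≠ j → rk b ≠ rk j := fun h h' => h (hrk h')
  simp only [swap_apply_def]
  split_ifs with c1 c2 c3 c4 c5 c6 c7 c8
  all_goals first | (subst_vars; simp_all; done) | (simp_all; omega) | omega

end A3
section A4
open MvPolynomial

variable {Ω V : Type} [Fintype Ω] (v : Ω → V) (e : V → V → ℕ)

/-- inversions -/
noncomputable def invs (rk : Ω → ℕ) (l : Ω → ℕ) : Finset (Ω × Ω) :=
  univ.filter fun p => 0 < l p.1 ∧ l p.1 < l p.2 ∧ rk p.2 < rk p.1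

lemma LSup.refl (rk : Ω → ℕ) (l : Ω → ℕ) : LSup v rk l l :=
  ⟨fun _ => Iff.rfl, fun _ _ => rfl, fun _ _ => le_rfl⟩

lemma exists_adj_inv (rk : Ω → ℕ) (l : Ω → ℕ) (h : (invs rk l).Nonempty) :
    ∃ i j, 0 < l i ∧ l i < l j ∧ rk j < rk i ∧
      ∀ x, 0 < l x → ¬ (rk j < rk x ∧ rk x < rk i) := by
  obtain ⟨p, hp, hmin⟩ := Finset.exists_min_image (invs rk l) (fun p => rk p.1 - rk p.2) h
  simp only [invs, mem_filter, mem_univ, true_and] at hp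
  refine ⟨p.1, p.2, hp.1, hp.2.1, hp.2.2, ?_⟩
  rintro x hx ⟨h1, h2⟩
  by_cases hc : l x < l p.2
  · have := hmin (x, p.2) (by simp [invs, hx, hc, h1])
    simp only at this; omega
  · have := hmin (p.1, x) (by simp [invs, hp.1, h2]; omega)
    simp only at this; omega

lemma cnt_swap {i j : Ω} (h : v i = v j) (l : Ω → ℕ) (w : V) (c : ℕ) :
    (univ.filter fun x => v x = w ∧ (l ∘ swap i j) x = c).card
    = (univ.filter fun x => v x = w ∧ l x = c).card := by
  refine card_bij' (fun x _ => swap i j x) (fun x _ => swap i j x) ?_ ?_ ?_ ?_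
  · intro x hx; simpa [v_swap v h] using hx
  · intro x hx; simpa [v_swap v h] using hx
  · intro x hx; simp
  · intro x hx; simp

lemma lead_base (rk : Ω → ℕ) (hrk : Injective rk) (l0 : Ω → ℕ)
    (h : invs rk l0 = ∅) :
    ∃ K, LFam v e rk K ∧ K l0 = leadL v e rk l0 ∧ ∀ l, K l ≠ 0 → LSup v rk l0 l := by
  have hinv : ∀ a b, 0 < l0 a → l0 a < l0 b → ¬ rk b < rk a := by
    intro a b h1 h2 h3
    have : (a, b) ∈ invs rk l0 := by simp [invs, h1, h2, h3]
    rw [h] at this; simp at this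
  refine ⟨fun l => if l = l0 then leadL v e rk l0 else 0, ⟨?_, ?_⟩, by simp, ?_⟩
  · intro l
    by_cases hl : l = l0
    · subst hl
      have : PP v e rk l = 1 := by
        apply Finset.prod_eq_one
        intro p _
        rw [if_neg]; rintro ⟨h1, h2, h3⟩; exact hinv _ _ h1 h2 h3
      rw [this]; exact one_dvd _
    · simp [hl]
  · have key : ∀ i j, v i = v j → 0 < l0 i → l0 i < l0 j → lin i j ∣ leadL v e rk l0 := by
      intro i j hv hi hij
      refine dvd_trans ?_ (Finset.dvd_prod_of_mem _ (mem_univ (i, j)))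
      simp [hi, hij, hinv i j hi hij, hv]
    have key2 : ∀ i j, v i = v j → 0 < l0 i → 0 < l0 j → l0 i ≠ l0 j →
        lin i j ∣ leadL v e rk l0 := by
      intro i j hv hi hj hne
      rcases lt_or_gt_of_ne hne with h | h
      · exact key i j hv hi h
      · rw [lin_swap, neg_dvd]; exact key j i hv.symm hj h
    intro l i j hv hi hj
    by_cases heq : l i = l j
    · have : l ∘ swap i j = l := by
        funext x
        simp only [comp, swap_apply_def]
        split_ifs with h1 h2
        · rw [h1, heq]
        · rw [h2, heq]
        · rfl
      rw [this, sub_self]; exact dvd_zero _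
    · apply dvd_sub
      · by_cases hl : l = l0
        · grind
        · simp [hl]
      · by_cases hl : l ∘ swap i j = l0
        · subst hl; grind
        · simp [hl]
  · intro l hl
    by_cases h : l = l0
    · subst h; exact LSup.refl v rk l
    · simp [h] at hl

lemma invs_swap_lt (rk : Ω → ℕ) (hrk : Injective rk) (l0 : Ω → ℕ) {i j : Ω}
    (hi : 0 < l0 i) (hij : l0 i < l0 j) (hji : rk j < rk i)
    (hadj : ∀ x, 0 < l0 x → ¬ (rk j < rk x ∧ rk x < rk i)) :
    (invs (rk ∘ swap i j) l0).card < (invs rk l0).card := by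
  apply card_lt_card
  rw [ssubset_iff_of_subset]
  · refine ⟨(i, j), by simp [invs, hi, hij, hji], ?_⟩
    simp [invs]; intro _ _; omega
  · intro p
    simp only [invs, mem_filter, mem_univ, true_and, comp]
    grind

lemma PP_dvd_step (rk : Ω → ℕ) (hrk : Injective rk) (l : Ω → ℕ) {i j : Ω}
    (hji : rk j < rk i) (hadj : ∀ x, 0 < l x → ¬ (rk j < rk x ∧ rk x < rk i)) :
    PP v e rk l ∣ lin i j ^ e (v i) (v j) * PP v e (rk ∘ swap i j) l := by
  have : lin i j ^ e (v i) (v j) * PP v e (rk ∘ swap i j) l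
      = ∏ p : Ω × Ω, ((if p = (i, j) then lin i j ^ e (v i) (v j) else 1) *
        if 0 < l p.1 ∧ l p.1 < l p.2 ∧ (rk ∘ swap i j) p.2 < (rk ∘ swap i j) p.1
        then lin p.1 p.2 ^ e (v p.1) (v p.2) else 1) := by
    rw [prod_mul_distrib]
    congr 1
    simp
  rw [this]
  apply Finset.prod_dvd_prod_of_dvd
  intro p _
  by_cases hc : 0 < l p.1 ∧ l p.1 < l p.2 ∧ rk p.2 < rk p.1
  · rw [if_pos hc]
    by_cases hp : p = (i, j)
    · subst hp; rw [if_pos rfl]; exact dvd_mul_right _ _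
    · have h1 : ¬ (p.1 = i ∧ p.2 = j) := fun h => hp (Prod.ext h.1 h.2)
      have h2 : ¬ (p.1 = j ∧ p.2 = i) := fun h => by
        have := hc.2.2; rw [h.1, h.2] at this; omega
      have h3 := (order_swap hrk hji (hadj _ hc.1) (hadj _ (by omega)) h1 h2).2 hc.2.2
      have h4 : 0 < l p.1 ∧ l p.1 < l p.2 ∧ (rk ∘ swap i j) p.2 < (rk ∘ swap i j) p.1 :=
        ⟨hc.1, hc.2.1, h3⟩
      rw [if_pos h4]
      exact dvd_mul_left _ _
  · rw [if_neg hc]; exact one_dvd _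

lemma lead_step (rk : Ω → ℕ) (hrk : Injective rk) (l : Ω → ℕ) {i j : Ω}
    (hi : 0 < l i) (hij : l i < l j)
    (hji : rk j < rk i) (hadj : ∀ x, 0 < l x → ¬ (rk j < rk x ∧ rk x < rk i)) :
    (if v i = v j then lin i j else 1) * leadL v e rk l
      = lin i j ^ e (v i) (v j) * leadL v e (rk ∘ swap i j) l := by
  have h1 : (if v i = v j then lin i j else 1)
      = ∏ p : Ω × Ω, (if p = (i, j) then (if v i = v j then lin i j else 1) else 1) := by simp
  have h2 : lin i j ^ e (v i) (v j)
      = ∏ p : Ω × Ω, (if p = (i, j) then lin i j ^ e (v i) (v j) else 1) := by simp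
  rw [h1, h2]
  unfold leadL
  rw [← prod_mul_distrib, ← prod_mul_distrib]
  apply prod_congr rfl
  grind

lemma pm_conj (i j a b : Ω) (l : Ω → ℕ) :
    (l ∘ swap a b) ∘ swap i j
      = (l ∘ swap i j) ∘ swap (swap i j a) (swap i j b) := by
  funext x
  simp only [comp]
  congr 1
  have := Equiv.swap_apply_apply (swap i j) a b
  rw [this]
  simp

/-- existence of leading families -/
theorem exists_lead (he : ∀ w, e w w = 0) (n : ℕ) : ∀ (rk : Ω → ℕ) (_ : Injective rk)
    (l0 : Ω → ℕ) (_ : (invs rk l0).card = n),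
    ∃ K, LFam v e rk K ∧ K l0 = leadL v e rk l0 ∧ ∀ l, K l ≠ 0 → LSup v rk l0 l := by
  induction n using Nat.strong_induction_on with
  | _ n ih =>
  intro rk hrk l0 hn
  by_cases hne : (invs rk l0).Nonempty
  swap
  · exact lead_base v e rk hrk l0 (Finset.not_nonempty_iff_eq_empty.1 hne)
  obtain ⟨i, j, hi, hij, hji, hadj⟩ := exists_adj_inv rk l0 hne
  have hne' : i ≠ j := fun h => by subst h; omega
  have hrk' : Injective (rk ∘ swap i j) := hrk.comp (Equiv.injective _)
  obtain ⟨K, hK, hlead, hsup⟩ := ih _ (hn ▸ invs_swap_lt rk hrk l0 hi hij hji hadj)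
    (rk ∘ swap i j) hrk' l0 rfl
  have hls := lead_step v e rk hrk l0 hi hij hji hadj
  have hadj' : ∀ l : Ω → ℕ, (∀ x, l x = 0 ↔ l0 x = 0) →
      ∀ x, 0 < l x → ¬ (rk j < rk x ∧ rk x < rk i) := by
    intro l hz x hx
    exact hadj x (Nat.pos_of_ne_zero fun h => by rw [(hz x).2 h] at hx; omega)
  have hsup1 : ∀ l, K l ≠ 0 → LSup v rk l0 l := fun l hl =>
    ⟨(hsup l hl).zero, (hsup l hl).cnt,
      Dmn_step hrk hji hi hij hadj (hsup l hl).zero (hsup l hl).dom⟩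
  by_cases hv : v i = v j
  · rw [if_pos hv, hv, he, pow_zero, one_mul] at hls
    have hprime := lin_prime hne'
    -- the numerator
    have hnum : ∀ l, lin i j ∣ K l - sw i j (K (l ∘ swap i j)) := by
      intro l
      have h1 : lin i j ∣ K l - K (l ∘ swap i j) := by
        by_cases hl : 0 < l i ∧ 0 < l j
        · exact hK.gkm l i j hv hl.1 hl.2
        · have h0 : K l = 0 := by
            by_contra h
            have hz := (hsup l h).zero
            have := (hz i).1; have := (hz j).1; omega
          have h1 : K (l ∘ swap i j) = 0 := by
            by_contra h
            have hz := (hsup _ h).zero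
            have h1 := (hz i).1; have h2 := (hz j).1
            simp at h1 h2; omega
          rw [h0, h1]; simp
      have h2 := lin_dvd_sub_sw i j (K (l ∘ swap i j))
      have := dvd_add h1 h2
      simpa using this
    choose D hD using hnum
    refine ⟨D, ⟨?_, ?_⟩, ?_, ?_⟩
    · intro l
      have h1 : PP v e rk l ∣ K l := by
        by_cases h : K l = 0
        · rw [h]; exact dvd_zero _
        · have := PP_dvd_step v e rk hrk l hji (hadj' l (hsup l h).zero)
          rw [hv, he, pow_zero, one_mul] at this
          exact this.trans (hK.div l)
      have h2 : PP v e rk l ∣ sw i j (K (l ∘ swap i j)) := by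
        have h3 := map_dvd (sw i j) (hK.div (l ∘ swap i j))
        rwa [sw_PP v e _ hv, swap_swap_comp, swap_swap_comp] at h3
      obtain ⟨c, hc⟩ := dvd_sub h1 h2
      have h4 : lin i j ∣ PP v e rk l * c := ⟨D l, by rw [← hc, hD]⟩
      obtain ⟨c', rfl⟩ := (hprime.dvd_or_dvd h4).resolve_left (lin_not_dvd_PP v rk he hne' hv l)
      refine ⟨c', mul_left_cancel₀ (lin_ne_zero hne') ?_⟩
      rw [← hD, hc]; ring
    · intro l a b hab ha hb
      by_cases hab' : a = b
      · subst hab'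
        have : l ∘ swap a a = l := by funext x; simp
        rw [this, sub_self]; exact dvd_zero _
      by_cases hc : lin a b ∣ lin i j
      · have hsw : D (l ∘ swap i j) = sw i j (D l) := by
          apply mul_left_cancel₀ (lin_ne_zero hne')
          have h1 := congrArg (sw i j) (hD l)
          rw [map_sub, sw_sw, map_mul] at h1
          have h2 := hD (l ∘ swap i j)
          rw [swap_swap_comp] at h2
          have h3 : sw i j (lin i j) = - lin i j := by simp [lin]
          rw [h3] at h1
          rw [← h2]
          linear_combination - h1
        rcases lin_dvd_lin (Ne.symm hne').symm hc with ⟨rfl, rfl⟩ | ⟨rfl, rfl⟩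
        · rw [hsw]; exact lin_dvd_sub_sw _ _ _
        · rw [swap_comm, hsw, lin_swap, neg_dvd]; exact lin_dvd_sub_sw _ _ _
      · have h1 := hK.gkm l a b hab ha hb
        have h2 := hK.gkm (l ∘ swap i j) (swap i j a) (swap i j b)
          (by simp [v_swap v hv, hab]) (by simpa using ha) (by simpa using hb)
        have h3 := map_dvd (sw i j) h2
        rw [sw_lin, swap_apply_self, swap_apply_self, map_sub, ← pm_conj] at h3
        have h4 : lin a b ∣ lin i j * (D l - D (l ∘ swap a b)) := by
          rw [mul_sub, ← hD, ← hD]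
          have := dvd_sub h1 h3
          convert this using 1; ring
        exact ((lin_prime hab').dvd_or_dvd h4).resolve_left hc
    · have h0 : K (l0 ∘ swap i j) = 0 := by
        by_contra h
        have := (hsup _ h).dom (l0 i) (rk i)
        rw [Dmn_swap, swap_swap_comp] at this
        have h2 : Dmn (rk ∘ swap i j) l0 (l0 i) (rk i) < Dmn rk l0 (l0 i) (rk i) := by
          apply card_lt_card
          rw [ssubset_iff_of_subset]
          · refine ⟨i, by simp [hi], ?_⟩
            simp; intro _; omega
          · grind
        omega
      apply mul_left_cancel₀ (lin_ne_zero hne')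
      rw [← hD, h0, map_zero, sub_zero, hlead, hls]
    · intro l hl
      by_cases h : K l = 0
      · have h' : K (l ∘ swap i j) ≠ 0 := by
          intro h'
          have := hD l
          rw [h, h', map_zero, sub_zero, eq_comm, mul_eq_zero] at this
          exact this.elim (lin_ne_zero hne') hl
        have hs := hsup _ h'
        refine ⟨?_, ?_, ?_⟩
        · intro x
          by_cases hxi : x = i
          · subst hxi
            have := hs.zero j; simp at this; rw [this]; omega
          · by_cases hxj : x = j
            · subst hxj
              have := hs.zero i; simp at this; rw [this]; omega
            · have := hs.zero x
              grind
        · intro w c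
          rw [← hs.cnt w c, cnt_swap v hv]
        · intro k m
          have h1 := hs.dom k m
          rw [Dmn_swap, swap_swap_comp] at h1
          exact h1.trans (Dmn_le_swap hji hi hij k m)
      · exact hsup1 l h
  · rw [if_neg hv, one_mul] at hls
    refine ⟨fun l => lin i j ^ e (v i) (v j) * K l, ⟨?_, ?_⟩, ?_, ?_⟩
    · intro l
      by_cases h : K l = 0
      · simp [h]
      · exact (PP_dvd_step v e rk hrk l hji (hadj' l (hsup l h).zero)).trans
          (mul_dvd_mul_left _ (hK.div l))
    · intro l a b hab ha hb
      rw [← mul_sub]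
      exact (hK.gkm l a b hab ha hb).mul_left _
    · simp only [hlead, hls]
    grind

end A4
section A5
open MvPolynomial

variable {Ω V : Type} [Fintype Ω] (v : Ω → V) (e : V → V → ℕ) (rk : Ω → ℕ)

/-- product over a rectangle -/
noncomputable def pr (h : Ω × Ω → PS Ω) (A B : Finset Ω) : PS Ω := ∏ p ∈ A ×ˢ B, h p

lemma pr_union_left (h : Ω × Ω → PS Ω) {A A' : Finset Ω} (hd : Disjoint A A') (B : Finset Ω) :
    pr h (A ∪ A') B = pr h A B * pr h A' B := by
  unfold pr
  rw [Finset.union_product, prod_union]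
  rw [disjoint_left] at *
  intro p hp hp'
  exact hd (mem_product.1 hp).1 (mem_product.1 hp').1

lemma pr_union_right (h : Ω × Ω → PS Ω) {A A' : Finset Ω} (hd : Disjoint A A') (B : Finset Ω) :
    pr h B (A ∪ A') = pr h B A * pr h B A' := by
  unfold pr
  rw [Finset.product_union, prod_union]
  rw [disjoint_left] at *
  intro p hp hp'
  exact hd (mem_product.1 hp).2 (mem_product.1 hp').2

@[simp] lemma pr_empty_left (h : Ω × Ω → PS Ω) (B : Finset Ω) : pr h ∅ B = 1 := by simp [pr]
@[simp] lemma pr_empty_right (h : Ω × Ω → PS Ω) (B : Finset Ω) : pr h B ∅ = 1 := by simp [pr]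

/-- arrow factor -/
noncomputable def arf (p : Ω × Ω) : PS Ω :=
  if rk p.2 < rk p.1 then lin p.1 p.2 ^ e (v p.1) (v p.2) else 1
/-- leading factor -/
noncomputable def ldf (p : Ω × Ω) : PS Ω :=
  if rk p.2 < rk p.1 then lin p.1 p.2 ^ e (v p.1) (v p.2)
      else if v p.1 = v p.2 then lin p.1 p.2 else 1
/-- vertex factor -/
noncomputable def vtf (p : Ω × Ω) : PS Ω := if v p.1 = v p.2 then lin p.1 p.2 else 1

lemma vt_eq_pr (A B : Finset Ω) : vt v A B = pr (vtf v) A B := rfl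

/-- three-step labelling -/
noncomputable def lab (A B C : Finset Ω) (x : Ω) : ℕ :=
  if x ∈ A then 1 else if x ∈ B then 2 else if x ∈ C then 3 else 0

lemma lab_swap (A B C : Finset Ω) (i j : Ω) : lab A B C ∘ swap i j =
    lab (pm (swap i j) A) (pm (swap i j) B) (pm (swap i j) C) := by
  funext x; simp [lab, mem_pm_swap]

lemma prod_lab {A B C : Finset Ω} (hAB : Disjoint A B) (hAC : Disjoint A C) (hBC : Disjoint B C)
    (h : Ω × Ω → PS Ω) :
    (∏ p : Ω × Ω, if 0 < lab A B C p.1 ∧ lab A B C p.1 < lab A B C p.2 then h p else 1)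
      = pr h A B * pr h A C * pr h B C := by
  rw [← Finset.prod_filter]
  unfold pr
  rw [← prod_union, ← prod_union]
  · apply prod_congr _ (fun _ _ => rfl)
    ext p
    simp only [mem_filter, mem_univ, true_and, mem_union, mem_product]
    simp only [lab]
    have a1 : ∀ x, x ∈ A → x ∉ B := fun x hx => disjoint_left.1 hAB hx
    have a2 : ∀ x, x ∈ A → x ∉ C := fun x hx => disjoint_left.1 hAC hx
    have a3 : ∀ x, x ∈ B → x ∉ C := fun x hx => disjoint_left.1 hBC hx
    have b1 := a1 p.1; have b2 := a2 p.1; have b3 := a3 p.1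
    have c1 := a1 p.2; have c2 := a2 p.2; have c3 := a3 p.2
    by_cases h1 : p.1 ∈ A <;> by_cases h2 : p.1 ∈ B <;> by_cases h3 : p.1 ∈ C <;>
    by_cases h4 : p.2 ∈ A <;> by_cases h5 : p.2 ∈ B <;> by_cases h6 : p.2 ∈ C <;>
    simp_all
  · rw [disjoint_left] at *
    intro p hp hp'
    simp only [mem_union, mem_product] at hp hp'
    rcases hp with hp | hp
    · exact hAB hp.1 hp'.1
    · exact hAB hp.1 hp'.1
  · rw [disjoint_left] at *
    intro p hp hp'
    simp only [mem_product] at hp hp'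
    exact hBC hp.2 hp'.2

lemma PP_lab {A B C : Finset Ω} (hAB : Disjoint A B) (hAC : Disjoint A C) (hBC : Disjoint B C) :
    PP v e rk (lab A B C)
      = pr (arf v e rk) A B * pr (arf v e rk) A C * pr (arf v e rk) B C := by
  rw [← prod_lab hAB hAC hBC]
  unfold PP
  refine prod_congr rfl fun p _ => ?_
  unfold arf
  by_cases h : 0 < lab A B C p.1 ∧ lab A B C p.1 < lab A B C p.2
  · simp only [h.1, h.2, true_and, if_true, and_self]
  · rw [if_neg h, if_neg]
    rintro ⟨h1, h2, _⟩; exact h ⟨h1, h2⟩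

lemma leadL_lab {A B C : Finset Ω} (hAB : Disjoint A B) (hAC : Disjoint A C) (hBC : Disjoint B C) :
    leadL v e rk (lab A B C)
      = pr (ldf v e rk) A B * pr (ldf v e rk) A C * pr (ldf v e rk) B C := by
  rw [← prod_lab hAB hAC hBC]; rfl

/-- two-step families -/
structure Fam2 (Y : Finset Ω) (g : Finset Ω → PS Ω) : Prop where
  div : ∀ T ⊆ Y, pr (arf v e rk) T (Y \ T) ∣ g T
  gkm : GKM v Y g

variable {v e rk}

lemma Fam2.add {Y : Finset Ω} {g g' : Finset Ω → PS Ω} (h : Fam2 v e rk Y g)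
    (h' : Fam2 v e rk Y g') : Fam2 v e rk Y (fun T => g T + g' T) := by
  refine ⟨fun T hT => dvd_add (h.div T hT) (h'.div T hT), ?_⟩
  intro T hT i hi j hj hv
  have := dvd_add (h.gkm T hT i hi j hj hv) (h'.gkm T hT i hi j hj hv)
  convert this using 1; ring

lemma Fam2.smul {Y : Finset Ω} {g : Finset Ω → PS Ω} (h : Fam2 v e rk Y g) (c : PS Ω) :
    Fam2 v e rk Y (fun T => c * g T) := by
  refine ⟨fun T hT => (h.div T hT).mul_left c, ?_⟩
  intro T hT i hi j hj hv
  have := (h.gkm T hT i hi j hj hv).mul_left c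
  convert this using 1; ring

lemma Fam2.zero {Y : Finset Ω} : Fam2 v e rk Y (fun _ => 0) :=
  ⟨fun T hT => dvd_zero _, fun T hT i hi j hj hv => by simp⟩

lemma Fam2.sum {Y : Finset Ω} {ι : Type*} (s : Finset ι) (g : ι → Finset Ω → PS Ω)
    (h : ∀ a ∈ s, Fam2 v e rk Y (g a)) : Fam2 v e rk Y (fun T => ∑ a ∈ s, g a T) := by
  induction s using cons_induction with
  | empty => simpa using Fam2.zero
  | cons a s ha ih =>
    simp only [sum_cons]
    exact (h a (by simp)).add (ih fun i hi => h i (by simp [hi]))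

lemma Fam2.sub {Y : Finset Ω} {g g' : Finset Ω → PS Ω} (h : Fam2 v e rk Y g)
    (h' : Fam2 v e rk Y g') : Fam2 v e rk Y (fun T => g T - g' T) := by
  have := h.add (h'.smul (-1))
  convert this using 2; ring

lemma intF_add (Z : Finset Ω) (F G : Finset Ω → PS Ω) :
    intF v Z (fun T => F T + G T) = intF v Z F + intF v Z G := by
  unfold intF Iterm
  rw [← sum_add_distrib]
  refine sum_congr rfl fun T _ => ?_
  rw [map_add, add_div]

lemma intF_smul (Z : Finset Ω) (c : PS Ω) (F : Finset Ω → PS Ω) :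
    intF v Z (fun T => c * F T) = algebraMap _ _ c * intF v Z F := by
  unfold intF Iterm
  rw [mul_sum]
  refine sum_congr rfl fun T _ => ?_
  rw [map_mul, mul_div_assoc]

lemma intF_congr {Z : Finset Ω} {F G : Finset Ω → PS Ω} (h : ∀ T ⊆ Z, F T = G T) :
    intF v Z F = intF v Z G := by
  unfold intF Iterm
  refine sum_congr rfl fun T hT => ?_
  rw [h T (mem_powerset.1 hT)]

lemma intP_congr {Z : Finset Ω} {F G : Finset Ω → PS Ω} (h : ∀ T ⊆ Z, F T = G T) :
    intP v Z F = intP v Z G := by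
  unfold intP
  simp only [intF_congr (v := v) h]

lemma Fam2.int {Y : Finset Ω} {g : Finset Ω → PS Ω} (h : Fam2 v e rk Y g) :
    algebraMap _ _ (intP v Y g) = intF v Y g := intP_gkm v h.gkm

lemma intP_add {Y : Finset Ω} {g g' : Finset Ω → PS Ω} (h : Fam2 v e rk Y g)
    (h' : Fam2 v e rk Y g') : intP v Y (fun T => g T + g' T) = intP v Y g + intP v Y g' := by
  apply amap_inj
  rw [map_add, h.int, h'.int, (h.add h').int, intF_add]

lemma intP_smul {Y : Finset Ω} {g : Finset Ω → PS Ω} (h : Fam2 v e rk Y g) (c : PS Ω) :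
    intP v Y (fun T => c * g T) = c * intP v Y g := by
  apply amap_inj
  rw [map_mul, h.int, (h.smul c).int, intF_smul]

lemma intP_sub {Y : Finset Ω} {g g' : Finset Ω → PS Ω} (h : Fam2 v e rk Y g)
    (h' : Fam2 v e rk Y g') : intP v Y (fun T => g T - g' T) = intP v Y g - intP v Y g' := by
  have h1 := intP_add h (h'.smul (-1))
  rw [intP_smul h'] at h1
  have : (fun T => g T - g' T) = fun T => g T + -1 * g' T := by funext T; ring
  rw [this, h1]; ring

lemma intP_zero {Y : Finset Ω} : intP v Y (fun _ => (0 : PS Ω)) = 0 := by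
  apply amap_inj
  rw [intP_spec]
  · simp [intF, Iterm]
  · exact ⟨0, by simp [intF, Iterm]⟩

lemma intP_sum {Y : Finset Ω} {ι : Type*} (s : Finset ι) (g : ι → Finset Ω → PS Ω)
    (h : ∀ a ∈ s, Fam2 v e rk Y (g a)) :
    intP v Y (fun T => ∑ a ∈ s, g a T) = ∑ a ∈ s, intP v Y (g a) := by
  induction s using cons_induction with
  | empty => simpa using intP_zero
  | cons a s ha ih =>
    simp only [sum_cons]
    rw [intP_add (h a (by simp)) (Fam2.sum s g fun i hi => h i (by simp [hi])),
      ih fun i hi => h i (by simp [hi])]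

end A5
section A6
open MvPolynomial

variable {Ω V : Type} [Fintype Ω] {v : Ω → V} {e : V → V → ℕ} {rk : Ω → ℕ}

/-- dominance between subsets with the same vertex content -/
structure LE1 (v : Ω → V) (rk : Ω → ℕ) (T A : Finset Ω) : Prop where
  sc : T.val.map v = A.val.map v
  dom : ∀ m, (T.filter fun x => m ≤ rk x).card ≤ (A.filter fun x => m ≤ rk x).card

lemma LE1.card {T A : Finset Ω} (h : LE1 v rk T A) : T.card = A.card := by
  have := congrArg Multiset.card h.sc
  simpa using this

lemma sc_sum {T A : Finset Ω} (h : T.val.map v = A.val.map v) (θ : V → ℤ) :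
    ∑ x ∈ T, θ (v x) = ∑ x ∈ A, θ (v x) := by
  have := congrArg (fun s => (s.map θ).sum) h
  simp only [Multiset.map_map] at this
  exact this

/-- rank sum -/
def srk (rk : Ω → ℕ) (A : Finset Ω) : ℕ := ∑ x ∈ A, rk x

lemma srk_eq (A : Finset Ω) {N : ℕ} (hN : ∀ x, rk x ≤ N) :
    srk rk A = ∑ m ∈ range N, (A.filter fun x => m + 1 ≤ rk x).card := by
  unfold srk
  simp only [card_filter]
  rw [sum_comm]
  refine sum_congr rfl fun x _ => ?_
  rw [← card_filter]
  have : (range N).filter (fun m => m + 1 ≤ rk x) = range (rk x) := by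
    ext m; have := hN x; simp; omega
  rw [this, card_range]

lemma exists_rk_bound (rk : Ω → ℕ) : ∃ N, ∀ x, rk x ≤ N :=
  ⟨univ.sup rk, fun x => Finset.le_sup (f := rk) (mem_univ x)⟩

lemma LE1.eq_or (hrk : Injective rk) {T A : Finset Ω} (h : LE1 v rk T A) :
    T = A ∨ srk rk T < srk rk A := by
  obtain ⟨N, hN⟩ := exists_rk_bound rk
  rw [srk_eq T hN, srk_eq A hN]
  by_cases hs : ∀ m ∈ range N,
      (A.filter fun x => m + 1 ≤ rk x).card ≤ (T.filter fun x => m + 1 ≤ rk x).card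
  · left
    have hall : ∀ m, (T.filter fun x => m ≤ rk x).card = (A.filter fun x => m ≤ rk x).card := by
      intro m
      rcases Nat.eq_zero_or_pos m with rfl | hm
      · simpa using h.card
      · by_cases hmN : m ≤ N
        · refine le_antisymm (h.dom m) ?_
          have := hs (m - 1) (by simp; omega)
          rwa [Nat.sub_add_cancel hm] at this
        · rw [Finset.filter_false_of_mem, Finset.filter_false_of_mem] <;>
          (intro x _; have := hN x; omega)
    have key : ∀ (B : Finset Ω) x, (x ∈ B ↔
        (B.filter fun y => rk x + 1 ≤ rk y).card < (B.filter fun y => rk x ≤ rk y).card) := by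
      intro B x
      constructor
      · intro hx
        apply card_lt_card
        rw [ssubset_iff_of_subset]
        · exact ⟨x, by simp [hx], by simp⟩
        grind
      · intro hlt
        by_contra hx
        apply hlt.ne
        congr 1
        grind
    ext x
    rw [key T x, key A x, hall, hall]
  · right
    push Not at hs
    obtain ⟨m, hm, hlt⟩ := hs
    exact Finset.sum_lt_sum (fun m _ => h.dom _) ⟨m, hm, hlt⟩

lemma LSup_le1 {A B C T1 T2 T3 : Finset Ω} (h : LSup v rk (lab A B C) (lab T1 T2 T3)) :
    LE1 v rk T1 A := by
  constructor
  · ext w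
    rw [count_map, count_map]
    have := h.cnt w 1
    have e1 : ∀ (A B C : Finset Ω), (univ.filter fun x => v x = w ∧ lab A B C x = 1)
        = A.filter fun x => w = v x := by
      intro A B C; ext x; simp only [mem_filter, mem_univ, true_and]
      simp only [lab]
      split_ifs <;> simp_all [eq_comm]
    rw [e1, e1] at this
    exact this
  · intro m
    have := h.dom 1 m
    unfold Dmn at this
    have e1 : ∀ (A B C : Finset Ω), (univ.filter fun x => 0 < lab A B C x ∧ lab A B C x ≤ 1 ∧ m ≤ rk x)
        = A.filter fun x => m ≤ rk x := by
      intro A B C; ext x; simp only [mem_filter, mem_univ, true_and]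
      simp only [lab]
      split_ifs <;> simp_all
    rw [e1, e1] at this
    exact this

lemma LSup_le2 {A B C T1 T2 T3 : Finset Ω} (h : LSup v rk (lab A B C) (lab T1 T2 T3)) :
    LE1 v rk (T1 ∪ T2) (A ∪ B) := by
  constructor
  · ext w
    rw [count_map, count_map]
    have h1 := h.cnt w 1
    have h2 := h.cnt w 2
    have e1 : ∀ (A B C : Finset Ω), ((A ∪ B).filter fun x => w = v x).card =
        (univ.filter fun x => v x = w ∧ lab A B C x = 1).card +
        (univ.filter fun x => v x = w ∧ lab A B C x = 2).card := by
      intro A B C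
      rw [← card_union_of_disjoint]
      · congr 1
        ext x; simp only [mem_filter, mem_univ, true_and, mem_union]
        simp only [lab]
        split_ifs <;> simp_all [eq_comm]
      · rw [disjoint_left]; intro x; simp; omega
    have := e1 A B C
    have h3 := e1 T1 T2 T3
    rw [h1, h2, ← this] at h3
    exact h3
  · intro m
    have := h.dom 2 m
    unfold Dmn at this
    have e1 : ∀ (A B C : Finset Ω), (univ.filter fun x => 0 < lab A B C x ∧ lab A B C x ≤ 2 ∧ m ≤ rk x)
        = (A ∪ B).filter fun x => m ≤ rk x := by
      intro A B C; ext x; simp only [mem_filter, mem_univ, true_and, mem_union]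
      simp only [lab]
      split_ifs <;> simp_all
    rw [e1, e1] at this
    exact this

/-- vertex part of the lead -/
noncomputable def vlf (v : Ω → V) (rk : Ω → ℕ) (p : Ω × Ω) : PS Ω :=
  if rk p.2 < rk p.1 then 1 else if v p.1 = v p.2 then lin p.1 p.2 else 1

lemma pr_ldf (A B : Finset Ω) :
    pr (ldf v e rk) A B = pr (arf v e rk) A B * pr (vlf v rk) A B := by
  unfold pr
  rw [← prod_mul_distrib]
  refine prod_congr rfl fun p _ => ?_
  unfold ldf arf vlf
  split_ifs <;> simp

lemma isRelPrime_of_prime {a b : PS Ω} (ha : Prime a) (h : ¬ a ∣ b) : IsRelPrime a b :=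
  (Irreducible.isRelPrime_iff_not_dvd ha.irreducible).2 h

lemma vl_mul_dvd (hrk : Injective rk) {P R : Finset Ω} (hPR : Disjoint P R) {d f : PS Ω}
    (hd : ∀ i j, i ≠ j → v i = v j → ¬ lin i j ∣ d) (h : d ∣ f)
    (hl : ∀ i ∈ P, ∀ j ∈ R, v i = v j → rk i < rk j → lin i j ∣ f) :
    d * pr (vlf v rk) P R ∣ f := by
  have hne : ∀ p ∈ P ×ˢ R, p.1 ≠ p.2 := by
    intro p hp; rw [mem_product] at hp
    intro hh; exact disjoint_left.1 hPR hp.1 (hh ▸ hp.2)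
  refine IsRelPrime.mul_dvd ?_ h ?_
  · unfold pr
    refine IsRelPrime.prod_right fun p hp => ?_
    unfold vlf
    split_ifs with h1 h2
    · exact isRelPrime_one_right
    · exact (isRelPrime_of_prime (lin_prime (hne p hp)) (hd _ _ (hne p hp) h2)).symm
    · exact isRelPrime_one_right
  · unfold pr
    refine Finset.prod_dvd_of_isRelPrime ?_ ?_
    · intro p hp p' hp' hpp
      have n1 := hne p hp
      have n2 := hne p' hp'
      simp only [Finset.coe_product, Set.mem_prod, Finset.mem_coe] at hp hp'
      show IsRelPrime (vlf v rk p) (vlf v rk p')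
      unfold vlf
      split_ifs
      all_goals try exact isRelPrime_one_right
      all_goals try exact isRelPrime_one_left
      refine isRelPrime_of_prime (lin_prime n1) fun hdv => ?_
      rcases lin_dvd_lin n2 hdv with ⟨h1, h2⟩ | ⟨h1, h2⟩
      · exact hpp (Prod.ext h1.symm h2.symm)
      grind
    · intro p hp
      have n1 := hne p hp
      rw [mem_product] at hp
      unfold vlf
      split_ifs with h1 h2
      · exact one_dvd _
      · grind
      · exact one_dvd _

lemma arP_eq_PP {A B : Finset Ω} (h : Disjoint A B) :
    pr (arf v e rk) A B = PP v e rk (lab A B ∅) := by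
  rw [PP_lab v e rk h (by simp) (by simp)]; simp

lemma lin_not_dvd_ar (he : ∀ w, e w w = 0) {A B : Finset Ω} (h : Disjoint A B) (i j : Ω)
    (hij : i ≠ j) (hv : v i = v j) : ¬ lin i j ∣ pr (arf v e rk) A B := by
  rw [arP_eq_PP h]; exact lin_not_dvd_PP v rk he hij hv _

lemma sdiff_pm {i j : Ω} {Y T : Finset Ω} (h : i ∈ Y ↔ j ∈ Y) :
    pm (swap i j) (Y \ T) = Y \ pm (swap i j) T := by
  rw [pm_sdiff, pm_swap_eq h]

lemma pm_sub {i j : Ω} {Y T : Finset Ω} (h : i ∈ Y ↔ j ∈ Y) (hT : T ⊆ Y) :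
    pm (swap i j) T ⊆ Y := by
  rw [← pm_swap_eq h, pm_subset]; exact hT

lemma ind_exists (he : ∀ w, e w w = 0) (hrk : Injective rk) {A Y : Finset Ω} (hA : A ⊆ Y) :
    ∃ g, Fam2 v e rk Y g ∧ g A = pr (ldf v e rk) A (Y \ A) ∧
      ∀ T ⊆ Y, g T ≠ 0 → LE1 v rk T A := by
  obtain ⟨K, hK, hl, hs⟩ := exists_lead v e he _ rk hrk (lab A (Y \ A) ∅) rfl
  refine ⟨fun T => K (lab T (Y \ T) ∅), ⟨?_, ?_⟩, ?_, ?_⟩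
  · intro T hT
    rw [arP_eq_PP disjoint_sdiff]; exact hK.div _
  · intro T hT i hi j hj hv
    have := hK.gkm (lab T (Y \ T) ∅) i j hv (by simp [lab]; split_ifs <;> simp_all)
      (by simp [lab]; split_ifs <;> simp_all)
    rw [lab_swap, sdiff_pm (by simp [hi, hj])] at this
    exact this
  · show K _ = _
    rw [hl, leadL_lab v e rk disjoint_sdiff (by simp) (by simp)]; simp
  · intro T hT h
    exact LSup_le1 (hs _ h)

lemma pm_srk {A : Finset Ω} {i j : Ω} (hi : i ∈ A) (hj : j ∉ A) :
    srk rk (pm (swap i j) A) + rk i = srk rk A + rk j := by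
  unfold srk pm
  rw [sum_map]
  have h1 := add_sum_erase A (fun x => rk (swap i j x)) hi
  have h2 := add_sum_erase A rk hi
  have : ∑ x ∈ A.erase i, rk (swap i j x) = ∑ x ∈ A.erase i, rk x := by
    refine sum_congr rfl fun x hx => ?_
    rw [mem_erase] at hx
    rw [swap_apply_of_ne_of_ne hx.1 (fun h => hj (by rw [← h]; exact hx.2))]
  simp only [Equiv.coe_toEmbedding]
  rw [← h1, ← h2, this]
  simp; ring

lemma lead_dvd (he : ∀ w, e w w = 0) (hrk : Injective rk) {A Y : Finset Ω} (hA : A ⊆ Y)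
    {g : Finset Ω → PS Ω} (hg : Fam2 v e rk Y g)
    (h : ∀ T ⊆ Y, srk rk A < srk rk T → g T = 0) : pr (ldf v e rk) A (Y \ A) ∣ g A := by
  rw [pr_ldf]
  refine vl_mul_dvd hrk disjoint_sdiff (lin_not_dvd_ar he disjoint_sdiff)
    (hg.div A hA) ?_
  intro i hi j hj hv hlt
  have hj' := mem_sdiff.1 hj
  have h1 := hg.gkm A hA i (hA hi) j hj'.1 hv
  rw [h _ (pm_sub (by simp [hA hi, hj'.1]) hA), sub_zero] at h1
  · exact h1
  · have := pm_srk (rk := rk) hi hj'.2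
    omega

/-- generation of families by leading families -/
lemma gen (he : ∀ w, e w w = 0) (hrk : Injective rk) {Y : Finset Ω}
    (p : Finset Ω → Prop) (κ : Finset Ω → Finset Ω → PS Ω)
    (hκ : ∀ T0 ⊆ Y, p T0 → Fam2 v e rk Y (κ T0) ∧ κ T0 T0 = pr (ldf v e rk) T0 (Y \ T0) ∧
      ∀ T ⊆ Y, κ T0 T ≠ 0 → p T ∧ (T = T0 ∨ srk rk T < srk rk T0)) (n : ℕ) :
    ∀ g, Fam2 v e rk Y g → (∀ T ⊆ Y, g T ≠ 0 → p T ∧ srk rk T < n) →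
    ∃ c : Finset Ω → PS Ω, ∀ T ⊆ Y, g T = ∑ T0 ∈ Y.powerset.filter p, c T0 * κ T0 T := by
  induction n with
  | zero =>
    intro g hg hs
    refine ⟨fun _ => 0, fun T hT => ?_⟩
    simp_all
  | succ n ih =>
    intro g hg hs
    have hd : ∀ T0 : Finset Ω, ∃ c, T0 ⊆ Y → srk rk T0 = n → g T0 = c * pr (ldf v e rk) T0 (Y \ T0) := by
      intro T0
      by_cases h : T0 ⊆ Y ∧ srk rk T0 = n
      · obtain ⟨c, hc⟩ := lead_dvd he hrk h.1 hg (fun T hT hlt => by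
          grind)
        exact ⟨c, fun _ _ => by rw [hc]; ring⟩
      · exact ⟨0, fun h1 h2 => absurd ⟨h1, h2⟩ h⟩
    choose c0 hc0 using hd
    let I := (Y.powerset.filter p).filter fun T0 => srk rk T0 = n
    have hI : ∀ T0 ∈ I, T0 ⊆ Y ∧ p T0 ∧ srk rk T0 = n := by
      intro T0 h; simp only [I, mem_filter, mem_powerset] at h; tauto
    obtain ⟨c, hc⟩ := ih (fun T => g T - ∑ T0 ∈ I, c0 T0 * κ T0 T)
      (hg.sub (Fam2.sum I (fun T0 T => c0 T0 * κ T0 T) fun T0 h =>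
        ((hκ T0 (hI T0 h).1 (hI T0 h).2.1).1.smul _))) (by
      intro T hT hne
      have hpT : p T ∧ srk rk T < n + 1 := by
        by_cases hgT : g T = 0
        · rw [hgT, zero_sub, neg_ne_zero] at hne
          obtain ⟨T0, h0, hh⟩ := exists_ne_zero_of_sum_ne_zero hne
          have h3 := hI T0 h0
          have := (hκ T0 h3.1 h3.2.1).2.2 T hT (right_ne_zero_of_mul hh)
          grind
        · exact hs T hT hgT
      refine ⟨hpT.1, ?_⟩
      by_contra hn
      have hn' : srk rk T = n := by omega
      apply hne
      have hTI : T ∈ I := by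
        simp only [I, mem_filter, mem_powerset]; exact ⟨⟨hT, hpT.1⟩, hn'⟩
      rw [sum_eq_single_of_mem T hTI]
      · rw [(hκ T hT hpT.1).2.1, hc0 T hT hn', sub_self]
      grind)
    refine ⟨fun T0 => c T0 + if srk rk T0 = n then c0 T0 else 0, fun T hT => ?_⟩
    have := hc T hT
    rw [sub_eq_iff_eq_add] at this
    rw [this]
    simp only [add_mul, sum_add_distrib]
    congr 1
    simp only [I]
    rw [sum_filter]
    grind

lemma srk_bound (rk : Ω → ℕ) : ∃ n, ∀ T : Finset Ω, srk rk T < n :=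
  ⟨srk rk univ + 1, fun T => Nat.lt_succ_of_le
    (Finset.sum_le_sum_of_subset (subset_univ T))⟩

lemma gen' (he : ∀ w, e w w = 0) (hrk : Injective rk) {Y : Finset Ω}
    (p : Finset Ω → Prop) (κ : Finset Ω → Finset Ω → PS Ω)
    (hκ : ∀ T0 ⊆ Y, p T0 → Fam2 v e rk Y (κ T0) ∧ κ T0 T0 = pr (ldf v e rk) T0 (Y \ T0) ∧
      ∀ T ⊆ Y, κ T0 T ≠ 0 → p T ∧ (T = T0 ∨ srk rk T < srk rk T0))
    {g} (hg : Fam2 v e rk Y g) (hs : ∀ T ⊆ Y, g T ≠ 0 → p T) :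
    ∃ c : Finset Ω → PS Ω, ∀ T ⊆ Y, g T = ∑ T0 ∈ Y.powerset.filter p, c T0 * κ T0 T := by
  obtain ⟨n, hn⟩ := srk_bound rk
  exact gen he hrk p κ hκ n g hg fun T hT h => ⟨hs T hT h, hn T⟩

end A6
section A7
open MvPolynomial

variable {Ω V : Type} [Fintype Ω] {v : Ω → V} {e : V → V → ℕ} {rk : Ω → ℕ}

/-- merge of the first two steps -/
noncomputable def m12 (v : Ω → V) (K : (Ω → ℕ) → PS Ω) (Y T : Finset Ω) : PS Ω :=
  intP v T fun T1 => K (lab T1 (T \ T1) (Y \ T))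
/-- merge of the last two steps -/
noncomputable def m23 (v : Ω → V) (K : (Ω → ℕ) → PS Ω) (Y T : Finset Ω) : PS Ω :=
  intP v (Y \ T) fun T2 => K (lab T T2 ((Y \ T) \ T2))

lemma lab_pos {A B C Y : Finset Ω} (h : A ∪ B ∪ C = Y) {i : Ω} (hi : i ∈ Y) : 0 < lab A B C i := by
  rw [← h] at hi
  simp only [lab]
  simp only [mem_union] at hi
  split_ifs <;> simp_all

lemma part3 {T T1 Y : Finset Ω} (h1 : T1 ⊆ T) (h : T ⊆ Y) : T1 ∪ (T \ T1) ∪ (Y \ T) = Y := by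
  ext x; have := @h1 x; have := @h x; simp; tauto

lemma part3' {T T2 Y : Finset Ω} (h1 : T2 ⊆ Y \ T) (h : T ⊆ Y) : T ∪ T2 ∪ ((Y \ T) \ T2) = Y := by
  ext x; have := @h1 x; have := @h x; simp at *; tauto

lemma pm_dvd_self {i j : Ω} {f : Finset Ω → PS Ω} {T : Finset Ω}
    (h : i ≠ j → lin i j ∣ f T - f (pm (swap i j) T)) :
    lin i j ∣ f T - f (pm (swap i j) T) := by
  by_cases hij : i = j
  · subst hij
    have : pm (swap i i) T = T := pm_swap_eq (by simp)
    rw [this, sub_self]; exact dvd_zero _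
  · exact h hij

lemma gkm_in12 {K : (Ω → ℕ) → PS Ω} (hK : LFam v e rk K) {Y T : Finset Ω} (hT : T ⊆ Y) :
    GKM v T fun T1 => K (lab T1 (T \ T1) (Y \ T)) := by
  intro T1 h1 i hi j hj hv
  have := hK.gkm _ i j hv (lab_pos (part3 h1 hT) (hT hi)) (lab_pos (part3 h1 hT) (hT hj))
  rw [lab_swap, sdiff_pm (by simp [hi, hj]), sdiff_pm (by simp [hT hi, hT hj]),
    pm_swap_eq (Z := T) (by simp [hi, hj])] at this
  exact this

lemma gkm_in23 {K : (Ω → ℕ) → PS Ω} (hK : LFam v e rk K) {Y T : Finset Ω} (hT : T ⊆ Y) :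
    GKM v (Y \ T) fun T2 => K (lab T T2 ((Y \ T) \ T2)) := by
  intro T2 h1 i hi j hj hv
  have hi' := mem_sdiff.1 hi
  have hj' := mem_sdiff.1 hj
  have := hK.gkm _ i j hv (lab_pos (part3' h1 hT) hi'.1) (lab_pos (part3' h1 hT) hj'.1)
  rw [lab_swap, sdiff_pm (by simp [hi', hj']),
    pm_swap_eq (Z := T) (by simp [hi', hj'])] at this
  exact this

lemma PP3 (A B C : Finset Ω) (h1 : Disjoint A B) (h2 : Disjoint A C) (h3 : Disjoint B C) :
    PP v e rk (lab A B C) = pr (arf v e rk) A B * pr (arf v e rk) (A ∪ B) C := by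
  rw [PP_lab v e rk h1 h2 h3, pr_union_left _ h1]; ring

lemma PP3' (A B C : Finset Ω) (h1 : Disjoint A B) (h2 : Disjoint A C) (h3 : Disjoint B C) :
    PP v e rk (lab A B C) = pr (arf v e rk) B C * pr (arf v e rk) A (B ∪ C) := by
  rw [PP_lab v e rk h1 h2 h3, pr_union_right _ h3]; ring

lemma dis12 {T T1 Y : Finset Ω} (h1 : T1 ⊆ T) : Disjoint T1 (Y \ T) :=
  Finset.disjoint_of_subset_left h1 disjoint_sdiff

lemma PP12 {T T1 Y : Finset Ω} (h1 : T1 ⊆ T) : PP v e rk (lab T1 (T \ T1) (Y \ T)) =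
    pr (arf v e rk) T1 (T \ T1) * pr (arf v e rk) T (Y \ T) := by
  rw [PP3 _ _ _ disjoint_sdiff (dis12 h1) (dis12 sdiff_subset),
    union_sdiff_of_subset h1]

lemma dis23 {T T2 Y : Finset Ω} (h1 : T2 ⊆ Y \ T) : Disjoint T T2 :=
  Finset.disjoint_of_subset_right h1 disjoint_sdiff

lemma PP23 {T T2 Y : Finset Ω} (h1 : T2 ⊆ Y \ T) : PP v e rk (lab T T2 ((Y \ T) \ T2)) =
    pr (arf v e rk) T2 ((Y \ T) \ T2) * pr (arf v e rk) T (Y \ T) := by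
  rw [PP3' _ _ _ (dis23 h1) (dis23 sdiff_subset) disjoint_sdiff,
    union_sdiff_of_subset h1]

lemma m12_fam (he : ∀ w, e w w = 0) {K : (Ω → ℕ) → PS Ω} (hK : LFam v e rk K) (Y : Finset Ω) :
    Fam2 v e rk Y (m12 v K Y) := by
  constructor
  · intro T hT
    refine dvd_intP v (gkm_in12 hK hT) (lin_not_dvd_ar he disjoint_sdiff) ?_
    intro T1 h1
    refine dvd_trans ?_ (hK.div _)
    rw [PP12 h1]; exact dvd_mul_left _ _
  · intro T hT i hi j hj hv
    refine pm_dvd_self fun hij => ?_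
    by_cases hc : i ∈ T ∧ j ∈ T
    · rw [pm_swap_eq (Z := T) (by simp [hc]), sub_self]; exact dvd_zero _
    have hp : pm (swap i j) T ⊆ Y := pm_sub (by simp [hi, hj]) hT
    unfold m12
    refine intP_cong v hij hv hc (gkm_in12 hK hT) (gkm_in12 hK hp) ?_
    intro T1 h1
    have := hK.gkm _ i j hv (lab_pos (part3 h1 hT) hi) (lab_pos (part3 h1 hT) hj)
    rw [lab_swap, pm_sdiff, sdiff_pm (by simp [hi, hj])] at this
    exact this

lemma m23_fam (he : ∀ w, e w w = 0) {K : (Ω → ℕ) → PS Ω} (hK : LFam v e rk K) (Y : Finset Ω) :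
    Fam2 v e rk Y (m23 v K Y) := by
  constructor
  · intro T hT
    refine dvd_intP v (gkm_in23 hK hT) (lin_not_dvd_ar he disjoint_sdiff) ?_
    intro T1 h1
    refine dvd_trans ?_ (hK.div _)
    rw [PP23 h1]; exact dvd_mul_left _ _
  · intro T hT i hi j hj hv
    refine pm_dvd_self fun hij => ?_
    by_cases hc : i ∈ Y \ T ∧ j ∈ Y \ T
    · have := hc; simp only [mem_sdiff] at this
      rw [pm_swap_eq (Z := T) (by simp [this]), sub_self]; exact dvd_zero _
    have hp : pm (swap i j) T ⊆ Y := pm_sub (by simp [hi, hj]) hT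
    have hq : pm (swap i j) (Y \ T) = Y \ pm (swap i j) T := sdiff_pm (by simp [hi, hj])
    unfold m23
    have := intP_cong v hij hv hc (gkm_in23 hK hT) (hq ▸ gkm_in23 hK hp :
      GKM v (pm (swap i j) (Y \ T)) fun T2 => K (lab (pm (swap i j) T) T2
        ((Y \ (pm (swap i j) T)) \ T2))) ?_
    · rw [hq] at this; exact this
    intro T1 h1
    have := hK.gkm _ i j hv (lab_pos (part3' h1 hT) hi) (lab_pos (part3' h1 hT) hj)
    rw [lab_swap, pm_sdiff, hq] at this
    exact this

lemma vt_union_left {A A' : Finset Ω} (hd : Disjoint A A') (B : Finset Ω) :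
    vt v (A ∪ A') B = vt v A B * vt v A' B := by
  simp only [vt_eq_pr]; exact pr_union_left _ hd B

lemma vt_union_right {A A' : Finset Ω} (hd : Disjoint A A') (B : Finset Ω) :
    vt v B (A ∪ A') = vt v B A * vt v B A' := by
  simp only [vt_eq_pr]; exact pr_union_right _ hd B

lemma merge_eq (he : ∀ w, e w w = 0) {K : (Ω → ℕ) → PS Ω} (hK : LFam v e rk K) (Y : Finset Ω) :
    intP v Y (m12 v K Y) = intP v Y (m23 v K Y) := by
  apply amap_inj
  rw [(m12_fam he hK Y).int, (m23_fam he hK Y).int]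
  let G : Finset Ω → Finset Ω → Finset Ω → PF Ω := fun A B C =>
    algebraMap _ _ (K (lab A B C)) / (algebraMap _ _ (vt v A B) * algebraMap _ _ (vt v A C)
      * algebraMap _ _ (vt v B C))
  have h1 : intF v Y (m12 v K Y) = ∑ T ∈ Y.powerset, ∑ T1 ∈ T.powerset, G T1 (T \ T1) (Y \ T) := by
    unfold intF
    refine sum_congr rfl fun T hT => ?_
    rw [mem_powerset] at hT
    unfold Iterm m12
    rw [intP_gkm v (gkm_in12 hK hT)]
    unfold intF
    rw [sum_div]
    refine sum_congr rfl fun T1 h1 => ?_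
    rw [mem_powerset] at h1
    unfold Iterm
    simp only [G]
    rw [div_div]
    congr 1
    conv_lhs => rw [show vt v T (Y \ T) = vt v (T1 ∪ (T \ T1)) (Y \ T) by
      rw [union_sdiff_of_subset h1]]
    rw [vt_union_left disjoint_sdiff, map_mul]; ring
  have h2 : intF v Y (m23 v K Y) =
      ∑ T ∈ Y.powerset, ∑ T2 ∈ (Y \ T).powerset, G T T2 ((Y \ T) \ T2) := by
    unfold intF
    refine sum_congr rfl fun T hT => ?_
    rw [mem_powerset] at hT
    unfold Iterm m23
    rw [intP_gkm v (gkm_in23 hK hT)]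
    unfold intF
    rw [sum_div]
    refine sum_congr rfl fun T1 h1 => ?_
    rw [mem_powerset] at h1
    unfold Iterm
    simp only [G]
    rw [div_div]
    congr 1
    conv_lhs => rw [show vt v T (Y \ T) = vt v T (T1 ∪ ((Y \ T) \ T1)) by
      rw [union_sdiff_of_subset h1]]
    rw [vt_union_right disjoint_sdiff, map_mul]; ring
  rw [h1, h2, Finset.sum_sigma', Finset.sum_sigma']
  refine sum_bij' (fun p _ => ⟨p.2, p.1 \ p.2⟩) (fun p _ => ⟨p.1 ∪ p.2, p.1⟩) ?_ ?_ ?_ ?_ ?_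
  · rintro ⟨T, T1⟩ h
    simp only [mem_sigma, mem_powerset] at h ⊢
    refine ⟨h.2.trans h.1, fun x => ?_⟩
    have := @h.1 x; simp; tauto
  · rintro ⟨T, T1⟩ h
    simp only [mem_sigma, mem_powerset] at h ⊢
    refine ⟨Finset.union_subset h.1 (h.2.trans sdiff_subset), Finset.subset_union_left⟩
  · rintro ⟨T, T1⟩ h
    simp only [mem_sigma, mem_powerset] at h ⊢
    rw [union_sdiff_of_subset h.2]
  · rintro ⟨T, T1⟩ h
    simp only [mem_sigma, mem_powerset] at h ⊢
    rw [Finset.union_sdiff_cancel_left (dis23 h.2)]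
  · rintro ⟨T, T1⟩ h
    simp only [mem_sigma, mem_powerset] at h ⊢
    congr 1
    ext x; have := @h.2 x; simp; tauto

variable (v e rk) in
/-- the ideal of integrals with support condition -/
def UU (Y : Finset Ω) (p : Finset Ω → Prop) : Ideal (PS Ω) where
  carrier := {f | ∃ g, Fam2 v e rk Y g ∧ (∀ T ⊆ Y, g T ≠ 0 → p T) ∧ f = intP v Y g}
  add_mem' := by
    rintro f f' ⟨g, h1, h2, rfl⟩ ⟨g', h1', h2', rfl⟩
    refine ⟨_, h1.add h1', fun T hT hne => ?_, (intP_add h1 h1').symm⟩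
    by_cases h : g T = 0
    · rw [h, zero_add] at hne; exact h2' T hT hne
    · exact h2 T hT h
  zero_mem' := ⟨_, Fam2.zero, by simp, intP_zero.symm⟩
  smul_mem' := by
    rintro c f ⟨g, h1, h2, rfl⟩
    exact ⟨_, h1.smul c, fun T hT hne => h2 T hT (right_ne_zero_of_mul hne), (intP_smul h1 c).symm⟩

variable (v) in
/-- theta of a subset -/
def th (θ : V → ℤ) (A : Finset Ω) : ℤ := ∑ x ∈ A, θ (v x)

lemma LE1.th {T A : Finset Ω} (h : LE1 v rk T A) (θ : V → ℤ) : th v θ T = th v θ A := sc_sum h.sc θ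

variable (v) in
/-- torsion-free condition -/
def pF (θ : V → ℤ) (T : Finset Ω) : Prop := th v θ T < 0
variable (v) in
/-- torsion condition -/
def pT (θ : V → ℤ) (Y : Finset Ω) (T : Finset Ω) : Prop := T ≠ Y ∧ 0 ≤ th v θ (Y \ T)

lemma intP_ne_zero {Z : Finset Ω} {F : Finset Ω → PS Ω} (h : intP v Z F ≠ 0) :
    ∃ T ⊆ Z, F T ≠ 0 := by
  by_contra hc
  push Not at hc
  apply h
  rw [intP_congr hc, intP_zero]

lemma th_sdiff {θ : V → ℤ} {A T : Finset Ω} (h : T ⊆ A) :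
    th v θ (A \ T) = th v θ A - th v θ T := by
  unfold th; rw [← Finset.sum_sdiff h]; ring

lemma ld_not_dvd {P R : Finset Ω} (he : ∀ w, e w w = 0) (hPR : Disjoint P R) {i j : Ω} (hij : i ≠ j)
    (hv : v i = v j) (h : (i ∈ P ∧ j ∈ P) ∨ (i ∈ R ∧ j ∈ R)) :
    ¬ lin i j ∣ pr (ldf v e rk) P R := by
  rw [pr_ldf]
  intro hd
  rcases (lin_prime hij).dvd_or_dvd hd with hd | hd
  · exact lin_not_dvd_ar he hPR i j hij hv hd
  · obtain ⟨p, hp, hd⟩ := (lin_prime hij).exists_mem_finset_dvd hd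
    rw [mem_product] at hp
    unfold vlf at hd
    have hne : p.1 ≠ p.2 := fun hh => disjoint_left.1 hPR hp.1 (hh ▸ hp.2)
    split_ifs at hd
    · exact (lin_prime hij).not_isUnit (isUnit_of_dvd_one hd)
    · have hPR' : ∀ x, x ∈ P → x ∉ R := fun x hx => disjoint_left.1 hPR hx
      rcases lin_dvd_lin hne hd with ⟨h1, h2⟩ | ⟨h1, h2⟩ <;> rw [h1, h2] at hp
      · rcases h with h | h
        · exact hPR' _ h.2 hp.2
        · exact hPR' _ hp.1 h.1
      · rcases h with h | h
        · exact hPR' _ h.1 hp.2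
        · exact hPR' _ hp.1 h.2
    · exact (lin_prime hij).not_isUnit (isUnit_of_dvd_one hd)

lemma pr_ne_zero {P R : Finset Ω} (hPR : Disjoint P R) : pr (ldf v e rk) P R ≠ 0 := by
  unfold pr
  rw [prod_ne_zero_iff]
  intro p hp
  rw [mem_product] at hp
  have hne : p.1 ≠ p.2 := fun hh => disjoint_left.1 hPR hp.1 (hh ▸ hp.2)
  unfold ldf
  split_ifs
  · exact pow_ne_zero _ (lin_ne_zero hne)
  · exact lin_ne_zero hne
  · exact one_ne_zero

end A7
section A8
open MvPolynomial

variable {Ω V : Type} [Fintype Ω] {v : Ω → V} {e : V → V → ℕ} {rk : Ω → ℕ}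

lemma le1_swap {A : Finset Ω} {i j : Ω} (hi : i ∈ A) (hj : j ∉ A) (hr : rk i < rk j)
    (hrk : Injective rk) : ¬ LE1 v rk (pm (swap i j) A) A := by
  intro h
  have := pm_srk (rk := rk) hi hj
  rcases h.eq_or hrk with h | h
  · rw [h] at this; omega
  · omega

lemma pm_union (i j : Ω) (A B : Finset Ω) : pm (swap i j) (A ∪ B) =
    pm (swap i j) A ∪ pm (swap i j) B := by
  ext x; simp [mem_pm_swap]

lemma ld_split3 {A B C : Finset Ω} (hAB : Disjoint A B) (hAC : Disjoint A C) (hBC : Disjoint B C) :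
    leadL v e rk (lab A B C) = pr (ldf v e rk) A B * pr (ldf v e rk) (A ∪ B) C := by
  rw [leadL_lab v e rk hAB hAC hBC, pr_union_left _ hAB]; ring

lemma ld_split3' {A B C : Finset Ω} (hAB : Disjoint A B) (hAC : Disjoint A C) (hBC : Disjoint B C) :
    leadL v e rk (lab A B C) = pr (ldf v e rk) B C * pr (ldf v e rk) A (B ∪ C) := by
  rw [leadL_lab v e rk hAB hAC hBC, pr_union_right _ hBC]; ring

lemma dvd_cancel_prime {π a b : PS Ω} (hπ : Prime π) (h : ¬ π ∣ a) (hd : π ∣ a * b) : π ∣ b :=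
  (hπ.dvd_or_dvd hd).resolve_left h

lemma core1 (he : ∀ w, e w w = 0) (hrk : Injective rk) {T0 A0 Y : Finset Ω}
    (hT : T0 ⊆ A0) (hA : A0 ⊆ Y) :
    ∃ κ g' y, Fam2 v e rk A0 κ ∧ κ T0 = pr (ldf v e rk) T0 (A0 \ T0) ∧
      (∀ T ⊆ A0, κ T ≠ 0 → LE1 v rk T T0) ∧ Fam2 v e rk Y g' ∧
      (∀ T ⊆ Y, g' T ≠ 0 → LE1 v rk T A0) ∧
      g' A0 = pr (ldf v e rk) A0 (Y \ A0) * intP v A0 κ ∧ Fam2 v e rk Y y ∧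
      intP v Y g' = intP v Y y ∧ ∀ T ⊆ Y, y T ≠ 0 → LE1 v rk T T0 := by
  obtain ⟨K, hK, hl, hs⟩ := exists_lead v e he _ rk hrk (lab T0 (A0 \ T0) (Y \ A0)) rfl
  have hu : T0 ∪ (A0 \ T0) = A0 := union_sdiff_of_subset hT
  have hs1 : ∀ T1 T2 T3, K (lab T1 T2 T3) ≠ 0 → LE1 v rk T1 T0 ∧ LE1 v rk (T1 ∪ T2) A0 := by
    intro T1 T2 T3 h
    refine ⟨LSup_le1 (hs _ h), ?_⟩
    have := LSup_le2 (hs _ h)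
    rwa [hu] at this
  have hLd : Disjoint A0 (Y \ A0) := disjoint_sdiff
  have hd : ∀ T : Finset Ω, ∃ c, T ⊆ A0 → K (lab T (A0 \ T) (Y \ A0)) =
      pr (ldf v e rk) A0 (Y \ A0) * (pr (arf v e rk) T (A0 \ T) * c) := by
    intro T
    by_cases h1 : T ⊆ A0
    · have : PP v e rk (lab T (A0 \ T) (Y \ A0)) * pr (vlf v rk) A0 (Y \ A0) ∣
          K (lab T (A0 \ T) (Y \ A0)) := by
        refine vl_mul_dvd hrk hLd (fun i j hij hv => lin_not_dvd_PP v rk he hij hv _)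
          (hK.div _) ?_
        intro i hi j hj hv hlt
        have hj' := mem_sdiff.1 hj
        have h2 := hK.gkm _ i j hv (lab_pos (part3 h1 hA) (hA hi)) (lab_pos (part3 h1 hA) hj'.1)
        have h0 : K (lab T (A0 \ T) (Y \ A0) ∘ swap i j) = 0 := by
          by_contra hne
          rw [lab_swap] at hne
          have := (hs1 _ _ _ hne).2
          rw [← pm_union, union_sdiff_of_subset h1] at this
          exact le1_swap hi hj'.2 hlt hrk this
        rwa [h0, sub_zero] at h2
      obtain ⟨c, hc⟩ := this
      refine ⟨c, fun _ => ?_⟩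
      rw [hc, PP12 h1, pr_ldf]; ring
    · exact ⟨0, fun h => absurd h h1⟩
  choose c hc using hd
  let κ : Finset Ω → PS Ω := fun T => pr (arf v e rk) T (A0 \ T) * c T
  have hκ : ∀ T ⊆ A0, K (lab T (A0 \ T) (Y \ A0)) = pr (ldf v e rk) A0 (Y \ A0) * κ T := hc
  have hκF : Fam2 v e rk A0 κ := by
    refine ⟨fun T h1 => Dvd.intro _ rfl, ?_⟩
    intro T h1 i hi j hj hv
    refine pm_dvd_self fun hij => ?_
    have h2 := gkm_in12 hK hA T h1 i hi j hj hv
    simp only at h2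
    rw [hκ T h1, hκ _ (pm_sub (by simp [hi, hj]) h1), ← mul_sub] at h2
    exact dvd_cancel_prime (lin_prime hij) (ld_not_dvd he hLd hij hv (Or.inl ⟨hi, hj⟩)) h2
  refine ⟨κ, m12 v K Y, m23 v K Y, hκF, ?_, ?_, m12_fam he hK Y, ?_, ?_, m23_fam he hK Y,
    merge_eq he hK Y, ?_⟩
  · have h1 := hκ T0 hT
    rw [hl, ld_split3 disjoint_sdiff (dis12 hT) (dis12 sdiff_subset), hu, mul_comm] at h1
    exact (mul_left_cancel₀ (pr_ne_zero hLd) h1).symm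
  · intro T h1 hne
    refine (hs1 T (A0 \ T) (Y \ A0) ?_).1
    rw [hκ T h1]; exact mul_ne_zero (pr_ne_zero hLd) hne
  · intro T h1 hne
    obtain ⟨T1, h2, h3⟩ := intP_ne_zero hne
    have := (hs1 _ _ _ h3).2
    rwa [union_sdiff_of_subset h2] at this
  · unfold m12
    rw [intP_congr hκ, intP_smul hκF]
  · intro T h1 hne
    obtain ⟨T1, h2, h3⟩ := intP_ne_zero hne
    exact (hs1 _ _ _ h3).1

lemma core2 (he : ∀ w, e w w = 0) (hrk : Injective rk) {T0 A0 Y : Finset Ω}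
    (hT : T0 ⊆ Y \ A0) (hA : A0 ⊆ Y) :
    ∃ κ g' y, Fam2 v e rk (Y \ A0) κ ∧ κ T0 = pr (ldf v e rk) T0 ((Y \ A0) \ T0) ∧
      (∀ T ⊆ Y \ A0, κ T ≠ 0 → LE1 v rk T T0) ∧ Fam2 v e rk Y g' ∧
      (∀ T ⊆ Y, g' T ≠ 0 → LE1 v rk T A0) ∧
      g' A0 = pr (ldf v e rk) A0 (Y \ A0) * intP v (Y \ A0) κ ∧ Fam2 v e rk Y y ∧
      intP v Y g' = intP v Y y ∧ ∀ T ⊆ Y, y T ≠ 0 → LE1 v rk T (A0 ∪ T0) := by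
  obtain ⟨K, hK, hl, hs⟩ := exists_lead v e he _ rk hrk (lab A0 T0 ((Y \ A0) \ T0)) rfl
  have hs1 : ∀ T1 T2 T3, K (lab T1 T2 T3) ≠ 0 → LE1 v rk T1 A0 ∧ LE1 v rk (T1 ∪ T2) (A0 ∪ T0) :=
    fun T1 T2 T3 h => ⟨LSup_le1 (hs _ h), LSup_le2 (hs _ h)⟩
  have hLd : Disjoint A0 (Y \ A0) := disjoint_sdiff
  have hd : ∀ T : Finset Ω, ∃ c, T ⊆ Y \ A0 → K (lab A0 T ((Y \ A0) \ T)) =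
      pr (ldf v e rk) A0 (Y \ A0) * (pr (arf v e rk) T ((Y \ A0) \ T) * c) := by
    intro T
    by_cases h1 : T ⊆ Y \ A0
    · have : PP v e rk (lab A0 T ((Y \ A0) \ T)) * pr (vlf v rk) A0 (Y \ A0) ∣
          K (lab A0 T ((Y \ A0) \ T)) := by
        refine vl_mul_dvd hrk hLd (fun i j hij hv => lin_not_dvd_PP v rk he hij hv _)
          (hK.div _) ?_
        intro i hi j hj hv hlt
        have hj' := mem_sdiff.1 hj
        have h2 := hK.gkm _ i j hv (lab_pos (part3' h1 hA) (hA hi)) (lab_pos (part3' h1 hA) hj'.1)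
        have h0 : K (lab A0 T ((Y \ A0) \ T) ∘ swap i j) = 0 := by
          by_contra hne
          rw [lab_swap] at hne
          have := (hs1 _ _ _ hne).1
          exact le1_swap hi hj'.2 hlt hrk this
        rwa [h0, sub_zero] at h2
      obtain ⟨c, hc⟩ := this
      refine ⟨c, fun _ => ?_⟩
      rw [hc, PP23 h1, pr_ldf]; ring
    · exact ⟨0, fun h => absurd h h1⟩
  choose c hc using hd
  let κ : Finset Ω → PS Ω := fun T => pr (arf v e rk) T ((Y \ A0) \ T) * c T
  have hκ : ∀ T ⊆ Y \ A0, K (lab A0 T ((Y \ A0) \ T)) = pr (ldf v e rk) A0 (Y \ A0) * κ T := hc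
  have hκF : Fam2 v e rk (Y \ A0) κ := by
    refine ⟨fun T h1 => Dvd.intro _ rfl, ?_⟩
    intro T h1 i hi j hj hv
    refine pm_dvd_self fun hij => ?_
    have h2 := gkm_in23 hK hA T h1 i hi j hj hv
    simp only at h2
    rw [hκ T h1, hκ _ (pm_sub (by simp only [hi, hj]) h1), ← mul_sub] at h2
    exact dvd_cancel_prime (lin_prime hij) (ld_not_dvd he hLd hij hv (Or.inr ⟨hi, hj⟩)) h2
  refine ⟨κ, m23 v K Y, m12 v K Y, hκF, ?_, ?_, m23_fam he hK Y, ?_, ?_, m12_fam he hK Y,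
    (merge_eq he hK Y).symm, ?_⟩
  · have h1 := hκ T0 hT
    rw [hl, ld_split3' (dis23 hT) (dis23 sdiff_subset) disjoint_sdiff,
      union_sdiff_of_subset hT, mul_comm] at h1
    exact (mul_left_cancel₀ (pr_ne_zero hLd) h1).symm
  · intro T h1 hne
    have := (hs1 A0 T ((Y \ A0) \ T) (by rw [hκ T h1]; exact mul_ne_zero (pr_ne_zero hLd) hne)).2
    constructor
    · have h3 := this.sc
      rw [← Finset.disjUnion_eq_union _ _ (dis23 h1), ← Finset.disjUnion_eq_union _ _ (dis23 hT)] at h3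
      have h4 : (A0.val + T.val).map v = (A0.val + T0.val).map v := h3
      rw [Multiset.map_add, Multiset.map_add] at h4
      exact add_left_cancel h4
    · intro m
      have h3 := this.dom m
      rw [Finset.filter_union, Finset.filter_union, card_union_of_disjoint,
        card_union_of_disjoint] at h3
      · omega
      · exact Finset.disjoint_filter_filter (dis23 hT)
      · exact Finset.disjoint_filter_filter (dis23 h1)
  · intro T h1 hne
    obtain ⟨T1, h2, h3⟩ := intP_ne_zero hne
    exact (hs1 _ _ _ h3).1
  · unfold m23
    rw [intP_congr hκ, intP_smul hκF]
  · intro T h1 hne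
    obtain ⟨T1, h2, h3⟩ := intP_ne_zero hne
    have := (hs1 _ _ _ h3).2
    rwa [union_sdiff_of_subset h2] at this

/-- common closure argument -/
lemma NN (he : ∀ w, e w w = 0) (hrk : Injective rk) {Z A0 Y : Finset Ω}
    (hA : A0 ⊆ Y) (p q : Finset Ω → Prop)
    (hp : ∀ T ⊆ Z, ∀ T0 ⊆ Z, LE1 v rk T T0 → p T0 → p T)
    (H : ∀ T0 ⊆ Z, p T0 → ∃ κ g' y, Fam2 v e rk Z κ ∧ κ T0 = pr (ldf v e rk) T0 (Z \ T0) ∧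
      (∀ T ⊆ Z, κ T ≠ 0 → LE1 v rk T T0) ∧ Fam2 v e rk Y g' ∧
      (∀ T ⊆ Y, g' T ≠ 0 → LE1 v rk T A0) ∧
      g' A0 = pr (ldf v e rk) A0 (Y \ A0) * intP v Z κ ∧ Fam2 v e rk Y y ∧
      intP v Y g' = intP v Y y ∧ ∀ T ⊆ Y, y T ≠ 0 → q T)
    {f : PS Ω} (hf : f ∈ UU v e rk Z p) :
    ∃ g' y, Fam2 v e rk Y g' ∧ (∀ T ⊆ Y, g' T ≠ 0 → LE1 v rk T A0) ∧
      g' A0 = pr (ldf v e rk) A0 (Y \ A0) * f ∧ Fam2 v e rk Y y ∧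
      intP v Y g' = intP v Y y ∧ ∀ T ⊆ Y, y T ≠ 0 → q T := by
  choose! κ g' y h1 h2 h3 h4 h5 h6 h7 h8 h9 using H
  obtain ⟨g, hg, hgp, rfl⟩ := hf
  obtain ⟨c, hc⟩ := gen' he hrk p κ (fun T0 h0 hp0 => ⟨h1 T0 h0 hp0, h2 T0 h0 hp0, fun T hT hne =>
    ⟨hp _ hT _ h0 (h3 T0 h0 hp0 T hT hne) hp0, (h3 T0 h0 hp0 T hT hne).eq_or hrk⟩⟩) hg hgp
  have hI : ∀ T0 ∈ Z.powerset.filter p, T0 ⊆ Z ∧ p T0 := by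
    intro T0 h; simpa using h
  have hF1 := fun T0 h0 => (h1 T0 (hI T0 h0).1 (hI T0 h0).2).smul (c T0)
  have hF4 := fun T0 h0 => (h4 T0 (hI T0 h0).1 (hI T0 h0).2).smul (c T0)
  have hF7 := fun T0 h0 => (h7 T0 (hI T0 h0).1 (hI T0 h0).2).smul (c T0)
  refine ⟨fun T => ∑ T0 ∈ Z.powerset.filter p, c T0 * g' T0 T,
    fun T => ∑ T0 ∈ Z.powerset.filter p, c T0 * y T0 T, Fam2.sum _ _ hF4, ?_, ?_,
    Fam2.sum _ _ hF7, ?_, ?_⟩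
  · intro T hT hne
    obtain ⟨T0, h0, hh⟩ := exists_ne_zero_of_sum_ne_zero hne
    exact h5 T0 (hI T0 h0).1 (hI T0 h0).2 T hT (right_ne_zero_of_mul hh)
  · rw [intP_congr hc, intP_sum _ _ hF1, mul_sum]
    refine sum_congr rfl fun T0 h0 => ?_
    rw [intP_smul (h1 T0 (hI T0 h0).1 (hI T0 h0).2), h6 T0 (hI T0 h0).1 (hI T0 h0).2]; ring
  · rw [intP_sum _ _ hF4, intP_sum _ _ hF7]
    refine sum_congr rfl fun T0 h0 => ?_
    rw [intP_smul (h4 T0 (hI T0 h0).1 (hI T0 h0).2), intP_smul (h7 T0 (hI T0 h0).1 (hI T0 h0).2),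
      h8 T0 (hI T0 h0).1 (hI T0 h0).2]
  · intro T hT hne
    obtain ⟨T0, h0, hh⟩ := exists_ne_zero_of_sum_ne_zero hne
    grind

variable (v) in
/-- strict lexicographic order on (theta, card) -/
def lt2 (θ : V → ℤ) (T A : Finset Ω) : Prop :=
  th v θ T < th v θ A ∨ (th v θ T = th v θ A ∧ T.card < A.card)

lemma pT_le1 {θ : V → ℤ} {A T T0 : Finset Ω} (hT : T ⊆ A) (hT0 : T0 ⊆ A) (h : LE1 v rk T T0)
    (hp : pT v θ A T0) : pT v θ A T := by
  refine ⟨?_, ?_⟩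
  · rintro rfl
    exact hp.1 (Finset.eq_of_subset_of_card_le hT0 h.card.le)
  · rw [th_sdiff hT, h.th, ← th_sdiff hT0]; exact hp.2

/-- N1 -/
lemma N1 (he : ∀ w, e w w = 0) (hrk : Injective rk) (θ : V → ℤ) {A0 Y : Finset Ω}
    (hA : A0 ⊆ Y) {f : PS Ω} (hf : f ∈ UU v e rk A0 (pT v θ A0)) :
    ∃ g' y, Fam2 v e rk Y g' ∧ (∀ T ⊆ Y, g' T ≠ 0 → LE1 v rk T A0) ∧
      g' A0 = pr (ldf v e rk) A0 (Y \ A0) * f ∧ Fam2 v e rk Y y ∧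
      intP v Y g' = intP v Y y ∧ ∀ T ⊆ Y, y T ≠ 0 → lt2 v θ T A0 := by
  refine NN he hrk hA _ _ (fun T hT T0 hT0 h hp => pT_le1 hT hT0 h hp) ?_ hf
  intro T0 h0 hp
  obtain ⟨κ, g', y, h1, h2, h3, h4, h5, h6, h7, h8, h9⟩ := core1 (v := v) (e := e) he hrk h0 hA
  refine ⟨κ, g', y, h1, h2, h3, h4, h5, h6, h7, h8, fun T hT hne => ?_⟩
  have := h9 T hT hne
  have hth := th_sdiff (v := v) (θ := θ) h0
  have hp2 := hp.2
  have hc : T0.card < A0.card := card_lt_card (Finset.ssubset_iff_subset_ne.2 ⟨h0, hp.1⟩)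
  unfold lt2
  rw [this.th, this.card]
  grind

/-- N2 -/
lemma N2 (he : ∀ w, e w w = 0) (hrk : Injective rk) (θ : V → ℤ) {A0 Y : Finset Ω}
    (hA : A0 ⊆ Y) {f : PS Ω} (hf : f ∈ UU v e rk (Y \ A0) (pF v θ)) :
    ∃ g' y, Fam2 v e rk Y g' ∧ (∀ T ⊆ Y, g' T ≠ 0 → LE1 v rk T A0) ∧
      g' A0 = pr (ldf v e rk) A0 (Y \ A0) * f ∧ Fam2 v e rk Y y ∧
      intP v Y g' = intP v Y y ∧ ∀ T ⊆ Y, y T ≠ 0 → lt2 v θ T A0 := by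
  refine NN he hrk hA _ _ (fun T hT T0 hT0 h (hp : pF v θ T0) =>
    (show pF v θ T by unfold pF at *; rwa [h.th])) ?_ hf
  intro T0 h0 hp
  obtain ⟨κ, g', y, h1, h2, h3, h4, h5, h6, h7, h8, h9⟩ := core2 (v := v) (e := e) he hrk h0 hA
  refine ⟨κ, g', y, h1, h2, h3, h4, h5, h6, h7, h8, fun T hT hne => ?_⟩
  have := h9 T hT hne
  left
  rw [this.th]
  unfold pF th at *
  rw [sum_union (dis23 h0)]
  omega

end A8
section A9
open MvPolynomial

variable {Ω V : Type} [Fintype Ω] {v : Ω → V} {e : V → V → ℕ} {rk : Ω → ℕ}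

variable (v) in
/-- sign -/
noncomputable def sg (A B : Finset Ω) : PS Ω := pr (fun p => if v p.1 = v p.2 then -1 else 1) A B

lemma vt_comm (A B : Finset Ω) : vt v B A = sg v A B * vt v A B := by
  unfold sg vt pr
  rw [← prod_mul_distrib]
  refine prod_bij' (fun p _ => (p.2, p.1)) (fun p _ => (p.2, p.1)) ?_ ?_ ?_ ?_ ?_
  · intro p hp; simp at *; tauto
  · intro p hp; simp at *; tauto
  · intro p hp; simp
  · intro p hp; simp
  · intro p hp
    simp only [eq_comm (a := v p.1)]
    split_ifs
    · rw [lin_swap]; ring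
    · simp

lemma sg_sq (A B : Finset Ω) : sg v A B * sg v A B = 1 := by
  unfold sg pr
  rw [← prod_mul_distrib]
  simp_all

lemma sw_sg {i j : Ω} (h : v i = v j) (A B : Finset Ω) :
    sw i j (sg v A B) = sg v (pm (swap i j) A) (pm (swap i j) B) := by
  unfold sg pr
  rw [map_prod]
  refine prod_bij' (fun p _ => (swap i j p.1, swap i j p.2))
    (fun p _ => (swap i j p.1, swap i j p.2)) ?_ ?_ ?_ ?_ ?_
  · intro p hp; simpa [mem_pm_swap] using hp
  · intro p hp; simpa [mem_pm_swap] using hp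
  · intro p hp; simp
  · intro p hp; simp
  grind

variable (v) in
/-- cross factor -/
noncomputable def rx (A0 B0 A B : Finset Ω) : PS Ω :=
  sg v (A0 \ A) B * vt v A B * vt v (A0 \ A) (B0 \ B)

lemma sw_rx {A0 B0 A B : Finset Ω} {i j : Ω} (h : v i = v j) (hA : i ∈ A0 ↔ j ∈ A0)
    (hB : i ∈ B0 ↔ j ∈ B0) : sw i j (rx v A0 B0 A B) =
      rx v A0 B0 (pm (swap i j) A) (pm (swap i j) B) := by
  unfold rx
  rw [map_mul, map_mul, sw_sg h, sw_vt v h, sw_vt v h, sdiff_pm hA, sdiff_pm hB]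

lemma rx_spec {A0 B0 A B : Finset Ω} (h0 : Disjoint A0 B0) (hA : A ⊆ A0) (hB : B ⊆ B0) :
    vt v A0 B0 * (vt v A (A0 \ A) * vt v B (B0 \ B)) =
      rx v A0 B0 A B * vt v (A ∪ B) ((A0 ∪ B0) \ (A ∪ B)) := by
  have hu : (A0 ∪ B0) \ (A ∪ B) = (A0 \ A) ∪ (B0 \ B) := by
    ext x
    have h1 := @hA x; have h2 := @hB x
    have h3 : x ∈ A0 → x ∉ B0 := fun h => disjoint_left.1 h0 h
    simp; tauto
  have d1 : Disjoint A B := Finset.disjoint_of_subset_left hA (Finset.disjoint_of_subset_right hB h0)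
  have d2 : Disjoint (A0 \ A) (B0 \ B) := Finset.disjoint_of_subset_left sdiff_subset
    (Finset.disjoint_of_subset_right sdiff_subset h0)
  rw [hu, vt_union_left d1, vt_union_right d2, vt_union_right d2]
  have e1 : vt v A0 B0 = (vt v A B * vt v A (B0 \ B)) * (vt v (A0 \ A) B * vt v (A0 \ A) (B0 \ B)) := by
    rw [← vt_union_right disjoint_sdiff, ← vt_union_right disjoint_sdiff,
      union_sdiff_of_subset hB, ← vt_union_left disjoint_sdiff,
      union_sdiff_of_subset hA]
  rw [e1, vt_comm (A0 \ A) B]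
  unfold rx
  linear_combination -(vt v A B * vt v (A0 \ A) (B0 \ B) * vt v A (A0 \ A) * vt v A (B0 \ B) *
    vt v (A0 \ A) B * vt v B (B0 \ B)) * sg_sq (v := v) (A0 \ A) B

variable (v) in
/-- two-variable family -/
noncomputable def hh (g : Finset Ω → PS Ω) (A0 B0 A B : Finset Ω) : PS Ω :=
  g (A ∪ B) * rx v A0 B0 A B

lemma hh_gkm {g : Finset Ω → PS Ω} {A0 B0 : Finset Ω}
    (hg : Fam2 v e rk (A0 ∪ B0) g) {A B : Finset Ω} (hA : A ⊆ A0) (hB : B ⊆ B0) {i j : Ω}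
    (hv : v i = v j) (hi : i ∈ A0 ∪ B0) (hj : j ∈ A0 ∪ B0) (h1 : i ∈ A0 ↔ j ∈ A0)
    (h2 : i ∈ B0 ↔ j ∈ B0) :
    lin i j ∣ hh v g A0 B0 A B -
      hh v g A0 B0 (pm (swap i j) A) (pm (swap i j) B) := by
  have e1 := hg.gkm (A ∪ B) (union_subset_union hA hB) i hi j hj hv
  have e2 := lin_dvd_sub_sw i j (rx v A0 B0 A B)
  rw [sw_rx hv h1 h2] at e2
  rw [pm_union] at e1
  unfold hh
  have : ∀ a b c d : PS Ω, a * b - c * d = (a - c) * b + c * (b - d) := by intros; ring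
  rw [this]
  exact dvd_add (e1.mul_right _) (e2.mul_left _)

lemma ar_dvd_left {A0 B0 A B : Finset Ω} (h0 : Disjoint A0 B0) (hA : A ⊆ A0) (hB : B ⊆ B0) :
    pr (arf v e rk) A (A0 \ A) ∣ pr (arf v e rk) (A ∪ B) ((A0 ∪ B0) \ (A ∪ B)) := by
  unfold pr
  apply Finset.prod_dvd_prod_of_subset
  intro p
  have h3 : ∀ x, x ∈ A0 → x ∉ B0 := fun x h => disjoint_left.1 h0 h
  grind

lemma hh_left {g : Finset Ω → PS Ω} {A0 B0 : Finset Ω} (h0 : Disjoint A0 B0)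
    (hg : Fam2 v e rk (A0 ∪ B0) g) {B : Finset Ω} (hB : B ⊆ B0) :
    Fam2 v e rk A0 fun A => hh v g A0 B0 A B := by
  constructor
  · intro A hA
    exact ((ar_dvd_left h0 hA hB).trans (hg.div _ (union_subset_union hA hB))).mul_right _
  · intro A hA i hi j hj hv
    have n1 : i ∉ B0 := disjoint_left.1 h0 hi
    have n2 : j ∉ B0 := disjoint_left.1 h0 hj
    have := hh_gkm hg hA hB hv (by simp [hi]) (by simp [hj]) (by simp [hi, hj]) (by simp [n1, n2])
    rwa [pm_swap_eq (Z := B) ⟨fun h => absurd (hB h) n1, fun h => absurd (hB h) n2⟩] at this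

lemma hh_right {g : Finset Ω → PS Ω} {A0 B0 : Finset Ω} (h0 : Disjoint A0 B0)
    (hg : Fam2 v e rk (A0 ∪ B0) g) {A : Finset Ω} (hA : A ⊆ A0) :
    Fam2 v e rk B0 fun B => hh v g A0 B0 A B := by
  constructor
  · intro B hB
    have := ar_dvd_left (v := v) (e := e) (rk := rk) h0.symm hB hA
    rw [Finset.union_comm B, Finset.union_comm B0] at this
    exact (this.trans (hg.div _ (union_subset_union hA hB))).mul_right _
  · intro B hB i hi j hj hv
    have n1 : i ∉ A0 := disjoint_right.1 h0 hi
    have n2 : j ∉ A0 := disjoint_right.1 h0 hj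
    have := hh_gkm hg hA hB hv (by simp [hi]) (by simp [hj]) (by simp [n1, n2]) (by simp [hi, hj])
    rwa [pm_swap_eq (Z := A) ⟨fun h => absurd (hA h) n1, fun h => absurd (hA h) n2⟩] at this

lemma th_pm {i j : Ω} (hv : v i = v j) (θ : V → ℤ) (A : Finset Ω) :
    th v θ (pm (swap i j) A) = th v θ A := by
  unfold th pm
  rw [sum_map]
  exact sum_congr rfl fun x _ => by simp [v_swap v hv]

/-- restriction of a family to an invariant condition -/
lemma Fam2.restrict {Y : Finset Ω} {g : Finset Ω → PS Ω} (hg : Fam2 v e rk Y g)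
    (p : Finset Ω → Prop)
    (hp : ∀ T ⊆ Y, ∀ i ∈ Y, ∀ j ∈ Y, v i = v j → (p (pm (swap i j) T) ↔ p T)) :
    Fam2 v e rk Y fun T => if p T then g T else 0 := by
  constructor
  · intro T hT
    split_ifs
    · exact hg.div T hT
    · exact dvd_zero _
  · intro T hT i hi j hj hv
    simp only [hp T hT i hi j hj hv]
    split_ifs
    · exact hg.gkm T hT i hi j hj hv
    · simp

variable (v) in
/-- nonnegativity condition -/
def pN (θ : V → ℤ) (T : Finset Ω) : Prop := 0 ≤ th v θ T

lemma fubini {g : Finset Ω → PS Ω} {A0 B0 : Finset Ω} (h0 : Disjoint A0 B0)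
    (q : Finset Ω → Prop) :
    ∑ T ∈ (A0 ∪ B0).powerset with q (T ∩ B0), algebraMap (PS Ω) (PF Ω) (vt v A0 B0) * Iterm v (A0 ∪ B0) g T
      = ∑ A ∈ A0.powerset, ∑ B ∈ B0.powerset with q B, algebraMap (PS Ω) (PF Ω) (hh v g A0 B0 A B) /
        (algebraMap _ _ (vt v A (A0 \ A)) * algebraMap _ _ (vt v B (B0 \ B))) := by
  have hcap : ∀ A B : Finset Ω, A ⊆ A0 → B ⊆ B0 → (A ∪ B) ∩ A0 = A ∧ (A ∪ B) ∩ B0 = B := by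
    intro A B hA hB
    constructor <;> ext x <;> have h1 := @hA x <;> have h2 := @hB x <;>
    have h3 : x ∈ A0 → x ∉ B0 := fun h => disjoint_left.1 h0 h
    all_goals simp; tauto
  rw [← Finset.sum_product']
  refine sum_bij' (fun T _ => (T ∩ A0, T ∩ B0)) (fun p _ => p.1 ∪ p.2) ?_ ?_ ?_ ?_ ?_
  · grind
  · grind
  · grind
  · grind
  · intro T hT
    simp only [mem_filter, mem_powerset] at hT
    have hu : T ∩ A0 ∪ T ∩ B0 = T := by
      rw [← Finset.inter_union_distrib_left, Finset.inter_eq_left.2 hT.1]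
    have := rx_spec (v := v) h0 (Finset.inter_subset_right (s₁ := T)) (Finset.inter_subset_right (s₁ := T))
    rw [hu] at this
    simp only [hh, Iterm]
    rw [hu]
    have n1 := amap_ne_zero (vt_ne_zero v (disjoint_sdiff (s := T) (t := A0 ∪ B0)))
    have n2 := amap_ne_zero (vt_ne_zero v (disjoint_sdiff (s := T ∩ A0) (t := A0)))
    have n3 := amap_ne_zero (vt_ne_zero v (disjoint_sdiff (s := T ∩ B0) (t := B0)))
    rw [← mul_div_assoc, div_eq_div_iff n1 (mul_ne_zero n2 n3)]
    rw [← map_mul, ← map_mul, ← map_mul, ← map_mul]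
    congr 1
    linear_combination g T * this

lemma int_hh_left {g : Finset Ω → PS Ω} {A0 B0 : Finset Ω} (he : ∀ w, e w w = 0) (h0 : Disjoint A0 B0)
    (hg : Fam2 v e rk (A0 ∪ B0) g) : Fam2 v e rk B0 fun B => intP v A0 fun A => hh v g A0 B0 A B := by
  constructor
  · intro B hB
    refine dvd_intP v (hh_left h0 hg hB).gkm (lin_not_dvd_ar he disjoint_sdiff) ?_
    intro A hA
    exact (hh_right h0 hg hA).div B hB
  · intro B hB i hi j hj hv
    refine pm_dvd_self (f := fun B => intP v A0 fun A => hh v g A0 B0 A B) fun hij => ?_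
    have n1 : i ∉ A0 := disjoint_right.1 h0 hi
    have n2 : j ∉ A0 := disjoint_right.1 h0 hj
    have hpA : pm (swap i j) A0 = A0 := pm_swap_eq (by simp [n1, n2])
    have hpB : pm (swap i j) B ⊆ B0 := pm_sub (by simp [hi, hj]) hB
    have := intP_cong v hij hv (Z := A0) (by simp [n1]) (hh_left h0 hg hB).gkm
      (F' := fun A => hh v g A0 B0 A (pm (swap i j) B)) (by
        rw [hpA]; exact (hh_left h0 hg hpB).gkm) (fun A hA =>
        hh_gkm hg hA hB hv (by simp [hi]) (by simp [hj]) (by simp [n1, n2]) (by simp [hi, hj]))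
    rwa [hpA] at this

lemma int_hh_right {g : Finset Ω → PS Ω} {A0 B0 : Finset Ω} (he : ∀ w, e w w = 0) (h0 : Disjoint A0 B0)
    (hg : Fam2 v e rk (A0 ∪ B0) g) (θ : V → ℤ) : Fam2 v e rk A0 fun A => intP v B0 fun B =>
      if pN v θ B then hh v g A0 B0 A B else 0 := by
  have hr : ∀ A ⊆ A0, Fam2 v e rk B0 fun B => if pN v θ B then hh v g A0 B0 A B else 0 :=
    fun A hA => (hh_right h0 hg hA).restrict (pN v θ)
      (fun T _ i _ j _ hv => by simp only [pN, th_pm hv])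
  constructor
  · intro A hA
    refine dvd_intP v (hr A hA).gkm (lin_not_dvd_ar he disjoint_sdiff) ?_
    intro B hB
    split_ifs
    · exact (hh_left h0 hg hB).div A hA
    · exact dvd_zero _
  · intro A hA i hi j hj hv
    refine pm_dvd_self (f := fun A => intP v B0 fun B => if pN v θ B then hh v g A0 B0 A B else 0) fun hij => ?_
    have n1 : i ∉ B0 := disjoint_left.1 h0 hi
    have n2 : j ∉ B0 := disjoint_left.1 h0 hj
    have hpA : pm (swap i j) B0 = B0 := pm_swap_eq (by simp [n1, n2])
    have hpB : pm (swap i j) A ⊆ A0 := pm_sub (by simp [hi, hj]) hA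
    have := intP_cong v hij hv (Z := B0) (by simp [n1]) (hr A hA).gkm
      (F' := fun B => if pN v θ B then hh v g A0 B0 (pm (swap i j) A) B else 0) (by
        rw [hpA]; exact (hr _ hpB).gkm) (fun B hB => by
        have hpN : pN v θ (pm (swap i j) B) ↔ pN v θ B := by unfold pN; rw [th_pm hv]
        by_cases hb : pN v θ B
        · simp only [hpN, hb, if_true]
          exact hh_gkm hg hA hB hv (by simp [hi]) (by simp [hj]) (by simp [hi, hj]) (by simp [n1, n2])
        · simp only [hpN, hb, if_false]; simp)
    rwa [hpA] at this

/-- L4 -/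
lemma L4 (he : ∀ w, e w w = 0) {g : Finset Ω → PS Ω} {A0 B0 : Finset Ω} (h0 : Disjoint A0 B0)
    (hg : Fam2 v e rk (A0 ∪ B0) g) (θ : V → ℤ)
    (hs : ∀ T ⊆ A0 ∪ B0, g T ≠ 0 → lt2 v θ T A0 ∨ (th v θ T = th v θ A0 ∧ T.card = A0.card)) :
    vt v A0 B0 * intP v (A0 ∪ B0) g - g A0 ∈
      UU v e rk A0 (pT v θ A0) ⊔ UU v e rk B0 (pF v θ) := by
  set x : Finset Ω → PS Ω := fun B => intP v A0 fun A => hh v g A0 B0 A B with hx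
  set y : Finset Ω → PS Ω := fun A => intP v B0 fun B =>
      if pN v θ B then hh v g A0 B0 A B else 0 with hy
  have xF : Fam2 v e rk B0 x := int_hh_left he h0 hg
  have yF : Fam2 v e rk A0 y := int_hh_right he h0 hg θ
  have xF' := xF.restrict (pF v θ) (fun T _ i _ j _ hv => by simp only [pF, th_pm hv])
  have yF' := yF.restrict (pT v θ A0) (fun T hT i hi j hj hv => by
    have : pm (swap i j) A0 = A0 := pm_swap_eq (by simp [hi, hj])
    have h2 : pm (swap i j) T = A0 ↔ T = A0 := by
      constructor
      · intro h; rw [← pm_pm_swap i j T, h, this]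
      · rintro rfl; exact this
    have h3 : A0 \ pm (swap i j) T = pm (swap i j) (A0 \ T) := by
      rw [pm_sdiff, this]
    simp only [pT, h3, th_pm hv, h2, ne_eq])
  have hkey : vt v A0 B0 * intP v (A0 ∪ B0) g - g A0 =
      intP v A0 (fun A => if pT v θ A0 A then y A else 0) +
      intP v B0 (fun B => if pF v θ B then x B else 0) := by
    apply amap_inj
    rw [map_sub, map_mul, map_add, hg.int, xF'.int, yF'.int]
    have h1 : algebraMap (PS Ω) (PF Ω) (vt v A0 B0) * intF v (A0 ∪ B0) g =
       (∑ T ∈ (A0 ∪ B0).powerset with pN v θ (T ∩ B0), algebraMap (PS Ω) (PF Ω) (vt v A0 B0) * Iterm v (A0 ∪ B0) g T) +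
       ∑ T ∈ (A0 ∪ B0).powerset with pF v θ (T ∩ B0), algebraMap (PS Ω) (PF Ω) (vt v A0 B0) * Iterm v (A0 ∪ B0) g T := by
      unfold intF
      rw [mul_sum, sum_filter, sum_filter, ← sum_add_distrib]
      refine sum_congr rfl fun T _ => ?_
      by_cases hb : 0 ≤ th v θ (T ∩ B0)
      · rw [if_pos (show pN v θ (T ∩ B0) from hb), if_neg (by unfold pF; omega), add_zero]
      · rw [if_neg (show ¬ pN v θ (T ∩ B0) from hb), if_pos (by unfold pF; omega), zero_add]
    rw [h1, fubini h0 (fun B => pF v θ B), fubini h0 (fun B => pN v θ B)]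
    have h2 : ∑ A ∈ A0.powerset, ∑ B ∈ B0.powerset with pF v θ B, algebraMap (PS Ω) (PF Ω) (hh v g A0 B0 A B) /
        (algebraMap _ _ (vt v A (A0 \ A)) * algebraMap _ _ (vt v B (B0 \ B))) =
        intF v B0 (fun B => if pF v θ B then x B else 0) := by
      rw [sum_comm]
      unfold intF
      rw [sum_filter]
      refine sum_congr rfl fun B hB => ?_
      rw [mem_powerset] at hB
      unfold Iterm
      by_cases hb : pF v θ B
      · simp only [hb, if_true]
        rw [hx]
        simp only
        rw [(hh_left h0 hg hB).int]
        unfold intF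
        rw [sum_div]
        refine sum_congr rfl fun A hA => ?_
        unfold Iterm
        rw [div_div]
      · simp [hb]
    have h3 : ∑ A ∈ A0.powerset, ∑ B ∈ B0.powerset with pN v θ B, algebraMap (PS Ω) (PF Ω) (hh v g A0 B0 A B) /
        (algebraMap _ _ (vt v A (A0 \ A)) * algebraMap _ _ (vt v B (B0 \ B))) = intF v A0 y := by
      unfold intF
      refine sum_congr rfl fun A hA => ?_
      rw [mem_powerset] at hA
      unfold Iterm
      rw [hy]
      simp only
      rw [((hh_right h0 hg hA).restrict (pN v θ)
        (fun T _ i _ j _ hv => by simp only [pN, th_pm hv])).int]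
      unfold intF
      rw [sum_div, sum_filter]
      refine sum_congr rfl fun B hB => ?_
      unfold Iterm
      by_cases hb : pN v θ B
      · simp only [hb, if_true]
        rw [div_div, mul_comm]
      · simp [hb]
    have hz : ∀ A ⊆ A0, ∀ B ⊆ B0, 0 ≤ th v θ B → hh v g A0 B0 A B ≠ 0 → pT v θ A0 A ∨ (A = A0 ∧ B = ∅) := by
      intro A hA B hB hb hne
      have d1 : Disjoint A B := Finset.disjoint_of_subset_left hA (Finset.disjoint_of_subset_right hB h0)
      have := hs (A ∪ B) (union_subset_union hA hB) (left_ne_zero_of_mul hne)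
      have e1 : th v θ (A ∪ B) = th v θ A + th v θ B := by unfold th; rw [sum_union d1]
      have e2 := card_union_of_disjoint d1
      have e3 := th_sdiff (v := v) (θ := θ) hA
      unfold lt2 at this
      by_cases hAA : A = A0
      · right
        refine ⟨hAA, ?_⟩
        subst hAA
        rw [← card_eq_zero]
        omega
      · left
        exact ⟨hAA, by omega⟩
    have h4 : intF v A0 y = intF v A0 (fun A => if pT v θ A0 A then y A else 0)
        + algebraMap (PS Ω) (PF Ω) (g A0) := by
      have hyA : ∀ A ⊆ A0, ¬ pT v θ A0 A → A ≠ A0 → y A = 0 := by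
        intro A hA hp hne
        by_contra hc
        obtain ⟨B, hB, hBn⟩ := intP_ne_zero hc
        simp only [ne_eq, ite_eq_right_iff, Classical.not_imp] at hBn
        rcases hz A hA B hB hBn.1 hBn.2 with h | h
        · exact hp h
        · exact hne h.1
      have hyA0 : y A0 = g A0 := by
        apply amap_inj
        rw [hy]
        simp only
        rw [((hh_right h0 hg subset_rfl).restrict (pN v θ)
          (fun T _ i _ j _ hv => by simp only [pN, th_pm hv])).int]
        unfold intF
        rw [sum_eq_single_of_mem ∅ (by simp)]
        · have : th v θ (∅ : Finset Ω) = 0 := by simp [th]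
          simp [Iterm, hh, rx, pN, this, sg, vt]
        · intro B hB hne
          rw [mem_powerset] at hB
          unfold Iterm
          beta_reduce; split_ifs with hb
          · by_cases hc : hh v g A0 B0 A0 B = 0
            · simp [hc]
            · rcases hz A0 subset_rfl B hB hb hc with h | h
              · exact absurd rfl h.1
              · exact absurd h.2 hne
          · simp
      unfold intF
      rw [← add_sum_erase _ _ (Finset.mem_powerset_self A0),
        ← add_sum_erase _ _ (Finset.mem_powerset_self A0)]
      have : Iterm v A0 (fun A => if pT v θ A0 A then y A else 0) A0 = 0 := by
        simp [Iterm, pT]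
      rw [this, zero_add, add_comm]
      congr 1
      · refine sum_congr rfl fun A hA => ?_
        rw [mem_erase, mem_powerset] at hA
        unfold Iterm
        by_cases hp : pT v θ A0 A
        · simp [hp]
        · simp [hp, hyA A hA.2 hp hA.1]
      · simp [Iterm, hyA0, vt]
    rw [h2, h3, h4]; ring
  rw [hkey]
  refine add_mem_sup ?_ ?_
  · refine ⟨_, yF', fun T hT h => ?_, rfl⟩
    grind
  · refine ⟨_, xF', fun T hT h => ?_, rfl⟩
    grind

end A9
section A10
open MvPolynomial
variable {Ω V : Type} [Fintype Ω] {v : Ω → V} {e : V → V → ℕ} {rk : Ω → ℕ}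

variable (v) in
/-- complementary denominator -/
noncomputable def DT (Y T : Finset Ω) : PS Ω := ∏ T' ∈ Y.powerset.erase T, vt v T' (Y \ T')

variable (v) in
/-- common denominator -/
noncomputable def DD (Y : Finset Ω) : PS Ω := ∏ T' ∈ Y.powerset, vt v T' (Y \ T')

lemma DD_ne_zero (Y : Finset Ω) : DD v Y ≠ 0 := by
  unfold DD
  rw [prod_ne_zero_iff]
  intro T _
  exact vt_ne_zero v disjoint_sdiff

lemma DD_eq {Y T : Finset Ω} (h : T ⊆ Y) : DD v Y = vt v T (Y \ T) * DT v Y T := by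
  unfold DD DT
  exact (mul_prod_erase _ (fun T' => vt v T' (Y \ T')) (mem_powerset.2 h)).symm

lemma clear_den {Y : Finset Ω} {g : Finset Ω → PS Ω} (hg : GKM v Y g) :
    DD v Y * intP v Y g = ∑ T ∈ Y.powerset, DT v Y T * g T := by
  apply amap_inj
  rw [map_mul, intP_gkm v hg, map_sum]
  unfold intF Iterm
  rw [mul_sum]
  refine sum_congr rfl fun T hT => ?_
  rw [DD_eq (mem_powerset.1 hT), map_mul, map_mul]
  have := amap_ne_zero (vt_ne_zero v (A := T) (B := Y \ T) disjoint_sdiff)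
  field_simp

/-- commuting with multiplication -/
def Cm (L : PS Ω →ₗ[ℚ] PS Ω) (a : PS Ω) : Prop := ∀ x, L (a * x) = a * L x

lemma Cm.one (L : PS Ω →ₗ[ℚ] PS Ω) : Cm L 1 := fun x => by simp
lemma Cm.mul {L : PS Ω →ₗ[ℚ] PS Ω} {a b : PS Ω} (ha : Cm L a) (hb : Cm L b) : Cm L (a * b) :=
  fun x => by rw [mul_assoc, ha, hb, mul_assoc]
lemma Cm.prod {ι : Type*} {L : PS Ω →ₗ[ℚ] PS Ω} {f : ι → PS Ω} (s : Finset ι)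
    (h : ∀ i ∈ s, Cm L (f i)) : Cm L (∏ i ∈ s, f i) := by
  induction s using cons_induction with
  | empty => simpa using Cm.one L
  | cons a s ha ih =>
    rw [prod_cons]
    exact (h a (by simp)).mul (ih fun i hi => h i (by simp [hi]))
lemma Cm.pow {L : PS Ω →ₗ[ℚ] PS Ω} {a : PS Ω} (ha : Cm L a) (n : ℕ) : Cm L (a ^ n) := by
  induction n with
  | zero => simpa using Cm.one L
  | succ n ih => rw [pow_succ]; exact ih.mul ha

/-- operators commuting with the differences -/
def CmY (L : PS Ω →ₗ[ℚ] PS Ω) (Y : Finset Ω) : Prop := ∀ i ∈ Y, ∀ j ∈ Y, Cm L (lin i j)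

lemma CmY.vt {L : PS Ω →ₗ[ℚ] PS Ω} {Y : Finset Ω} (h : CmY L Y) {A B : Finset Ω} (hA : A ⊆ Y)
    (hB : B ⊆ Y) : Cm L (vt v A B) := by
  refine Cm.prod _ fun p hp => ?_
  rw [mem_product] at hp
  split_ifs
  · exact h _ (hA hp.1) _ (hB hp.2)
  · exact Cm.one L

lemma CmY.ar {L : PS Ω →ₗ[ℚ] PS Ω} {Y : Finset Ω} (h : CmY L Y) {A B : Finset Ω} (hA : A ⊆ Y)
    (hB : B ⊆ Y) : Cm L (pr (arf v e rk) A B) := by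
  refine Cm.prod _ fun p hp => ?_
  rw [mem_product] at hp
  unfold arf
  split_ifs
  · exact (h _ (hA hp.1) _ (hB hp.2)).pow _
  · exact Cm.one L

lemma Fam2.lmap {L : PS Ω →ₗ[ℚ] PS Ω} {Y : Finset Ω} (h : CmY L Y) {g : Finset Ω → PS Ω}
    (hg : Fam2 v e rk Y g) : Fam2 v e rk Y (fun T => L (g T)) := by
  constructor
  · intro T hT
    obtain ⟨c, hc⟩ := hg.div T hT
    show _ ∣ L (g T)
    rw [hc, h.ar hT sdiff_subset]
    exact dvd_mul_right _ _
  · intro T hT i hi j hj hv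
    obtain ⟨c, hc⟩ := hg.gkm T hT i hi j hj hv
    show _ ∣ L (g T) - L _
    rw [← map_sub, hc, h i hi j hj]
    exact dvd_mul_right _ _

lemma intP_lmap {L : PS Ω →ₗ[ℚ] PS Ω} {Y : Finset Ω} (h : CmY L Y) {g : Finset Ω → PS Ω}
    (hg : Fam2 v e rk Y g) : intP v Y (fun T => L (g T)) = L (intP v Y g) := by
  apply mul_left_cancel₀ (DD_ne_zero (v := v) Y)
  rw [clear_den (hg.lmap h).gkm]
  have hD : Cm L (DD v Y) := by
    refine Cm.prod _ fun T hT => ?_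
    exact h.vt (mem_powerset.1 hT) sdiff_subset
  have hDT : ∀ T, Cm L (DT v Y T) := fun T => by
    refine Cm.prod _ fun T hT => ?_
    exact h.vt (mem_powerset.1 (Finset.mem_of_mem_erase hT)) sdiff_subset
  rw [← hD, clear_den hg.gkm, map_sum]
  exact sum_congr rfl fun T _ => (hDT T _).symm

lemma ULin {L : PS Ω →ₗ[ℚ] PS Ω} {Y : Finset Ω} (h : CmY L Y) {p : Finset Ω → Prop} {f : PS Ω}
    (hf : f ∈ UU v e rk Y p) : L f ∈ UU v e rk Y p := by
  obtain ⟨g, hg, hs, rfl⟩ := hf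
  refine ⟨_, hg.lmap h, fun T hT hne => hs T hT fun h0 => hne (by rw [h0, map_zero]), (intP_lmap h hg).symm⟩

/-! homogeneity -/

lemma comp_mul {a : PS Ω} {d : ℕ} (ha : a.IsHomogeneous d) (f : PS Ω) (n : ℕ) :
    homogeneousComponent (n + d) (a * f) = a * homogeneousComponent n f := by
  conv_lhs => rw [← sum_homogeneousComponent f, mul_sum, map_sum]
  have : ∀ i, homogeneousComponent (n + d) (a * homogeneousComponent i f)
      = if i = n then a * homogeneousComponent n f else 0 := by
    intro i
    have h1 : (a * homogeneousComponent i f).IsHomogeneous (d + i) :=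
      ha.mul (homogeneousComponent_isHomogeneous i f)
    rw [homogeneousComponent_of_mem h1]
    by_cases hi : i = n
    · subst hi; simp [add_comm]
    · rw [if_neg hi, if_neg (by omega)]
  simp only [this]
  rw [Finset.sum_ite_eq']
  split_ifs with h
  · rfl
  · rw [mem_range, not_lt] at h
    rw [homogeneousComponent_eq_zero _ _ (by omega), mul_zero]

lemma comp_mul_lt {a : PS Ω} {d : ℕ} (ha : a.IsHomogeneous d) (f : PS Ω) (n : ℕ) (hn : n < d) :
    homogeneousComponent n (a * f) = 0 := by
  conv_lhs => rw [← sum_homogeneousComponent f, mul_sum, map_sum]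
  refine sum_eq_zero fun i _ => ?_
  have h1 : (a * homogeneousComponent i f).IsHomogeneous (d + i) :=
      ha.mul (homogeneousComponent_isHomogeneous i f)
  rw [homogeneousComponent_of_mem h1, if_neg (by omega)]

lemma dvd_comp {a : PS Ω} {d : ℕ} (ha : a.IsHomogeneous d) {f : PS Ω} (h : a ∣ f) (n : ℕ) :
    a ∣ homogeneousComponent n f := by
  obtain ⟨g, rfl⟩ := h
  by_cases hn : n < d
  · rw [comp_mul_lt ha g n hn]; exact dvd_zero _
  · obtain ⟨m, rfl⟩ := Nat.exists_eq_add_of_le (not_lt.1 hn)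
    rw [add_comm, comp_mul ha]; exact dvd_mul_right _ _

lemma lin_hom (i j : Ω) : (lin i j).IsHomogeneous 1 :=
  (isHomogeneous_X _ _).sub (isHomogeneous_X _ _)

variable (v) in
/-- vertex pair count -/
noncomputable def vc (A B : Finset Ω) : ℕ := ∑ p ∈ A ×ˢ B, if v p.1 = v p.2 then 1 else 0
variable (v rk) in
/-- descending vertex pair count -/
noncomputable def vtc (A B : Finset Ω) : ℕ :=
  ∑ p ∈ A ×ˢ B, if rk p.2 < rk p.1 then (if v p.1 = v p.2 then 1 else 0) else 0
variable (v e rk) in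
/-- arrow count -/
noncomputable def ar (A B : Finset Ω) : ℕ :=
  ∑ p ∈ A ×ˢ B, if rk p.2 < rk p.1 then e (v p.1) (v p.2) else 0
variable (v e rk) in
/-- degree of the leading term -/
noncomputable def ldc (A B : Finset Ω) : ℕ :=
  ∑ p ∈ A ×ˢ B, if rk p.2 < rk p.1 then e (v p.1) (v p.2) else if v p.1 = v p.2 then 1 else 0

lemma vt_hom (A B : Finset Ω) : (vt v A B).IsHomogeneous (vc v A B) := by
  refine IsHomogeneous.prod _ _ _ fun p _ => ?_
  split_ifs
  · exact lin_hom _ _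
  · exact isHomogeneous_one _ _

lemma arf_hom (A B : Finset Ω) : (pr (arf v e rk) A B).IsHomogeneous (ar v e rk A B) := by
  refine IsHomogeneous.prod _ _ _ fun p _ => ?_
  unfold arf
  split_ifs
  · simpa using (lin_hom _ _).pow (e (v p.1) (v p.2))
  · exact isHomogeneous_one _ _

lemma ldf_hom (A B : Finset Ω) : (pr (ldf v e rk) A B).IsHomogeneous (ldc v e rk A B) := by
  refine IsHomogeneous.prod _ _ _ fun p _ => ?_
  unfold ldf
  split_ifs
  · simpa using (lin_hom _ _).pow (e (v p.1) (v p.2))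
  · exact lin_hom _ _
  · exact isHomogeneous_one _ _

lemma ldc_eq (A B : Finset Ω) : ldc v e rk A B + vtc v rk A B = ar v e rk A B + vc v A B := by
  unfold ldc vtc ar vc
  rw [← sum_add_distrib, ← sum_add_distrib]
  grind

lemma vc_pm {i j : Ω} (hv : v i = v j) (A B : Finset Ω) :
    vc v (pm (swap i j) A) (pm (swap i j) B) = vc v A B := by
  unfold vc pm
  rw [sum_product, sum_product, sum_map]
  refine sum_congr rfl fun x _ => ?_
  rw [sum_map]
  refine sum_congr rfl fun y _ => ?_
  simp only [Equiv.coe_toEmbedding, v_swap v hv]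

/-- HOM -/
lemma Fam2.comp {Y : Finset Ω} {g : Finset Ω → PS Ω} (hg : Fam2 v e rk Y g) (n : ℕ) :
    Fam2 v e rk Y (fun T => homogeneousComponent (n + vc v T (Y \ T)) (g T)) := by
  constructor
  · intro T hT
    exact dvd_comp (arf_hom _ _) (hg.div T hT) _
  · intro T hT i hi j hj hv
    have h1 : vc v (pm (swap i j) T) (Y \ pm (swap i j) T) = vc v T (Y \ T) := by
      rw [← sdiff_pm (by simp [hi, hj]), vc_pm hv]
    simp only [h1]
    rw [← map_sub]
    exact dvd_comp (lin_hom _ _) (hg.gkm T hT i hi j hj hv) _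

lemma intP_comp {Y : Finset Ω} {g : Finset Ω → PS Ω} (hg : Fam2 v e rk Y g) (n : ℕ) :
    intP v Y (fun T => homogeneousComponent (n + vc v T (Y \ T)) (g T))
      = homogeneousComponent n (intP v Y g) := by
  apply mul_left_cancel₀ (DD_ne_zero (v := v) Y)
  rw [clear_den (hg.comp n).gkm]
  have hD : (DD v Y).IsHomogeneous (∑ T ∈ Y.powerset, vc v T (Y \ T)) :=
    IsHomogeneous.prod _ _ _ fun T _ => vt_hom _ _
  have hDT : ∀ T, (DT v Y T).IsHomogeneous (∑ T ∈ Y.powerset.erase T, vc v T (Y \ T)) :=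
    fun T => IsHomogeneous.prod _ _ _ fun T _ => vt_hom _ _
  rw [← comp_mul hD, clear_den hg.gkm, map_sum]
  refine sum_congr rfl fun T hT => ?_
  rw [← comp_mul (hDT T), add_assoc, add_sum_erase _ (fun T => vc v T (Y \ T)) hT]

lemma UU_comp {Y : Finset Ω} {p : Finset Ω → Prop} {f : PS Ω}
    (hf : f ∈ UU v e rk Y p) (n : ℕ) : homogeneousComponent n f ∈ UU v e rk Y p := by
  obtain ⟨g, hg, hs, rfl⟩ := hf
  exact ⟨_, hg.comp n, fun T hT hne => hs T hT fun h0 => hne (by rw [h0, map_zero]), (intP_comp hg n).symm⟩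

lemma vc_sc {Y T A : Finset Ω} (hT : T ⊆ Y) (hA : A ⊆ Y) (h : T.val.map v = A.val.map v) :
    vc v T (Y \ T) = vc v A (Y \ A) := by
  have hc : (Y \ T).val.map v = (Y \ A).val.map v := by
    have h1 : T.val.map v + (Y \ T).val.map v = Y.val.map v := by
      rw [← Multiset.map_add, Finset.sdiff_val, add_tsub_cancel_of_le (Finset.val_le_iff.2 hT)]
    have h2 : A.val.map v + (Y \ A).val.map v = Y.val.map v := by
      rw [← Multiset.map_add, Finset.sdiff_val, add_tsub_cancel_of_le (Finset.val_le_iff.2 hA)]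
    rw [← h2, h] at h1
    exact add_left_cancel h1
  have key : ∀ P R : Finset Ω, vc v P R
     = ((P.val.map v).map fun a => ((R.val.map v).map fun b => if a = b then 1 else 0).sum).sum := by
    intro P R
    unfold vc
    rw [sum_product]
    simp only [Multiset.map_map]
    rfl
  rw [key, key, h, hc]

/-- homogeneous leading families -/
lemma ind_hom (he : ∀ w, e w w = 0) (hrk : Injective rk) {A Y : Finset Ω} (hA : A ⊆ Y) :
    ∃ g, Fam2 v e rk Y g ∧ g A = pr (ldf v e rk) A (Y \ A) ∧
      (∀ T ⊆ Y, g T ≠ 0 → LE1 v rk T A) ∧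
      ∀ k, homogeneousComponent k (intP v Y g) ≠ 0 → k + vtc v rk A (Y \ A) = ar v e rk A (Y \ A) := by
  obtain ⟨g, hg, hgA, hs⟩ := ind_exists (v := v) (e := e) he hrk hA
  have hF : Fam2 v e rk Y (fun T => homogeneousComponent (ldc v e rk A (Y \ A)) (g T)) := by
    constructor
    · intro T hT
      exact dvd_comp (arf_hom _ _) (hg.div T hT) _
    · intro T hT i hi j hj hv
      rw [← map_sub]
      exact dvd_comp (lin_hom _ _) (hg.gkm T hT i hi j hj hv) _
  have hs' : ∀ T ⊆ Y, homogeneousComponent (ldc v e rk A (Y \ A)) (g T) ≠ 0 → LE1 v rk T A :=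
    fun T hT hne => hs T hT fun h0 => hne (by rw [h0, map_zero])
  refine ⟨_, hF, ?_, hs', ?_⟩
  · show homogeneousComponent _ (g A) = _
    rw [hgA, homogeneousComponent_of_mem (ldf_hom _ _), if_pos rfl]
  · intro k hk
    rw [← intP_comp hF] at hk
    obtain ⟨T, hT, hne⟩ := intP_ne_zero hk
    rw [homogeneousComponent_of_mem (homogeneousComponent_isHomogeneous _ _)] at hne
    split_ifs at hne with h
    · have := vc_sc hT hA (hs' T hT hne).sc
      have := ldc_eq (v := v) (e := e) (rk := rk) A (Y \ A)
      omega
    · exact absurd rfl hne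

/-! L5 -/

/-- sum of partial derivatives -/
noncomputable def dB (B : Finset Ω) : Derivation ℚ (PS Ω) (PS Ω) :=
  MvPolynomial.mkDerivation ℚ fun i => if i ∈ B then 1 else 0

lemma dB_X (B : Finset Ω) (i : Ω) : dB B (X i) = if i ∈ B then 1 else 0 := by
  unfold dB; rw [mkDerivation_X]

lemma dB_cm {B A : Finset Ω} (h : A ⊆ B ∨ Disjoint A B) : CmY (dB B).toLinearMap A := by
  intro i hi j hj x
  have : dB B (lin i j) = 0 := by
    unfold lin
    rw [map_sub, dB_X, dB_X]
    rcases h with h | h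
    · simp [h hi, h hj]
    · rw [if_neg (disjoint_left.1 h hi), if_neg (disjoint_left.1 h hj), sub_zero]
  simp_all

lemma dB_iter (B : Finset Ω) {w : PS Ω} {c : ℚ} (hw : dB B w = C c) (y : PS Ω) (n : ℕ) :
    (dB B)^[n+1] (w * y) = w * (dB B)^[n+1] y + C ((n + 1) * c) * (dB B)^[n] y := by
  induction n with
  | zero => simp [Derivation.leibniz, hw]; ring
  | succ n ih =>
    rw [iterate_succ_apply', ih, map_add, Derivation.leibniz, hw,
      Derivation.leibniz, iterate_succ_apply' _ (n + 1), iterate_succ_apply' _ n]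
    have : dB B (C ((n + 1) * c)) = 0 := by
      exact (dB B).map_algebraMap _
    rw [this]
    simp only [smul_eq_mul, C_mul, C_add, map_natCast, map_one]
    push_cast
    ring

lemma iter_zero (B : Finset Ω) (n : ℕ) : (dB B)^[n] (0 : PS Ω) = 0 := by
  simp_all

lemma iter_add (B : Finset Ω) (n : ℕ) (x y : PS Ω) :
    (dB B)^[n] (x + y) = (dB B)^[n] x + (dB B)^[n] y := by
  simp_all

lemma dB_nil (B : Finset Ω) (y : PS Ω) : ∃ n, ∀ m ≥ n, (dB B)^[m] y = 0 := by
  induction y using MvPolynomial.induction_on with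
  | C a =>
    refine ⟨1, fun m hm => ?_⟩
    obtain ⟨k, rfl⟩ := Nat.exists_eq_add_of_le hm
    rw [add_comm, Function.iterate_add_apply]
    simp_all
  | add p q hp hq =>
    obtain ⟨n, hn⟩ := hp
    obtain ⟨n', hn'⟩ := hq
    refine ⟨max n n', fun m hm => ?_⟩
    rw [iter_add, hn m (le_trans (le_max_left _ _) hm), hn' m (le_trans (le_max_right _ _) hm), add_zero]
  | mul_X p i hp =>
    obtain ⟨n, hn⟩ := hp
    refine ⟨n + 1, fun m hm => ?_⟩
    obtain ⟨k, rfl⟩ : ∃ k, m = k + 1 := ⟨m - 1, by omega⟩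
    have hw : dB B (X i) = C (if i ∈ B then 1 else 0) := by rw [dB_X]; split_ifs <;> simp
    rw [mul_comm, dB_iter B hw, hn k (by omega), hn (k + 1) (by omega)]; simp

lemma nzd_of_stable (B : Finset Ω) (J : Ideal (PS Ω)) (hJ : ∀ f ∈ J, dB B f ∈ J) {w y : PS Ω} {c : ℚ}
    (hc : c ≠ 0) (hw : dB B w = C c) (h : w * y ∈ J) : y ∈ J := by
  have hit : ∀ n, (dB B)^[n] (w * y) ∈ J := by
    intro n
    induction n with
    | zero => exact h
    | succ n ih => rw [iterate_succ_apply']; exact hJ _ ih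
  obtain ⟨n, hn⟩ := dB_nil B y
  have : ∀ n, (dB B)^[n] y ∈ J → y ∈ J := by
    intro n
    induction n with
    | zero => exact id
    | succ n ih =>
      intro h1
      apply ih
      have h2 := hit (n + 1)
      rw [dB_iter B hw] at h2
      have h3 := (J.add_mem_iff_right (J.mul_mem_left w h1)).1 h2
      have h4 := J.mul_mem_left (C (((n + 1) * c)⁻¹)) h3
      rw [← mul_assoc, ← C_mul, inv_mul_cancel₀ (by positivity), C_1, one_mul] at h4
      exact h4
  exact this n (by rw [hn n le_rfl]; exact J.zero_mem)

lemma J_stable {A B : Finset Ω} (h : Disjoint A B) (p p' : Finset Ω → Prop) :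
    ∀ f ∈ UU v e rk A p ⊔ UU v e rk B p', dB B f ∈ UU v e rk A p ⊔ UU v e rk B p' := by
  intro f hf
  obtain ⟨a, ha, b, hb, rfl⟩ := mem_sup.1 hf
  rw [map_add]
  exact add_mem_sup (ULin (dB_cm (Or.inr h)) ha) (ULin (dB_cm (Or.inl subset_rfl)) hb)

lemma L5 {A B : Finset Ω} (h : Disjoint A B) (p p' : Finset Ω → Prop) {f : PS Ω}
    (hf : pr (ldf v e rk) A B * f ∈ UU v e rk A p ⊔ UU v e rk B p') :
    f ∈ UU v e rk A p ⊔ UU v e rk B p' := by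
  set J := UU v e rk A p ⊔ UU v e rk B p' with hJ
  have hw : ∀ i ∈ A, ∀ j ∈ B, ∀ y, lin i j * y ∈ J → y ∈ J := by
    intro i hi j hj y hy
    refine nzd_of_stable B J (J_stable h p p') (c := 1) one_ne_zero ?_ hy
    unfold lin
    rw [map_sub, dB_X, dB_X, if_pos hj, if_neg (disjoint_left.1 h hi)]; simp
  have hw' : ∀ i ∈ A, ∀ j ∈ B, ∀ n y, lin i j ^ n * y ∈ J → y ∈ J := by
    intro i hi j hj n
    induction n with
    | zero => intro y hy; simpa using hy
    | succ n ih =>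
      intro y hy
      rw [pow_succ, mul_assoc] at hy
      exact hw i hi j hj _ (ih _ hy)
  have : ∀ s ⊆ A ×ˢ B, ∀ y, (∏ p ∈ s, ldf v e rk p) * y ∈ J → y ∈ J := by
    intro s
    induction s using cons_induction with
    | empty => intro _ y hy; simpa using hy
    | cons a s ha ih =>
      intro hs y hy
      rw [prod_cons, mul_assoc] at hy
      refine ih (fun x hx => hs (by simp [hx])) y ?_
      have := mem_product.1 (hs (Finset.mem_cons_self a s))
      generalize (∏ p ∈ s, ldf v e rk p) * y = z at hy ⊢
      unfold ldf at hy
      grind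
  exact this _ subset_rfl f hf

end A10
section A11
open MvPolynomial
variable {Ω V : Type} [Fintype Ω] {v : Ω → V} {e : V → V → ℕ} {rk : Ω → ℕ}

/-- an injection of exponents into the naturals -/
noncomputable def enc (s : Ω →₀ ℕ) : ℕ := (exists_injective_nat (Ω →₀ ℕ)).choose s

lemma enc_inj : Injective (enc (Ω := Ω)) := (exists_injective_nat (Ω →₀ ℕ)).choose_spec

/-- monomials -/
noncomputable abbrev mon (s : Ω →₀ ℕ) : PS Ω := monomial s 1

/-- standard exponents -/
def std (U : Submodule ℚ (PS Ω)) (A : Finset Ω) : Set (Ω →₀ ℕ) :=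
  {s | s.support ⊆ A ∧ mon s ∉ U ⊔ span ℚ
    (mon '' {s' | s'.support ⊆ A ∧ s'.degree = s.degree ∧ enc s' < enc s})}

lemma std_span (U : Submodule ℚ (PS Ω)) (A : Finset Ω) (s : Ω →₀ ℕ) (hs : s.support ⊆ A) :
    mon s ∈ U ⊔ span ℚ (mon '' {p | p ∈ std U A ∧ p.degree = s.degree}) := by
  induction h : enc s using Nat.strong_induction_on generalizing s with
  | _ n ih =>
    by_cases hm : s ∈ std U A
    · exact mem_sup_right (subset_span ⟨s, ⟨hm, rfl⟩, rfl⟩)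
    · unfold std at hm
      simp only [mem_setOf_eq, not_and, not_not] at hm
      have := hm hs
      revert this
      apply SetLike.le_def.1
      refine sup_le le_sup_left ?_
      rw [span_le]
      rintro _ ⟨s', ⟨h1, h2, h3⟩, rfl⟩
      have := ih (enc s') (by omega) s' h1 rfl
      rw [h2] at this
      exact this

lemma std_indep_hom {U : Submodule ℚ (PS Ω)} {A : Finset Ω} {f : PS Ω} (hf : f ∈ U) {n : ℕ}
    (hn : f.IsHomogeneous n) (hs : ∀ s ∈ f.support, s ∈ std U A) : f = 0 := by
  by_contra hc
  have hne : f.support.Nonempty := MvPolynomial.support_nonempty.2 hc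
  obtain ⟨s, hsm, hmax⟩ := f.support.exists_max_image enc hne
  have hstd := hs s hsm
  apply hstd.2
  have hcs : coeff s f ≠ 0 := mem_support_iff.1 hsm
  have hdeg : ∀ s ∈ f.support, s.degree = n := by
    intro s' h'
    have := hn (mem_support_iff.1 h')
    rw [Finsupp.degree_eq_weight_one]; exact this
  have hdec : mon s = (coeff s f)⁻¹ • f - ∑ s' ∈ f.support.erase s, ((coeff s f)⁻¹ * coeff s' f) • mon s' := by
    have h1 : f = monomial s (coeff s f) + ∑ s' ∈ f.support.erase s, monomial s' (coeff s' f) := by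
      rw [add_sum_erase _ (fun s => monomial s (coeff s f)) hsm]; exact f.as_sum
    have h2 := congrArg (fun x => (coeff s f)⁻¹ • x) h1
    simp only [smul_add, Finset.smul_sum, smul_monomial, smul_eq_mul] at h2
    rw [inv_mul_cancel₀ hcs] at h2
    simp only [smul_monomial, smul_eq_mul, mul_one]
    rw [h2]; ring
  rw [hdec]
  refine Submodule.sub_mem _ (mem_sup_left (U.smul_mem _ hf)) (mem_sup_right ?_)
  refine Submodule.sum_mem _ fun s' h' => smul_mem _ _ (subset_span ⟨s', ⟨?_, ?_, ?_⟩, rfl⟩)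
  · exact (hs s' (Finset.mem_of_mem_erase h')).1
  · grind
  · refine lt_of_le_of_ne (hmax s' (Finset.mem_of_mem_erase h')) fun h => ?_
    exact Finset.ne_of_mem_erase h' (enc_inj h)

/-- gradedness of a subspace -/
def Grd (U : Submodule ℚ (PS Ω)) : Prop := ∀ f ∈ U, ∀ n, homogeneousComponent n f ∈ U

lemma std_indep {U : Submodule ℚ (PS Ω)} (hU : Grd U) {A : Finset Ω} {f : PS Ω} (hf : f ∈ U)
    (hs : ∀ s ∈ f.support, s ∈ std U A) : f = 0 := by
  rw [← sum_homogeneousComponent f]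
  refine sum_eq_zero fun n _ => ?_
  refine std_indep_hom (hU f hf n) (homogeneousComponent_isHomogeneous n f) fun s h => hs s ?_
  rw [mem_support_iff] at h ⊢
  intro h0
  apply h
  rw [coeff_homogeneousComponent, h0]; simp

lemma span_supp {D : Set (Ω →₀ ℕ)} {r : PS Ω} (hr : r ∈ span ℚ (mon '' D)) :
    ∀ s, coeff s r ≠ 0 → s ∈ D := by
  induction hr using span_induction with
  | mem x hx =>
    aesop
  | zero => intro s hs; simp at hs
  | add x y _ _ hx hy =>
    intro s hs
    by_cases h : coeff s x = 0
    · simp_all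
    · exact hx s h
  | smul a x _ hx =>
    simp_all

lemma std_dual {U : Submodule ℚ (PS Ω)} (hU : Grd U) {A : Finset Ω} {b0 : Ω →₀ ℕ} (hb : b0 ∈ std U A) :
    ∃ φ : PS Ω →ₗ[ℚ] ℚ, (∀ f ∈ U, φ f = 0) ∧ φ (mon b0) ≠ 0 ∧ ∀ b ∈ std U A, b ≠ b0 → φ (mon b) = 0 := by
  have hnm : mon b0 ∉ U ⊔ span ℚ (mon '' {b | b ∈ std U A ∧ b ≠ b0}) := by
    intro h
    obtain ⟨f, hf, r, hr, hfr⟩ := mem_sup.1 h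
    have hr' : ∀ s ∈ r.support, s ∈ std U A ∧ s ≠ b0 := by
      intro s hs
      exact span_supp hr s (mem_support_iff.1 hs)
    have hf0 : f = 0 := by
      refine std_indep hU hf (A := A) fun s hs => ?_
      have hfe : f = mon b0 - r := by rw [← hfr]; ring
      rw [hfe] at hs
      have := MvPolynomial.support_sub _ _ _ hs
      rw [mem_union] at this
      rcases this with h | h
      · have : s = b0 := by simpa [support_monomial] using h
        rw [this]; exact hb
      · exact (hr' s h).1
    rw [hf0, zero_add] at hfr
    have : b0 ∈ r.support := by rw [hfr]; simp [support_monomial]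
    exact (hr' b0 this).2 rfl
  obtain ⟨φ, h1, h2⟩ := Submodule.exists_dual_map_eq_bot_of_notMem hnm inferInstance
  have h3 : ∀ x ∈ U ⊔ span ℚ (mon '' {b | b ∈ std U A ∧ b ≠ b0}), φ x = 0 := by
    intro x hx
    have : φ x ∈ Submodule.map φ (U ⊔ span ℚ (mon '' {b | b ∈ std U A ∧ b ≠ b0})) := ⟨x, hx, rfl⟩
    rw [h2] at this
    exact (mem_bot ℚ).1 this
  exact ⟨φ, fun f hf => h3 f (mem_sup_left hf), h1, fun b hb hne =>
    h3 _ (mem_sup_right (subset_span ⟨b, ⟨hb, hne⟩, rfl⟩))⟩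

/-- restriction of exponents -/
noncomputable def rs (A : Finset Ω) (s : Ω →₀ ℕ) : Ω →₀ ℕ := s.filter (· ∈ A)

lemma rs_supp (A : Finset Ω) (s : Ω →₀ ℕ) : (rs A s).support ⊆ A := by
  intro x hx; unfold rs at hx
  simp_all

lemma rs_add (A : Finset Ω) (s t : Ω →₀ ℕ) : rs A (s + t) = rs A s + rs A t := by
  unfold rs; exact Finsupp.filter_add

lemma rs_single_mem {A : Finset Ω} {i : Ω} (h : i ∈ A) : rs A (Finsupp.single i 1) = Finsupp.single i 1 := by
  unfold rs; exact Finsupp.filter_single_of_pos _ h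
lemma rs_single_notMem {A : Finset Ω} {i : Ω} (h : i ∉ A) : rs A (Finsupp.single i 1) = 0 := by
  unfold rs; exact Finsupp.filter_single_of_neg _ h

lemma rs_split {A B : Finset Ω} (h : Disjoint A B) (s : Ω →₀ ℕ) :
    s = rs A s + rs B s + rs (univ \ (A ∪ B)) s := by
  ext x
  simp only [rs, Finsupp.add_apply, Finsupp.filter_apply]
  have : ∀ x, x ∈ A → x ∉ B := fun x hx => disjoint_left.1 h hx
  grind

/-- linear maps given on monomials -/
noncomputable def lm {M : Type*} [AddCommGroup M] [Module ℚ M] (F : (Ω →₀ ℕ) → M) : PS Ω →ₗ[ℚ] M :=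
  (basisMonomials Ω ℚ).constr ℚ F

lemma lm_mon {M : Type*} [AddCommGroup M] [Module ℚ M] (F : (Ω →₀ ℕ) → M) (s : Ω →₀ ℕ) :
    lm F (mon s) = F s := by
  have := (basisMonomials Ω ℚ).constr_basis ℚ F s
  rwa [coe_basisMonomials] at this

lemma lin_ext {M : Type*} [AddCommGroup M] [Module ℚ M] {F G : PS Ω →ₗ[ℚ] M}
    (h : ∀ s, F (mon s) = G (mon s)) : F = G :=
  (basisMonomials Ω ℚ).ext fun s => by rw [coe_basisMonomials]; exact h s

lemma Cm_X {L : PS Ω →ₗ[ℚ] PS Ω} {i : Ω} (h : ∀ s, L (mon (s + Finsupp.single i 1)) = X i * L (mon s)) :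
    Cm L (X i) := by
  have : L ∘ₗ mulLeft ℚ (X i) = mulLeft ℚ (X i) ∘ₗ L := by
    refine lin_ext fun s => ?_
    simp only [comp_apply, mulLeft_apply]
    rw [← h, mon, mon, monomial_add_single, pow_one, mul_comm]
  intro x
  exact LinearMap.congr_fun this x

lemma CmY_X {L : PS Ω →ₗ[ℚ] PS Ω} {A : Finset Ω}
    (h : ∀ i ∈ A, ∀ s, L (mon (s + Finsupp.single i 1)) = X i * L (mon s)) : CmY L A := by
  intro i hi j hj x
  unfold lin
  rw [sub_mul, map_sub, Cm_X (h i hi), Cm_X (h j hj), sub_mul]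

lemma tens_indep {A B : Finset Ω} (h : Disjoint A B) (p p' : Finset Ω → Prop) {f : PS Ω}
    (hf : f ∈ UU v e rk A p ⊔ UU v e rk B p')
    (hs : ∀ s ∈ f.support, rs A s ∈ std ((UU v e rk A p).restrictScalars ℚ) A ∧
      rs B s ∈ std ((UU v e rk B p').restrictScalars ℚ) B) : f = 0 := by
  by_contra hc
  obtain ⟨s0, hs0⟩ := MvPolynomial.support_nonempty.2 hc
  have gA : Grd ((UU v e rk A p).restrictScalars ℚ) := fun f hf n => UU_comp hf n
  have gB : Grd ((UU v e rk B p').restrictScalars ℚ) := fun f hf n => UU_comp hf n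
  obtain ⟨φ, φ1, φ2, φ3⟩ := std_dual gB (hs s0 hs0).2
  set O := univ \ (A ∪ B) with hO
  have hAB : ∀ x, x ∈ A → x ∉ B := fun x hx => disjoint_left.1 h hx
  set Φ : PS Ω →ₗ[ℚ] PS Ω := lm fun s => if rs O s = rs O s0 then φ (mon (rs B s)) • mon (rs A s) else 0 with hΦ
  have hΦm : ∀ s, Φ (mon s) = if rs O s = rs O s0 then φ (mon (rs B s)) • mon (rs A s) else 0 :=
    fun s => lm_mon _ s
  have hΦA : CmY Φ A := by
    refine CmY_X fun i hi s => ?_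
    rw [hΦm, hΦm, rs_add, rs_add, rs_add, rs_single_mem hi, rs_single_notMem (hAB i hi),
      rs_single_notMem (show i ∉ O by simp [hO, hi]), add_zero, add_zero]
    split_ifs
    · rw [mul_smul_comm]
      congr 1
      rw [mon, monomial_add_single, pow_one, mul_comm]
    · simp
  have hΦB : ∀ b ∈ UU v e rk B p', Φ b = 0 := by
    intro b hb
    ext a
    rw [coeff_zero]
    set Λ : PS Ω →ₗ[ℚ] PS Ω := lm fun s => if rs O s = rs O s0 ∧ rs A s = a then mon (rs B s) else 0 with hΛ
    have hΛm : ∀ s, Λ (mon s) = if rs O s = rs O s0 ∧ rs A s = a then mon (rs B s) else 0 :=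
      fun s => lm_mon _ s
    have hΛB : CmY Λ B := by
      refine CmY_X fun i hi s => ?_
      rw [hΛm, hΛm, rs_add, rs_add, rs_add, rs_single_mem hi, rs_single_notMem (fun h' => hAB i h' hi),
        rs_single_notMem (show i ∉ O by simp [hO, hi]), add_zero, add_zero]
      split_ifs
      · rw [mon, monomial_add_single, pow_one, mul_comm]
      · simp
    have : (MvPolynomial.lcoeff ℚ a) ∘ₗ Φ = φ ∘ₗ Λ := by
      refine lin_ext fun s => ?_
      simp only [comp_apply, lcoeff_apply]
      rw [hΦm, hΛm]
      by_cases h1 : rs O s = rs O s0 <;> by_cases h2 : rs A s = a <;> simp [h1, h2, coeff_monomial]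
    have h2 := LinearMap.congr_fun this b
    simp only [comp_apply, lcoeff_apply] at h2
    rw [h2]
    exact φ1 _ (ULin hΛB hb)
  have hΦf : Φ f ∈ UU v e rk A p := by
    obtain ⟨a, ha, b, hb, rfl⟩ := mem_sup.1 hf
    rw [map_add, hΦB b hb, add_zero]
    exact ULin hΦA ha
  have hexp : Φ f = ∑ s ∈ f.support, coeff s f • (if rs O s = rs O s0 then φ (mon (rs B s)) • mon (rs A s) else 0) := by
    conv_lhs => rw [f.as_sum, map_sum]
    refine sum_congr rfl fun s _ => ?_
    rw [← hΦm, ← map_smul, mon, smul_monomial, smul_eq_mul, mul_one]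
  have h0 : Φ f = 0 := by
    refine std_indep gA hΦf (A := A) fun s hs' => ?_
    rw [mem_support_iff, hexp, coeff_sum] at hs'
    obtain ⟨s', h1, h2⟩ := exists_ne_zero_of_sum_ne_zero hs'
    rw [coeff_smul] at h2
    have h3 := right_ne_zero_of_mul h2
    split_ifs at h3
    · rw [coeff_smul, coeff_monomial] at h3
      have h4 := right_ne_zero_of_mul h3
      split_ifs at h4 with h5
      · rw [← h5]; exact (hs s' h1).1
      · exact absurd rfl h4
    · simp at h3
  have h1 := congrArg (coeff (rs A s0)) h0
  rw [hexp, coeff_sum, coeff_zero, sum_eq_single_of_mem s0 hs0] at h1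
  · rw [if_pos rfl, coeff_smul, coeff_smul, coeff_monomial, if_pos rfl] at h1
    simp only [smul_eq_mul, mul_one, mul_eq_zero] at h1
    grind
  · intro s hs1 hne
    split_ifs with hh
    · rw [coeff_smul, coeff_smul, coeff_monomial]
      split_ifs with h3
      · by_cases h4 : rs B s = rs B s0
        · exfalso; apply hne
          rw [rs_split h s, rs_split h s0, h3, h4, hh]
        · rw [φ3 _ (hs s hs1).2 h4]; simp
      · simp
    · simp

lemma tens_span {A B : Finset Ω} (h : Disjoint A B) (I I' : Ideal (PS Ω)) (s : Ω →₀ ℕ) :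
    mon s ∈ (I ⊔ I').restrictScalars ℚ ⊔ span ℚ (mon '' {s' | rs A s' ∈ std (I.restrictScalars ℚ) A ∧
      rs B s' ∈ std (I'.restrictScalars ℚ) B}) := by
  set W := (I ⊔ I').restrictScalars ℚ ⊔ span ℚ (mon '' {s' | rs A s' ∈ std (I.restrictScalars ℚ) A ∧
      rs B s' ∈ std (I'.restrictScalars ℚ) B}) with hW
  set O := univ \ (A ∪ B) with hO
  have hJ : ∀ f ∈ I ⊔ I', f ∈ W := fun f hf => mem_sup_left hf
  have e1 : mon s = mon (rs A s) * (mon (rs B s) * mon (rs O s)) := by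
    conv_lhs => rw [rs_split h s]
    simp [mon, monomial_mul, add_assoc, hO]
  have rsz : ∀ (P R : Finset Ω) (t : Ω →₀ ℕ), Disjoint P R → t.support ⊆ R → rs P t = 0 := by
    intro P R t hd ht
    unfold rs
    rw [Finsupp.filter_eq_zero_iff]
    intro x hx
    by_contra hn
    exact disjoint_left.1 hd hx (ht (Finsupp.mem_support_iff.2 hn))
  have rse : ∀ (P : Finset Ω) (t : Ω →₀ ℕ), t.support ⊆ P → rs P t = t := by
    intro P t ht
    unfold rs
    rw [Finsupp.filter_eq_self_iff]
    intro x hx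
    exact ht (Finsupp.mem_support_iff.2 hx)
  have hAO : Disjoint A O := by
    rw [disjoint_left]; intro x hx; simp [hO, hx]
  have hBO : Disjoint B O := by
    rw [disjoint_left]; intro x hx; simp [hO, hx]
  have st2 : ∀ a ∈ std (I.restrictScalars ℚ) A, mon a * (mon (rs B s) * mon (rs O s)) ∈ W := by
    intro a ha
    obtain ⟨f, hf, r, hr, hfr⟩ := mem_sup.1 (std_span (I'.restrictScalars ℚ) B _ (rs_supp B s))
    rw [← hfr, add_mul, mul_add]
    refine W.add_mem (hJ _ (Ideal.mul_mem_left _ _ (Ideal.mul_mem_right _ _ (mem_sup_right hf)))) ?_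
    clear hfr
    induction hr using span_induction with
    | mem x hx =>
      obtain ⟨b, ⟨hb, _⟩, rfl⟩ := hx
      refine mem_sup_right (subset_span ⟨a + (b + rs O s), ⟨?_, ?_⟩, ?_⟩)
      · rw [rs_add, rs_add, rse A a ha.1, rsz A B b h hb.1, rsz A O _ hAO (rs_supp _ _)]; simpa using ha
      · rw [rs_add, rs_add, rse B b hb.1, rsz B A a h.symm ha.1, rsz B O _ hBO (rs_supp _ _)]; simpa using hb
      · simp [mon, monomial_mul]
    | zero => simp
    | add x y _ _ hx hy => rw [add_mul, mul_add]; exact W.add_mem hx hy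
    | smul c x _ hx => rw [smul_mul_assoc, mul_smul_comm]; exact W.smul_mem _ hx
  rw [e1]
  obtain ⟨f, hf, r, hr, hfr⟩ := mem_sup.1 (std_span (I.restrictScalars ℚ) A _ (rs_supp A s))
  rw [← hfr, add_mul]
  refine W.add_mem (hJ _ (Ideal.mul_mem_right _ _ (mem_sup_left hf))) ?_
  clear hfr
  induction hr using span_induction with
  | mem x hx =>
    obtain ⟨b, ⟨hb, _⟩, rfl⟩ := hx
    exact st2 b hb
  | zero => simp
  | add x y _ _ hx hy => rw [add_mul]; exact W.add_mem hx hy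
  | smul c x _ hx => rw [smul_mul_assoc]; exact W.smul_mem _ hx

end A11
section A12
open MvPolynomial
variable {Ω V : Type} [Fintype Ω] {v : Ω → V} {e : V → V → ℕ} {rk : Ω → ℕ}

/-- homogeneous bases have the same degree distribution -/
lemma hom_basis_equiv {ι κ : Type} (b : Basis ι ℚ (PS Ω)) (b' : Basis κ ℚ (PS Ω)) (d : ι → ℕ) (d' : κ → ℕ)
    (hb : ∀ i, (b i).IsHomogeneous (d i)) (hb' : ∀ i, (b' i).IsHomogeneous (d' i)) :
    ∃ φ : ι ≃ κ, ∀ i, d' (φ i) = d i := by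
  have key : ∀ {μ : Type} (b : Basis μ ℚ (PS Ω)) (d : μ → ℕ) (hb : ∀ i, (b i).IsHomogeneous (d i)) (n : ℕ),
      Nonempty (Basis {i // d i = n} ℚ (homogeneousSubmodule Ω ℚ n)) := by
    intro μ b d hb n
    let w : {i // d i = n} → homogeneousSubmodule Ω ℚ n := fun i => ⟨b i.1, by
      have h := hb i.1
      rw [i.2] at h; exact h⟩
    have hw : LinearIndependent ℚ w := by
      apply LinearIndependent.of_comp (homogeneousSubmodule Ω ℚ n).subtype
      exact b.linearIndependent.comp (fun i : {i // d i = n} => i.1) Subtype.val_injective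
    refine ⟨Basis.mk hw ?_⟩
    rintro ⟨f, hf⟩ -
    have h1 : ∀ f, homogeneousComponent n f ∈ (span ℚ (Set.range w)).map (homogeneousSubmodule Ω ℚ n).subtype := by
      intro f
      have := b.mem_span f
      induction this using span_induction with
      | mem x hx =>
        obtain ⟨i, rfl⟩ := hx
        rw [homogeneousComponent_of_mem (hb i)]
        split_ifs with h
        · exact ⟨w ⟨i, h.symm⟩, subset_span ⟨_, rfl⟩, rfl⟩
        · exact Submodule.zero_mem _
      | zero => rw [map_zero]; exact Submodule.zero_mem _
      | add x y _ _ hx hy => rw [map_add]; exact add_mem _ hx hy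
      | smul a x _ hx => rw [map_smul]; exact smul_mem _ _ hx
    have h2 := h1 f
    rw [homogeneousComponent_of_mem hf, if_pos rfl] at h2
    obtain ⟨x, hx, hxe⟩ := h2
    have : x = ⟨f, hf⟩ := Subtype.ext hxe
    rwa [this] at hx
  let ψ : ∀ n, {i // d i = n} ≃ {i // d' i = n} := fun n =>
    (key b d hb n).some.indexEquiv (key b' d' hb' n).some
  refine ⟨(sigmaFiberEquiv d).symm.trans ((Equiv.sigmaCongrRight ψ).trans (sigmaFiberEquiv d')), fun i => ?_⟩
  exact (ψ (d i) ⟨i, rfl⟩).2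

variable (v rk) in
/-- sort key -/
def key (θ : V → ℤ) (A : Finset Ω) : ℤ ×ₗ (ℕ ×ₗ ℕ) := toLex (th v θ A, toLex (A.card, srk rk A))

lemma key_le {θ : V → ℤ} {T A : Finset Ω} : key v rk θ T ≤ key v rk θ A ↔
    th v θ T < th v θ A ∨ th v θ T = th v θ A ∧ (T.card < A.card ∨ T.card = A.card ∧ srk rk T ≤ srk rk A) := by
  unfold key; rw [Prod.Lex.toLex_le_toLex, Prod.Lex.toLex_le_toLex]

lemma key_lt {θ : V → ℤ} {T A : Finset Ω} : key v rk θ T < key v rk θ A ↔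
    th v θ T < th v θ A ∨ th v θ T = th v θ A ∧ (T.card < A.card ∨ T.card = A.card ∧ srk rk T < srk rk A) := by
  unfold key; rw [Prod.Lex.toLex_lt_toLex, Prod.Lex.toLex_lt_toLex]

lemma LE1.key_lt (hrk : Injective rk) {T A : Finset Ω} (h : LE1 v rk T A) (hne : T ≠ A) (θ : V → ℤ) :
    key v rk θ T < key v rk θ A := by
  rw [HallPaper.key_lt]
  right
  refine ⟨h.th θ, Or.inr ⟨h.card, (h.eq_or hrk).resolve_left hne⟩⟩

variable (v e rk) in
/-- standard exponents, torsion -/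
def stT (θ : V → ℤ) (A : Finset Ω) : Set (Ω →₀ ℕ) := std ((UU v e rk A (pT v θ A)).restrictScalars ℚ) A
variable (v e rk) in
/-- standard exponents, torsion free -/
def stF (θ : V → ℤ) (A : Finset Ω) : Set (Ω →₀ ℕ) := std ((UU v e rk A (pF v θ)).restrictScalars ℚ) A

variable (v e rk) in
/-- index type of the adapted basis -/
def Ix (θ : V → ℤ) (Y : Finset Ω) : Type :=
  {x : Finset Ω × (Ω →₀ ℕ) // x.1 ⊆ Y ∧ rs x.1 x.2 ∈ stT v e rk θ x.1 ∧ rs (Y \ x.1) x.2 ∈ stF v e rk θ (Y \ x.1)}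

lemma mem_of_mon {W : Submodule ℚ (PS Ω)} (h : ∀ s, mon s ∈ W) (f : PS Ω) : f ∈ W := by
  rw [f.as_sum]
  refine Submodule.sum_mem _ fun s _ => ?_
  have : monomial s (coeff s f) = coeff s f • mon s := by rw [mon, smul_monomial, smul_eq_mul, mul_one]
  rw [this]; exact W.smul_mem _ (h s)

lemma Ix_indep (he : ∀ w, e w w = 0) (hrk : Injective rk) (θ : V → ℤ) (Y : Finset Ω)
    (κ : Finset Ω → Finset Ω → PS Ω)
    (hκ : ∀ A ⊆ Y, Fam2 v e rk Y (κ A) ∧ κ A A = pr (ldf v e rk) A (Y \ A) ∧ ∀ T ⊆ Y, κ A T ≠ 0 → LE1 v rk T A) :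
    LinearIndependent ℚ (fun x : Ix v e rk θ Y => mon x.1.2 * intP v Y (κ x.1.1)) := by
  rw [linearIndependent_iff']
  intro s c hc
  by_contra hcon
  push Not at hcon
  obtain ⟨i1, hi1, hi1c⟩ := hcon
  obtain ⟨i0, hi0, hmax⟩ := (s.filter fun i => c i ≠ 0).exists_max_image (fun i => key v rk θ i.1.1)
    ⟨i1, by simp [hi1, hi1c]⟩
  rw [mem_filter] at hi0
  set A0 := i0.1.1 with hA0
  have hA0Y : A0 ⊆ Y := i0.2.1
  let f : Finset Ω → PS Ω := fun A => ∑ i ∈ s with i.1.1 = A, c i • mon i.1.2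
  have hf : ∀ A, f A ≠ 0 → key v rk θ A ≤ key v rk θ A0 := by
    intro A hA
    obtain ⟨i, hi, hne⟩ := exists_ne_zero_of_sum_ne_zero hA
    rw [mem_filter] at hi
    rw [← hi.2]
    refine hmax i (mem_filter.2 ⟨hi.1, fun h => hne (by rw [h, zero_smul])⟩)
  let g : Finset Ω → PS Ω := fun T => ∑ A ∈ Y.powerset, f A * κ A T
  have hgF : ∀ A ∈ Y.powerset, Fam2 v e rk Y (fun T => f A * κ A T) := fun A hA =>
    (hκ A (mem_powerset.1 hA)).1.smul _
  have hg : Fam2 v e rk Y g := Fam2.sum _ _ hgF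
  have hgi : intP v Y g = 0 := by
    rw [intP_sum _ _ hgF]
    rw [← hc]
    rw [← Finset.sum_fiberwise_of_maps_to (s := s) (t := Y.powerset) (g := fun i => i.1.1)
      (fun i _ => mem_powerset.2 i.2.1)]
    refine sum_congr rfl fun A hA => ?_
    rw [intP_smul (hκ A (mem_powerset.1 hA)).1, sum_mul]
    refine sum_congr rfl fun i hi => ?_
    rw [(mem_filter.1 hi).2, smul_mul_assoc]
  have hgA : g A0 = f A0 * pr (ldf v e rk) A0 (Y \ A0) := by
    rw [← (hκ A0 hA0Y).2.1]
    refine sum_eq_single_of_mem (f := fun A => f A * κ A A0) A0 (mem_powerset.2 hA0Y) fun A hA hne => ?_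
    by_contra hn
    have h1 := (hκ A (mem_powerset.1 hA)).2.2 A0 hA0Y (right_ne_zero_of_mul hn)
    exact absurd (hf A (left_ne_zero_of_mul hn)) (not_le.2 (h1.key_lt hrk (Ne.symm hne) θ))
  have hU : A0 ∪ (Y \ A0) = Y := union_sdiff_of_subset hA0Y
  have h4 := L4 (v := v) (e := e) (rk := rk) he (g := g) (A0 := A0) (B0 := Y \ A0) disjoint_sdiff (by rw [hU]; exact hg) θ (by
    rw [hU]
    intro T hT hne
    obtain ⟨A, hA, hn⟩ := exists_ne_zero_of_sum_ne_zero hne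
    have h1 := (hκ A (mem_powerset.1 hA)).2.2 T hT (right_ne_zero_of_mul hn)
    have h2 := key_le.1 (hf A (left_ne_zero_of_mul hn))
    unfold lt2
    rw [h1.th, h1.card]
    omega)
  rw [hU, hgi, mul_zero, zero_sub, neg_mem_iff, hgA, mul_comm] at h4
  have h5 := L5 disjoint_sdiff _ _ h4
  have hsupp : ∀ t, coeff t (f A0) ≠ 0 → ∃ i ∈ s, i.1.1 = A0 ∧ i.1.2 = t := by
    intro t ht
    have : coeff t (f A0) = ∑ i ∈ s with i.1.1 = A0, c i * (if i.1.2 = t then 1 else 0) := by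
      show coeff t (∑ i ∈ s with i.1.1 = A0, c i • mon i.1.2) = _
      rw [coeff_sum]
      simp only [coeff_smul, coeff_monomial, smul_eq_mul]
    rw [this] at ht
    obtain ⟨i, hi, hn⟩ := exists_ne_zero_of_sum_ne_zero ht
    have := right_ne_zero_of_mul hn
    rw [mem_filter] at hi
    refine ⟨i, hi.1, hi.2, ?_⟩
    by_contra h'
    rw [if_neg h'] at this
    exact this rfl
  have h6 : f A0 = 0 := by
    refine tens_indep disjoint_sdiff _ _ h5 fun t ht => ?_
    obtain ⟨i, _, h1, h2⟩ := hsupp t (mem_support_iff.1 ht)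
    have := i.2.2
    rw [h1, h2] at this
    exact this
  have h7 : coeff i0.1.2 (f A0) = c i0 := by
    show coeff _ (∑ i ∈ s with i.1.1 = A0, c i • mon i.1.2) = _
    have hm : i0 ∈ s.filter (fun i => i.1.1 = A0) := mem_filter.2 ⟨hi0.1, rfl⟩
    rw [coeff_sum, sum_eq_single_of_mem i0 hm]
    · rw [coeff_smul, coeff_monomial, if_pos rfl, smul_eq_mul, mul_one]
    · intro i hi hne
      rw [coeff_smul, coeff_monomial, if_neg, smul_zero]
      intro h
      exact hne (Subtype.ext (Prod.ext (mem_filter.1 hi).2 h))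
  rw [h6, coeff_zero] at h7
  exact hi0.2 h7.symm

lemma Ix_span (he : ∀ w, e w w = 0) (hrk : Injective rk) (θ : V → ℤ) (Y : Finset Ω)
    (κ : Finset Ω → Finset Ω → PS Ω)
    (hκ : ∀ A ⊆ Y, Fam2 v e rk Y (κ A) ∧ κ A A = pr (ldf v e rk) A (Y \ A) ∧ ∀ T ⊆ Y, κ A T ≠ 0 → LE1 v rk T A) :
    ⊤ ≤ span ℚ (Set.range (fun x : Ix v e rk θ Y => mon x.1.2 * intP v Y (κ x.1.1))) := by
  set W := span ℚ (Set.range (fun x : Ix v e rk θ Y => mon x.1.2 * intP v Y (κ x.1.1))) with hW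
  have hgen : ∀ q : Finset Ω → Prop, (∀ A ⊆ Y, q A → ∀ f, f * intP v Y (κ A) ∈ W) →
      (∀ T A, LE1 v rk T A → q A → q T) → ∀ g, Fam2 v e rk Y g → (∀ T ⊆ Y, g T ≠ 0 → q T) → intP v Y g ∈ W := by
    intro q hq hqm g hg hgs
    obtain ⟨c, hc⟩ := gen' he hrk q κ (fun T0 h0 hq0 => ⟨(hκ T0 h0).1, (hκ T0 h0).2.1, fun T hT hne =>
      have h1 := (hκ T0 h0).2.2 T hT hne
      ⟨hqm T T0 h1 hq0, h1.eq_or hrk⟩⟩) hg hgs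
    rw [intP_congr hc, intP_sum (e := e) (rk := rk)]
    · refine Submodule.sum_mem _ fun A hA => ?_
      rw [mem_filter, mem_powerset] at hA
      rw [intP_smul (hκ A hA.1).1]
      exact hq A hA.1 hA.2 _
    · intro A hA
      rw [mem_filter, mem_powerset] at hA
      exact (hκ A hA.1).1.smul _
  have hall : ∀ A ⊆ Y, ∀ f, f * intP v Y (κ A) ∈ W := by
    by_contra hcon
    push Not at hcon
    obtain ⟨A1, hA1, hA1'⟩ := hcon
    obtain ⟨A, hA, hmin⟩ := (Y.powerset.filter fun A => ∃ f, f * intP v Y (κ A) ∉ W).exists_min_image (key v rk θ)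
      ⟨A1, by grind⟩
    rw [mem_filter, mem_powerset] at hA
    obtain ⟨hAY, f, hf⟩ := hA
    have hlow : ∀ g, Fam2 v e rk Y g → (∀ T ⊆ Y, g T ≠ 0 → key v rk θ T < key v rk θ A) → intP v Y g ∈ W := by
      refine hgen _ ?_ ?_
      · grind
      · intro T A' h1 hlt
        by_cases hTA : T = A'
        · rwa [hTA]
        · exact (h1.key_lt hrk hTA θ).trans hlt
    have hN : ∀ j g' y, Fam2 v e rk Y g' → (∀ T ⊆ Y, g' T ≠ 0 → LE1 v rk T A) →
      g' A = pr (ldf v e rk) A (Y \ A) * j → Fam2 v e rk Y y →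
      intP v Y g' = intP v Y y → (∀ T ⊆ Y, y T ≠ 0 → lt2 v θ T A) → j * intP v Y (κ A) ∈ W := by
      intro j g' y h1 h2 h3 h4 h5 h6
      have hd : intP v Y (fun T => g' T - j * κ A T) ∈ W := by
        refine hlow _ (h1.sub ((hκ A hAY).1.smul j)) fun T hT hne => ?_
        by_cases hTA : T = A
        · grind
        · refine LE1.key_lt hrk ?_ hTA θ
          grind
      rw [intP_sub h1 ((hκ A hAY).1.smul j), intP_smul (hκ A hAY).1, h5] at hd
      have hy : intP v Y y ∈ W := by
        refine hlow y h4 fun T hT hne => ?_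
        have := h6 T hT hne
        unfold lt2 at this
        rw [key_lt]
        omega
      have := W.sub_mem hy hd
      rwa [sub_sub_cancel] at this
    apply hf
    have hmap : ∀ f, f ∈ W.comap (LinearMap.mulRight ℚ (intP v Y (κ A))) := by
      refine mem_of_mon fun s => ?_
      have := tens_span (A := A) (B := Y \ A) disjoint_sdiff (UU v e rk A (pT v θ A)) (UU v e rk (Y \ A) (pF v θ)) s
      revert this
      apply SetLike.le_def.1
      refine sup_le ?_ ?_
      · intro x hx
        obtain ⟨a, ha, b, hb, rfl⟩ := mem_sup.1 (show x ∈ UU v e rk A (pT v θ A) ⊔ UU v e rk (Y \ A) (pF v θ) from hx)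
        refine add_mem _ ?_ ?_
        · obtain ⟨g', y, h1, h2, h3, h4, h5, h6⟩ := N1 he hrk θ hAY ha
          exact hN a g' y h1 h2 h3 h4 h5 h6
        · obtain ⟨g', y, h1, h2, h3, h4, h5, h6⟩ := N2 he hrk θ hAY hb
          exact hN b g' y h1 h2 h3 h4 h5 h6
      · rw [span_le]
        rintro _ ⟨t, ht, rfl⟩
        exact subset_span ⟨⟨(A, t), hAY, ht⟩, rfl⟩
    exact hmap f
  intro f _
  have hfF : Fam2 v e rk Y (fun T => if T = Y then f else 0) := by
    constructor
    · intro T hT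
      split_ifs with h
      · subst h; simp
      · exact dvd_zero _
    · intro T hT i hi j hj hv
      have hp : pm (swap i j) Y = Y := pm_swap_eq (by simp [hi, hj])
      have : pm (swap i j) T = Y ↔ T = Y := by
        constructor
        · intro h; rw [← pm_pm_swap i j T, h, hp]
        · rintro rfl; exact hp
      simp only [this, sub_self, dvd_zero]
  have hfi : intP v Y (fun T => if T = Y then f else 0) = f := by
    apply amap_inj
    rw [hfF.int]
    unfold intF
    rw [sum_eq_single_of_mem Y (Finset.mem_powerset_self Y)]
    · simp [Iterm, vt]
    · intro T _ hne
      simp [Iterm, hne]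
  rw [← hfi]
  exact hgen (fun _ => True) (fun A hA _ f => hall A hA f) (fun _ _ _ _ => trivial) _ hfF (fun _ _ _ => trivial)

/-- the Hilbert identity, in bijective form -/
lemma Ix_equiv (he : ∀ w, e w w = 0) (hrk : Injective rk) (θ : V → ℤ) (Y : Finset Ω) :
    ∃ φ : Ix v e rk θ Y ≃ (Ω →₀ ℕ), ∀ x, (φ x).degree + vtc v rk x.1.1 (Y \ x.1.1)
      = x.1.2.degree + ar v e rk x.1.1 (Y \ x.1.1) := by
  choose! κ hκ using fun (A : Finset Ω) (hA : A ⊆ Y) => ind_hom (v := v) (e := e) (rk := rk) he hrk hA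
  have hκ' : ∀ A ⊆ Y, Fam2 v e rk Y (κ A) ∧ κ A A = pr (ldf v e rk) A (Y \ A) ∧ ∀ T ⊆ Y, κ A T ≠ 0 → LE1 v rk T A :=
    fun A hA => ⟨(hκ A hA).1, (hκ A hA).2.1, (hκ A hA).2.2.1⟩
  have hli := Ix_indep he hrk θ Y κ hκ'
  let b := Basis.mk hli (Ix_span he hrk θ Y κ hκ')
  have hb : ∀ x, b x = mon x.1.2 * intP v Y (κ x.1.1) := fun x => by simp [b]
  have hdeg : ∀ x : Ix v e rk θ Y, ∃ d, (b x).IsHomogeneous d ∧ d + vtc v rk x.1.1 (Y \ x.1.1)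
      = x.1.2.degree + ar v e rk x.1.1 (Y \ x.1.1) := by
    intro x
    set P := intP v Y (κ x.1.1) with hP
    have hP0 : P ≠ 0 := by
      intro h0
      have := b.ne_zero x
      rw [hb, ← hP, h0, mul_zero] at this
      exact this rfl
    have h1 : ∃ k, homogeneousComponent k P ≠ 0 := by
      by_contra hn
      push Not at hn
      apply hP0
      rw [← sum_homogeneousComponent P]
      exact sum_eq_zero fun i _ => hn i
    obtain ⟨k, hk⟩ := h1
    have hk' := (hκ x.1.1 x.2.1).2.2.2 k hk
    have hPk : P.IsHomogeneous k := by
      rw [← sum_homogeneousComponent P]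
      refine IsHomogeneous.sum _ _ _ fun i _ => ?_
      by_cases hi : homogeneousComponent i P = 0
      · rw [hi]; exact isHomogeneous_zero _ _ _
      · have := (hκ x.1.1 x.2.1).2.2.2 i hi
        have : i = k := by omega
        rw [this]; exact homogeneousComponent_isHomogeneous _ _
    refine ⟨x.1.2.degree + k, ?_, by omega⟩
    rw [hb]
    exact (isHomogeneous_monomial 1 rfl).mul hPk
  choose d hd1 hd2 using hdeg
  obtain ⟨φ, hφ⟩ := hom_basis_equiv b (basisMonomials Ω ℚ) d (fun s => s.degree) hd1 (fun s => by
    rw [coe_basisMonomials]; exact isHomogeneous_monomial 1 rfl)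
  exact ⟨φ, fun x => by rw [hφ, hd2]⟩

end A12
section A13
open MvPolynomial
open scoped ENNReal
variable {Ω V : Type} [Fintype Ω] {v : Ω → V} {e : V → V → ℕ} {rk : Ω → ℕ}

/-- Hilbert series of a set of exponents -/
noncomputable def hs (S : Set (Ω →₀ ℕ)) (t : ℝ≥0∞) : ℝ≥0∞ := ∑' s : S, t ^ (s : Ω →₀ ℕ).degree

lemma rs_self {A : Finset Ω} {s : Ω →₀ ℕ} (h : s.support ⊆ A) : rs A s = s := by
  unfold rs
  rw [Finsupp.filter_eq_self_iff]
  grind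

lemma rs_zero_of {A B : Finset Ω} (hd : Disjoint A B) {s : Ω →₀ ℕ} (h : s.support ⊆ B) : rs A s = 0 := by
  unfold rs
  rw [Finsupp.filter_eq_zero_iff]
  intro x hx
  by_contra h0
  exact disjoint_left.1 hd hx (h (Finsupp.mem_support_iff.2 h0))

lemma hs_mul {A B : Finset Ω} (hd : Disjoint A B) {S S' : Set (Ω →₀ ℕ)} (hS : ∀ s ∈ S, s.support ⊆ A)
    (hS' : ∀ s ∈ S', s.support ⊆ B) (t : ℝ≥0∞) :
    hs S t * hs S' t = hs {u | u.support ⊆ A ∪ B ∧ rs A u ∈ S ∧ rs B u ∈ S'} t := by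
  let e : S × S' ≃ {u : Ω →₀ ℕ | u.support ⊆ A ∪ B ∧ rs A u ∈ S ∧ rs B u ∈ S'} :=
    { toFun := fun p => ⟨p.1.1 + p.2.1, by
        refine ⟨?_, ?_, ?_⟩
        · exact (Finsupp.support_add).trans (union_subset_union (hS _ p.1.2) (hS' _ p.2.2))
        · rw [rs_add, rs_self (hS _ p.1.2), rs_zero_of hd (hS' _ p.2.2), add_zero]; exact p.1.2
        · rw [rs_add, rs_self (hS' _ p.2.2), rs_zero_of hd.symm (hS _ p.1.2), zero_add]; exact p.2.2⟩
      invFun := fun u => ⟨⟨rs A u.1, u.2.2.1⟩, ⟨rs B u.1, u.2.2.2⟩⟩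
      left_inv := fun p => by
        refine Prod.ext (Subtype.ext ?_) (Subtype.ext ?_)
        · show rs A (p.1.1 + p.2.1) = p.1.1
          rw [rs_add, rs_self (hS _ p.1.2), rs_zero_of hd (hS' _ p.2.2), add_zero]
        · show rs B (p.1.1 + p.2.1) = p.2.1
          rw [rs_add, rs_self (hS' _ p.2.2), rs_zero_of hd.symm (hS _ p.1.2), zero_add]
      right_inv := fun u => by
        refine Subtype.ext ?_
        show rs A u.1 + rs B u.1 = u.1
        conv_rhs => rw [rs_split hd u.1]
        rw [rs_zero_of (A := univ \ (A ∪ B)) (B := A ∪ B) Finset.sdiff_disjoint u.2.1, add_zero] }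
  unfold hs
  rw [← e.tsum_eq, ENNReal.tsum_prod', ← ENNReal.tsum_mul_right]
  refine tsum_congr fun a => ?_
  rw [← ENNReal.tsum_mul_left]
  refine tsum_congr fun b => ?_
  show _ = t ^ (a.1 + b.1).degree
  rw [map_add, pow_add]

lemma hs_full (A : Finset Ω) (t : ℝ≥0∞) : hs {s : Ω →₀ ℕ | s.support ⊆ A} t = ((1 - t)⁻¹) ^ A.card := by
  induction A using cons_induction with
  | empty =>
    have : {s : Ω →₀ ℕ | s.support ⊆ ∅} = {0} := by
      ext s; simp [subset_empty]
    rw [this]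
    unfold hs
    rw [tsum_fintype]
    simp
  | cons a A ha ih =>
    have h1 : hs {s : Ω →₀ ℕ | s.support ⊆ {a}} t = (1 - t)⁻¹ := by
      rw [← ENNReal.tsum_geometric]
      unfold hs
      let e : ℕ ≃ {s : Ω →₀ ℕ | s.support ⊆ {a}} :=
        { toFun := fun n => ⟨Finsupp.single a n, Finsupp.support_single_subset⟩
          invFun := fun s => s.1 a
          left_inv := fun n => by simp
          right_inv := fun s => by
            refine Subtype.ext ?_
            have := s.2
            show Finsupp.single a (s.1 a) = s.1
            rw [mem_setOf_eq, Finsupp.support_subset_singleton] at this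
            exact this.symm }
      rw [← e.tsum_eq]
      refine tsum_congr fun n => ?_
      show t ^ (Finsupp.single a n).degree = _
      rw [Finsupp.degree_single]
    have hd : Disjoint ({a} : Finset Ω) A := Finset.disjoint_singleton_left.2 ha
    have := hs_mul hd (S := {s : Ω →₀ ℕ | s.support ⊆ {a}}) (S' := {s : Ω →₀ ℕ | s.support ⊆ A})
      (fun s h => h) (fun s h => h) t
    rw [Finset.card_cons, pow_succ', ← ih, ← h1, this]
    congr 1
    ext u
    simp only [mem_setOf_eq, rs_supp, and_true]
    rw [Finset.cons_eq_insert, Finset.insert_eq]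

lemma hs_mono {S S' : Set (Ω →₀ ℕ)} (h : S ⊆ S') (t : ℝ≥0∞) : hs S t ≤ hs S' t := by
  unfold hs
  exact ENNReal.tsum_mono_subtype (fun s : Ω →₀ ℕ => t ^ s.degree) h

lemma hs_inter {A B : Finset Ω} (hd : Disjoint A B) {S S' : Set (Ω →₀ ℕ)} (hS : ∀ s ∈ S, s.support ⊆ A)
    (hS' : ∀ s ∈ S', s.support ⊆ B) (t : ℝ≥0∞) :
    hs {u | rs A u ∈ S ∧ rs B u ∈ S'} t = hs S t * hs S' t * ((1 - t)⁻¹) ^ (univ \ (A ∪ B)).card := by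
  rw [hs_mul hd hS hS', ← hs_full, hs_mul (A := A ∪ B) (B := univ \ (A ∪ B)) disjoint_sdiff
    (S := {u | u.support ⊆ A ∪ B ∧ rs A u ∈ S ∧ rs B u ∈ S'}) (S' := {s | s.support ⊆ univ \ (A ∪ B)}) (fun s h => h.1) (fun s h => h)]
  congr 1
  ext u
  simp only [mem_setOf_eq, rs_supp, and_true, true_and]
  have key : ∀ P ⊆ A ∪ B, rs P (rs (A ∪ B) u) = rs P u := by
    intro P hP
    ext x
    simp only [rs, Finsupp.filter_apply]
    by_cases hx : x ∈ P
    · simp only [hx, if_true, hP hx]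
    · simp only [hx, if_false]
  rw [key A Finset.subset_union_left, key B Finset.subset_union_right]
  constructor
  · intro h; exact ⟨fun x _ => by simp, h⟩
  · intro h; exact h.2

lemma stT_supp {θ : V → ℤ} {A : Finset Ω} : ∀ s ∈ stT v e rk θ A, s.support ⊆ A := fun s h => h.1
lemma stF_supp {θ : V → ℤ} {A : Finset Ω} : ∀ s ∈ stF v e rk θ A, s.support ⊆ A := fun s h => h.1

lemma hilb_enn (he : ∀ w, e w w = 0) (hrk : Injective rk) (θ : V → ℤ) (Y : Finset Ω) (t : ℝ≥0∞)
    (h0 : t ≠ 0) (h1 : t ≠ ⊤) :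
    ((1 - t)⁻¹) ^ (univ : Finset Ω).card = ∑ A ∈ Y.powerset, t ^ ar v e rk A (Y \ A) * (t ^ vtc v rk A (Y \ A))⁻¹ *
      (hs (stT v e rk θ A) t * hs (stF v e rk θ (Y \ A)) t * ((1 - t)⁻¹) ^ (univ \ Y).card) := by
  obtain ⟨φ, hφ⟩ := Ix_equiv (v := v) (e := e) (rk := rk) he hrk θ Y
  have e1 : hs (Set.univ : Set (Ω →₀ ℕ)) t = ((1 - t)⁻¹) ^ (univ : Finset Ω).card := by
    rw [← hs_full]; congr 1; ext s; simp
  rw [← e1]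
  have e2 : hs (Set.univ : Set (Ω →₀ ℕ)) t = ∑' s : Ω →₀ ℕ, t ^ s.degree := by
    unfold hs; rw [tsum_univ (fun s : Ω →₀ ℕ => t ^ s.degree)]
  rw [e2, ← φ.tsum_eq]
  let S : Y.powerset → Set (Ω →₀ ℕ) := fun A => {u | rs A.1 u ∈ stT v e rk θ A.1 ∧ rs (Y \ A.1) u ∈ stF v e rk θ (Y \ A.1)}
  let ψ : (Σ A : Y.powerset, S A) ≃ Ix v e rk θ Y :=
    { toFun := fun p => ⟨(p.1.1, p.2.1), mem_powerset.1 p.1.2, p.2.2⟩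
      invFun := fun x => ⟨⟨x.1.1, mem_powerset.2 x.2.1⟩, ⟨x.1.2, x.2.2⟩⟩
      left_inv := fun p => rfl
      right_inv := fun x => rfl }
  rw [← ψ.tsum_eq, ENNReal.tsum_sigma', tsum_fintype, ← Finset.sum_coe_sort Y.powerset]
  refine sum_congr rfl fun A _ => ?_
  have hAY : A.1 ⊆ Y := mem_powerset.1 A.2
  have e3 := hs_inter (A := A.1) (B := Y \ A.1) disjoint_sdiff (stT_supp (v := v) (e := e) (rk := rk) (θ := θ))
    (stF_supp (v := v) (e := e) (rk := rk) (θ := θ)) t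
  rw [union_sdiff_of_subset hAY] at e3
  rw [← e3]
  unfold hs
  rw [← ENNReal.tsum_mul_left]
  refine tsum_congr fun s => ?_
  have h2 := hφ (ψ ⟨A, s⟩)
  have h3 : t ^ vtc v rk A.1 (Y \ A.1) ≠ 0 := pow_ne_zero _ h0
  have h4 : t ^ vtc v rk A.1 (Y \ A.1) ≠ ⊤ := pow_ne_top h1
  have h5 : t ^ (φ (ψ ⟨A, s⟩)).degree * t ^ vtc v rk A.1 (Y \ A.1) = t ^ (s.1.degree) * t ^ ar v e rk A.1 (Y \ A.1) := by
    rw [← pow_add, ← pow_add]; exact congrArg _ h2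
  calc t ^ (φ (ψ ⟨A, s⟩)).degree = t ^ (φ (ψ ⟨A, s⟩)).degree * (t ^ vtc v rk A.1 (Y \ A.1) * (t ^ vtc v rk A.1 (Y \ A.1))⁻¹) := by
        rw [ENNReal.mul_inv_cancel h3 h4, mul_one]
    _ = _ := by rw [← mul_assoc, h5]; ring

/-- normalised real Hilbert series -/
noncomputable def hR (S : Set (Ω →₀ ℕ)) (n : ℕ) (t : ℝ) : ℝ := (hs S (ofReal t)).toReal * (1 - t) ^ n

lemma hilb (he : ∀ w, e w w = 0) (hrk : Injective rk) (θ : V → ℤ) (Y : Finset Ω) {t : ℝ} (h0 : 0 < t) (h1 : t < 1) :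
    1 = ∑ A ∈ Y.powerset, t ^ ar v e rk A (Y \ A) * (t ^ vtc v rk A (Y \ A))⁻¹ *
      (hR (stT v e rk θ A) A.card t * hR (stF v e rk θ (Y \ A)) (Y \ A).card t) := by
  have h := hilb_enn (v := v) (e := e) (rk := rk) he hrk θ Y (ofReal t) (by simpa using h0) ofReal_ne_top
  have hsub : (1 - ofReal t) = ofReal (1 - t) := by
    rw [ENNReal.ofReal_sub _ h0.le, ENNReal.ofReal_one]
  have hp : 0 < 1 - t := by linarith
  have hG : (1 - ofReal t)⁻¹ = ofReal (1 - t)⁻¹ := by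
    rw [hsub, ENNReal.ofReal_inv_of_pos hp]
  have hfin : ∀ (S : Set (Ω →₀ ℕ)), hs S (ofReal t) ≠ ⊤ := by
    intro S
    refine ne_top_of_le_ne_top ?_ (hs_mono (S' := {s | s.support ⊆ univ}) (fun s _ => by simp) _)
    rw [hs_full, hG]; exact pow_ne_top ofReal_ne_top
  have h' := congrArg toReal h
  rw [toReal_sum] at h'
  · simp only [toReal_mul, toReal_pow, ENNReal.toReal_inv, hG, toReal_ofReal h0.le,
      toReal_ofReal (inv_pos.2 hp).le] at h'
    have h2 : (1 - t) ^ (univ : Finset Ω).card * ((1 - t)⁻¹) ^ (univ : Finset Ω).card = 1 := by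
      rw [← mul_pow, mul_inv_cancel₀ hp.ne', one_pow]
    rw [← h2, h', mul_sum]
    refine sum_congr rfl fun A hA => ?_
    have hAY := mem_powerset.1 hA
    have c1 : (univ : Finset Ω).card = A.card + (Y \ A).card + (univ \ Y).card := by
      rw [Finset.card_sdiff_of_subset hAY, Finset.card_sdiff_of_subset (subset_univ Y)]
      have := card_le_card hAY
      have := card_le_card (subset_univ Y)
      omega
    have h3 : (1 - t) ^ (univ \ Y).card * ((1 - t)⁻¹) ^ (univ \ Y).card = 1 := by
      rw [← mul_pow, mul_inv_cancel₀ hp.ne', one_pow]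
    unfold hR
    rw [c1, pow_add, pow_add]
    linear_combination (t ^ ar v e rk A (Y \ A) * (t ^ vtc v rk A (Y \ A))⁻¹ * (1 - t) ^ A.card * (1 - t) ^ (Y \ A).card *
      (hs (stT v e rk θ A) (ofReal t)).toReal * (hs (stF v e rk θ (Y \ A)) (ofReal t)).toReal) * h3
  · intro A _
    refine mul_ne_top (mul_ne_top (pow_ne_top ofReal_ne_top) ?_)
      (mul_ne_top (mul_ne_top (hfin _) (hfin _)) (pow_ne_top ?_))
    · simp_all
    · rw [hG]; exact ofReal_ne_top

lemma UU_one {Y : Finset Ω} {p : Finset Ω → Prop} {Z : Finset Ω} (hZ : Z = Y ∨ Z = ∅) (hp : p Z) : (1 : PS Ω) ∈ UU v e rk Y p := by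
  have hZY : Z ⊆ Y := by rcases hZ with rfl | rfl <;> simp
  have hpm : ∀ i ∈ Y, ∀ j ∈ Y, ∀ T : Finset Ω, pm (swap i j) T = Z ↔ T = Z := by
    intro i hi j hj T
    have hpz : pm (swap i j) Z = Z := by
      rcases hZ with rfl | rfl
      · exact pm_swap_eq (by tauto)
      · simp [pm]
    constructor
    · intro h
      rw [← pm_pm_swap i j T, h, hpz]
    · rintro rfl; exact hpz
  have hemp : ∀ f : Ω × Ω → PS Ω, pr f Z (Y \ Z) = 1 := by
    intro f
    rcases hZ with rfl | rfl <;> simp [pr]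
  have hF : Fam2 v e rk Y (fun T => if T = Z then 1 else 0) := by
    refine ⟨fun T hT => ?_, fun T hT i hi j hj hv => ?_⟩
    · split_ifs with h
      · rw [h, hemp]
      · exact dvd_zero _
    · simp only [hpm i hi j hj T, sub_self, dvd_zero]
  refine ⟨_, hF, fun T hT hne => ?_, ?_⟩
  · by_cases h : T = Z
    · rw [h]; exact hp
    · simp [h] at hne
  · apply amap_inj
    rw [hF.int]
    unfold intF
    rw [sum_eq_single_of_mem Z (mem_powerset.2 hZY)]
    · simp [Iterm, vt_eq_pr, hemp]
    · intro T _ hT; simp [Iterm, hT]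

lemma std_top {U : Submodule ℚ (PS Ω)} (h : U = ⊤) (A : Finset Ω) : std U A = ∅ := by
  ext s
  simp only [Set.mem_empty_iff_false, iff_false]
  intro hs; apply hs.2; rw [h]; simp

lemma hR_empty (n : ℕ) (t : ℝ) : hR (∅ : Set (Ω →₀ ℕ)) n t = 0 := by
  unfold hR hs; simp

lemma stF_neg {θ : V → ℤ} {Y : Finset Ω} (h : th v θ Y < 0) : stF v e rk θ Y = ∅ := by
  apply std_top
  have : UU v e rk Y (pF v θ) = ⊤ := (Ideal.eq_top_iff_one _).2 (UU_one (Or.inl rfl) h)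
  rw [this]; rfl

lemma stT_nonneg {θ : V → ℤ} {Y : Finset Ω} (h : 0 ≤ th v θ Y) (hne : Y ≠ ∅) : stT v e rk θ Y = ∅ := by
  apply std_top
  have : UU v e rk Y (pT v θ Y) = ⊤ := (Ideal.eq_top_iff_one _).2 (UU_one (Or.inr rfl) ⟨hne.symm, by simpa using h⟩)
  rw [this]; rfl

lemma std_none {p : Finset Ω → Prop} (hp : ¬ p ∅) : std ((UU v e rk ∅ p).restrictScalars ℚ) ∅ = {0} := by
  have hU : ((UU v e rk ∅ p).restrictScalars ℚ) = ⊥ := by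
    rw [eq_bot_iff]
    rintro f ⟨g, h1, h2, rfl⟩
    rw [mem_bot]
    by_contra hne
    obtain ⟨T, hT, hg⟩ := intP_ne_zero hne
    have := h2 T hT hg
    rw [subset_empty.1 hT] at this
    exact hp this
  rw [hU]
  ext s
  simp only [std, subset_empty, Finsupp.support_eq_empty, mem_setOf_eq, Set.mem_singleton_iff, bot_sup_eq]
  constructor
  · exact fun h => h.1
  · intro h
    refine ⟨h, fun hm => ?_⟩
    have := span_supp hm s (by simp)
    simp only [mem_setOf_eq] at this
    obtain ⟨a, _, b⟩ := this
    rw [a] at b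
    exact lt_irrefl _ b

lemma hR_zero (t : ℝ) : hR ({0} : Set (Ω →₀ ℕ)) 0 t = 1 := by
  unfold hR hs; rw [tsum_fintype]; simp

lemma stF_none {θ : V → ℤ} : stF v e rk θ ∅ = {0} := std_none (by simp [pF, th])
lemma stT_none {θ : V → ℤ} : stT v e rk θ ∅ = {0} := std_none (by simp [pT])

/-- uniqueness of the solution of the recursion -/
lemma recur_unique {θ : V → ℤ} (c : Finset Ω → Finset Ω → ℝ) (hc0 : ∀ Y, c ∅ Y = 1) (hc1 : ∀ Y, c Y ∅ = 1)
    (f f' g g' : Finset Ω → ℝ)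
    (hf0 : f ∅ = 1) (hf0' : f' ∅ = 1) (hg0 : g ∅ = 1) (hg0' : g' ∅ = 1)
    (hf : ∀ Y, Y ≠ ∅ → 0 ≤ th v θ Y → f Y = 0) (hf' : ∀ Y, Y ≠ ∅ → 0 ≤ th v θ Y → f' Y = 0)
    (hg : ∀ Y, th v θ Y < 0 → g Y = 0) (hg' : ∀ Y, th v θ Y < 0 → g' Y = 0)
    (hr : ∀ Y : Finset Ω, 1 = ∑ A ∈ Y.powerset, c A (Y \ A) * (f A * g (Y \ A)))
    (hr' : ∀ Y : Finset Ω, 1 = ∑ A ∈ Y.powerset, c A (Y \ A) * (f' A * g' (Y \ A))) :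
    ∀ Y, f Y = f' Y ∧ g Y = g' Y := by
  intro Y
  induction Y using Finset.strongInduction with
  | H Y ih =>
    by_cases hY : Y = ∅
    · grind
    have e1 := (hr Y).symm.trans (hr' Y)
    have hmem : Y ∈ Y.powerset := by simp
    have hmem' : ∅ ∈ Y.powerset.erase Y := by simp [Ne.symm hY]
    rw [← add_sum_erase _ _ hmem, ← add_sum_erase _ (fun A => c A (Y \ A) * (f' A * g' (Y \ A))) hmem,
      ← add_sum_erase _ _ hmem', ← add_sum_erase _ (fun A => c A (Y \ A) * (f' A * g' (Y \ A))) hmem'] at e1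
    have e2 : ∑ A ∈ (Y.powerset.erase Y).erase ∅, c A (Y \ A) * (f A * g (Y \ A)) =
        ∑ A ∈ (Y.powerset.erase Y).erase ∅, c A (Y \ A) * (f' A * g' (Y \ A)) := by
      refine sum_congr rfl fun A hA => ?_
      simp only [mem_erase, mem_powerset] at hA
      obtain ⟨a, b, d⟩ := hA
      rw [(ih A (lt_of_le_of_ne d b)).1, (ih (Y \ A) (Finset.sdiff_ssubset d (Finset.nonempty_iff_ne_empty.2 a))).2]
    rw [e2] at e1
    simp only [Finset.sdiff_self, Finset.sdiff_empty, hc0, hc1, hg0, hg0', hf0, hf0', one_mul, mul_one] at e1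
    grind
end A13
section C1
open Matrix
variable {Ω V E : Type} [Fintype Ω] [Fintype V] [Fintype E] {v : Ω → V} {rk : Ω → ℕ} {src tgt : E → V}
  {K : Type} [Field K] [Fintype K]

variable (v K) in
/-- coordinate subspaces -/
def Sp (Y : Finset Ω) (w : V) : Submodule K (Ω → K) where
  carrier := {x | ∀ i, x i ≠ 0 → i ∈ Y ∧ v i = w}
  add_mem' := by
    intro a b ha hb i hi
    by_contra hc
    have h1 : a i = 0 := by by_contra h; exact hc (ha i h)
    simp_all
  zero_mem' := fun i hi => absurd rfl hi
  smul_mem' := by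
    simp_all

/-- weight of a graded subspace -/
noncomputable def tW (θ : V → ℤ) (W : V → Submodule K (Ω → K)) : ℤ := ∑ w, θ w * finrank K (W w)

lemma finrank_Sp (Y : Finset Ω) (w : V) : finrank K (Sp v K Y w) = (Y.filter (fun i => v i = w)).card := by
  let f : Sp v K Y w ≃ₗ[K] ({i // i ∈ Y.filter (fun i => v i = w)} → K) :=
    { toFun := fun x i => x.1 i.1
      map_add' := fun x y => rfl
      map_smul' := fun c x => rfl
      invFun := fun g => ⟨fun i => if h : i ∈ Y.filter (fun i => v i = w) then g ⟨i, h⟩ else 0, by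
        intro i hi
        grind⟩
      left_inv := fun x => by
        refine Subtype.ext (funext fun i => ?_)
        show (if h : i ∈ Y.filter (fun i => v i = w) then x.1 i else 0) = x.1 i
        split_ifs with h
        · rfl
        · by_contra h0
          exact h (mem_filter.2 (x.2 i (Ne.symm h0)))
      right_inv := fun g => by
        grind }
  rw [f.finrank_eq, Module.finrank_fintype_fun_eq_card, card_coe]

lemma tW_Sp (θ : V → ℤ) (Y : Finset Ω) : tW θ (Sp v K Y) = th v θ Y := by
  unfold tW th
  rw [← Finset.sum_fiberwise_of_maps_to (g := v) (t := univ) (fun x _ => mem_univ _)]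
  refine sum_congr rfl fun w _ => ?_
  rw [finrank_Sp, sum_congr rfl (g := fun _ => θ w) (fun x hx => by rw [(mem_filter.1 hx).2]),
    sum_const, nsmul_eq_mul, mul_comm]

lemma tW_mod (θ : V → ℤ) (W W' : V → Submodule K (Ω → K)) : tW θ (W ⊔ W') + tW θ (W ⊓ W') = tW θ W + tW θ W' := by
  unfold tW
  rw [← sum_add_distrib, ← sum_add_distrib]
  refine sum_congr rfl fun w _ => ?_
  have := Submodule.finrank_sup_add_finrank_inf_eq (W w) (W' w)
  rw [Pi.sup_apply, Pi.inf_apply, ← mul_add, ← mul_add]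
  congr 1
  exact_mod_cast this

variable (src tgt) in
/-- stability -/
def Stab (z : E → Matrix Ω Ω K) (W : V → Submodule K (Ω → K)) : Prop :=
  ∀ a x, x ∈ W (src a) → (z a) *ᵥ x ∈ W (tgt a)

lemma Stab.inf {z : E → Matrix Ω Ω K} {W W' : V → Submodule K (Ω → K)} (h : Stab src tgt z W) (h' : Stab src tgt z W') :
    Stab src tgt z (W ⊓ W') := fun a x hx => ⟨h a x hx.1, h' a x hx.2⟩

lemma Stab.sup {z : E → Matrix Ω Ω K} {W W' : V → Submodule K (Ω → K)} (h : Stab src tgt z W) (h' : Stab src tgt z W') :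
    Stab src tgt z (W ⊔ W') := by
  intro a x hx
  obtain ⟨y, hy, y', hy', rfl⟩ := mem_sup.1 hx
  rw [mulVec_add]
  exact add_mem_sup (h a y hy) (h' a y' hy')

variable (v src tgt) in
/-- torsion-free condition -/
def FC (θ : V → ℤ) (Y : Finset Ω) (z : E → Matrix Ω Ω K) : Prop :=
  ∀ W, W ≤ Sp v K Y → Stab src tgt z W → 0 ≤ tW θ W
variable (v src tgt) in
/-- torsion condition -/
def TC (θ : V → ℤ) (Y : Finset Ω) (z : E → Matrix Ω Ω K) : Prop :=
  ∀ W, W ≤ Sp v K Y → Stab src tgt z W → W ≠ Sp v K Y → tW θ (Sp v K Y) < tW θ W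

variable (v src tgt) in
/-- the torsion subspace -/
def Tors (θ : V → ℤ) (Y : Finset Ω) (z : E → Matrix Ω Ω K) (W : V → Submodule K (Ω → K)) : Prop :=
  W ≤ Sp v K Y ∧ Stab src tgt z W ∧ (∀ W', W' ≤ W → Stab src tgt z W' → W' ≠ W → tW θ W < tW θ W') ∧
    (∀ W', W ≤ W' → W' ≤ Sp v K Y → Stab src tgt z W' → tW θ W ≤ tW θ W')

lemma Tors.le {θ : V → ℤ} {Y : Finset Ω} {z : E → Matrix Ω Ω K} {W W' : V → Submodule K (Ω → K)}
    (h : Tors v src tgt θ Y z W) (h' : Tors v src tgt θ Y z W') : W' ≤ W := by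
  have h1 := h.2.2.2 (W ⊔ W') le_sup_left (sup_le h.1 h'.1) (h.2.1.sup h'.2.1)
  have h2 := tW_mod θ W W'
  by_contra hc
  have h3 := h'.2.2.1 (W ⊓ W') inf_le_right (h.2.1.inf h'.2.1) (fun h => hc (inf_eq_right.1 h))
  linarith

lemma Tors.unique {θ : V → ℤ} {Y : Finset Ω} {z : E → Matrix Ω Ω K} {W W' : V → Submodule K (Ω → K)}
    (h : Tors v src tgt θ Y z W) (h' : Tors v src tgt θ Y z W') : W = W' := le_antisymm (h'.le h) (h.le h')

lemma Tors.exists (θ : V → ℤ) (Y : Finset Ω) (z : E → Matrix Ω Ω K) : ∃ W, Tors v src tgt θ Y z W := by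
  have : Finite (V → Submodule K (Ω → K)) := by
    have : Finite (Submodule K (Ω → K)) := Finite.of_injective (fun W => (W : Set (Ω → K))) SetLike.coe_injective
    infer_instance
  let S : Set (V → Submodule K (Ω → K)) := {W | W ≤ Sp v K Y ∧ Stab src tgt z W}
  have hS : S.Finite := Set.toFinite _
  have hne : S.Nonempty := ⟨⊥, bot_le, fun a x hx => by
    simp_all⟩
  obtain ⟨W, hW, hmin⟩ := Set.exists_min_image S (fun W => (toLex (tW θ W, ∑ w, finrank K (W w)) : ℤ ×ₗ ℕ)) hS hne
  refine ⟨W, hW.1, hW.2, fun W' h1 h2 h3 => ?_, fun W' h1 h2 h3 => ?_⟩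
  · have := hmin W' ⟨h1.trans hW.1, h2⟩
    rw [Prod.Lex.toLex_le_toLex] at this
    rcases this with h | ⟨h, h'⟩
    · exact h
    · exfalso
      apply h3
      have h4 : ∀ w ∈ univ, finrank K (W' w) ≤ finrank K (W w) := fun w _ => finrank_mono (h1 w)
      have h5 := (Finset.sum_eq_sum_iff_of_le h4).1 (le_antisymm (Finset.sum_le_sum h4) h')
      funext w
      exact Submodule.eq_of_le_of_finrank_eq (h1 w) (h5 w (mem_univ w))
  · have := hmin W' ⟨h2, h3⟩
    rw [Prod.Lex.toLex_le_toLex] at this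
    grind

variable (v rk src tgt) in
/-- support condition -/
def Su (B A : Finset Ω) (z : E → Matrix Ω Ω K) : Prop :=
  ∀ a j i, z a j i ≠ 0 → i ∈ B ∧ j ∈ A ∧ v i = src a ∧ v j = tgt a ∧ rk j < rk i

/-- block -/
noncomputable def bl (B A : Finset Ω) (z : E → Matrix Ω Ω K) : E → Matrix Ω Ω K :=
  fun a j i => if i ∈ B ∧ j ∈ A then z a j i else 0

lemma Su.bl {Y : Finset Ω} {z : E → Matrix Ω Ω K} (h : Su v rk src tgt Y Y z) (B A : Finset Ω) :
    Su v rk src tgt B A (bl B A z) := by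
  intro a j i hne
  unfold HallPaper.bl at hne
  split_ifs at hne with hh
  · exact ⟨hh.1, hh.2, (h a j i hne).2.2⟩
  · exact absurd rfl hne

lemma Su.mono {Y Y' B A : Finset Ω} {z : E → Matrix Ω Ω K} (h : Su v rk src tgt B A z) (h1 : B ⊆ Y) (h2 : A ⊆ Y') :
    Su v rk src tgt Y Y' z := fun a j i hne => by
  obtain ⟨p, q, r⟩ := h a j i hne
  exact ⟨h1 p, h2 q, r⟩

lemma Su.add {B A : Finset Ω} {z z' : E → Matrix Ω Ω K} (h : Su v rk src tgt B A z) (h' : Su v rk src tgt B A z') :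
    Su v rk src tgt B A (z + z') := by
  intro a j i hne
  by_cases h0 : z a j i = 0
  · refine h' a j i fun h1 => hne ?_
    simp_all
  · exact h a j i h0

/-- mulVec lands in the coordinate subspace -/
lemma Su.map {B A : Finset Ω} {z : E → Matrix Ω Ω K} (h : Su v rk src tgt B A z) (a : E) (x : Ω → K) :
    (z a) *ᵥ x ∈ Sp v K A (tgt a) := by
  intro j hj
  obtain ⟨i, _, hi⟩ := exists_ne_zero_of_sum_ne_zero hj
  have := h a j i (left_ne_zero_of_mul hi)
  exact ⟨this.2.1, this.2.2.2.1⟩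

/-- mulVec vanishes off the source -/
lemma Su.van {B A B' : Finset Ω} {z : E → Matrix Ω Ω K} (h : Su v rk src tgt B A z) (hd : Disjoint B B') (a : E) {w : V} {x : Ω → K}
    (hx : x ∈ Sp v K B' w) : (z a) *ᵥ x = 0 := by
  funext j
  refine sum_eq_zero fun i _ => ?_
  by_contra hc
  exact disjoint_left.1 hd (h a j i (left_ne_zero_of_mul hc)).1 (hx i (right_ne_zero_of_mul hc)).1

/-- blocks: assembled matrix -/
lemma bl_sum {Y A : Finset Ω} (hA : A ⊆ Y) {z : E → Matrix Ω Ω K} (h : Su v rk src tgt Y Y z) :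
    z = bl A A z + bl (Y \ A) (Y \ A) z + bl (Y \ A) A z + bl A (Y \ A) z := by
  funext a j i
  show z a j i = bl A A z a j i + bl (Y \ A) (Y \ A) z a j i + bl (Y \ A) A z a j i + bl A (Y \ A) z a j i
  unfold bl
  by_cases h0 : z a j i = 0
  · simp [h0]
  · obtain ⟨h1, h2, _⟩ := h a j i h0
    grind

lemma Sp_mono {A Y : Finset Ω} (h : A ⊆ Y) : Sp v K A ≤ Sp v K Y := fun w x hx i hi => ⟨h (hx i hi).1, (hx i hi).2⟩

lemma Stab_congr {z z' : E → Matrix Ω Ω K} {W : V → Submodule K (Ω → K)}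
    (h : ∀ a x, x ∈ W (src a) → z a *ᵥ x = z' a *ᵥ x) : Stab src tgt z W ↔ Stab src tgt z' W := by
  constructor
  · intro hs a x hx; rw [← h a x hx]; exact hs a x hx
  · intro hs a x hx; rw [h a x hx]; exact hs a x hx

lemma Sp_inf_bot {A B : Finset Ω} (hd : Disjoint A B) : Sp v K A ⊓ Sp v K B = ⊥ := by
  rw [eq_bot_iff]
  rintro w x ⟨h1, h2⟩
  rw [Pi.bot_apply, mem_bot]
  funext i
  by_contra hc
  exact disjoint_left.1 hd (h1 i hc).1 (h2 i hc).1

/-- restriction of a vector -/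
noncomputable def rv (A : Finset Ω) (x : Ω → K) : Ω → K := fun i => if i ∈ A then x i else 0

lemma rv_Sp {A Y : Finset Ω} {w : V} {x : Ω → K} (hx : x ∈ Sp v K Y w) : rv A x ∈ Sp v K A w := by
  intro i hi
  unfold rv at hi
  split_ifs at hi with h
  · exact ⟨h, (hx i hi).2⟩
  · exact absurd rfl hi

lemma rv_add {A Y : Finset Ω} {w : V} {x : Ω → K} (hx : x ∈ Sp v K Y w) : x = rv A x + rv (Y \ A) x := by
  funext i
  show x i = rv A x i + rv (Y \ A) x i
  unfold rv
  by_cases h0 : x i = 0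
  · simp [h0]
  · have := (hx i h0).1
    by_cases h : i ∈ A <;> simp [h, this]

/-- the torsion condition for a coordinate subspace -/
lemma Tors_Sp {θ : V → ℤ} {Y A : Finset Ω} (hA : A ⊆ Y) {z1 z2 z3 : E → Matrix Ω Ω K} (h1 : Su v rk src tgt A A z1)
    (h2 : Su v rk src tgt (Y \ A) (Y \ A) z2) (h3 : Su v rk src tgt (Y \ A) A z3) :
    Tors v src tgt θ Y (z1 + z2 + z3) (Sp v K A) ↔ TC v src tgt θ A z1 ∧ FC v src tgt θ (Y \ A) z2 := by
  have hd : Disjoint A (Y \ A) := disjoint_sdiff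
  have a1 : ∀ a w x, x ∈ Sp v K A w → (z1 + z2 + z3) a *ᵥ x = z1 a *ᵥ x := by
    intro a w x hx
    show (z1 a + z2 a + z3 a) *ᵥ x = _
    rw [add_mulVec, add_mulVec, h2.van hd.symm a hx, h3.van hd.symm a hx, add_zero, add_zero]
  have a2 : ∀ a w x, x ∈ Sp v K (Y \ A) w → (z1 + z2 + z3) a *ᵥ x = z3 a *ᵥ x + z2 a *ᵥ x := by
    intro a w x hx
    show (z1 a + z2 a + z3 a) *ᵥ x = _
    rw [add_mulVec, add_mulVec, h1.van hd a hx, zero_add, add_comm]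
  have a3 : Stab src tgt (z1 + z2 + z3) (Sp v K A) := by
    intro a x hx; rw [a1 a _ x hx]; exact h1.map a x
  have st1 : ∀ W, W ≤ Sp v K A → (Stab src tgt (z1 + z2 + z3) W ↔ Stab src tgt z1 W) := fun W hW =>
    Stab_congr fun a x hx => a1 a _ x (hW _ hx)
  constructor
  · rintro ⟨_, _, t1, t2⟩
    refine ⟨fun W hW hs hne => t1 W hW ((st1 W hW).2 hs) hne, fun W hW hs => ?_⟩
    have hst : Stab src tgt (z1 + z2 + z3) (Sp v K A ⊔ W) := by
      intro a x hx
      obtain ⟨y, hy, y', hy', rfl⟩ := mem_sup.1 hx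
      rw [mulVec_add, a2 a _ _ (hW _ hy'), ← add_assoc]
      exact add_mem_sup (add_mem _ (a3 a y hy) (h3.map a y')) (hs a y' hy')
    have h4 := t2 (Sp v K A ⊔ W) le_sup_left (sup_le (Sp_mono hA) (hW.trans (Sp_mono sdiff_subset))) hst
    have h5 := tW_mod θ (Sp v K A) W
    have h6 : Sp v K A ⊓ W = ⊥ := by
      rw [eq_bot_iff, ← Sp_inf_bot hd]; exact inf_le_inf_left _ hW
    have h7 : tW θ (⊥ : V → Submodule K (Ω → K)) = 0 := by unfold tW; simp
    rw [h6, h7] at h5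
    linarith
  · rintro ⟨t1, t2⟩
    refine ⟨Sp_mono hA, a3, fun W hW hs hne => t1 W hW ((st1 W hW).1 hs) hne, fun W hW hWY hs => ?_⟩
    have hw : W ≤ Sp v K A ⊔ (W ⊓ Sp v K (Y \ A)) := by
      intro w x hx
      have hxY := hWY w hx
      rw [rv_add (A := A) hxY]
      refine add_mem_sup (rv_Sp hxY) ⟨?_, rv_Sp hxY⟩
      have : rv (Y \ A) x = x - rv A x := eq_sub_of_add_eq (by rw [add_comm]; exact (rv_add (A := A) hxY).symm)
      rw [this]
      exact Submodule.sub_mem _ hx (hW w (rv_Sp hxY))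
    have hst : Stab src tgt z2 (W ⊓ Sp v K (Y \ A)) := by
      rintro a x ⟨hx, hx'⟩
      refine ⟨?_, h2.map a x⟩
      have h4 := hs a x hx
      rw [a2 a _ x hx'] at h4
      have h5 := Submodule.sub_mem _ h4 (hW _ (h3.map a x))
      rwa [add_sub_cancel_left] at h5
    have h4 := t2 _ inf_le_right hst
    have h5 := tW_mod θ (Sp v K A) (W ⊓ Sp v K (Y \ A))
    have h6 : Sp v K A ⊓ (W ⊓ Sp v K (Y \ A)) = ⊥ := by
      rw [eq_bot_iff, ← Sp_inf_bot hd]; exact inf_le_inf_left _ inf_le_right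
    have h7 : tW θ (⊥ : V → Submodule K (Ω → K)) = 0 := by unfold tW; simp
    rw [h6, h7, ← le_antisymm hw (sup_le hW inf_le_left)] at h5
    linarith
end C1
section C2
open Matrix
variable {Ω V E : Type} [Fintype Ω] [Fintype V] [Fintype E] {v : Ω → V} {rk : Ω → ℕ} {src tgt : E → V}
  {K : Type} [Field K] [Fintype K]

variable (v rk) in
/-- echelon parameters -/
def Ec (A B : Finset Ω) (N : Matrix Ω Ω K) : Prop :=
  ∀ j i, N j i ≠ 0 → i ∈ A ∧ j ∈ B ∧ v i = v j ∧ rk j < rk i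

lemma Ec.sq {A B : Finset Ω} (hd : Disjoint A B) {N : Matrix Ω Ω K} (h : Ec v rk A B N) : N * N = 0 := by
  ext j i
  rw [mul_apply, Matrix.zero_apply]
  refine sum_eq_zero fun l _ => ?_
  by_contra hc
  exact disjoint_left.1 hd (h j l (left_ne_zero_of_mul hc)).1 (h l i (right_ne_zero_of_mul hc)).2.1

/-- transport of graded subspaces -/
noncomputable def ac (N : Matrix Ω Ω K) (W : V → Submodule K (Ω → K)) : V → Submodule K (Ω → K) :=
  fun w => (W w).map (1 + N).mulVecLin

lemma one_add_vec (N : Matrix Ω Ω K) (x : Ω → K) : (1 + N) *ᵥ x = x + N *ᵥ x := by rw [add_mulVec, one_mulVec]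

lemma Ec.vecA {A B : Finset Ω} (hd : Disjoint A B) {N : Matrix Ω Ω K} (h : Ec v rk A B N) (x : Ω → K) {i : Ω} (hi : i ∈ A) :
    ((1 + N) *ᵥ x) i = x i := by
  rw [one_add_vec, Pi.add_apply]
  have : (N *ᵥ x) i = 0 := by
    refine sum_eq_zero fun l _ => ?_
    by_contra hc
    exact disjoint_left.1 hd hi (h i l (left_ne_zero_of_mul hc)).2.1
  rw [this, add_zero]

lemma Ec.ac_le {A B Y : Finset Ω} (hA : A ⊆ Y) (hB : B ⊆ Y) {N : Matrix Ω Ω K} (h : Ec v rk A B N) {W : V → Submodule K (Ω → K)}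
    (hW : W ≤ Sp v K Y) : ac N W ≤ Sp v K Y := by
  rintro w _ ⟨x, hx, rfl⟩
  rw [mulVecLin_apply, one_add_vec]
  refine add_mem _ (hW w hx) ?_
  intro j hj
  obtain ⟨i, _, hi⟩ := exists_ne_zero_of_sum_ne_zero hj
  obtain ⟨h1, h2, h3, _⟩ := h j i (left_ne_zero_of_mul hi)
  exact ⟨hB h2, h3 ▸ (hW w hx i (right_ne_zero_of_mul hi)).2⟩

variable (v rk) in
/-- leading indices -/
def Top (W : V → Submodule K (Ω → K)) (i : Ω) : Prop := ∃ x ∈ W (v i), x i ≠ 0 ∧ ∀ j, rk i < rk j → x j = 0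

lemma single_Sp {A : Finset Ω} {i : Ω} (hi : i ∈ A) : Pi.single i (1 : K) ∈ Sp v K A (v i) := by
  intro j hj
  by_cases h : j = i
  · subst h; exact ⟨hi, rfl⟩
  · exact absurd (Pi.single_eq_of_ne h _) hj

lemma vec_single (N : Matrix Ω Ω K) (i j : Ω) : (N *ᵥ Pi.single i 1) j = N j i := by
  rw [mulVec_single_one]; rfl

lemma Ec.top {A Y : Finset Ω} (hA : A ⊆ Y) {N : Matrix Ω Ω K} (h : Ec v rk A (Y \ A) N) (i : Ω) :
    Top v rk (ac N (Sp v K A)) i ↔ i ∈ A := by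
  have hd : Disjoint A (Y \ A) := disjoint_sdiff
  constructor
  · rintro ⟨y, hy, h1, h2⟩
    have hyY := h.ac_le hA sdiff_subset (Sp_mono hA) _ hy
    obtain ⟨x, hx, rfl⟩ := hy
    by_contra hi
    have hxi : x i = 0 := by by_contra h0; exact hi (hx i h0).1
    rw [mulVecLin_apply, one_add_vec, Pi.add_apply, hxi, zero_add] at h1
    obtain ⟨l, _, hl⟩ := exists_ne_zero_of_sum_ne_zero h1
    obtain ⟨h3, _, _, h4⟩ := h i l (left_ne_zero_of_mul hl)
    have := h2 l h4
    rw [mulVecLin_apply, h.vecA hd x h3] at this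
    exact right_ne_zero_of_mul hl this
  · intro hi
    refine ⟨(1 + N).mulVecLin (Pi.single i 1), ⟨_, single_Sp hi, rfl⟩, ?_, fun j hj => ?_⟩
    · rw [mulVecLin_apply, h.vecA hd _ hi, Pi.single_eq_same]; exact one_ne_zero
    · rw [mulVecLin_apply, one_add_vec, Pi.add_apply, vec_single, Pi.single_eq_of_ne (by rintro rfl; exact lt_irrefl _ hj), zero_add]
      by_contra hc
      exact absurd (h j i hc).2.2.2 (by omega)

lemma Ec.inj {A A' Y : Finset Ω} (hA : A ⊆ Y) (hA' : A' ⊆ Y) {N N' : Matrix Ω Ω K} (h : Ec v rk A (Y \ A) N)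
    (h' : Ec v rk A' (Y \ A') N') (he : ac N (Sp v K A) = ac N' (Sp v K A')) : A = A' ∧ N = N' := by
  have hAA : A = A' := by
    ext i; rw [← h.top hA, he, h'.top hA']
  subst hAA
  refine ⟨rfl, ?_⟩
  have hd : Disjoint A (Y \ A) := disjoint_sdiff
  ext j i
  by_cases hi : i ∈ A
  · have hm : (1 + N).mulVecLin (Pi.single i 1) ∈ ac N' (Sp v K A) (v i) := he ▸ ⟨_, single_Sp hi, rfl⟩
    obtain ⟨x, hx, hxe⟩ := hm
    rw [mulVecLin_apply, mulVecLin_apply] at hxe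
    have hxs : x = Pi.single i 1 := by
      funext l
      by_cases hl : l ∈ A
      · rw [← h'.vecA hd x hl, hxe, h.vecA hd _ hl]
      · rw [Pi.single_eq_of_ne (by rintro rfl; exact hl hi)]
        by_contra h0; exact hl (hx l h0).1
    rw [hxs, one_add_vec, one_add_vec] at hxe
    have := congrFun (add_left_cancel hxe) j
    rw [vec_single, vec_single] at this
    exact this.symm
  · have h1 : N j i = 0 := by by_contra hc; exact hi (h j i hc).1
    have h2 : N' j i = 0 := by by_contra hc; exact hi (h' j i hc).1
    rw [h1, h2]

lemma Ec.exists (hrk : Injective rk) {Y : Finset Ω} {W : V → Submodule K (Ω → K)} (hW : W ≤ Sp v K Y) :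
    ∃ A ⊆ Y, ∃ N : Matrix Ω Ω K, Ec v rk A (Y \ A) N ∧ W = ac N (Sp v K A) := by
  let A := Y.filter (fun i => Top v rk W i)
  have hA : A ⊆ Y := Finset.filter_subset _ _
  have hr : ∀ n, ∀ i ∈ A, rk i = n → ∃ r ∈ W (v i), r i = 1 ∧ (∀ l ∈ A, l ≠ i → r l = 0) ∧ ∀ j, rk i < rk j → r j = 0 := by
    intro n
    induction n using Nat.strong_induction_on with
    | _ n ih =>
      intro i hi hin
      obtain ⟨x0, hx0, hx1, hx2⟩ := (mem_filter.1 hi).2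
      let x := (x0 i)⁻¹ • x0
      have hxW : x ∈ W (v i) := smul_mem _ _ hx0
      have hxi : x i = 1 := inv_mul_cancel₀ hx1
      have hxj : ∀ j, rk i < rk j → x j = 0 := fun j hj => by
        show (x0 i)⁻¹ * x0 j = 0
        rw [hx2 j hj, mul_zero]
      have ih' : ∀ l, ∃ r, l ∈ A → rk l < rk i → (r ∈ W (v l) ∧ r l = 1 ∧ (∀ l' ∈ A, l' ≠ l → r l' = 0) ∧ ∀ j, rk l < rk j → r j = 0) := by
        intro l
        by_cases hl : l ∈ A ∧ rk l < rk i
        · obtain ⟨r, h1⟩ := ih (rk l) (hin ▸ hl.2) l hl.1 rfl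
          exact ⟨r, fun _ _ => h1⟩
        · exact ⟨0, fun h1 h2 => absurd ⟨h1, h2⟩ hl⟩
      choose r hr using ih'
      let S := A.filter (fun l => rk l < rk i ∧ v l = v i)
      have hS : ∀ l ∈ S, l ∈ A ∧ rk l < rk i ∧ v l = v i := fun l hl => by
        have := mem_filter.1 hl; exact ⟨this.1, this.2⟩
      have happ : ∀ j, (x - ∑ l ∈ S, x l • r l) j = x j - ∑ l ∈ S, x l * r l j := by
        intro j; rw [Pi.sub_apply, Finset.sum_apply]; rfl
      refine ⟨x - ∑ l ∈ S, x l • r l, ?_, ?_, ?_, ?_⟩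
      · refine Submodule.sub_mem _ hxW (Submodule.sum_mem _ fun l hl => smul_mem _ _ ?_)
        obtain ⟨h1, h2, h3⟩ := hS l hl
        rw [← h3]; exact (hr l h1 h2).1
      · rw [happ, hxi, sum_eq_zero, sub_zero]
        intro l hl
        obtain ⟨h1, h2, h3⟩ := hS l hl
        rw [(hr l h1 h2).2.2.2 i h2, mul_zero]
      · intro l hl hne
        rw [happ]
        by_cases hlS : l ∈ S
        · obtain ⟨h1, h2, h3⟩ := hS l hlS
          rw [sum_eq_single_of_mem l hlS, (hr l h1 h2).2.1, mul_one, sub_self]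
          intro l' hl' hne'
          obtain ⟨h1', h2', h3'⟩ := hS l' hl'
          rw [(hr l' h1' h2').2.2.1 l hl (Ne.symm hne'), mul_zero]
        · have hx0 : x l = 0 := by
            by_contra h0
            have hv := (hW _ hxW l h0).2
            have : ¬ rk i < rk l := fun h => h0 (hxj l h)
            have h2 : rk l ≠ rk i := fun h => hne (hrk h)
            exact hlS (mem_filter.2 ⟨hl, by omega, hv⟩)
          rw [hx0, zero_sub, neg_eq_zero]
          refine sum_eq_zero fun l' hl' => ?_
          obtain ⟨h1', h2', h3'⟩ := hS l' hl'
          rw [(hr l' h1' h2').2.2.1 l hl (by rintro rfl; exact hlS hl'), mul_zero]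
      · intro j hj
        rw [happ, hxj j hj, zero_sub, neg_eq_zero]
        refine sum_eq_zero fun l' hl' => ?_
        obtain ⟨h1', h2', h3'⟩ := hS l' hl'
        rw [(hr l' h1' h2').2.2.2 j (by omega), mul_zero]
  have hr' : ∀ i, ∃ r, i ∈ A → (r ∈ W (v i) ∧ r i = 1 ∧ (∀ l ∈ A, l ≠ i → r l = 0) ∧ ∀ j, rk i < rk j → r j = 0) := by
    intro i
    by_cases hi : i ∈ A
    · obtain ⟨r, h⟩ := hr _ i hi rfl; exact ⟨r, fun _ => h⟩
    · exact ⟨0, fun h => absurd h hi⟩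
  choose r hr using hr'
  let N : Matrix Ω Ω K := fun j i => if i ∈ A ∧ j ∉ A then r i j else 0
  have hN : Ec v rk A (Y \ A) N := by
    intro j i hne
    have hh : i ∈ A ∧ j ∉ A := by by_contra h; exact hne (if_neg h)
    have hv : N j i = r i j := if_pos hh
    rw [hv] at hne
    obtain ⟨h1, h2, h3, h4⟩ := hr i hh.1
    have h5 := hW _ h1 j hne
    refine ⟨hh.1, mem_sdiff.2 ⟨h5.1, hh.2⟩, h5.2.symm, ?_⟩
    have h6 : ¬ rk i < rk j := fun h => hne (h4 j h)
    have h7 : rk j ≠ rk i := fun h => hh.2 (hrk h ▸ hh.1)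
    omega
  have hd : Disjoint A (Y \ A) := disjoint_sdiff
  have hcol : ∀ i ∈ A, (1 + N) *ᵥ Pi.single i 1 = r i := by
    intro i hi
    obtain ⟨h1, h2, h3, h4⟩ := hr i hi
    funext j
    by_cases hj : j ∈ A
    · rw [hN.vecA hd _ hj]
      by_cases hij : j = i
      · subst hij; rw [Pi.single_eq_same, h2]
      · rw [Pi.single_eq_of_ne hij, h3 j hj hij]
    · rw [one_add_vec, Pi.add_apply, vec_single, Pi.single_eq_of_ne (by rintro rfl; exact hj hi), zero_add]
      exact if_pos ⟨hi, hj⟩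
  have hsub : ∀ w x, x ∈ Sp v K A w → (1 + N) *ᵥ x ∈ W w := by
    intro w x hx
    have : x = ∑ i, x i • Pi.single i (1 : K) := by
      conv_lhs => rw [← Finset.univ_sum_single x]
      refine sum_congr rfl fun i _ => ?_
      rw [← Pi.single_smul, smul_eq_mul, mul_one]
    rw [this, mulVec_sum]
    refine Submodule.sum_mem _ fun i _ => ?_
    by_cases h0 : x i = 0
    · rw [h0, zero_smul, mulVec_zero]; exact Submodule.zero_mem _
    · obtain ⟨h1, h2⟩ := hx i h0
      rw [mulVec_smul, hcol i h1, ← h2]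
      exact smul_mem _ _ (hr i h1).1
  refine ⟨A, hA, N, hN, le_antisymm ?_ ?_⟩
  · intro w y hy
    have hyY := hW w hy
    refine ⟨rv A y, rv_Sp hyY, ?_⟩
    rw [mulVecLin_apply]
    by_contra hne
    let d := y - (1 + N) *ᵥ rv A y
    have hdW : d ∈ W w := Submodule.sub_mem _ hy (hsub w _ (rv_Sp hyY))
    have hdn : (univ.filter fun i => d i ≠ 0).Nonempty := by
      by_contra hc
      rw [Finset.not_nonempty_iff_eq_empty, Finset.filter_eq_empty_iff] at hc
      apply hne
      have : d = 0 := funext fun i => by by_contra h; exact hc (mem_univ i) h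
      exact (sub_eq_zero.1 this).symm
    obtain ⟨i, hi, hmax⟩ := Finset.exists_max_image _ rk hdn
    rw [mem_filter] at hi
    obtain ⟨h1, h2⟩ := hW w hdW i hi.2
    have hiA : i ∈ A := mem_filter.2 ⟨h1, d, h2 ▸ hdW, hi.2, fun j hj => by
      by_contra h0
      have := hmax j (mem_filter.2 ⟨mem_univ _, h0⟩)
      omega⟩
    apply hi.2
    show y i - ((1 + N) *ᵥ rv A y) i = 0
    rw [hN.vecA hd _ hiA, rv, if_pos hiA, sub_self]
  · rintro w _ ⟨x, hx, rfl⟩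
    exact hsub w x hx
end C2
section C3
open Matrix
variable {Ω V E : Type} [Fintype Ω] [Fintype V] [Fintype E] {v : Ω → V} {rk : Ω → ℕ} {src tgt : E → V}
  {K : Type} [Field K] [Fintype K]

lemma Ec.neg {A B : Finset Ω} {N : Matrix Ω Ω K} (h : Ec v rk A B N) : Ec v rk A B (-N) := fun j i hne =>
  h j i (fun h0 => hne (by rw [neg_apply, h0, neg_zero]))

lemma inv2 {N : Matrix Ω Ω K} (h : N * N = 0) : (1 + -N) * (1 + N) = 1 := by
  have : (1 + -N) * (1 + N) = 1 - N * N := by noncomm_ring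
  rw [this, h, sub_zero]

lemma ac_ac {N : Matrix Ω Ω K} (h : N * N = 0) (W : V → Submodule K (Ω → K)) : ac (-N) (ac N W) = W := by
  funext w
  unfold ac
  rw [← Submodule.map_comp, ← mulVecLin_mul, inv2 h, mulVecLin_one, Submodule.map_id]

lemma ac_mono {N : Matrix Ω Ω K} {W W' : V → Submodule K (Ω → K)} (h : W ≤ W') : ac N W ≤ ac N W' :=
  fun w => Submodule.map_mono (h w)

lemma tW_ac (θ : V → ℤ) {N : Matrix Ω Ω K} (h : N * N = 0) (W : V → Submodule K (Ω → K)) : tW θ (ac N W) = tW θ W := by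
  unfold tW
  refine sum_congr rfl fun w _ => ?_
  have hi : Injective (1 + N).mulVecLin := by
    intro x y hxy
    have := congrArg (fun z => (1 + -N) *ᵥ z) hxy
    simpa only [mulVecLin_apply, mulVec_mulVec, inv2 h, one_mulVec] using this
  unfold ac
  exact (Submodule.equivMapOfInjective _ hi (W w)).finrank_eq.symm ▸ rfl

/-- conjugation -/
noncomputable def cj (N : Matrix Ω Ω K) (z : E → Matrix Ω Ω K) : E → Matrix Ω Ω K := fun a => (1 + N) * z a * (1 + -N)

lemma cj_cj {N : Matrix Ω Ω K} (h : N * N = 0) (z : E → Matrix Ω Ω K) : cj (-N) (cj N z) = z := by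
  funext a
  unfold cj
  rw [neg_neg]
  calc (1 + -N) * ((1 + N) * z a * (1 + -N)) * (1 + N) = ((1 + -N) * (1 + N)) * z a * ((1 + -N) * (1 + N)) := by
        simp only [mul_assoc]
    _ = z a := by rw [inv2 h, one_mul, mul_one]

lemma Stab.cj {N : Matrix Ω Ω K} (hN : N * N = 0) {z : E → Matrix Ω Ω K} {W : V → Submodule K (Ω → K)} (h : Stab src tgt z W) :
    Stab src tgt (cj N z) (ac N W) := by
  rintro a _ ⟨x, hx, rfl⟩
  refine ⟨z a *ᵥ x, h a x hx, ?_⟩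
  rw [mulVecLin_apply, mulVecLin_apply, mulVec_mulVec, mulVec_mulVec]
  unfold HallPaper.cj
  rw [mul_assoc, inv2 hN, mul_one]

lemma Su.cj {A B Y : Finset Ω} (hA : A ⊆ Y) (hB : B ⊆ Y) {N : Matrix Ω Ω K} (h : Ec v rk A B N)
    {z : E → Matrix Ω Ω K} (hz : Su v rk src tgt Y Y z) : Su v rk src tgt Y Y (cj N z) := by
  have hl : ∀ {N : Matrix Ω Ω K} (h : Ec v rk A B N) {z : E → Matrix Ω Ω K} (hz : Su v rk src tgt Y Y z),
      Su v rk src tgt Y Y (fun a => N * z a) := by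
    intro N h z hz a j i hne
    obtain ⟨l, _, hl⟩ := exists_ne_zero_of_sum_ne_zero (show ∑ l, N j l * z a l i ≠ 0 from hne)
    obtain ⟨h1, h2, h3, h4⟩ := h j l (left_ne_zero_of_mul hl)
    obtain ⟨g1, g2, g3, g4, g5⟩ := hz a l i (right_ne_zero_of_mul hl)
    exact ⟨g1, hB h2, g3, h3 ▸ g4, h4.trans g5⟩
  have hr : ∀ {N : Matrix Ω Ω K} (h : Ec v rk A B N) {z : E → Matrix Ω Ω K} (hz : Su v rk src tgt Y Y z),
      Su v rk src tgt Y Y (fun a => z a * N) := by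
    intro N h z hz a j i hne
    obtain ⟨l, _, hl⟩ := exists_ne_zero_of_sum_ne_zero (show ∑ l, z a j l * N l i ≠ 0 from hne)
    obtain ⟨h1, h2, h3, h4⟩ := h l i (right_ne_zero_of_mul hl)
    obtain ⟨g1, g2, g3, g4, g5⟩ := hz a j l (left_ne_zero_of_mul hl)
    exact ⟨hA h1, g2, h3.trans g3, g4, g5.trans h4⟩
  have h1 := hz.add (hl h hz)
  have h2 := h1.add (hr h.neg h1)
  have : HallPaper.cj N z = z + (fun a => N * z a) + (fun a => (z + fun a => N * z a) a * -N) := by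
    funext a
    show (1 + N) * z a * (1 + -N) = z a + N * z a + (z a + N * z a) * -N
    noncomm_ring
  rw [this]; exact h2

lemma Tors.cj {θ : V → ℤ} {A Y : Finset Ω} (hA : A ⊆ Y) {N : Matrix Ω Ω K} (hE : Ec v rk A (Y \ A) N)
    {z : E → Matrix Ω Ω K} {W : V → Submodule K (Ω → K)} (h : Tors v src tgt θ Y z W) :
    Tors v src tgt θ Y (cj N z) (ac N W) := by
  have hN : N * N = 0 := hE.sq disjoint_sdiff
  have hN' : -N * -N = 0 := by rw [neg_mul_neg]; exact hN
  obtain ⟨h1, h2, h3, h4⟩ := h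
  have back : ∀ W', Stab src tgt (HallPaper.cj N z) W' → Stab src tgt z (ac (-N) W') := fun W' hW' => by
    have := hW'.cj hN'
    rwa [cj_cj hN] at this
  refine ⟨hE.ac_le hA sdiff_subset h1, h2.cj hN, fun W' hle hs hne => ?_, fun W' hle hY hs => ?_⟩
  · rw [tW_ac θ hN, ← tW_ac θ hN' W']
    refine h3 _ ?_ (back _ hs) ?_
    · have := ac_mono (N := -N) hle
      rwa [ac_ac hN] at this
    · intro he
      apply hne
      rw [← he]
      have := ac_ac hN' W'
      rw [neg_neg] at this
      exact this.symm
  · rw [tW_ac θ hN, ← tW_ac θ hN' W']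
    refine h4 _ ?_ (hE.neg.ac_le hA sdiff_subset hY) (back _ hs)
    have := ac_mono (N := -N) hle
    rwa [ac_ac hN] at this

/-- splitting off blocks -/
lemma card_blocks (θ : V → ℤ) {Y A : Finset Ω} (hA : A ⊆ Y) :
    Nat.card {z : E → Matrix Ω Ω K // Su v rk src tgt Y Y z ∧ Tors v src tgt θ Y z (Sp v K A)} =
    Nat.card {z : E → Matrix Ω Ω K // Su v rk src tgt A A z ∧ TC v src tgt θ A z} *
    Nat.card {z : E → Matrix Ω Ω K // Su v rk src tgt (Y \ A) (Y \ A) z ∧ FC v src tgt θ (Y \ A) z} *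
    Nat.card {z : E → Matrix Ω Ω K // Su v rk src tgt (Y \ A) A z} := by
  rw [← card_prod, ← card_prod]
  symm
  let B := Y \ A
  have hBY : B ⊆ Y := sdiff_subset
  have hd : Disjoint A B := disjoint_sdiff
  have hAB : ∀ x, x ∈ A → x ∉ B := fun x hx => disjoint_left.1 hd hx
  have bself : ∀ {B A : Finset Ω} {z : E → Matrix Ω Ω K}, Su v rk src tgt B A z → bl B A z = z := by
    intro B A z hz
    funext a j i
    unfold bl
    split_ifs with h
    · rfl
    · by_contra hc
      have := hz a j i (Ne.symm hc)
      exact h ⟨this.1, this.2.1⟩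
  have bzero : ∀ {B A B' A' : Finset Ω} {z : E → Matrix Ω Ω K}, Su v rk src tgt B A z → (Disjoint B B' ∨ Disjoint A A') → bl B' A' z = 0 := by
    intro B A B' A' z hz hor
    funext a j i
    unfold bl
    split_ifs with h
    · by_contra hc
      have := hz a j i hc
      rcases hor with h' | h'
      · exact disjoint_left.1 h' this.1 h.1
      · exact disjoint_left.1 h' this.2.1 h.2
    · rfl
  have badd : ∀ (B A : Finset Ω) (z z' : E → Matrix Ω Ω K), bl B A (z + z') = bl B A z + bl B A z' := by
    intro B A z z'
    funext a j i
    show (if i ∈ B ∧ j ∈ A then z a j i + z' a j i else 0) = (if i ∈ B ∧ j ∈ A then z a j i else 0) + (if i ∈ B ∧ j ∈ A then z' a j i else 0)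
    split_ifs <;> simp
  refine card_congr (ofBijective (fun p => ⟨p.1.1.1 + p.1.2.1 + p.2.1,
    ((p.1.1.2.1.mono hA hA).add (p.1.2.2.1.mono hBY hBY)).add (p.2.2.mono hBY hA),
    (Tors_Sp hA p.1.1.2.1 p.1.2.2.1 p.2.2).2 ⟨p.1.1.2.2, p.1.2.2.2⟩⟩) ⟨?_, ?_⟩)
  · rintro ⟨⟨⟨z1, h1⟩, ⟨z2, h2⟩⟩, ⟨z3, h3⟩⟩ ⟨⟨⟨z1', h1'⟩, ⟨z2', h2'⟩⟩, ⟨z3', h3'⟩⟩ heq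
    have heq := congrArg val heq
    simp only at heq
    have e1 := congrArg (bl A A) heq
    have e2 := congrArg (bl B B) heq
    have e3 := congrArg (bl B A) heq
    rw [badd, badd, badd, badd, bself h1.1, bself h1'.1, bzero h2.1 (Or.inl hd.symm), bzero h2'.1 (Or.inl hd.symm),
      bzero h3 (Or.inl hd.symm), bzero h3' (Or.inl hd.symm)] at e1
    rw [badd, badd, badd, badd, bself h2.1, bself h2'.1, bzero h1.1 (Or.inl hd), bzero h1'.1 (Or.inl hd),
      bzero h3 (Or.inr hd), bzero h3' (Or.inr hd)] at e2
    simp_all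
  · rintro ⟨z, hz, ht⟩
    have h0 : bl A B z = 0 := by
      funext a j i
      unfold bl
      split_ifs with h
      · by_contra hc
        have h1 := hz a j i hc
        have h2 : Pi.single i (1 : K) ∈ Sp v K A (src a) := h1.2.2.1 ▸ single_Sp h.1
        have h3 := ht.2.1 a _ h2 j (by rw [vec_single]; exact hc)
        exact hAB j h3.1 h.2
      · rfl
    have hs := bl_sum hA hz
    have h0' : bl A (Y \ A) z = 0 := h0
    rw [h0', add_zero] at hs
    have hT : Tors v src tgt θ Y (bl A A z + bl (Y \ A) (Y \ A) z + bl (Y \ A) A z) (Sp v K A) := hs ▸ ht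
    rw [Tors_Sp hA (hz.bl A A) (hz.bl (Y \ A) (Y \ A)) (hz.bl (Y \ A) A)] at hT
    exact ⟨⟨⟨⟨bl A A z, hz.bl A A, hT.1⟩, ⟨bl (Y \ A) (Y \ A) z, hz.bl _ _, hT.2⟩⟩, ⟨bl (Y \ A) A z, hz.bl _ _⟩⟩,
      Subtype.ext hs.symm⟩

lemma card_torsion (hrk : Injective rk) (θ : V → ℤ) (Y : Finset Ω) :
    Nat.card {z : E → Matrix Ω Ω K // Su v rk src tgt Y Y z} = ∑ A ∈ Y.powerset,
      Nat.card {N : Matrix Ω Ω K // Ec v rk A (Y \ A) N} *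
      Nat.card {z : E → Matrix Ω Ω K // Su v rk src tgt Y Y z ∧ Tors v src tgt θ Y z (Sp v K A)} := by
  rw [← Finset.sum_coe_sort]
  have : ∀ A : Y.powerset, Nat.card {N : Matrix Ω Ω K // Ec v rk A.1 (Y \ A.1) N} *
      Nat.card {z : E → Matrix Ω Ω K // Su v rk src tgt Y Y z ∧ Tors v src tgt θ Y z (Sp v K A.1)} =
      Nat.card ({N : Matrix Ω Ω K // Ec v rk A.1 (Y \ A.1) N} ×
        {z : E → Matrix Ω Ω K // Su v rk src tgt Y Y z ∧ Tors v src tgt θ Y z (Sp v K A.1)}) := fun A => (card_prod _ _).symm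
  rw [sum_congr rfl (fun A _ => this A), ← Nat.card_sigma]
  symm
  have hsub : ∀ A : Y.powerset, A.1 ⊆ Y := fun A => mem_powerset.1 A.2
  refine card_congr (ofBijective (fun p => ⟨cj p.2.1.1 p.2.2.1,
    p.2.2.2.1.cj (hsub p.1) sdiff_subset p.2.1.2⟩) ⟨?_, ?_⟩)
  · rintro ⟨⟨A, hA⟩, ⟨N, hN⟩, ⟨z, hz⟩⟩ ⟨⟨A', hA'⟩, ⟨N', hN'⟩, ⟨z', hz'⟩⟩ heq
    have heq2 : cj N z = cj N' z' := congrArg val heq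
    clear heq
    have t1 := hz.2.cj (mem_powerset.1 hA) hN
    have t2 := hz'.2.cj (mem_powerset.1 hA') hN'
    rw [heq2] at t1
    obtain ⟨rfl, rfl⟩ := hN.inj (mem_powerset.1 hA) (mem_powerset.1 hA') hN' (t1.unique t2)
    have := congrArg (cj (-N)) heq2
    rw [cj_cj (hN.sq disjoint_sdiff), cj_cj (hN.sq disjoint_sdiff)] at this
    subst this
    rfl
  · rintro ⟨z, hz⟩
    obtain ⟨W, hW⟩ := Tors.exists (v := v) (src := src) (tgt := tgt) θ Y z
    obtain ⟨A, hA, N, hN, rfl⟩ := Ec.exists hrk hW.1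
    have hNN := hN.sq disjoint_sdiff
    have hNN' : -N * -N = 0 := by rw [neg_mul_neg]; exact hNN
    have h1 := hW.cj hA hN.neg
    rw [ac_ac hNN] at h1
    refine ⟨⟨⟨A, mem_powerset.2 hA⟩, ⟨N, hN⟩, ⟨cj (-N) z, hz.cj hA sdiff_subset hN.neg, h1⟩⟩, Subtype.ext ?_⟩
    show cj N (cj (-N) z) = z
    have := cj_cj hNN' z
    rwa [neg_neg] at this

lemma card_supp {I : Type} [Fintype I] (P : Finset I) : Nat.card {f : I → K // ∀ i, f i ≠ 0 → i ∈ P} = Fintype.card K ^ P.card := by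
  let g : {f : I → K // ∀ i, f i ≠ 0 → i ∈ P} ≃ (P → K) :=
    { toFun := fun f i => f.1 i.1
      invFun := fun h => ⟨fun i => if hi : i ∈ P then h ⟨i, hi⟩ else 0, fun i hne => by
        by_contra hc; exact hne (dif_neg hc)⟩
      left_inv := fun f => by
        refine Subtype.ext (funext fun i => ?_)
        grind
      right_inv := fun h => by
        grind }
  rw [card_congr g, Nat.card_eq_fintype_card, Fintype.card_fun, card_coe]

lemma card_Ec (A B : Finset Ω) : Nat.card {N : Matrix Ω Ω K // Ec v rk A B N} = Fintype.card K ^ vtc v rk A B := by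
  let P : Finset (Ω × Ω) := (A ×ˢ B).filter fun p => rk p.2 < rk p.1 ∧ v p.1 = v p.2
  have h1 : Nat.card {N : Matrix Ω Ω K // Ec v rk A B N} = Nat.card {f : Ω × Ω → K // ∀ i, f i ≠ 0 → i ∈ P} := by
    refine card_congr (Equiv.subtypeEquiv ((Equiv.curry Ω Ω K).symm.trans (Equiv.arrowCongr (Equiv.prodComm Ω Ω) (Equiv.refl K))) ?_)
    intro N
    constructor
    · rintro h ⟨i, j⟩ hne
      obtain ⟨a, b, c, d⟩ := h j i hne
      grind
    · intro h j i hne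
      have := h (i, j) hne
      grind
  rw [h1, card_supp]
  congr 1
  unfold vtc
  simp only [P, card_filter, ite_and]

variable (src tgt) in
/-- number of arrows -/
noncomputable def ea (w w' : V) : ℕ := (univ.filter fun a : E => src a = w ∧ tgt a = w').card

lemma card_Su (B A : Finset Ω) : Nat.card {z : E → Matrix Ω Ω K // Su v rk src tgt B A z} = Fintype.card K ^ ar v (ea src tgt) rk B A := by
  let P : Finset ((Ω × Ω) × E) := univ.filter fun p => p.1 ∈ B ×ˢ A ∧ rk p.1.2 < rk p.1.1 ∧ src p.2 = v p.1.1 ∧ tgt p.2 = v p.1.2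
  have h1 : Nat.card {z : E → Matrix Ω Ω K // Su v rk src tgt B A z} = Nat.card {f : (Ω × Ω) × E → K // ∀ i, f i ≠ 0 → i ∈ P} := by
    let φ : (E → Matrix Ω Ω K) ≃ ((Ω × Ω) × E → K) :=
      { toFun := fun z p => z p.2 p.1.2 p.1.1
        invFun := fun f a j i => f ((i, j), a)
        left_inv := fun z => rfl
        right_inv := fun f => rfl }
    refine card_congr (Equiv.subtypeEquiv φ ?_)
    intro z
    constructor
    · rintro h ⟨⟨i, j⟩, a⟩ hne
      obtain ⟨h1, h2, h3, h4, h5⟩ := h a j i hne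
      grind
    · intro h a j i hne
      have := h ((i, j), a) hne
      grind
  rw [h1, card_supp]
  congr 1
  unfold ar ea
  simp only [P, card_filter, Fintype.sum_prod_type]
  rw [← Fintype.sum_prod_type' (f := fun (x : Ω) (x_1 : Ω) => ∑ x_2, if (x, x_1) ∈ B ×ˢ A ∧ rk x_1 < rk x ∧ src x_2 = v x ∧ tgt x_2 = v x_1 then 1 else 0)]
  rw [← Finset.sum_subset (subset_univ (B ×ˢ A))]
  · refine sum_congr rfl fun p hp => ?_
    have hp' : (p.1, p.2) ∈ B ×ˢ A := hp
    simp only [hp', true_and]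
    by_cases hlt : rk p.2 < rk p.1 <;> simp only [hlt, true_and, false_and, if_true, if_false, Finset.sum_const_zero]
  · intro p _ hp
    have hp' : (p.1, p.2) ∉ B ×ˢ A := hp
    simp only [hp', false_and, if_false, Finset.sum_const_zero]

variable (v rk src tgt K) in
/-- torsion-free count -/
noncomputable def nF (θ : V → ℤ) (Y : Finset Ω) : ℕ := Nat.card {z : E → Matrix Ω Ω K // Su v rk src tgt Y Y z ∧ FC v src tgt θ Y z}
variable (v rk src tgt K) in
/-- torsion count -/
noncomputable def nT (θ : V → ℤ) (Y : Finset Ω) : ℕ := Nat.card {z : E → Matrix Ω Ω K // Su v rk src tgt Y Y z ∧ TC v src tgt θ Y z}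

lemma count_rec (hrk : Injective rk) (θ : V → ℤ) (Y : Finset Ω) :
    Fintype.card K ^ ar v (ea src tgt) rk Y Y = ∑ A ∈ Y.powerset, Fintype.card K ^ vtc v rk A (Y \ A) *
      (nT v rk src tgt K θ A * nF v rk src tgt K θ (Y \ A) * Fintype.card K ^ ar v (ea src tgt) rk (Y \ A) A) := by
  rw [← card_Su, card_torsion hrk θ Y]
  refine sum_congr rfl fun A hA => ?_
  rw [card_Ec, card_blocks θ (mem_powerset.1 hA), card_Su]
  rfl

lemma ar_split {e : V → V → ℕ} {A Y : Finset Ω} (hA : A ⊆ Y) : ar v e rk Y Y = ar v e rk A A + ar v e rk (Y \ A) (Y \ A)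
    + ar v e rk A (Y \ A) + ar v e rk (Y \ A) A := by
  unfold ar
  have : Y = A ∪ (Y \ A) := (union_sdiff_of_subset hA).symm
  have hd : Disjoint A (Y \ A) := disjoint_sdiff
  simp only [sum_product]
  generalize Y \ A = B at *
  subst this
  rw [sum_union hd]
  simp only [sum_union hd, sum_add_distrib]
  ring

/-- Hilbert series and counts -/
theorem hR_count (hac : ∀ a, src a ≠ tgt a) (hrk : Injective rk) (θ : V → ℤ) (Y : Finset Ω) :
    hR (stF v (ea src tgt) rk θ Y) Y.card ((Fintype.card K : ℝ)⁻¹) =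
      nF v rk src tgt K θ Y * ((Fintype.card K : ℝ)⁻¹) ^ ar v (ea src tgt) rk Y Y := by
  set t : ℝ := (Fintype.card K : ℝ)⁻¹ with ht
  have hq : (1 : ℝ) < Fintype.card K := by exact_mod_cast Fintype.one_lt_card
  have ht0 : 0 < t := by rw [ht]; positivity
  have ht1 : t < 1 := inv_lt_one_of_one_lt₀ hq
  have he : ∀ w, ea src tgt w w = 0 := by
    intro w
    unfold ea
    rw [card_eq_zero, Finset.filter_eq_empty_iff]
    rintro a _ ⟨h1, h2⟩
    exact hac a (h1.trans h2.symm)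
  have one : ∀ (p : Finset Ω → (E → Matrix Ω Ω K) → Prop), p ∅ 0 → Nat.card {z : E → Matrix Ω Ω K // Su v rk src tgt ∅ ∅ z ∧ p ∅ z} = 1 := by
    intro p hp
    have hz : ∀ z : E → Matrix Ω Ω K, Su v rk src tgt ∅ ∅ z → z = 0 := by
      intro z hz
      funext a j i
      by_contra hc
      exact absurd (hz a j i hc).1 (Finset.notMem_empty _)
    have : Unique {z : E → Matrix Ω Ω K // Su v rk src tgt ∅ ∅ z ∧ p ∅ z} :=
      ⟨⟨⟨0, fun a j i h => absurd rfl h, hp⟩⟩, fun z => Subtype.ext (hz z.1 z.2.1)⟩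
    exact Nat.card_unique
  have hW0 : ∀ W : V → Submodule K (Ω → K), W ≤ Sp v K ∅ → W = ⊥ := by
    intro W hW
    rw [eq_bot_iff]
    intro w x hx
    rw [Pi.bot_apply, mem_bot]
    funext i
    by_contra hc
    exact absurd (hW w hx i hc).1 (Finset.notMem_empty _)
  have hb0 : tW θ (⊥ : V → Submodule K (Ω → K)) = 0 := by unfold tW; simp
  have arz : ar v (ea src tgt) rk ∅ ∅ = 0 := by simp [ar]
  have stz : ∀ z : E → Matrix Ω Ω K, Stab src tgt z ⊥ := by
    intro z a x hx
    have : x = 0 := (mem_bot K).1 hx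
    rw [this, mulVec_zero]; exact Submodule.zero_mem _
  have main := recur_unique (v := v) (θ := θ)
    (fun A B => t ^ ar v (ea src tgt) rk A B * (t ^ vtc v rk A B)⁻¹) (by intro Y; simp [ar, vtc]) (by intro Y; simp [ar, vtc])
    (fun A => hR (stT v (ea src tgt) rk θ A) A.card t) (fun A => nT v rk src tgt K θ A * t ^ ar v (ea src tgt) rk A A)
    (fun A => hR (stF v (ea src tgt) rk θ A) A.card t) (fun A => nF v rk src tgt K θ A * t ^ ar v (ea src tgt) rk A A)
    (by rw [stT_none, Finset.card_empty, hR_zero])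
    (by
      beta_reduce
      rw [arz, pow_zero, mul_one, nT, one, Nat.cast_one]
      intro W hW _ hne
      exact absurd ((hW0 W hW).trans (hW0 _ le_rfl).symm) hne)
    (by rw [stF_none, Finset.card_empty, hR_zero])
    (by
      beta_reduce
      rw [arz, pow_zero, mul_one, nF, one, Nat.cast_one]
      intro W hW _
      rw [hW0 W hW, hb0])
    (by
      intro Y hY h
      beta_reduce
      rw [stT_nonneg h hY, hR_empty])
    (by
      intro Y hY h
      beta_reduce
      have : nT v rk src tgt K θ Y = 0 := by
        unfold nT
        rw [Nat.card_eq_zero]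
        left
        refine ⟨fun z => ?_⟩
        have hne : (⊥ : V → Submodule K (Ω → K)) ≠ Sp v K Y := by
          intro hc
          obtain ⟨i, hi⟩ := Finset.nonempty_iff_ne_empty.2 hY
          have h1 := single_Sp (v := v) (K := K) hi
          rw [← hc, Pi.bot_apply, mem_bot] at h1
          have := congrFun h1 i
          rw [Pi.single_eq_same] at this
          exact one_ne_zero this
        have := z.2.2 ⊥ bot_le (stz _) hne
        rw [hb0, tW_Sp] at this
        linarith
      rw [this, Nat.cast_zero, zero_mul])
    (by
      intro Y h
      beta_reduce
      rw [stF_neg h, hR_empty])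
    (by
      intro Y h
      beta_reduce
      have : nF v rk src tgt K θ Y = 0 := by
        unfold nF
        rw [Nat.card_eq_zero]
        left
        refine ⟨fun z => ?_⟩
        have := z.2.2 (Sp v K Y) le_rfl (fun a x _ => z.2.1.map a x)
        rw [tW_Sp] at this
        linarith
      rw [this, Nat.cast_zero, zero_mul])
    (fun Y => hilb he hrk θ Y ht0 ht1)
    (fun Y => by
      have h := count_rec (src := src) (tgt := tgt) (K := K) (v := v) hrk θ Y
      have h' := congrArg (Nat.cast (R := ℝ)) h
      push_cast at h'
      have hqt : (Fintype.card K : ℝ) = t⁻¹ := by rw [ht, inv_inv]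
      rw [hqt] at h'
      have h1 : t ^ ar v (ea src tgt) rk Y Y * t⁻¹ ^ ar v (ea src tgt) rk Y Y = 1 := by
        rw [← mul_pow, mul_inv_cancel₀ ht0.ne', one_pow]
      rw [← h1, h', mul_sum]
      refine sum_congr rfl fun A hA => ?_
      rw [ar_split (mem_powerset.1 hA)]
      have h2 : t ^ ar v (ea src tgt) rk (Y \ A) A * t⁻¹ ^ ar v (ea src tgt) rk (Y \ A) A = 1 := by
        rw [← mul_pow, mul_inv_cancel₀ ht0.ne', one_pow]
      rw [pow_add, pow_add, pow_add, inv_pow _ (vtc v rk A (Y \ A))]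
      linear_combination (t ^ ar v (ea src tgt) rk A A * t ^ ar v (ea src tgt) rk (Y \ A) (Y \ A) * t ^ ar v (ea src tgt) rk A (Y \ A) *
        (t ^ vtc v rk A (Y \ A))⁻¹ * nT v rk src tgt K θ A * nF v rk src tgt K θ (Y \ A)) * h2)
  exact (main Y).2
end C3
section A14
open MvPolynomial
variable {Ω V : Type}

/-- the Demazure operator -/
noncomputable def dm (i j : Ω) : PS Ω →ₗ[ℚ] PS Ω :=
  if h : i = j then 0 else
  { toFun := fun f => (show lin j i ∣ f - sw i j f by
      rw [lin_swap, neg_dvd]; exact lin_dvd_sub_sw i j f).choose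
    map_add' := by
      intro f g
      apply mul_left_cancel₀ (lin_ne_zero (Ne.symm h))
      rw [mul_add]
      have h1 := (show lin j i ∣ (f + g) - sw i j (f + g) by rw [lin_swap, neg_dvd]; exact lin_dvd_sub_sw i j _).choose_spec
      have h2 := (show lin j i ∣ f - sw i j f by rw [lin_swap, neg_dvd]; exact lin_dvd_sub_sw i j _).choose_spec
      have h3 := (show lin j i ∣ g - sw i j g by rw [lin_swap, neg_dvd]; exact lin_dvd_sub_sw i j _).choose_spec
      rw [← h1, ← h2, ← h3, map_add]; ring
    map_smul' := by
      intro c f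
      apply mul_left_cancel₀ (lin_ne_zero (Ne.symm h))
      have h1 := (show lin j i ∣ (c • f) - sw i j (c • f) by rw [lin_swap, neg_dvd]; exact lin_dvd_sub_sw i j _).choose_spec
      have h2 := (show lin j i ∣ f - sw i j f by rw [lin_swap, neg_dvd]; exact lin_dvd_sub_sw i j _).choose_spec
      rw [RingHom.id_apply, mul_smul_comm, ← h1, ← h2, map_smul, smul_sub] }

lemma dm_spec {i j : Ω} (h : i ≠ j) (f : PS Ω) : lin j i * dm i j f = f - sw i j f := by
  unfold dm
  rw [dif_neg h]
  exact (show lin j i ∣ f - sw i j f by rw [lin_swap, neg_dvd]; exact lin_dvd_sub_sw i j _).choose_spec.symm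

lemma dm_eq {i j : Ω} (h : i ≠ j) {f g : PS Ω} (hg : lin j i * g = f - sw i j f) : dm i j f = g :=
  mul_left_cancel₀ (lin_ne_zero (Ne.symm h)) ((dm_spec h f).trans hg.symm)

lemma sw_dm {i j : Ω} (h : i ≠ j) (f : PS Ω) : sw i j (dm i j f) = dm i j f := by
  apply mul_left_cancel₀ (lin_ne_zero (Ne.symm h))
  have h1 := congrArg (sw i j) (dm_spec h f)
  rw [map_mul, sw_lin, swap_apply_left, swap_apply_right, map_sub, sw_sw] at h1
  have h2 := dm_spec h f
  rw [lin_swap] at h1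
  rw [h2]
  linear_combination -h1

lemma dm_sq {i j : Ω} (h : i ≠ j) (f : PS Ω) : dm i j (dm i j f) = 0 :=
  dm_eq h (by rw [sw_dm h, mul_zero, sub_self])

lemma dm_mul {i j : Ω} (h : i ≠ j) (f g : PS Ω) : dm i j (f * g) = dm i j f * g + sw i j f * dm i j g :=
  dm_eq h (by rw [map_mul]; linear_combination g * dm_spec h f + sw i j f * dm_spec h g)

lemma dm_mul_of_fix {i j : Ω} (h : i ≠ j) {f : PS Ω} (hf : sw i j f = f) (g : PS Ω) : dm i j (f * g) = f * dm i j g :=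
  dm_eq h (by rw [map_mul, hf]; linear_combination f * dm_spec h g)

lemma dm_fix {i j : Ω} (h : i ≠ j) {f : PS Ω} (hf : sw i j f = f) : dm i j f = 0 :=
  dm_eq h (by rw [hf]; ring)

lemma sw_fix_X {i j k : Ω} (h1 : k ≠ i) (h2 : k ≠ j) : sw i j (X k) = X k := by
  rw [sw_X, swap_apply_of_ne_of_ne h1 h2]

lemma dm_X {i j : Ω} (h : i ≠ j) : dm i j (X i) = 1 :=
  dm_eq h (by rw [sw_X, swap_apply_left]; unfold lin; ring)

lemma sw_comm {i j k l : Ω} (hik : i ≠ k) (hil : i ≠ l) (hjk : j ≠ k) (hjl : j ≠ l) (f : PS Ω) :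
    sw i j (sw k l f) = sw k l (sw i j f) := by
  unfold sw
  rw [rename_rename, rename_rename]
  congr 2
  funext x
  simp only [comp, swap_apply_def]
  split_ifs <;> simp_all

lemma dm_comm {i j k l : Ω} (hij : i ≠ j) (hkl : k ≠ l) (hik : i ≠ k) (hil : i ≠ l) (hjk : j ≠ k) (hjl : j ≠ l) (f : PS Ω) :
    dm i j (dm k l f) = dm k l (dm i j f) := by
  apply mul_left_cancel₀ (lin_ne_zero (Ne.symm hij))
  apply mul_left_cancel₀ (lin_ne_zero (Ne.symm hkl))
  have a1 := dm_spec hij (dm k l f)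
  have a2 := dm_spec hkl (dm i j f)
  have b1 := dm_spec hkl f
  have b2 := dm_spec hij f
  have c1 := congrArg (sw i j) b1
  have c2 := congrArg (sw k l) b2
  rw [map_mul, sw_lin, swap_apply_of_ne_of_ne hik.symm hjk.symm, swap_apply_of_ne_of_ne hil.symm hjl.symm, map_sub] at c1
  rw [map_mul, sw_lin, swap_apply_of_ne_of_ne hik hil, swap_apply_of_ne_of_ne hjk hjl, map_sub] at c2
  have := sw_comm hik hil hjk hjl f
  linear_combination lin l k * a1 - lin j i * a2 + b1 - b2 - c1 + c2 + this

lemma sw_braid {i j k : Ω} (hij : i ≠ j) (hjk : j ≠ k) (hik : i ≠ k) (f : PS Ω) :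
    sw i j (sw j k (sw i j f)) = sw j k (sw i j (sw j k f)) := by
  unfold sw
  rw [rename_rename, rename_rename, rename_rename, rename_rename]
  congr 2
  funext x
  simp only [comp, swap_apply_def]
  split_ifs <;> simp_all

lemma dm_braid {i j k : Ω} (hij : i ≠ j) (hjk : j ≠ k) (hik : i ≠ k) (f : PS Ω) :
    dm i j (dm j k (dm i j f)) = dm j k (dm i j (dm j k f)) := by
  have sl : swap i j k = k := swap_apply_of_ne_of_ne hik.symm hjk.symm
  have sl2 : swap j k i = i := swap_apply_of_ne_of_ne hij hik
  apply mul_left_cancel₀ (lin_ne_zero (Ne.symm hij))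
  apply mul_left_cancel₀ (lin_ne_zero (Ne.symm hjk))
  apply mul_left_cancel₀ (lin_ne_zero (Ne.symm hik))
  have a1 := dm_spec hij f
  have a2 := dm_spec hjk (dm i j f)
  have a3 := dm_spec hij (dm j k (dm i j f))
  have a4 := congrArg (sw j k) a1
  have a5 := congrArg (sw i j) a2
  have a6 := congrArg (sw i j) a4
  have b1 := dm_spec hjk f
  have b2 := dm_spec hij (dm j k f)
  have b3 := dm_spec hjk (dm i j (dm j k f))
  have b4 := congrArg (sw i j) b1
  have b5 := congrArg (sw j k) b2
  have b6 := congrArg (sw j k) b4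
  simp only [map_mul, map_sub, sw_lin, swap_apply_left, swap_apply_right, sl, sl2, sw_dm hij, sw_dm hjk] at a4 a5 a6 b4 b5 b6
  have hb := sw_braid hij hjk hik f
  have e1 : lin k i * (lin k j * (lin j i * dm i j (dm j k (dm i j f)))) =
    f - sw i j f - sw j k f + sw j k (sw i j f) + sw i j (sw j k f) - sw i j (sw j k (sw i j f)) := by
    unfold lin at *
    linear_combination (X i - X k) * (X j - X k) * a3 + (X i - X k) * a2 - (X j - X k) * a5 + a1 - a4 + a6
  have e2 : lin k i * (lin k j * (lin j i * dm j k (dm i j (dm j k f)))) =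
    f - sw i j f - sw j k f + sw j k (sw i j f) + sw i j (sw j k f) - sw j k (sw i j (sw j k f)) := by
    unfold lin at *
    linear_combination (X i - X k) * (X i - X j) * b3 + (X i - X k) * b2 - (X i - X j) * b5 + b1 - b4 + b6
  rw [e1, e2, hb]

lemma dm_hom {i j : Ω} (h : i ≠ j) {f : PS Ω} {n : ℕ} (hf : f.IsHomogeneous (n + 1)) : (dm i j f).IsHomogeneous n := by
  have h1 : (f - sw i j f).IsHomogeneous (n + 1) := by
    refine hf.sub ?_
    exact hf.rename_isHomogeneous
  rw [← dm_spec h] at h1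
  intro d hd
  by_contra hc
  have hl : (lin j i : PS Ω).IsHomogeneous 1 := (isHomogeneous_X _ _).sub (isHomogeneous_X _ _)
  let m := d.degree
  have hm : homogeneousComponent m (dm i j f) ≠ 0 := by
    intro h0
    have := congrArg (coeff d) h0
    rw [coeff_homogeneousComponent, if_pos rfl] at this
    exact hd this
  have h2 : homogeneousComponent (m + 1) (lin j i * dm i j f) = lin j i * homogeneousComponent m (dm i j f) := by
    conv_lhs => rw [← sum_homogeneousComponent (dm i j f), mul_sum, map_sum]
    rw [Finset.sum_eq_single m]
    · rw [homogeneousComponent_of_mem (m := m+1), if_pos rfl]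
      rw [add_comm]; exact hl.mul (homogeneousComponent_isHomogeneous _ _)
    · intro b _ hb
      have hh := hl.mul (homogeneousComponent_isHomogeneous b (dm i j f))
      rw [homogeneousComponent_of_mem hh, if_neg (by omega)]
    · intro hnm
      rw [mem_range, not_lt] at hnm
      have h0 : homogeneousComponent m (dm i j f) = 0 := homogeneousComponent_eq_zero _ _ (by omega)
      exact absurd h0 hm
  rw [homogeneousComponent_of_mem h1] at h2
  split_ifs at h2 with hc2
  · apply hc
    have h3 : d.degree = n := by show m = n; omega
    rw [Finsupp.degree_eq_weight_one] at h3
    exact h3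
  · rcases mul_eq_zero.1 h2.symm with h | h'
    · exact lin_ne_zero (Ne.symm ‹i ≠ j›) h
    · exact hm h'

lemma dm_hom0 {i j : Ω} (h : i ≠ j) {f : PS Ω} (hf : f.IsHomogeneous 0) : dm i j f = 0 := by
  apply dm_fix h
  have : f = C (coeff 0 f) := by
    have := totalDegree_eq_zero_iff_eq_C.1 (Nat.le_zero.1 hf.totalDegree_le)
    exact this
  rw [this]; simp [sw]
end A14
section A15
open MvPolynomial
variable {Ω V : Type}

/-- elementary symmetric functions in a chain of variables -/
noncomputable def Es (p : ℕ → Ω) : ℕ → ℕ → PS Ω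
  | 0, 0 => 1
  | 0, _ + 1 => 0
  | _ + 1, 0 => 1
  | m + 1, j + 1 => Es p m (j + 1) + X (p m) * Es p m j

lemma Es_zero (p : ℕ → Ω) (m : ℕ) : Es p m 0 = 1 := by cases m <;> rfl

lemma Es_hom (p : ℕ → Ω) (m j : ℕ) : (Es p m j).IsHomogeneous j := by
  induction m generalizing j with
  | zero => cases j with
    | zero => exact isHomogeneous_one _ _
    | succ j => exact isHomogeneous_zero _ _ _
  | succ m ih => cases j with
    | zero => exact isHomogeneous_one _ _
    | succ j =>
      refine (ih _).add ?_
      rw [add_comm]; exact (isHomogeneous_X _ _).mul (ih j)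

lemma Es_fix1 {p : ℕ → Ω} {b : ℕ} (hp : ∀ i < b, ∀ j < b, p i = p j → i = j) {i : ℕ} (hi : i + 1 < b) {m : ℕ} (hm : m ≤ i)
    (j : ℕ) : sw (p i) (p (i + 1)) (Es p m j) = Es p m j := by
  induction m generalizing j with
  | zero => cases j <;> simp [Es]
  | succ m ih => cases j with
    | zero => simp [Es]
    | succ j =>
      rw [Es, map_add, map_mul, ih (by omega), ih (by omega), sw_fix_X]
      · intro h; have := hp _ (by omega) _ (by omega) h; omega
      · intro h; have := hp _ (by omega) _ (by omega) h; omega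

lemma Es_fix2 {p : ℕ → Ω} {b : ℕ} (hp : ∀ i < b, ∀ j < b, p i = p j → i = j) {i : ℕ} (hi : i + 1 < b) {m : ℕ} (hm : i + 2 ≤ m)
    (hmb : m ≤ b) (j : ℕ) : sw (p i) (p (i + 1)) (Es p m j) = Es p m j := by
  induction m generalizing j with
  | zero => omega
  | succ m ih => cases j with
    | zero => simp [Es]
    | succ j =>
      by_cases h : i + 2 ≤ m
      · rw [Es, map_add, map_mul, ih h (by omega), ih h (by omega), sw_fix_X]
        · intro h; have := hp _ (by omega) _ (by omega) h; omega
        · intro h; have := hp _ (by omega) _ (by omega) h; omega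
      · obtain rfl : m = i + 1 := by omega
        cases j with
        | zero =>
          rw [Es, Es_zero, Es, Es_zero]
          simp only [map_add, map_mul, map_one, Es_fix1 hp hi le_rfl, sw_X, swap_apply_left, swap_apply_right]
          ring
        | succ j =>
          rw [Es, Es, Es]
          simp only [map_add, map_mul, Es_fix1 hp hi le_rfl, sw_X, swap_apply_left, swap_apply_right]
          ring

variable (p : ℕ → Ω)

/-- operators of the chain -/
noncomputable abbrev dc (i : ℕ) : PS Ω →ₗ[ℚ] PS Ω := dm (p i) (p (i + 1))

/-- iterated operators -/
noncomputable def Dd (m : ℕ) : ℕ → PS Ω →ₗ[ℚ] PS Ω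
  | 0 => LinearMap.id
  | j + 1 => (dc p (m - j)).comp (Dd m j)

variable {p} {b : ℕ} (hp : ∀ i < b, ∀ j < b, p i = p j → i = j)
include hp

lemma pne {i j : ℕ} (hi : i < b) (hj : j < b) (h : i ≠ j) : p i ≠ p j := fun h' => h (hp i hi j hj h')

lemma dc_comm {i k : ℕ} (hi : i + 1 < b) (hk : k + 1 < b) (h : i + 2 ≤ k ∨ k + 2 ≤ i) (f : PS Ω) : dc p i (dc p k f) = dc p k (dc p i f) := by
  apply dm_comm <;> apply pne hp <;> omega

lemma Dd_comm {m j i : ℕ} (hm : m + 1 < b) (h : i + j < m) (f : PS Ω) : dc p i (Dd p m j f) = Dd p m j (dc p i f) := by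
  induction j with
  | zero => rfl
  | succ j ih =>
    simp only [Dd, comp_apply]
    rw [← ih (by omega), dc_comm hp (by omega) (by omega) (by omega)]

lemma Es_dc {i : ℕ} (hi : i + 1 < b) (j : ℕ) : dc p i (Es p (i + 1) (j + 1)) = Es p i j := by
  have h := pne hp (i := i) (j := i + 1) (by omega) (by omega) (by omega)
  rw [Es, map_add, dm_fix h (Es_fix1 hp hi le_rfl _), mul_comm, dm_mul_of_fix h (Es_fix1 hp hi le_rfl _), dm_X h, mul_one, zero_add]

variable (I : Ideal (PS Ω)) (hI : ∀ i, i + 1 < b → ∀ f ∈ I, dc p i f ∈ I)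
include hI

lemma Dd_I {m j : ℕ} (hm : m + 1 < b) {f : PS Ω} (hf : f ∈ I) : Dd p m j f ∈ I := by
  induction j with
  | zero => exact hf
  | succ j ih => exact hI _ (by omega) _ ih

lemma Dd_key {m j i : ℕ} (hm : m + 1 < b) (hj : j ≤ m + 1) (him : i ≤ m) (h : m + 1 ≤ i + j) {f : PS Ω}
    (hf : ∀ i < m, dc p i f ∈ I) : dc p i (Dd p m j f) ∈ I := by
  induction j with
  | zero => omega
  | succ j ih =>
    simp only [Dd, comp_apply]
    rcases Nat.lt_trichotomy i (m - j) with h1 | h1 | h1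
    · omega
    · subst h1
      rw [dm_sq (pne hp (by omega) (by omega) (by omega))]
      exact I.zero_mem
    · by_cases h2 : i = m - j + 1
      · obtain ⟨j, rfl⟩ : ∃ j', j = j' + 1 := ⟨j - 1, by omega⟩
        simp only [Dd, comp_apply]
        obtain ⟨i, rfl⟩ : ∃ i', i = i' + 1 := ⟨i - 1, by omega⟩
        have e1 : m - (j + 1) = i := by omega
        have e2 : m - j = i + 1 := by omega
        rw [e1, e2]
        have := dm_braid (i := p i) (j := p (i + 1)) (k := p (i + 1 + 1)) (pne hp (by omega) (by omega) (by omega))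
          (pne hp (by omega) (by omega) (by omega)) (pne hp (by omega) (by omega) (by omega)) (Dd p m j f)
        rw [← this]
        apply hI _ (by omega); apply hI _ (by omega)
        show dc p i _ ∈ I
        rw [Dd_comm hp hm (by omega)]
        exact Dd_I hp I hI hm (hf _ (by omega))
      · rw [dc_comm hp (by omega) (by omega) (by omega)]
        exact hI _ (by omega) _ (ih (by omega) (by omega))

lemma Dd_Es {m r j : ℕ} (hm : m + 1 < b) (hr : r ≤ j) (hj : j ≤ m + 1) {k : PS Ω} (hk : ∀ i < m + 1, dc p i k ∈ I) :
    Dd p m r (Es p (m + 1) j * k) - Es p (m + 1 - r) (j - r) * k ∈ I := by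
  induction r with
  | zero => simp [Dd]
  | succ r ih =>
    have h1 := hI (m - r) (by omega) _ (ih (by omega))
    rw [map_sub] at h1
    simp only [Dd, comp_apply]
    have e1 : m + 1 - r = (m - r) + 1 := by omega
    have e2 : m + 1 - (r + 1) = m - r := by omega
    have e3 : j - r = (j - (r + 1)) + 1 := by omega
    rw [dm_mul (pne hp (by omega) (by omega) (by omega)), e1, e3, Es_dc hp (by omega)] at h1
    rw [e2]
    have h2 := I.add_mem h1 (I.mul_mem_left (sw (p (m - r)) (p (m - r + 1)) (Es p (m - r + 1) (j - (r + 1) + 1))) (hk (m - r) (by omega)))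
    convert h2 using 1
    ring
end A15
section A16
open MvPolynomial
variable {Ω V : Type} [Fintype Ω]

lemma rank_step {M : Type*} [AddCommGroup M] [Module ℚ M] {A A' B B' : Submodule ℚ M} [FiniteDimensional ℚ A] [FiniteDimensional ℚ B]
    (hA : A' ≤ A) (hB : B' ≤ B) (φ : M →ₗ[ℚ] M) (h1 : ∀ a ∈ A, φ a ∈ B) (h2 : ∀ a ∈ A, φ a ∈ B' ↔ a ∈ A')
    (h3 : ∀ x ∈ B, ∃ a ∈ A, φ a - x ∈ B') :
    finrank ℚ A + finrank ℚ B' = finrank ℚ A' + finrank ℚ B := by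
  let ψ : A →ₗ[ℚ] (B ⧸ B'.comap B.subtype) := (B'.comap B.subtype).mkQ.comp (φ.restrict h1)
  have hs : Surjective ψ := by
    intro y
    obtain ⟨x, rfl⟩ := Submodule.mkQ_surjective _ y
    obtain ⟨a, ha, h⟩ := h3 x.1 x.2
    refine ⟨⟨a, ha⟩, ?_⟩
    show Submodule.Quotient.mk _ = Submodule.Quotient.mk _
    rw [Submodule.Quotient.eq]
    exact h
  have hk : ker ψ = A'.comap A.subtype := by
    ext a
    rw [mem_ker]
    show Submodule.Quotient.mk _ = 0 ↔ _
    rw [Submodule.Quotient.mk_eq_zero]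
    exact h2 a.1 a.2
  have e1 := finrank_range_add_finrank_ker ψ
  rw [range_eq_top.2 hs, finrank_top, hk] at e1
  have e2 := Submodule.finrank_quotient_add_finrank (B'.comap B.subtype)
  have e3 : finrank ℚ (A'.comap A.subtype) = finrank ℚ A' := (Submodule.comapSubtypeEquivOfLe hA).finrank_eq
  have e4 : finrank ℚ (B'.comap B.subtype) = finrank ℚ B' := (Submodule.comapSubtypeEquivOfLe hB).finrank_eq
  omega

/-- graded piece -/
noncomputable def gp (U : Submodule ℚ (PS Ω)) (n : ℕ) : Submodule ℚ (PS Ω) := U ⊓ homogeneousSubmodule Ω ℚ n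
/-- Hilbert function -/
noncomputable def hd (U : Submodule ℚ (PS Ω)) (n : ℕ) : ℕ := finrank ℚ (gp U n)

instance gp_fd (U : Submodule ℚ (PS Ω)) (n : ℕ) : FiniteDimensional ℚ (gp U n) := by
  have : FiniteDimensional ℚ (homogeneousSubmodule Ω ℚ n) := Module.Finite.iff_fg.2 (homogeneousSubmodule_fg Ω ℚ n)
  exact Submodule.finiteDimensional_of_le (inf_le_right : gp U n ≤ homogeneousSubmodule Ω ℚ n)

lemma hd_mono {U U' : Submodule ℚ (PS Ω)} (h : U ≤ U') (n : ℕ) : hd U n ≤ hd U' n :=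
  finrank_mono (inf_le_inf_right _ h)

/-- relative Hilbert function -/
noncomputable def hq (U I : Submodule ℚ (PS Ω)) (n : ℕ) : ℕ := hd U n - hd I n

/-- invariants modulo an ideal -/
noncomputable def Nm (p : ℕ → Ω) (I B : Submodule ℚ (PS Ω)) (m : ℕ) : Submodule ℚ (PS Ω) :=
  B ⊓ ⨅ i : Fin m, I.comap (dc p i)

omit [Fintype Ω] in
lemma mem_Nm {p : ℕ → Ω} {I B : Submodule ℚ (PS Ω)} {m : ℕ} {f : PS Ω} : f ∈ Nm p I B m ↔ f ∈ B ∧ ∀ i < m, dc p i f ∈ I := by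
  unfold Nm
  rw [Submodule.mem_inf, mem_iInf]
  exact and_congr_right fun _ => ⟨fun h i hi => h ⟨i, hi⟩, fun h i => h i i.2⟩

omit [Fintype Ω] in
lemma Dd_hom {p : ℕ → Ω} {b : ℕ} (hp : ∀ i < b, ∀ j < b, p i = p j → i = j) {m : ℕ} (hm : m + 1 < b) {f : PS Ω} {n : ℕ}
    (hf : f.IsHomogeneous n) (j : ℕ) : (j ≤ n → (Dd p m j f).IsHomogeneous (n - j)) ∧ (n < j → Dd p m j f = 0) := by
  induction j with
  | zero => exact ⟨fun _ => hf, fun h => by omega⟩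
  | succ j ih =>
    have hne := pne hp (i := m - j) (j := m - j + 1) (by omega) (by omega) (by omega)
    simp only [Dd, comp_apply]
    constructor
    · intro h
      have := ih.1 (by omega)
      have e : n - j = (n - (j + 1)) + 1 := by omega
      rw [e] at this
      exact dm_hom hne this
    · intro h
      by_cases h' : n < j
      · rw [ih.2 h', map_zero]
      · have := ih.1 (by omega)
        rw [show n - j = 0 by omega] at this
        exact dm_hom0 hne this

omit [Fintype Ω] in
lemma Es_mem {p : ℕ → Ω} {B : Submodule ℚ (PS Ω)} {b : ℕ} (hB : ∀ i < b, ∀ f ∈ B, X (p i) * f ∈ B) {m : ℕ} (hm : m ≤ b) (j : ℕ) {f : PS Ω}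
    (hf : f ∈ B) : Es p m j * f ∈ B := by
  induction m generalizing j with
  | zero => cases j <;> simp [Es, hf]
  | succ m ih => cases j with
    | zero => simp [Es, hf]
    | succ j =>
      rw [Es, add_mul, mul_assoc]
      exact B.add_mem (ih (by omega) _) (hB _ (by omega) _ (ih (by omega) _))

variable {p : ℕ → Ω} {b : ℕ} (hp : ∀ i < b, ∀ j < b, p i = p j → i = j) (I : Ideal (PS Ω))
  (hI : ∀ i, i + 1 < b → ∀ f ∈ I, dc p i f ∈ I) (B : Submodule ℚ (PS Ω)) (hIB : I.restrictScalars ℚ ≤ B)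
  (hB1 : ∀ i, i + 1 < b → ∀ f ∈ B, dc p i f ∈ B) (hB2 : ∀ i < b, ∀ f ∈ B, X (p i) * f ∈ B)
include hp hI hIB hB1 hB2

lemma Nm_I {m : ℕ} (hm : m < b) : I.restrictScalars ℚ ≤ Nm p (I.restrictScalars ℚ) B m :=
  fun f hf => mem_Nm.2 ⟨hIB hf, fun i hi => hI i (by omega) f hf⟩

/-- filtration steps -/
lemma fil_step {m j n : ℕ} (hm : m + 1 < b) (hj : j ≤ m + 1) {L' : Submodule ℚ (PS Ω)}
    (hL' : ∀ f, f ∈ L' ↔ f ∈ Nm p (I.restrictScalars ℚ) B m ∧ (j ≤ m → Dd p m (j + 1) f ∈ I)) :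
    hd L' n + (if j ≤ n then hd (I.restrictScalars ℚ) (n - j) else 0) =
      hd (Nm p (I.restrictScalars ℚ) B m ⊓ (I.restrictScalars ℚ).comap (Dd p m j)) n +
        (if j ≤ n then hd (Nm p (I.restrictScalars ℚ) B (m + 1)) (n - j) else 0) := by
  have hLL : Nm p (I.restrictScalars ℚ) B m ⊓ (I.restrictScalars ℚ).comap (Dd p m j) ≤ L' := by
    rintro f ⟨h1, h2⟩
    exact (hL' f).2 ⟨h1, fun h => hI _ (by omega) _ h2⟩
  have hDB : ∀ j, ∀ f ∈ B, Dd p m j f ∈ B := by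
    intro j f hf
    induction j with
    | zero => exact hf
    | succ j ih => exact hB1 _ (by omega) _ ih
  split_ifs with hjn
  · refine rank_step (inf_le_inf_right _ hLL) (inf_le_inf_right _ (Nm_I hp I hI B hIB hB1 hB2 hm)) (Dd p m j) ?_ ?_ ?_
    · rintro f ⟨hf, hn⟩
      obtain ⟨h1, h2⟩ := (hL' f).1 hf
      rw [mem_Nm] at h1
      refine ⟨mem_Nm.2 ⟨hDB _ _ h1.1, fun i hi => ?_⟩, (Dd_hom hp hm hn j).1 hjn⟩
      rcases Nat.lt_trichotomy (i + j) m with h | h | h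
      · rw [Dd_comm hp hm h]; exact Dd_I hp I hI hm (h1.2 i (by omega))
      · have := h2 (by omega)
        simp only [Dd, comp_apply] at this
        rw [show i = m - j by omega]; exact this
      · exact Dd_key hp I hI hm hj (by omega) h h1.2
    · rintro f ⟨hf, hn⟩
      constructor
      · intro h; exact ⟨⟨((hL' f).1 hf).1, h.1⟩, hn⟩
      · intro h; exact ⟨h.1.2, (Dd_hom hp hm hn j).1 hjn⟩
    · rintro k ⟨hk, hn⟩
      replace hk := mem_Nm.1 hk
      replace hn : k.IsHomogeneous (n - j) := hn
      have hE := Dd_Es hp I hI hm (le_refl j) hj hk.2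
      rw [Nat.sub_self, Es_zero, one_mul] at hE
      have hh : (Es p (m + 1) j * k).IsHomogeneous n := by
        have := (Es_hom p (m + 1) j).mul hn
        rwa [show j + (n - j) = n by omega] at this
      refine ⟨Es p (m + 1) j * k, ⟨(hL' _).2 ⟨mem_Nm.2 ⟨Es_mem hB2 (by omega) _ hk.1, fun i hi => ?_⟩, fun hjm => ?_⟩, hh⟩, ⟨hE, ?_⟩⟩
      · rw [dm_mul_of_fix (pne hp (by omega) (by omega) (by omega)) (Es_fix2 hp (by omega) (by omega) (by omega) _)]
        exact I.mul_mem_left _ (hk.2 i (by omega))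
      · have := hI (m - j) (by omega) _ hE
        rw [map_sub] at this
        simp only [Dd, comp_apply]
        have h3 := I.add_mem this (hk.2 (m - j) (by omega))
        rwa [sub_add_cancel] at h3
      · exact ((Dd_hom hp hm hh j).1 hjn).sub hn
  · rw [add_zero, add_zero]
    suffices h : gp L' n = gp (Nm p (I.restrictScalars ℚ) B m ⊓ (I.restrictScalars ℚ).comap (Dd p m j)) n by
      unfold hd; rw [h]
    apply le_antisymm
    · rintro f ⟨hf, hn⟩
      refine ⟨⟨((hL' f).1 hf).1, ?_⟩, hn⟩
      show Dd p m j f ∈ I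
      rw [(Dd_hom hp hm hn j).2 (by omega)]; exact I.zero_mem
    · exact inf_le_inf_right _ hLL

lemma Nm_step {m : ℕ} (hm : m + 1 < b) (n : ℕ) :
    hq (Nm p (I.restrictScalars ℚ) B m) (I.restrictScalars ℚ) n =
      ∑ j ∈ range (m + 2), if j ≤ n then hq (Nm p (I.restrictScalars ℚ) B (m + 1)) (I.restrictScalars ℚ) (n - j) else 0 := by
  have hmono := fun n => hd_mono (Nm_I hp I hI B hIB hB1 hB2 hm) n
  have hmono' := fun n => hd_mono (Nm_I hp I hI B hIB hB1 hB2 (m := m) (by omega)) n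
  have h0 : hd (Nm p (I.restrictScalars ℚ) B m ⊓ (I.restrictScalars ℚ).comap (Dd p m 0)) n = hd (I.restrictScalars ℚ) n := by
    congr 1
    apply le_antisymm
    · rintro f ⟨_, h⟩; exact h
    · exact le_inf (Nm_I hp I hI B hIB hB1 hB2 (by omega)) le_rfl
  have hj : ∀ j ≤ m + 1, hd (Nm p (I.restrictScalars ℚ) B m ⊓ (I.restrictScalars ℚ).comap (Dd p m j)) n = hd (I.restrictScalars ℚ) n +
      ∑ j ∈ range j, if j ≤ n then hq (Nm p (I.restrictScalars ℚ) B (m + 1)) (I.restrictScalars ℚ) (n - j) else 0 := by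
    intro j hj
    induction j with
    | zero => rw [h0]; simp
    | succ j ih =>
      have h1 := fil_step hp I hI B hIB hB1 hB2 (n := n) (j := j) hm (by omega)
        (L' := Nm p (I.restrictScalars ℚ) B m ⊓ (I.restrictScalars ℚ).comap (Dd p m (j + 1)))
        (fun f => ⟨fun h => ⟨h.1, fun _ => h.2⟩, fun h => ⟨h.1, h.2 (by omega)⟩⟩)
      rw [ih (by omega)] at h1
      rw [Finset.sum_range_succ]
      unfold hq at h1 ⊢
      have := hmono (n - j)
      split_ifs at h1 ⊢ <;> omega
  have h1 := fil_step hp I hI B hIB hB1 hB2 (n := n) (j := m + 1) hm le_rfl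
        (L' := Nm p (I.restrictScalars ℚ) B m) (fun f => ⟨fun h => ⟨h, fun h => by omega⟩, fun h => h.1⟩)
  rw [hj _ le_rfl] at h1
  rw [Finset.sum_range_succ]
  have := hmono (n - (m + 1))
  have := hmono' n
  generalize hS : (∑ j ∈ range (m + 1), if j ≤ n then hq (Nm p (I.restrictScalars ℚ) B (m + 1)) (I.restrictScalars ℚ) (n - j) else 0) = S at h1 ⊢
  unfold hq
  split_ifs at h1 ⊢ <;> omega
end A16
section A17
open MvPolynomial
open scoped ENNReal
variable {Ω V : Type} [Fintype Ω]

/-- Hilbert series -/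
noncomputable def HS (r : ℕ → ℕ) (t : ℝ≥0∞) : ℝ≥0∞ := ∑' n, (r n : ℝ≥0∞) * t ^ n
/-- quantum integers -/
noncomputable def qi (k : ℕ) (t : ℝ≥0∞) : ℝ≥0∞ := ∑ j ∈ range k, t ^ j
/-- quantum factorials -/
noncomputable def qf (k : ℕ) (t : ℝ≥0∞) : ℝ≥0∞ := ∏ m ∈ range k, qi (m + 1) t

lemma HS_shift (r : ℕ → ℕ) (t : ℝ≥0∞) (j : ℕ) : HS (fun n => if j ≤ n then r (n - j) else 0) t = t ^ j * HS r t := by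
  unfold HS
  rw [← ENNReal.tsum_mul_left]
  rw [← Injective.tsum_eq (g := fun n : ℕ => n + j) (fun a b h => Nat.add_right_cancel h)]
  · refine tsum_congr fun n => ?_
    beta_reduce
    rw [if_pos (Nat.le_add_left j n), Nat.add_sub_cancel, pow_add, mul_comm (t ^ n), mul_left_comm]
  · intro n hn
    by_cases h : j ≤ n
    · exact ⟨n - j, Nat.sub_add_cancel h⟩
    · exfalso
      apply hn
      beta_reduce
      rw [if_neg h, Nat.cast_zero, zero_mul]

lemma HS_sum {ι : Type*} (s : Finset ι) (r : ι → ℕ → ℕ) (t : ℝ≥0∞) : HS (fun n => ∑ i ∈ s, r i n) t = ∑ i ∈ s, HS (r i) t := by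
  unfold HS
  rw [← Summable.tsum_finsetSum (fun _ _ => ENNReal.summable)]
  congr 1; funext n
  rw [Nat.cast_sum, sum_mul]

lemma HS_conv {r r' : ℕ → ℕ} {k : ℕ} (h : ∀ n, r n = ∑ j ∈ range k, if j ≤ n then r' (n - j) else 0) (t : ℝ≥0∞) :
    HS r t = qi k t * HS r' t := by
  have : r = fun n => ∑ j ∈ range k, if j ≤ n then r' (n - j) else 0 := funext h
  rw [this, HS_sum, qi, sum_mul]
  exact sum_congr rfl fun j _ => HS_shift _ _ _

section chain
variable {p : ℕ → Ω} {b : ℕ} (hp : ∀ i < b, ∀ j < b, p i = p j → i = j) (I : Ideal (PS Ω))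
  (hI : ∀ i, i + 1 < b → ∀ f ∈ I, dc p i f ∈ I) (B : Submodule ℚ (PS Ω)) (hIB : I.restrictScalars ℚ ≤ B)
  (hB1 : ∀ i, i + 1 < b → ∀ f ∈ B, dc p i f ∈ B) (hB2 : ∀ i < b, ∀ f ∈ B, X (p i) * f ∈ B)
include hp hI hIB hB1 hB2
lemma chain_HS (t : ℝ≥0∞) : HS (hq B (I.restrictScalars ℚ)) t = qf b t * HS (hq (Nm p (I.restrictScalars ℚ) B (b - 1)) (I.restrictScalars ℚ)) t := by
  have h0 : Nm p (I.restrictScalars ℚ) B 0 = B := by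
    ext f; rw [mem_Nm]; simp
  have key : ∀ m, m + 1 ≤ b → HS (hq B (I.restrictScalars ℚ)) t = qf (m + 1) t * HS (hq (Nm p (I.restrictScalars ℚ) B m) (I.restrictScalars ℚ)) t := by
    intro m hm
    induction m with
    | zero => rw [h0]; simp [qf, qi]
    | succ m ih =>
      rw [ih (by omega), HS_conv (Nm_step hp I hI B hIB hB1 hB2 (m := m) (by omega)) t, qf, qf, Finset.prod_range_succ _ (m + 1), mul_assoc]
  cases b with
  | zero => simp [qf, h0]
  | succ b => exact key b le_rfl
end chain

/-- block invariants -/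
noncomputable def Bs {ι : Type} (P : ι → ℕ → Ω) (n : ι → ℕ) (I : Submodule ℚ (PS Ω)) (s : Finset ι) : Submodule ℚ (PS Ω) :=
  ⨅ c ∈ s, ⨅ i ∈ range (n c - 1), I.comap (dc (P c) i)

omit [Fintype Ω] in
lemma mem_Bs {ι : Type} {P : ι → ℕ → Ω} {n : ι → ℕ} {I : Submodule ℚ (PS Ω)} {s : Finset ι} {f : PS Ω} :
    f ∈ Bs P n I s ↔ ∀ c ∈ s, ∀ i, i + 1 < n c → dc (P c) i f ∈ I := by
  unfold Bs
  simp only [mem_iInf, mem_range, Submodule.mem_comap]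
  exact ⟨fun h c hc i hi => h c hc i (by omega), fun h c hc i hi => h c hc i (by omega)⟩

lemma blocks_HS {ι : Type} (P : ι → ℕ → Ω) (n : ι → ℕ) (hP : ∀ c i c' i', i < n c → i' < n c' → P c i = P c' i' → c = c' ∧ i = i')
    (I : Ideal (PS Ω)) (hI : ∀ c i, i + 1 < n c → ∀ f ∈ I, dc (P c) i f ∈ I) (t : ℝ≥0∞) (s : Finset ι) :
    HS (hq ⊤ (I.restrictScalars ℚ)) t = (∏ c ∈ s, qf (n c) t) * HS (hq (Bs P n (I.restrictScalars ℚ) s) (I.restrictScalars ℚ)) t := by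
  induction s using cons_induction with
  | empty => simp [Bs]
  | cons c s hc ih =>
    have hne : ∀ c' ∈ s, ∀ i i', i < n c → i' < n c' → P c i ≠ P c' i' := by
      intro c' hc' i i' hi hi' heq
      obtain ⟨rfl, -⟩ := hP _ _ _ _ hi hi' heq
      exact hc hc'
    have hne2 : ∀ c i i', i < n c → i' < n c → i ≠ i' → P c i ≠ P c i' := by
      intro c i i' hi hi' h heq
      exact h (hP _ _ _ _ hi hi' heq).2
    have h1 := chain_HS (p := P c) (b := n c) (fun i hi j hj h => (hP _ _ _ _ hi hj h).2) I (fun i hi => hI c i hi)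
      (Bs P n (I.restrictScalars ℚ) s) (fun f hf => mem_Bs.2 fun c' _ i hi => hI c' i hi f hf)
      (by
        intro i hi f hf
        rw [mem_Bs] at hf ⊢
        intro c' hc' i' hi'
        have := dm_comm (hne2 c' i' (i' + 1) (by omega) (by omega) (by omega)) (hne2 c i (i + 1) (by omega) (by omega) (by omega))
          (hne c' hc' i i' (by omega) (by omega)).symm (hne c' hc' (i + 1) i' (by omega) (by omega)).symm
          (hne c' hc' i (i' + 1) (by omega) (by omega)).symm (hne c' hc' (i + 1) (i' + 1) (by omega) (by omega)).symm f
        rw [this]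
        exact hI c i hi _ (hf c' hc' i' hi'))
      (by
        intro i hi f hf
        rw [mem_Bs] at hf ⊢
        intro c' hc' i' hi'
        rw [dm_mul_of_fix (hne2 c' i' (i' + 1) (by omega) (by omega) (by omega)) (sw_fix_X (hne c' hc' i i' (by omega) (by omega)) (hne c' hc' i (i' + 1) (by omega) (by omega)))]
        exact I.mul_mem_left _ (hf c' hc' i' hi')) t
    have h2 : Bs P n (I.restrictScalars ℚ) (Finset.cons c s hc) = Nm (P c) (I.restrictScalars ℚ) (Bs P n (I.restrictScalars ℚ) s) (n c - 1) := by
      ext f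
      rw [mem_Nm, mem_Bs, mem_Bs]
      constructor
      · intro h; exact ⟨fun c' hc' => h c' (by simp [hc']), fun i hi => h c (by simp) i (by omega)⟩
      · rintro ⟨h, h'⟩ c' hc' i hi
        rw [Finset.mem_cons] at hc'
        rcases hc' with rfl | hc'
        · exact h' i (by omega)
        · exact h c' hc' i hi
    rw [ih, h1, h2, prod_cons]; ring

/-- Hilbert function of standard monomials -/
lemma std_count (U : Submodule ℚ (PS Ω)) (hU : Grd U) (n : ℕ) :
    hd (⊤ : Submodule ℚ (PS Ω)) n = hd U n + Nat.card {s : Ω →₀ ℕ // s ∈ std U univ ∧ s.degree = n} := by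
  let S := {s : Ω →₀ ℕ // s ∈ std U univ ∧ s.degree = n}
  let F : S → PS Ω := fun s => mon s.1
  have hli : LinearIndependent ℚ F := by
    have := (basisMonomials Ω ℚ).linearIndependent
    rw [coe_basisMonomials] at this
    exact this.comp (fun s : S => s.1) Subtype.val_injective
  have hFh : ∀ s : S, F s ∈ homogeneousSubmodule Ω ℚ n := by
    intro s
    exact isHomogeneous_monomial _ s.2.2
  have hfin : FiniteDimensional ℚ (homogeneousSubmodule Ω ℚ n) := Module.Finite.iff_fg.2 (homogeneousSubmodule_fg Ω ℚ n)
  have hle : span ℚ (Set.range F) ≤ homogeneousSubmodule Ω ℚ n := by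
    rw [span_le]; rintro _ ⟨s, rfl⟩; exact hFh s
  have hfin2 : FiniteDimensional ℚ (span ℚ (Set.range F)) := Submodule.finiteDimensional_of_le hle
  have hli2 : LinearIndependent ℚ (fun s : S => (⟨F s, subset_span ⟨s, rfl⟩⟩ : span ℚ (Set.range F))) := by
    apply LinearIndependent.of_comp (Submodule.subtype _)
    exact hli
  have hSf : Finite S := hli2.finite
  haveI := ofFinite S
  have hcard : finrank ℚ (span ℚ (Set.range F)) = Nat.card S := by
    rw [finrank_span_eq_card hli, Nat.card_eq_fintype_card]
  have hdis : gp U n ⊓ span ℚ (Set.range F) = ⊥ := by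
    rw [eq_bot_iff]
    rintro f ⟨hf, hs⟩
    rw [mem_bot]
    refine std_indep (A := univ) hU hf.1 fun s hs' => ?_
    have : span ℚ (Set.range F) ≤ restrictSupport ℚ (std U univ) := by
      rw [span_le]
      rintro _ ⟨s, rfl⟩
      rw [SetLike.mem_coe, mem_restrictSupport_iff]
      intro x hx
      have := support_monomial_subset hx
      rw [Finset.mem_singleton] at this
      rw [this]; exact s.2.1
    have h2 := this hs
    rw [mem_restrictSupport_iff] at h2
    exact h2 hs'
  have hsup : gp U n ⊔ span ℚ (Set.range F) = gp ⊤ n := by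
    apply le_antisymm
    · exact sup_le (inf_le_inf_right _ le_top) (le_inf le_top hle)
    · rintro f ⟨-, hf⟩
      rw [SetLike.mem_coe, mem_homogeneousSubmodule] at hf
      rw [f.as_sum]
      refine Submodule.sum_mem _ fun s hs => ?_
      have hsd : s.degree = n := by
        have := hf (mem_support_iff.1 hs)
        rw [Finsupp.degree_eq_weight_one]; exact this
      have h1 := std_span U univ s (subset_univ _)
      have h3 : mon s ∈ gp U n ⊔ span ℚ (Set.range F) := by
        rw [mem_sup] at h1 ⊢
        obtain ⟨u, hu, w, hw, huw⟩ := h1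
        have hw2 : w ∈ span ℚ (Set.range F) := by
          refine Submodule.span_mono ?_ hw
          rintro _ ⟨q, ⟨hq1, hq2⟩, rfl⟩
          exact ⟨⟨q, hq1, hq2.trans hsd⟩, rfl⟩
        refine ⟨u, ⟨hu, ?_⟩, w, hw2, huw⟩
        have : u = mon s - w := by rw [← huw]; ring
        rw [this]
        exact Submodule.sub_mem _ (isHomogeneous_monomial _ hsd) (hle hw2)
      have h4 : monomial s (coeff s f) = coeff s f • mon s := by rw [mon, smul_monomial, smul_eq_mul, mul_one]
      rw [h4]; exact smul_mem _ _ h3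
  have := Submodule.finrank_sup_add_finrank_inf_eq (gp U n) (span ℚ (Set.range F))
  rw [hsup, hdis, finrank_bot, hcard] at this
  unfold hd
  omega

lemma hs_HS (U : Submodule ℚ (PS Ω)) (hU : Grd U) (t : ℝ≥0∞) : hs (std U univ) t = HS (hq ⊤ U) t := by
  unfold hs HS
  have e := (sigmaFiberEquiv (fun s : std U univ => (s : Ω →₀ ℕ).degree))
  rw [← (sigmaFiberEquiv (fun s : std U univ => (s : Ω →₀ ℕ).degree)).tsum_eq, ENNReal.tsum_sigma']
  congr 1
  funext n
  have h1 : ∀ x : {s : std U univ // (s : Ω →₀ ℕ).degree = n},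
    t ^ ((sigmaFiberEquiv (fun s : std U univ => (s : Ω →₀ ℕ).degree) ⟨n, x⟩ : Ω →₀ ℕ)).degree = t ^ n := by
    intro x; congr 1; exact x.2
  rw [tsum_congr h1, ENNReal.tsum_const]
  congr 1
  have hc : hq ⊤ U n = Nat.card {s : Ω →₀ ℕ // s ∈ std U univ ∧ s.degree = n} := by
    unfold hq; rw [std_count U hU n]; omega
  have e2 : {s : std U univ // (s : Ω →₀ ℕ).degree = n} ≃ {s : Ω →₀ ℕ // s ∈ std U univ ∧ s.degree = n} :=
    Equiv.subtypeSubtypeEquivSubtypeInter _ (fun s : Ω →₀ ℕ => s.degree = n)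
  have hf : Finite {s : Ω →₀ ℕ // s ∈ std U univ ∧ s.degree = n} := by
    have : Set.Finite {s : Ω →₀ ℕ | s.degree = n} := by
      have := Finsupp.finite_of_degree_le (σ := Ω) n
      exact this.subset fun s hs => le_of_eq hs
    exact (this.subset (s := {s : Ω →₀ ℕ | s.degree = n}) (t := {s | s ∈ std U univ ∧ s.degree = n}) fun s hs => hs.2)
  have : Finite {s : std U univ // (s : Ω →₀ ℕ).degree = n} := Finite.of_equiv _ e2.symm
  rw [ENat.card_eq_coe_natCard, hc, card_congr e2]
  rfl
end A17
section A18
open MvPolynomial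
open scoped ENNReal
variable {Ω V : Type} [Fintype Ω] {v : Ω → V} {e : V → V → ℕ} {rk : Ω → ℕ}

lemma arf_sw (he : ∀ w, e w w = 0) (hrk : Injective rk) {i j : Ω} (hij : rk i < rk j) (hv : v i = v j)
    (hadj : ∀ x, ¬ (rk i < rk x ∧ rk x < rk j)) (p : Ω × Ω) :
    sw i j (arf v e rk p) = arf v e rk (swap i j p.1, swap i j p.2) := by
  obtain ⟨a, b⟩ := p
  unfold arf
  simp only [v_swap v hv]
  by_cases h1 : a = j ∧ b = i
  · obtain ⟨rfl, rfl⟩ := h1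
    simp [hv, he]
  by_cases h2 : a = i ∧ b = j
  · obtain ⟨rfl, rfl⟩ := h2
    simp [hv, he]
  have := order_swap hrk hij (hadj a) (hadj b) h1 h2
  rw [swap_comm] at this
  by_cases h : rk b < rk a
  · rw [if_pos h, if_pos (this.2 h), map_pow, sw_lin]
  grind

lemma pr_sw (he : ∀ w, e w w = 0) (hrk : Injective rk) {i j : Ω} (hij : rk i < rk j) (hv : v i = v j)
    (hadj : ∀ x, ¬ (rk i < rk x ∧ rk x < rk j)) (A B : Finset Ω) :
    sw i j (pr (arf v e rk) A B) = pr (arf v e rk) (pm (swap i j) A) (pm (swap i j) B) := by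
  unfold pr
  rw [map_prod]
  refine prod_bij' (fun p _ => (swap i j p.1, swap i j p.2))
    (fun p _ => (swap i j p.1, swap i j p.2)) ?_ ?_ ?_ ?_ ?_
  · intro p hp; simpa [mem_pm_swap] using hp
  · intro p hp; simpa [mem_pm_swap] using hp
  · intro p _; simp
  · intro p _; simp
  · intro p _; exact arf_sw he hrk hij hv hadj p

lemma pr_arf_ndvd (he : ∀ w, e w w = 0) {i j : Ω} (hij : i ≠ j) (hv : v i = v j) {A B : Finset Ω} (hAB : Disjoint A B) :
    ¬ lin j i ∣ pr (arf v e rk) A B := by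
  intro h
  unfold pr at h
  obtain ⟨p, hp, h⟩ := (lin_prime hij.symm).exists_mem_finset_dvd h
  unfold arf at h
  have hp' := mem_product.1 hp
  have hne : p.1 ≠ p.2 := fun h' => disjoint_left.1 hAB hp'.1 (h' ▸ hp'.2)
  split_ifs at h
  · have h0 := (lin_prime hij.symm).dvd_of_dvd_pow h
    rcases lin_dvd_lin hne h0 with ⟨h1, h2⟩ | ⟨h1, h2⟩
    · rw [h1, h2, hv, he, pow_zero] at h
      exact (lin_prime hij.symm).not_isUnit (isUnit_of_dvd_one h)
    · rw [h1, h2, hv, he, pow_zero] at h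
      exact (lin_prime hij.symm).not_isUnit (isUnit_of_dvd_one h)
  · exact (lin_prime hij.symm).not_isUnit (isUnit_of_dvd_one h)

lemma pm_conj2 (i j a b : Ω) (T : Finset Ω) :
    pm (swap i j) (pm (swap a b) T) = pm (swap (swap i j a) (swap i j b)) (pm (swap i j) T) := by
  ext x
  rw [mem_pm_swap, mem_pm_swap, mem_pm_swap, mem_pm_swap, Equiv.swap_apply_apply (swap i j) a b]
  simp

lemma pm_univ (σ : Perm Ω) : pm σ (univ : Finset Ω) = univ := by
  ext x; simp [mem_pm]

lemma vt_term_sw {i j : Ω} (hv : v i = v j) (T : Finset Ω) : sw i j (vt v T (univ \ T)) = vt v (pm (swap i j) T) (univ \ pm (swap i j) T) := by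
  rw [sw_vt v hv, pm_sdiff, pm_univ]

lemma DD_sw {i j : Ω} (hv : v i = v j) : sw i j (DD v (univ : Finset Ω)) = DD v (univ : Finset Ω) := by
  unfold DD
  rw [map_prod]
  refine prod_bij' (fun T _ => pm (swap i j) T) (fun T _ => pm (swap i j) T) ?_ ?_ ?_ ?_ ?_
  · intro T _; simp
  · intro T _; simp
  · intro T _; exact pm_pm_swap i j T
  · intro T _; exact pm_pm_swap i j T
  · intro T _; exact vt_term_sw hv T

lemma DT_sw {i j : Ω} (hv : v i = v j) (T : Finset Ω) : sw i j (DT v univ T) = DT v univ (pm (swap i j) T) := by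
  have h1 := DD_eq (v := v) (subset_univ T)
  have h2 := DD_eq (v := v) (subset_univ (pm (swap i j) T))
  have h3 := congrArg (sw i j) h1
  rw [DD_sw hv, map_mul, vt_term_sw hv, h2] at h3
  exact (mul_left_cancel₀ (vt_ne_zero v disjoint_sdiff) h3).symm

lemma UU_dm (he : ∀ w, e w w = 0) (hrk : Injective rk) {i j : Ω} (hij : rk i < rk j) (hv : v i = v j)
    (hadj : ∀ x, ¬ (rk i < rk x ∧ rk x < rk j)) (θ : V → ℤ) {f : PS Ω} (hf : f ∈ UU v e rk univ (pF v θ)) :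
    dm i j f ∈ UU v e rk univ (pF v θ) := by
  obtain ⟨g, hg, hs, rfl⟩ := hf
  have hne : i ≠ j := fun h => by rw [h] at hij; omega
  have hpr := lin_prime hne.symm
  have hex : ∀ T, ∃ x, lin j i * x = g T - sw i j (g (pm (swap i j) T)) := by
    intro T
    have h1 := hg.gkm T (subset_univ _) i (mem_univ _) j (mem_univ _) hv
    have h2 := lin_dvd_sub_sw i j (g (pm (swap i j) T))
    have h3 := dvd_add h1 h2
    rw [sub_add_sub_cancel] at h3
    have h4 : lin j i ∣ lin i j := by rw [lin_swap]; exact (neg_dvd.2 dvd_rfl)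
    obtain ⟨x, hx⟩ := h4.trans h3
    exact ⟨x, hx.symm⟩
  choose g' hg' using hex
  have hgkm : GKM v univ g' := by
    intro T hT a ha b hb hab
    by_cases hab' : a = b
    · subst hab'; simp [pm]
    have keyij : lin i j ∣ g' T - g' (pm (swap i j) T) := by
      have h1 := hg.gkm T hT i (mem_univ _) j (mem_univ _) hv
      obtain ⟨h, hh⟩ := h1
      have e1 := congrArg (sw i j) hh
      have hsl : sw i j (lin i j) = lin j i := by rw [sw_lin]; simp
      rw [map_sub, map_mul, hsl, lin_swap] at e1
      have h2 := hg' T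
      have h3 := hg' (pm (swap i j) T)
      rw [pm_pm_swap] at h3
      have : g' T - g' (pm (swap i j) T) = - (h - sw i j h) := by
        apply mul_left_cancel₀ hpr.ne_zero
        rw [lin_swap] at h2 h3 ⊢
        linear_combination h2 - h3 + hh + e1
      rw [this, dvd_neg]
      exact lin_dvd_sub_sw i j h
    by_cases hc1 : a = i ∧ b = j
    · rw [hc1.1, hc1.2]; exact keyij
    by_cases hc2 : a = j ∧ b = i
    · rw [hc2.1, hc2.2, lin_swap, neg_dvd, swap_comm]; exact keyij
    have hp := lin_prime hab'
    have hd : lin a b ∣ lin j i * (g' T - g' (pm (swap a b) T)) := by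
      rw [mul_sub, hg', hg']
      have h1 := hg.gkm T hT a ha b hb hab
      have h2 := hg.gkm (pm (swap i j) T) (subset_univ _) (swap i j a) (mem_univ _) (swap i j b) (mem_univ _)
        (by rw [v_swap v hv, v_swap v hv, hab])
      rw [← pm_conj2] at h2
      have h3 := map_dvd (sw i j) h2
      rw [sw_lin, swap_apply_self, swap_apply_self, map_sub] at h3
      have h4 := dvd_sub h1 h3
      convert h4 using 1
      ring
    refine (hp.dvd_or_dvd hd).resolve_left fun h => ?_
    rcases lin_dvd_lin hne.symm h with ⟨h1, h2⟩ | ⟨h1, h2⟩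
    · exact hc2 ⟨h1.symm, h2.symm⟩
    · exact hc1 ⟨h2.symm, h1.symm⟩
  have hfam : Fam2 v e rk univ g' := by
    refine ⟨fun T hT => ?_, hgkm⟩
    have h1 := hg.div T hT
    have h2 := hg.div (pm (swap i j) T) (subset_univ _)
    have h3 := map_dvd (sw i j) h2
    rw [pr_sw he hrk hij hv hadj, pm_sdiff, pm_pm_swap, pm_univ] at h3
    have h4 := dvd_sub h1 h3
    rw [← hg'] at h4
    obtain ⟨c, hc⟩ := h4
    rcases hpr.dvd_or_dvd (⟨_, hc.symm⟩ : lin j i ∣ _ * c) with h | ⟨c', rfl⟩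
    · exact absurd h (pr_arf_ndvd he hne hv disjoint_sdiff)
    · refine ⟨c', mul_left_cancel₀ hpr.ne_zero ?_⟩
      rw [hc]; ring
  refine ⟨g', hfam, fun T hT hne' => ?_, ?_⟩
  · by_cases h0 : g T = 0
    · have h1 : g (pm (swap i j) T) ≠ 0 := by
        intro h1
        have := hg' T
        rw [h0, h1, map_zero, sub_zero] at this
        exact hne' ((mul_eq_zero.1 this).resolve_left hpr.ne_zero)
      have h2 := hs _ (subset_univ _) h1
      unfold pF th at h2 ⊢
      rw [pm, sum_map] at h2
      simpa [v_swap v hv] using h2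
    · exact hs T hT h0
  · apply dm_eq hne
    apply mul_left_cancel₀ (DD_ne_zero (v := v) (univ : Finset Ω))
    have e1 := clear_den hgkm
    have e2 := clear_den hg.gkm
    have e3 := congrArg (sw i j) e2
    rw [map_mul, DD_sw hv, map_sum] at e3
    rw [mul_left_comm, e1, mul_sub, e2, e3, sum_pm_swap (pm_univ (swap i j)) (fun T => sw i j (DT v univ T * g T)), ← sum_sub_distrib, mul_sum]
    refine sum_congr rfl fun T _ => ?_
    rw [map_mul, DT_sw hv, pm_pm_swap, mul_left_comm, hg']; ring

variable (Ω) in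
/-- sum of all variables -/
noncomputable def ell : PS Ω := ∑ i, X i

lemma sw_ell (i j : Ω) : sw i j (ell Ω) = ell Ω := by
  unfold ell
  rw [map_sum]
  simp only [sw_X]
  exact Equiv.sum_comp (swap i j) (fun i => (X i : PS Ω))

lemma dB_ell : dB univ (ell Ω) = C (Fintype.card Ω : ℚ) := by
  unfold ell
  rw [map_sum]
  simp [dB_X]

lemma ell_hom : (ell Ω).IsHomogeneous 1 := IsHomogeneous.sum _ _ _ fun i _ => isHomogeneous_X _ _

variable (v e rk) in
/-- the ideal with the extra linear form -/
noncomputable def II (θ : V → ℤ) : Ideal (PS Ω) := UU v e rk univ (pF v θ) ⊔ Ideal.span {ell Ω}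

lemma mem_II {θ : V → ℤ} {f : PS Ω} : f ∈ II v e rk θ ↔ ∃ u ∈ UU v e rk univ (pF v θ), ∃ y, f = u + ell Ω * y := by
  unfold II
  rw [mem_sup]
  constructor
  · rintro ⟨u, hu, w, hw, rfl⟩
    obtain ⟨y, rfl⟩ := Ideal.mem_span_singleton'.1 hw
    exact ⟨u, hu, y, by ring⟩
  · rintro ⟨u, hu, y, rfl⟩
    exact ⟨u, hu, _, Ideal.mem_span_singleton'.2 ⟨y, rfl⟩, by ring⟩

lemma II_dm (he : ∀ w, e w w = 0) (hrk : Injective rk) {i j : Ω} (hij : rk i < rk j) (hv : v i = v j)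
    (hadj : ∀ x, ¬ (rk i < rk x ∧ rk x < rk j)) (θ : V → ℤ) {f : PS Ω} (hf : f ∈ II v e rk θ) :
    dm i j f ∈ II v e rk θ := by
  have hne : i ≠ j := fun h => by rw [h] at hij; omega
  obtain ⟨u, hu, y, rfl⟩ := mem_II.1 hf
  rw [map_add, dm_mul_of_fix hne (sw_ell i j)]
  exact mem_II.2 ⟨_, UU_dm he hrk hij hv hadj θ hu, _, rfl⟩

lemma II_rank [Nonempty Ω] (θ : V → ℤ) (n : ℕ) :
    hq ⊤ ((UU v e rk univ (pF v θ)).restrictScalars ℚ) (n + 1) =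
      hq ⊤ ((II v e rk θ).restrictScalars ℚ) (n + 1) + hq ⊤ ((UU v e rk univ (pF v θ)).restrictScalars ℚ) n := by
  set U := UU v e rk univ (pF v θ) with hU
  have hUI : U.restrictScalars ℚ ≤ (II v e rk θ).restrictScalars ℚ := by
    intro f hf; exact mem_II.2 ⟨f, hf, 0, by ring⟩
  have h := rank_step (A := gp ⊤ n) (A' := gp (U.restrictScalars ℚ) n) (B := gp ((II v e rk θ).restrictScalars ℚ) (n + 1))
    (B' := gp (U.restrictScalars ℚ) (n + 1)) (inf_le_inf_right _ le_top) (inf_le_inf_right _ hUI) (mulLeft ℚ (ell Ω)) ?_ ?_ ?_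
  · have h1 := hd_mono (Ω := Ω) (U := U.restrictScalars ℚ) (U' := ⊤) le_top n
    have h2 := hd_mono hUI (n + 1)
    have h3 := hd_mono (Ω := Ω) (U := (II v e rk θ).restrictScalars ℚ) (U' := ⊤) le_top (n + 1)
    unfold hq
    unfold hd at *
    omega
  · rintro a ⟨-, ha⟩
    refine ⟨mem_II.2 ⟨0, U.zero_mem, a, by simp⟩, ?_⟩
    have := ell_hom.mul (show a.IsHomogeneous n from ha)
    rw [add_comm] at this; exact this
  · rintro a ⟨-, ha⟩
    constructor
    · rintro ⟨h, -⟩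
      refine ⟨?_, ha⟩
      exact nzd_of_stable univ U (fun f hf => ULin (dB_cm (Or.inl subset_rfl)) hf) (c := (Fintype.card Ω : ℚ)) (by simp [Fintype.card_ne_zero]) dB_ell h
    · rintro ⟨h, -⟩
      refine ⟨U.mul_mem_left _ h, ?_⟩
      have := ell_hom.mul (show a.IsHomogeneous n from ha)
      rw [add_comm] at this; exact this
  · rintro x ⟨hx, hh⟩
    obtain ⟨u, hu, y, hxe⟩ := mem_II.1 hx
    have hh' : homogeneousComponent (n + 1) x = x := homogeneousComponent_of_mem hh |>.trans (if_pos rfl)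
    have hly : homogeneousComponent (n + 1) (ell Ω * y) = ell Ω * homogeneousComponent n y := by
      have := comp_mul (ell_hom (Ω := Ω)) y n
      rw [← this, add_comm]
    refine ⟨homogeneousComponent n y, ⟨trivial, homogeneousComponent_isHomogeneous n y⟩, ?_⟩
    have e1 : mulLeft ℚ (ell Ω) (homogeneousComponent n y) - x = - homogeneousComponent (n + 1) u := by
      rw [mulLeft_apply, ← hly]
      nth_rw 1 [← hh']
      rw [hxe, map_add]; ring
    rw [e1]
    exact neg_mem _ ⟨UU_comp hu _, homogeneousComponent_isHomogeneous _ _⟩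

lemma II_rank0 (θ : V → ℤ) :
    hq ⊤ ((UU v e rk univ (pF v θ)).restrictScalars ℚ) 0 = hq ⊤ ((II v e rk θ).restrictScalars ℚ) 0 := by
  unfold hq hd
  suffices h : gp ((UU v e rk univ (pF v θ)).restrictScalars ℚ) 0 = gp ((II v e rk θ).restrictScalars ℚ) 0 by rw [h]
  apply le_antisymm
  · exact inf_le_inf_right _ fun f hf => mem_II.2 ⟨f, hf, 0, by ring⟩
  · rintro x ⟨hx, hh⟩
    obtain ⟨u, hu, y, hxe⟩ := mem_II.1 hx
    have hh' : homogeneousComponent 0 x = x := homogeneousComponent_of_mem hh |>.trans (if_pos rfl)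
    have hly : homogeneousComponent 0 (ell Ω * y) = 0 := by
      rw [homogeneousComponent_zero, coeff_mul]
      have : coeff 0 (ell Ω) = 0 := ell_hom.coeff_eq_zero (by simp)
      simp [this]
    have e1 : x = homogeneousComponent 0 u := by
      rw [← hh', hxe, map_add, hly, add_zero]
    refine ⟨?_, hh⟩
    rw [e1]
    exact UU_comp hu 0

lemma II_HS [Nonempty Ω] (θ : V → ℤ) (t : ℝ≥0∞) :
    HS (hq ⊤ ((UU v e rk univ (pF v θ)).restrictScalars ℚ)) t = HS (hq ⊤ ((II v e rk θ).restrictScalars ℚ)) t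
      + t * HS (hq ⊤ ((UU v e rk univ (pF v θ)).restrictScalars ℚ)) t := by
  have h := HS_shift (hq ⊤ ((UU v e rk univ (pF v θ)).restrictScalars ℚ)) t 1
  rw [pow_one] at h
  rw [← h]
  unfold HS
  rw [← ENNReal.tsum_add]
  refine tsum_congr fun n => ?_
  rw [← add_mul, ← Nat.cast_add]
  congr 2
  cases n with
  | zero => rw [II_rank0]; simp
  | succ n => rw [II_rank]; simp

/-- The main Hilbert identity. -/
lemma main_HS [Nonempty Ω] {ι : Type} [Fintype ι] (he : ∀ w, e w w = 0) (hrk : Injective rk) (θ : V → ℤ) (P : ι → ℕ → Ω) (n : ι → ℕ)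
    (hP : ∀ c i c' i', i < n c → i' < n c' → P c i = P c' i' → c = c' ∧ i = i')
    (hPv : ∀ c i, i + 1 < n c → v (P c i) = v (P c (i + 1)))
    (hPr : ∀ c i, i + 1 < n c → rk (P c i) < rk (P c (i + 1)))
    (hPa : ∀ c i, i + 1 < n c → ∀ x, ¬ (rk (P c i) < rk x ∧ rk x < rk (P c (i + 1)))) :
    ∃ r : ℕ → ℕ, ∀ t : ℝ≥0∞, t < 1 → HS r t ≠ ⊤ ∧
      hs (stF v e rk θ univ) t ≠ ⊤ ∧
      hs (stF v e rk θ univ) t = (∏ c, qf (n c) t) * HS r t + t * hs (stF v e rk θ univ) t := by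
  refine ⟨hq (Bs P n ((II v e rk θ).restrictScalars ℚ) univ) ((II v e rk θ).restrictScalars ℚ), fun t ht => ?_⟩
  have h1 : hs (stF v e rk θ univ) t = HS (hq ⊤ ((UU v e rk univ (pF v θ)).restrictScalars ℚ)) t :=
    hs_HS _ (fun f hf n => UU_comp hf n) t
  have h2 := blocks_HS P n hP (II v e rk θ) (fun c i hi f hf => II_dm he hrk (hPr c i hi) (hPv c i hi) (hPa c i hi) θ hf) t univ
  have h3 := II_HS (v := v) (e := e) (rk := rk) θ t
  have hfin : hs (stF v e rk θ univ) t ≠ ⊤ := by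
    have h4 : stF v e rk θ univ ⊆ {s : Ω →₀ ℕ | s.support ⊆ univ} := fun s _ => subset_univ _
    refine ne_top_of_le_ne_top ?_ (hs_mono h4 t)
    rw [hs_full]
    refine pow_ne_top (ENNReal.inv_ne_top.2 ?_)
    exact (tsub_pos_of_lt ht).ne'
  rw [← h1, h2] at h3
  refine ⟨?_, hfin, h3⟩
  intro htop
  rw [htop] at h3
  have hprod : (∏ c, qf (n c) t) ≠ 0 := by
    rw [prod_ne_zero_iff]
    intro c _
    unfold qf
    rw [prod_ne_zero_iff]
    intro m _
    unfold qi
    intro h0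
    have := Finset.sum_eq_zero_iff.1 h0 0 (by simp)
    simp at this
  rw [ENNReal.mul_top hprod, top_add] at h3
  exact hfin h3
end A18
open QRep
section T1
variable {Q : FinQuiver} {k : Type} [Field k]

/-- the coboundary as a linear map -/
def cb (U V : QRep Q k) : (∀ v, U.space v →ₗ[k] V.space v) →ₗ[k] Cochain U V where
  toFun := coboundary
  map_add' := fun f g => by
    funext a
    refine LinearMap.ext fun x => ?_
    simp only [coboundary, LinearMap.sub_apply, comp_apply, Pi.add_apply, LinearMap.add_apply, map_add]
    abel
  map_smul' := fun c f => by
    funext a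
    refine LinearMap.ext fun x => ?_
    simp only [coboundary, LinearMap.sub_apply, comp_apply, Pi.smul_apply, LinearMap.smul_apply, map_smul, smul_sub, RingHom.id_apply]

lemma mem_cb {U V : QRep Q k} {f : ∀ v, U.space v →ₗ[k] V.space v} :
    f ∈ ker (cb U V) ↔ ∀ a x, f (Q.tgt a) (U.map a x) = V.map a (f (Q.src a) x) := by
  rw [mem_ker]
  constructor
  · intro h a x
    have := LinearMap.congr_fun (congrFun h a) x
    exact (sub_eq_zero.1 this).symm
  · intro h
    funext a
    refine LinearMap.ext fun x => ?_
    exact sub_eq_zero.2 (h a x).symm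

lemma finrank_C0 (U V : QRep Q k) : finrank k (∀ v, U.space v →ₗ[k] V.space v) = ∑ v, U.dimVec v * V.dimVec v := by
  rw [Module.finrank_pi_fintype]
  exact sum_congr rfl fun v _ => Module.finrank_linearMap k k _ _

lemma finrank_C1 (U V : QRep Q k) : finrank k (Cochain U V) = ∑ a, U.dimVec (Q.src a) * V.dimVec (Q.tgt a) := by
  rw [Module.finrank_pi_fintype]
  exact sum_congr rfl fun v _ => Module.finrank_linearMap k k _ _

lemma euler_le (U V : QRep Q k) : eulerFormN Q U.dimVec V.dimVec ≤ finrank k (ker (cb U V)) := by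
  have h1 := finrank_range_add_finrank_ker (cb U V)
  have h2 := finrank_le (LinearMap.range (cb U V))
  rw [finrank_C0] at h1
  rw [finrank_C1] at h2
  unfold eulerFormN eulerForm
  zify at h1 h2
  linarith

lemma euler_eq {U V : QRep Q k} (h : Surjective (cb U V)) : eulerFormN Q U.dimVec V.dimVec = finrank k (ker (cb U V)) := by
  have h1 := finrank_range_add_finrank_ker (cb U V)
  rw [range_eq_top.2 h, finrank_top, finrank_C0, finrank_C1] at h1
  unfold eulerFormN eulerForm
  zify at h1
  linarith

lemma rigid_surj {T : QRep Q k} (h : IsRigid T) : Surjective (cb T T) := fun z => by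
  obtain ⟨f, hf⟩ := h z; exact ⟨f, hf.symm⟩

lemma ext_sub {T : QRep Q k} (h : Surjective (cb T T)) (S : SubRep T) : Surjective (cb S.toRep T) := by
  intro z
  choose z' hz' using fun a => exists_extend (p := S.sub (Q.src a)) (z a)
  obtain ⟨f, hf⟩ := h z'
  refine ⟨fun v => (f v).comp (S.sub v).subtype, ?_⟩
  funext a
  rw [← hz' a, ← hf]
  rfl

lemma ind_compl {T : QRep Q k} (hT : Indecomposable T) (A B : SubRep T) (h : ∀ v, IsCompl (A.sub v) (B.sub v)) : A.IsZero ∨ B.IsZero := by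
  have h1 : IsIsomorphic T (dsum A.toRep B.toRep) := by
    refine ⟨⟨fun v => ((A.sub v).prodEquivOfIsCompl (B.sub v) (h v)).symm, fun a x => ?_⟩⟩
    obtain ⟨y, rfl⟩ := ((A.sub (Q.src a)).prodEquivOfIsCompl (B.sub (Q.src a)) (h _)).surjective x
    refine (LinearEquiv.symm_apply_eq _).2 ?_
    have h2 : ((A.sub (Q.src a)).prodEquivOfIsCompl (B.sub (Q.src a)) (h _)).symm (((A.sub (Q.src a)).prodEquivOfIsCompl (B.sub (Q.src a)) (h _)) y) = y := symm_apply_apply _ _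
    refine Eq.trans ?_ (congrArg (fun z => ((A.sub (Q.tgt a)).prodEquivOfIsCompl (B.sub (Q.tgt a)) (h _)) ((dsum A.toRep B.toRep).map a z)) h2.symm)
    exact map_add (T.map a) (y.1 : T.space (Q.src a)) y.2
  have key : ∀ A : SubRep T, A.toRep.dimVec = 0 → A.IsZero := fun A h v => Submodule.finrank_eq_zero.1 (congrFun h v)
  exact (hT.2 _ _ h1).imp (key A) (key B)

/-- Fitting's lemma -/
lemma fitting {T : QRep Q k} (hT : Indecomposable T) {φ : ∀ v, End k (T.space v)} (hφ : φ ∈ ker (cb T T)) :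
    (∀ v, Injective (φ v)) ∨ ∀ v, Injective ((LinearMap.id : End k (T.space v)) - φ v) := by
  have h1 : ∀ᶠ n : ℕ in Filter.atTop, ∀ v, IsCompl (ker (φ v ^ n : End k (T.space v))) (LinearMap.range (φ v ^ n : End k (T.space v))) :=
    Filter.eventually_all.2 fun v => LinearMap.eventually_isCompl_ker_pow_range_pow (R := k) (M := T.space v) (φ v)
  obtain ⟨n, hn, hn1⟩ := (h1.and (Filter.eventually_ge_atTop 1)).exists
  have hp : ∀ a x, (φ (Q.tgt a) ^ n) (T.map a x) = T.map a ((φ (Q.src a) ^ n) x) := by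
    intro a x
    clear hn hn1
    induction n with
    | zero => rfl
    | succ n ih => rw [pow_succ', pow_succ', End.mul_apply, End.mul_apply, ih, mem_cb.1 hφ]
  let A : SubRep T := ⟨fun v => ker (φ v ^ n : End k (T.space v)), fun a x hx => by
    rw [mem_ker] at hx ⊢; rw [hp, hx, map_zero]⟩
  let B : SubRep T := ⟨fun v => LinearMap.range (φ v ^ n : End k (T.space v)), fun a x hx => by
    obtain ⟨y, rfl⟩ := hx; exact ⟨_, hp a y⟩⟩
  rcases ind_compl hT A B hn with h | h
  · left
    intro v
    have h2 : ker (φ v ^ n : End k (T.space v)) = ⊥ := h v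
    rw [← ker_eq_bot, eq_bot_iff, ← h2]
    intro x hx
    rw [mem_ker] at hx ⊢
    obtain ⟨m, rfl⟩ := Nat.exists_eq_add_of_le' hn1
    rw [pow_succ, End.mul_apply, hx, map_zero]
  · right
    intro v
    have h2 : LinearMap.range (φ v ^ n : End k (T.space v)) = ⊥ := h v
    rw [← ker_eq_bot, eq_bot_iff]
    intro x hx
    have hx' : φ v x = x := (sub_eq_zero.1 (mem_ker.1 hx)).symm
    have h3 : ∀ m, (φ v ^ m) x = x := by
      intro m
      induction m with
      | zero => rfl
      | succ m ih => rw [pow_succ, End.mul_apply, hx', ih]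
    rw [← h2, ← h3 n]
    exact ⟨x, rfl⟩

/-- Happel–Ringel -/
lemma happel_ringel {T : QRep Q k} (hT : Indecomposable T) (hr : IsRigid T) {f : ∀ v, T.space v →ₗ[k] T.space v}
    (hf : f ∈ ker (cb T T)) (hf0 : f ≠ 0) : ∀ v, Injective (f v) := by
  have hfc := mem_cb.1 hf
  choose g hg using fun v => exists_extend (p := LinearMap.range (f v)) (LinearMap.id)
  choose σ hσ using fun v => LinearMap.exists_rightInverse_of_surjective (f v).rangeRestrict (LinearMap.range_rangeRestrict _)
  have hg' : ∀ v y, y ∈ LinearMap.range (f v) → (g v y : T.space v) = y := fun v y hy => by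
    have := LinearMap.congr_fun (hg v) ⟨y, hy⟩
    exact congrArg val this
  have hσ' : ∀ v y, f v (σ v y) = y := fun v y => by
    have := LinearMap.congr_fun (hσ v) y
    exact congrArg val this
  let e : ∀ v, T.space v →ₗ[k] T.space v := fun v => LinearMap.id - (LinearMap.range (f v)).subtype.comp (g v)
  have he : ∀ v x, e v x = x - g v x := fun v x => rfl
  have he0 : ∀ v x, x ∈ LinearMap.range (f v) → e v x = 0 := fun v x hx => by rw [he, hg' v x hx, sub_self]
  have hI : ∀ a x, x ∈ LinearMap.range (f (Q.src a)) → T.map a x ∈ LinearMap.range (f (Q.tgt a)) := by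
    rintro a _ ⟨y, rfl⟩; exact ⟨_, hfc a y⟩
  let w := coboundary (U := T) (V := T) e
  have hw : ∀ a x, w a x = T.map a (e (Q.src a) x) - e (Q.tgt a) (T.map a x) := fun a x => rfl
  have hwI : ∀ a x, w a x ∈ LinearMap.range (f (Q.tgt a)) := by
    intro a x
    rw [hw, he, he, map_sub]
    have : T.map a x - T.map a (g (Q.src a) x) - (T.map a x - g (Q.tgt a) (T.map a x)) = g (Q.tgt a) (T.map a x) - T.map a (g (Q.src a) x) := by abel
    rw [this]
    exact Submodule.sub_mem _ (g _ _).2 (hI _ _ (g _ _).2)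
  have hw0 : ∀ a x, x ∈ LinearMap.range (f (Q.src a)) → w a x = 0 := by
    intro a x hx
    rw [hw, he0 _ _ hx, he0 _ _ (hI _ _ hx), map_zero, sub_zero]
  obtain ⟨h, hh⟩ := hr (fun a => ((σ (Q.tgt a)).comp (g (Q.tgt a))).comp (w a))
  have hh' : ∀ a x, σ (Q.tgt a) (g (Q.tgt a) (w a x)) = T.map a (h (Q.src a) x) - h (Q.tgt a) (T.map a x) := fun a x =>
    LinearMap.congr_fun (congrFun hh a) x
  let φ : ∀ v, T.space v →ₗ[k] T.space v := fun v => e v - (f v).comp (h v)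
  have hφv : ∀ v x, φ v x = e v x - f v (h v x) := fun v x => rfl
  have hφ : φ ∈ ker (cb T T) := by
    rw [mem_cb]
    intro a x
    rw [hφv, hφv, map_sub, ← hfc]
    have h1 := congrArg (f (Q.tgt a)) (hh' a x)
    rw [hσ', hg' _ _ (hwI a x), hw, map_sub] at h1
    rw [sub_eq_sub_iff_add_eq_add]
    rw [sub_eq_sub_iff_add_eq_add] at h1
    rw [add_comm, ← h1, add_comm]
  rcases fitting hT hφ with hi | hi
  · have hφI : ∀ v y, y ∈ LinearMap.range (f v) → φ v y = - f v (h v y) := fun v y hy => by rw [hφv, he0 v y hy, zero_sub]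
    let K : SubRep T := ⟨fun v => ker (f v), fun a x hx => by
      rw [mem_ker] at hx ⊢; rw [hfc, hx, map_zero]⟩
    let H : SubRep T := ⟨fun v => (LinearMap.range (f v)).map (h v), fun a x hx => by
      obtain ⟨y, hy, rfl⟩ := hx
      refine ⟨T.map a y, hI a y hy, ?_⟩
      have := hh' a y
      rw [hw0 a y hy, map_zero, map_zero] at this
      exact (sub_eq_zero.1 this.symm).symm⟩
    have hc : ∀ v, IsCompl (K.sub v) (H.sub v) := by
      intro v
      have hsurj : ∀ x, x ∈ LinearMap.range (f v) → ∃ y ∈ LinearMap.range (f v), φ v y = x := by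
        have hm : ∀ y ∈ LinearMap.range (f v), φ v y ∈ LinearMap.range (f v) := fun y hy => by
          rw [hφI v y hy]; exact neg_mem _ ⟨_, rfl⟩
        have h1 : Injective ((φ v).restrict hm) := fun x y hxy =>
          Subtype.ext (hi v (congrArg val hxy))
        intro x hx
        obtain ⟨y, hy⟩ := (injective_iff_surjective.1 h1) ⟨x, hx⟩
        exact ⟨y.1, y.2, congrArg val hy⟩
      constructor
      · rw [Submodule.disjoint_def]
        rintro x hx ⟨y, hy, rfl⟩
        have h1 : φ v y = φ v 0 := by rw [hφI v y hy, map_zero, mem_ker.1 hx, neg_zero]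
        rw [hi v h1, map_zero]
      · rw [codisjoint_iff, eq_top_iff]
        intro x _
        obtain ⟨y, hy, hxy⟩ := hsurj (f v x) ⟨x, rfl⟩
        rw [hφI v y hy] at hxy
        rw [mem_sup]
        refine ⟨x + h v y, ?_, - h v y, neg_mem _ ⟨y, hy, rfl⟩, by abel⟩
        show f v _ = 0
        rw [map_add, ← hxy, neg_add_cancel]
    rcases ind_compl hT K H hc with h1 | h1
    · intro v; rw [← ker_eq_bot]; exact h1 v
    · exfalso
      apply hf0
      funext v
      refine LinearMap.ext fun x => ?_
      have h2 : h v (f v x) = 0 := by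
        have : h v (f v x) ∈ H.sub v := ⟨_, ⟨x, rfl⟩, rfl⟩
        rw [h1 v] at this
        exact (mem_bot k).1 this
      apply hi v
      rw [hφI v _ ⟨x, rfl⟩, h2, map_zero, neg_zero]
      exact (map_zero _).symm
  · intro v
    rw [injective_iff_surjective]
    intro x
    obtain ⟨y, rfl⟩ := (injective_iff_surjective.1 (hi v)) x
    have : ((LinearMap.id : End k (T.space v)) - φ v) y = g v y + f v (h v y) := by
      rw [LinearMap.sub_apply, hφv, he]; simp only [LinearMap.id_apply]; abel
    rw [this]
    exact add_mem _ (g v y).2 ⟨_, rfl⟩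
end T1
open QRep
section T2
variable {Q : FinQuiver} {k : Type} [Field k]

/-- the endomorphism algebra -/
def EndA (T : QRep Q k) : Subalgebra k (∀ v, End k (T.space v)) where
  carrier := {f | f ∈ ker (cb T T)}
  mul_mem' := by
    intro f g hf hg
    have hf := mem_cb.1 hf
    have hg := mem_cb.1 hg
    refine mem_cb.2 fun a x => ?_
    show f _ (g _ (T.map a x)) = T.map a (f _ (g _ x))
    rw [hg, hf]
  add_mem' := fun {f g} hf hg => (ker (cb T T)).add_mem (show f ∈ ker (cb T T) from hf) (show g ∈ ker (cb T T) from hg)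
  algebraMap_mem' := fun c => mem_cb.2 fun a x => (map_smul (T.map a) c x).symm

lemma euler_one {T : QRep Q k} (hT : Indecomposable T) (hr : IsRigid T) : eulerFormN Q T.dimVec T.dimVec = 1 := by
  have hne : ∃ v, Nontrivial (T.space v) := by
    by_contra h
    push Not at h
    apply hT.1
    funext v
    exact Module.finrank_zero_of_subsingleton
  obtain ⟨v0, hv0⟩ := hne
  haveI : Nontrivial (EndA T) := ⟨⟨0, 1, fun h => by
    obtain ⟨x, hx⟩ := exists_ne (0 : T.space v0)
    have h1 : (0 : ∀ v, End k (T.space v)) v0 x = (1 : ∀ v, End k (T.space v)) v0 x := by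
      rw [show (0 : ∀ v, End k (T.space v)) = 1 from congrArg val h]
    exact hx h1.symm⟩⟩
  haveI : NoZeroDivisors (EndA T) := ⟨by
    intro f g hfg
    by_contra hc
    push Not at hc
    apply hc.2
    have hi := happel_ringel hT hr (show f.1 ∈ ker (cb T T) from f.2) (fun h => hc.1 (Subtype.ext h))
    apply Subtype.ext
    funext v
    refine LinearMap.ext fun x => ?_
    apply hi v
    have h1 : (f.1 * g.1) v x = 0 := by
      rw [show f.1 * g.1 = 0 from congrArg val hfg]; rfl
    refine Eq.trans h1 (map_zero _).symm⟩
  haveI : IsDomain (EndA T) := NoZeroDivisors.to_isDomain _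
  have h2 : finrank k (ker (cb T T)) = finrank k (EndA T) :=
    LinearEquiv.finrank_eq
      { toFun := fun f => (⟨f.1, f.2⟩ : EndA T)
        invFun := fun f => ⟨f.1, f.2⟩
        map_add' := fun _ _ => rfl
        map_smul' := fun _ _ => rfl
        left_inv := fun _ => rfl
        right_inv := fun _ => rfl }
  have h3 : 0 < finrank k (EndA T) := Module.finrank_pos
  letI : DivisionRing (EndA T) := divisionRingOfFiniteDimensional k (EndA T)
  have hd : ∀ v, finrank k (EndA T) ∣ T.dimVec v := by
    intro v
    letI : Module (EndA T) (T.space v) := Module.compHom (T.space v) ((Pi.evalRingHom (fun v => End k (T.space v)) v).comp (EndA T).val.toRingHom)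
    haveI : IsScalarTower k (EndA T) (T.space v) := ⟨fun c f x => rfl⟩
    exact ⟨_, (Module.finrank_mul_finrank k (EndA T) (T.space v)).symm⟩
  have h1 := euler_eq (rigid_surj hr)
  rw [h2] at h1
  choose β hβ using hd
  generalize finrank k (EndA T) = d at *
  have h4 : eulerFormN Q T.dimVec T.dimVec = d * (d * eulerFormN Q β β) := by
    unfold eulerFormN eulerForm
    simp only [hβ]
    rw [mul_sub, mul_sub, mul_sum, mul_sum, mul_sum, mul_sum]
    congr 1
    · exact sum_congr rfl fun v _ => by push_cast; ring
    · exact sum_congr rfl fun v _ => by push_cast; ring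
  rw [h1] at h4
  have h5 : (d:ℤ) * eulerFormN Q β β = 1 := by
    have : (d:ℤ) ≠ 0 := by exact_mod_cast h3.ne'
    apply mul_left_cancel₀ this
    rw [← h4, mul_one]
  have h6 : (d:ℤ) = 1 := Int.eq_one_of_dvd_one (by positivity) ⟨_, h5.symm⟩
  rw [h1, h6]

end T2
open QRep
section T3
variable {Q : FinQuiver} {k : Type} [Field k]

/-- the antisymmetrised Euler form -/
def wq (Q : FinQuiver) (α β : Q.V → ℕ) : ℤ := eulerFormN Q β α - eulerFormN Q α β

/-- the corresponding weight -/
noncomputable def thQ (Q : FinQuiver) (α : Q.V → ℕ) (w : Q.V) : ℤ :=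
  ∑ a, ((if Q.tgt a = w then (α (Q.src a) : ℤ) else 0) - (if Q.src a = w then (α (Q.tgt a) : ℤ) else 0))

lemma th_sum (α β : Q.V → ℕ) : ∑ w, thQ Q α w * β w = wq Q α β := by
  have h1 : ∑ w, thQ Q α w * β w = ∑ a, ((α (Q.src a) : ℤ) * β (Q.tgt a) - β (Q.src a) * α (Q.tgt a)) := by
    unfold thQ
    simp only [sum_mul]
    rw [sum_comm]
    refine sum_congr rfl fun a _ => ?_
    simp only [sub_mul, ite_mul, zero_mul, sum_sub_distrib, Finset.sum_ite_eq, mem_univ, if_true]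
    ring
  rw [h1, sum_sub_distrib]
  unfold wq eulerFormN eulerForm
  have h2 : ∑ v, (β v : ℤ) * α v = ∑ v, (α v : ℤ) * β v := sum_congr rfl fun v _ => mul_comm _ _
  rw [h2]; ring

lemma wq_add (α β γ : Q.V → ℕ) : wq Q α (β + γ) = wq Q α β + wq Q α γ := by
  rw [← th_sum, ← th_sum, ← th_sum, ← sum_add_distrib]
  refine sum_congr rfl fun w _ => ?_
  rw [Pi.add_apply]; push_cast; ring

lemma wq_self (α : Q.V → ℕ) : wq Q α α = 0 := sub_self _

lemma wq_zero (α : Q.V → ℕ) : wq Q α 0 = 0 := by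
  rw [← th_sum]; simp

variable {T : QRep Q k} (hs : Surjective (cb T T)) (h1 : eulerFormN Q T.dimVec T.dimVec = 1)

lemma ne_zero_of_one (h1 : eulerFormN Q T.dimVec T.dimVec = 1) : ∃ v, ∃ x : T.space v, x ≠ 0 := by
  by_contra h
  push Not at h
  have : T.dimVec = 0 := by
    funext v
    haveI : Subsingleton (T.space v) := ⟨fun x y => by rw [h v x, h v y]⟩
    exact Module.finrank_zero_of_subsingleton
  rw [this] at h1
  simp [eulerFormN, eulerForm] at h1

include hs h1 in
lemma end_scalar {f : ∀ v, T.space v →ₗ[k] T.space v} (hf : f ∈ ker (cb T T)) : ∃ c : k, ∀ v x, f v x = c • x := by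
  have h2 := euler_eq hs
  rw [h1] at h2
  have h3 : finrank k (ker (cb T T)) = 1 := by exact_mod_cast h2.symm
  let i : ker (cb T T) := ⟨fun v => LinearMap.id, mem_cb.2 fun a x => rfl⟩
  have hi : i ≠ 0 := by
    intro h
    obtain ⟨v, x, hx⟩ := ne_zero_of_one h1
    exact hx (LinearMap.congr_fun (congrFun (congrArg val h) v) x)
  obtain ⟨c, hc⟩ := (finrank_eq_one_iff_of_nonzero' i hi).1 h3 ⟨f, hf⟩
  refine ⟨c, fun v x => ?_⟩
  exact (LinearMap.congr_fun (congrFun (congrArg val hc) v) x).symm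

include hs h1 in
lemma stab_T (S : SubRep T) : 0 < wq Q T.dimVec S.dim ∨ S.IsZero ∨ S.IsFull := by
  by_contra hc
  push Not at hc
  obtain ⟨hw, hz, hf⟩ := hc
  apply absurd hw; push Not
  have e1 := euler_eq (ext_sub hs S)
  have e2 := euler_le T S.toRep
  have e3 : finrank k (ker (cb T S.toRep)) = 0 := by
    rw [Submodule.finrank_eq_zero, eq_bot_iff]
    intro g hg
    obtain ⟨c, hc⟩ := end_scalar (f := fun v => (S.sub v).subtype.comp (g v)) hs h1 (mem_cb.2 fun a x => by
      exact congrArg val (mem_cb.1 hg a x))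
    by_cases h0 : c = 0
    · refine (mem_bot k).2 ?_
      funext v
      refine LinearMap.ext fun x => Subtype.ext ?_
      have := hc v x
      rw [h0, zero_smul] at this
      exact this
    · exfalso
      apply hf
      intro v
      rw [eq_top_iff]
      intro x _
      have h2 := hc v (c⁻¹ • x)
      rw [smul_smul, mul_inv_cancel₀ h0, one_smul] at h2
      rw [← h2]
      exact (g v (c⁻¹ • x)).2
  have e4 : 0 < finrank k (ker (cb S.toRep T)) := by
    rw [Nat.pos_iff_ne_zero]
    intro h
    rw [Submodule.finrank_eq_zero] at h
    let ic : ∀ v, S.toRep.space v →ₗ[k] T.space v := fun v => (S.sub v).subtype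
    have hm : ic ∈ ker (cb S.toRep T) := mem_cb.2 fun a x => rfl
    rw [h] at hm
    have hm := (mem_bot (M := ∀ v, S.toRep.space v →ₗ[k] T.space v) k).1 hm
    apply hz
    intro v
    rw [eq_bot_iff]
    intro x hx
    exact (mem_bot k).2 (LinearMap.congr_fun (congrFun hm v) (⟨x, hx⟩ : S.sub v))
  have e5 : S.toRep.dimVec = S.dim := rfl
  rw [e5] at e1 e2
  unfold wq
  rw [e1]
  rw [e3] at e2
  zify at e4
  push_cast at e2
  linarith

lemma dim_zero {X : QRep Q k} {S : SubRep X} (h : S.IsZero) : S.dim = 0 := by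
  funext v
  show finrank k (S.sub v) = 0
  rw [h v]; exact finrank_bot k _

lemma dim_full {X : QRep Q k} {S : SubRep X} (h : S.IsFull) : S.dim = X.dimVec := by
  funext v
  show finrank k (S.sub v) = _
  rw [h v]; exact finrank_top k _

include hs h1 in
lemma semi_T (S : SubRep T) : 0 ≤ wq Q T.dimVec S.dim := by
  rcases stab_T hs h1 S with h | h | h
  · exact h.le
  · rw [dim_zero h, wq_zero]
  · rw [dim_full h, wq_self]

include hs h1 in
lemma iso_of_semi (X : QRep Q k) (hX : X.dimVec = T.dimVec) (hss : ∀ L : SubRep X, 0 ≤ wq Q T.dimVec L.dim) : IsIsomorphic X T := by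
  have e1 := euler_le T X
  rw [hX, h1] at e1
  have e2 : ker (cb T X) ≠ ⊥ := by
    intro h
    rw [h, finrank_bot] at e1
    norm_num at e1
  obtain ⟨g, hg, hg0⟩ := Submodule.exists_mem_ne_zero_of_ne_bot e2
  have hgc := mem_cb.1 hg
  let N : SubRep T := ⟨fun v => ker (g v), fun a x hx => by
    rw [mem_ker] at hx ⊢; rw [hgc, hx, map_zero]⟩
  let I : SubRep X := ⟨fun v => LinearMap.range (g v), fun a x hx => by
    obtain ⟨y, rfl⟩ := hx; exact ⟨_, hgc a y⟩⟩
  have hd : I.dim + N.dim = T.dimVec := by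
    funext v
    exact finrank_range_add_finrank_ker (g v)
  have hw := wq_add T.dimVec I.dim N.dim
  rw [hd, wq_self] at hw
  have hI := hss I
  have hi : ∀ v, Injective (g v) := by
    rcases stab_T hs h1 N with h | h | h
    · linarith
    · intro v; rw [← ker_eq_bot]; exact h v
    · exfalso
      apply hg0
      funext v
      exact LinearMap.ker_eq_top.1 (h v)
  have hb : ∀ v, Bijective (g v) := fun v =>
    ⟨hi v, (LinearMap.injective_iff_surjective_of_finrank_eq_finrank (congrFun hX v).symm).1 (hi v)⟩
  refine ⟨⟨fun v => (LinearEquiv.ofBijective (g v) (hb v)).symm, fun a x => ?_⟩⟩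
  obtain ⟨y, rfl⟩ := (hb _).2 x
  rw [← hgc]
  have : ∀ v y, (LinearEquiv.ofBijective (g v) (hb v)).symm (g v y) = y := fun v y =>
    (LinearEquiv.ofBijective (g v) (hb v)).symm_apply_apply y
  rw [this, this]

include hs h1 in
lemma semi_of_iso (X : QRep Q k) (h : IsIsomorphic X T) (L : SubRep X) : 0 ≤ wq Q T.dimVec L.dim := by
  obtain ⟨φ⟩ := h
  let S : SubRep T := ⟨fun v => (L.sub v).map (φ.app v).toLinearMap, fun a x hx => by
    obtain ⟨y, hy, rfl⟩ := hx
    exact ⟨_, L.stable a y hy, φ.comm a y⟩⟩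
  have hd : L.dim = S.dim := by
    funext v
    exact (finrank_map_eq (φ.app v) (L.sub v)).symm
  rw [hd]
  exact semi_T hs h1 S

include hs h1 in
lemma card_iso [Fintype k] (X : QRep Q k) (h : IsIsomorphic X T) : Nat.card (Iso X T) = Fintype.card k - 1 := by
  obtain ⟨φ⟩ := h
  have : Bijective (fun u : kˣ => (⟨fun v => (φ.app v).trans (LinearEquiv.smulOfUnit u), fun a x => by
      show u • φ.app _ (X.map a x) = T.map a (u • φ.app _ x)
      rw [φ.comm]; exact (map_smul (T.map a) (u : k) _).symm⟩ : Iso X T)) := by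
    constructor
    · intro u u' huu
      obtain ⟨v, x, hx⟩ := ne_zero_of_one h1
      have h2 : ∀ y, (u:k) • φ.app v y = (u':k) • φ.app v y := fun y =>
        LinearEquiv.congr_fun (congrFun (congrArg Iso.app huu) v) y
      have h3 := h2 ((φ.app v).symm x)
      rw [apply_symm_apply] at h3
      have h4 : ((u:k) - u') • x = 0 := by rw [sub_smul, h3, sub_self]
      rcases smul_eq_zero.1 h4 with h5 | h5
      · exact Units.ext (sub_eq_zero.1 h5)
      · exact absurd h5 hx
    · intro ψ
      obtain ⟨c, hc⟩ := end_scalar (f := fun v => (ψ.app v).toLinearMap.comp (φ.app v).symm.toLinearMap) hs h1 (mem_cb.2 fun a x => by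
        obtain ⟨y, rfl⟩ := (φ.app _).surjective x
        show ψ.app _ ((φ.app _).symm (T.map a (φ.app _ y))) = T.map a (ψ.app _ ((φ.app _).symm (φ.app _ y)))
        rw [← φ.comm, symm_apply_apply, symm_apply_apply, ψ.comm])
      have hc' : ∀ v x, ψ.app v x = c • φ.app v x := fun v x => by
        have h2 := hc v (φ.app v x)
        rw [← h2]
        show _ = ψ.app v ((φ.app v).symm (φ.app v x))
        rw [symm_apply_apply]
      have hc0 : c ≠ 0 := by
        rintro rfl
        obtain ⟨v, x, hx⟩ := ne_zero_of_one h1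
        apply hx
        have h2 := hc' v ((ψ.app v).symm x)
        rw [apply_symm_apply, zero_smul] at h2
        exact h2
      refine ⟨Units.mk0 c hc0, ?_⟩
      rcases ψ with ⟨ψ, hψ⟩
      beta_reduce
      congr 1
      funext v
      refine LinearEquiv.ext fun x => ?_
      exact (hc' v x).symm
  rw [← card_congr (ofBijective _ this), Nat.card_eq_fintype_card, Fintype.card_units]

end T3
open QRep
section T4
variable {Q : FinQuiver}

lemma chain_of_trans {u w : Q.V} (h : Relation.TransGen (fun u w => ∃ a, Q.src a = u ∧ Q.tgt a = w) u w) :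
    ∃ (n : ℕ) (c : Fin (n + 1) → Q.A), (∀ i : Fin n, Q.tgt (c i.castSucc) = Q.src (c i.succ)) ∧ Q.src (c 0) = u ∧ Q.tgt (c (Fin.last n)) = w := by
  induction h with
  | single h =>
    obtain ⟨a, h1, h2⟩ := h
    exact ⟨0, fun _ => a, fun i => i.elim0, h1, h2⟩
  | tail _ h ih =>
    obtain ⟨a, h1, h2⟩ := h
    obtain ⟨n, c, hc, hc0, hcn⟩ := ih
    refine ⟨n + 1, Fin.snoc (α := fun _ => Q.A) c a, ?_, ?_, ?_⟩
    · intro i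
      rw [Fin.snoc_castSucc]
      induction i using Fin.lastCases with
      | last => rw [Fin.succ_last, Fin.snoc_last, h1, hcn]
      | cast i => rw [Fin.succ_castSucc, Fin.snoc_castSucc]; exact hc i
    · rw [← Fin.castSucc_zero, Fin.snoc_castSucc]; exact hc0
    · rw [Fin.snoc_last]; exact h2

lemma exists_pos (hQ : NoCycles Q) : ∃ pos : Q.V → ℕ, Injective pos ∧ ∀ a, pos (Q.tgt a) < pos (Q.src a) := by
  let r : Q.V → Q.V → Prop := fun u w => ∃ a, Q.src a = u ∧ Q.tgt a = w
  have hirr : ∀ u, ¬ Relation.TransGen r u u := by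
    intro u h
    obtain ⟨n, c, hc, h0, hn⟩ := chain_of_trans h
    exact hQ ⟨n, c, hc, by rw [hn, h0]⟩
  let p : Q.V → ℕ := fun w => (univ.filter fun u => Relation.TransGen r w u).card
  have hp : ∀ a, p (Q.tgt a) < p (Q.src a) := by
    intro a
    have hr : Relation.TransGen r (Q.src a) (Q.tgt a) := Relation.TransGen.single ⟨a, rfl, rfl⟩
    apply card_lt_card
    rw [ssubset_iff_of_subset]
    · refine ⟨Q.tgt a, ?_, ?_⟩
      · rw [mem_filter]; exact ⟨mem_univ _, hr⟩
      · rw [mem_filter]; exact fun h => hirr _ h.2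
    · intro u hu
      rw [mem_filter] at hu ⊢
      exact ⟨mem_univ _, hr.trans hu.2⟩
  let e := Fintype.equivFin Q.V
  have key : ∀ u w, p u < p w → p u * Fintype.card Q.V + e u < p w * Fintype.card Q.V + e w := by
    intro u w h
    have h1 := (e u).2
    have h2 : (p u + 1) * Fintype.card Q.V ≤ p w * Fintype.card Q.V := Nat.mul_le_mul_right _ h
    rw [add_mul, one_mul] at h2
    omega
  refine ⟨fun w => p w * Fintype.card Q.V + e w, ?_, fun a => key _ _ (hp a)⟩
  intro u w h
  rcases lt_trichotomy (p u) (p w) with h1 | h1 | h1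
  · exact absurd h (key _ _ h1).ne
  · beta_reduce at h
    rw [h1] at h
    exact e.injective (Fin.ext (by omega))
  · exact absurd h (key _ _ h1).ne'

lemma src_ne_tgt (hQ : NoCycles Q) (a : Q.A) : Q.src a ≠ Q.tgt a := by
  obtain ⟨pos, _, h⟩ := exists_pos hQ
  intro h1
  have := h a
  rw [h1] at this
  exact lt_irrefl _ this

/-- block sizes -/
def bn (α γ : Q.V → ℕ) (c : Q.V × Bool) : ℕ := if c.2 = true then γ c.1 else α c.1 - γ c.1

lemma exists_data (hQ : NoCycles Q) (α γ : Q.V → ℕ) (hγ : γ ≤ α) (hα : ∃ w, α w ≠ 0) :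
    ∃ (Ω : Type) (_ : Fintype Ω) (_ : Nonempty Ω) (v : Ω → Q.V) (rk : Ω → ℕ) (Y : Finset Ω), Injective rk ∧
      (∀ w, (univ.filter fun i => v i = w).card = α w) ∧ (∀ w, (Y.filter fun i => v i = w).card = γ w) ∧
      (∀ a i j, v i = Q.src a → v j = Q.tgt a → (rk j < rk i ↔ ¬ (i ∈ Y ∧ j ∉ Y))) ∧
      ∃ P : Q.V × Bool → ℕ → Ω,
        (∀ c i c' i', i < bn α γ c → i' < bn α γ c' → P c i = P c' i' → c = c' ∧ i = i') ∧
        (∀ c i, i + 1 < bn α γ c → v (P c i) = v (P c (i+1))) ∧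
        (∀ c i, i + 1 < bn α γ c → rk (P c i) < rk (P c (i+1))) ∧
        (∀ c i, i + 1 < bn α γ c → ∀ x, ¬(rk (P c i) < rk x ∧ rk x < rk (P c (i+1)))) := by
  obtain ⟨pos, hpi, hpa⟩ := exists_pos hQ
  obtain ⟨M, hM⟩ : ∃ M, ∀ w, pos w < M := ⟨∑ w, pos w + 1, fun w => Nat.lt_succ_of_le (Finset.single_le_sum (f := pos) (fun _ _ => Nat.zero_le _) (mem_univ w))⟩
  obtain ⟨N, hN⟩ : ∃ N, ∀ c, bn α γ c ≤ N := ⟨∑ c, bn α γ c, fun c => Finset.single_le_sum (f := bn α γ) (fun _ _ => Nat.zero_le _) (mem_univ c)⟩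
  let p2 : Q.V × Bool → ℕ := fun c => if c.2 = true then pos c.1 else M + pos c.1
  have hp2 : Injective p2 := by
    rintro ⟨u, b⟩ ⟨w, b'⟩ h
    have := hM u
    have := hM w
    cases b <;> cases b' <;> simp [p2] at h
    · rw [hpi h]
    · omega
    · omega
    · rw [hpi h]
  let Ω := Σ c : Q.V × Bool, Fin (bn α γ c)
  let rk : Ω → ℕ := fun x => p2 x.1 * N + x.2.1
  have hlt : ∀ x y : Ω, p2 x.1 < p2 y.1 → rk x < rk y := by
    intro x y h
    have h1 := lt_of_lt_of_le x.2.2 (hN x.1)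
    have h2 : (p2 x.1 + 1) * N ≤ p2 y.1 * N := Nat.mul_le_mul_right _ h
    rw [add_mul, one_mul] at h2
    show p2 x.1 * N + x.2.1 < p2 y.1 * N + y.2.1
    omega
  have hrk : Injective rk := by
    rintro ⟨c, i⟩ ⟨c', i'⟩ h
    rcases lt_trichotomy (p2 c) (p2 c') with h1 | h1 | h1
    · exact absurd h (hlt _ _ h1).ne
    · obtain rfl := hp2 h1
      have : i = i' := Fin.ext (by simpa [rk] using h)
      rw [this]
    · exact absurd h (hlt _ _ h1).ne'
  have hne : Nonempty Ω := by
    obtain ⟨w, hw⟩ := hα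
    by_cases h : γ w = 0
    · exact ⟨⟨(w, false), ⟨0, by simp [bn, h]; omega⟩⟩⟩
    · exact ⟨⟨(w, true), ⟨0, by simp [bn]; omega⟩⟩⟩
  obtain ⟨o⟩ := hne
  have hcnt : ∀ w b, (univ.filter fun x : Ω => x.1 = (w, b)).card = bn α γ (w, b) := by
    intro w b
    have : (univ.filter fun x : Ω => x.1 = (w, b)) = univ.map ⟨fun i : Fin (bn α γ (w, b)) => (⟨(w, b), i⟩ : Ω), fun i j h => by simpa using h⟩ := by
      ext ⟨c, i⟩
      rw [mem_filter, Finset.mem_map]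
      constructor
      · rintro ⟨_, h⟩
        dsimp only at h
        subst h
        exact ⟨i, mem_univ _, rfl⟩
      · rintro ⟨j, _, h⟩
        refine ⟨mem_univ _, ?_⟩
        rw [← h]; rfl
    rw [this, Finset.card_map, card_univ, Fintype.card_fin]
  let Y : Finset Ω := univ.filter fun x => x.1.2 = true
  have hY : ∀ x, x ∈ Y ↔ x.1.2 = true := fun x => by rw [mem_filter]; exact ⟨fun h => h.2, fun h => ⟨mem_univ _, h⟩⟩
  have hP : ∀ c i (h : i < bn α γ c), (if h : i < bn α γ c then (⟨c, ⟨i, h⟩⟩ : Ω) else o) = ⟨c, ⟨i, h⟩⟩ := fun c i h => dif_pos h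
  refine ⟨Ω, inferInstance, ⟨o⟩, fun x => x.1.1, rk, Y, hrk, ?_, ?_, ?_, fun c i => if h : i < bn α γ c then (⟨c, ⟨i, h⟩⟩ : Ω) else o, ?_, ?_, ?_, ?_⟩
  · intro w
    have h1 : (univ.filter fun x : Ω => x.1.1 = w) = (univ.filter fun x : Ω => x.1 = (w, true)) ∪ (univ.filter fun x : Ω => x.1 = (w, false)) := by
      ext ⟨⟨u, b⟩, i⟩
      rw [mem_union, mem_filter, mem_filter, mem_filter]
      cases b <;> simp
    rw [h1, card_union_of_disjoint, hcnt, hcnt]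
    · have hle : γ w ≤ α w := hγ w
      simp [bn]; omega
    · rw [disjoint_left]
      intro x hx hx'
      have e1 := (mem_filter.1 hx).2
      have e2 := (mem_filter.1 hx').2
      rw [e1] at e2
      simp at e2
  · intro w
    have h1 : (Y.filter fun x : Ω => x.1.1 = w) = (univ.filter fun x : Ω => x.1 = (w, true)) := by
      ext ⟨⟨u, b⟩, i⟩
      rw [mem_filter, hY, mem_filter]
      cases b <;> simp
    rw [h1, hcnt]; simp [bn]
  · intro a i j hi hj
    rw [hY, hY]
    have h1 := hpa a
    rw [← hi, ← hj] at h1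
    have h2 := hM i.1.1
    have h3 := hM j.1.1
    obtain ⟨⟨u, b⟩, i⟩ := i
    obtain ⟨⟨w, b'⟩, j⟩ := j
    dsimp only at h1 h2 h3 ⊢
    cases b <;> cases b' <;> simp only [Bool.false_eq_true, false_and, not_false_eq_true, true_and, iff_true, not_true_eq_false, iff_false, not_lt]
    · apply hlt; simp [p2]; omega
    · apply hlt; simp [p2]; omega
    · apply le_of_lt; apply hlt; simp [p2]; omega
    · apply hlt; simp [p2]; omega
  · intro c i c' i' hi hi' h
    beta_reduce at h
    rw [hP c i hi, hP c' i' hi'] at h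
    have h1 : c = c' := congrArg (fun x : Ω => x.1) h
    refine ⟨h1, ?_⟩
    exact congrArg (fun x : Ω => x.2.1) h
  · intro c i hi
    beta_reduce
    rw [hP c i (by omega), hP c (i+1) hi]
  · intro c i hi
    beta_reduce
    rw [hP c i (by omega), hP c (i+1) hi]
    show p2 c * N + i < p2 c * N + (i + 1)
    omega
  · intro c i hi x hx
    beta_reduce at hx
    rw [hP c i (by omega), hP c (i+1) hi] at hx
    have h1 : p2 c * N + i < rk x := hx.1
    have h2 : rk x < p2 c * N + (i + 1) := hx.2
    omega
end T4
section T5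
variable {K : Type} [Field K] [Fintype K]

lemma fin_of_fd {A : Type} [AddCommGroup A] [Module K A] [FiniteDimensional K A] : Finite A := Module.finite_of_finite K

lemma card_equiv {A B : Type} [AddCommGroup A] [Module K A] [AddCommGroup B] [Module K B] [FiniteDimensional K A] [FiniteDimensional K B]
    {n : ℕ} (hA : finrank K A = n) (hB : finrank K B = n) : Nat.card (A ≃ₗ[K] B) = Nat.card (GeneralLinearGroup (Fin n) K) := by
  have a : A ≃ₗ[K] (Fin n → K) := ofFinrankEq _ _ (by rw [hA, finrank_fin_fun])
  have b : B ≃ₗ[K] (Fin n → K) := ofFinrankEq _ _ (by rw [hB, finrank_fin_fun])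
  rw [card_congr ((GeneralLinearGroup.toLin (n := Fin n) (R := K)).trans (LinearMap.GeneralLinearGroup.generalLinearEquiv K (Fin n → K))).toEquiv]
  refine card_congr ⟨fun e => (a.symm.trans e).trans b, fun e => (a.trans e).trans b.symm, fun e => ?_, fun e => ?_⟩
  · refine LinearEquiv.ext fun x => ?_
    simp
  · refine LinearEquiv.ext fun x => ?_
    simp

lemma exists_coord {A : Type} [AddCommGroup A] [Module K A] [FiniteDimensional K A] (M : Submodule K A) {m d : ℕ} (hA : finrank K A = m + d)
    (hM : finrank K M = m) : ∃ e : A ≃ₗ[K] (Fin d → K) × (Fin m → K), ∀ x, x ∈ M ↔ (e x).1 = 0 := by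
  obtain ⟨M', hc⟩ := Submodule.exists_isCompl M
  have h1 := Submodule.finrank_add_eq_of_isCompl hc
  have a : M ≃ₗ[K] (Fin m → K) := ofFinrankEq _ _ (by rw [hM, finrank_fin_fun])
  have b : M' ≃ₗ[K] (Fin d → K) := ofFinrankEq _ _ (by rw [finrank_fin_fun]; omega)
  refine ⟨(M'.prodEquivOfIsCompl M hc.symm).symm.trans (b.prodCongr a), fun x => ?_⟩
  have : (((M'.prodEquivOfIsCompl M hc.symm).symm.trans (b.prodCongr a)) x).1 = b (((M'.prodEquivOfIsCompl M hc.symm).symm x).1) := rfl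
  rw [this, LinearEquiv.map_eq_zero_iff]
  exact (Submodule.prodEquivOfIsCompl_symm_apply_fst_eq_zero (p := M') (q := M) hc.symm).symm

lemma card_skew (m d : ℕ) : Nat.card {e : ((Fin d → K) × (Fin m → K)) ≃ₗ[K] ((Fin d → K) × (Fin m → K)) // ∀ x, x.1 = 0 ↔ (e x).1 = 0} =
    Nat.card (GeneralLinearGroup (Fin m) K) * Nat.card (GeneralLinearGroup (Fin d) K) * Fintype.card K ^ (m * d) := by
  have h1 := card_equiv (K := K) (A := Fin m → K) (B := Fin m → K) (finrank_fin_fun K) (finrank_fin_fun K)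
  have h2 := card_equiv (K := K) (A := Fin d → K) (B := Fin d → K) (finrank_fin_fun K) (finrank_fin_fun K)
  have h3 : Nat.card ((Fin d → K) →ₗ[K] (Fin m → K)) = Fintype.card K ^ (m * d) := by
    rw [Module.natCard_eq_pow_finrank (K := K), Module.finrank_linearMap, finrank_fin_fun, finrank_fin_fun, mul_comm, Nat.card_eq_fintype_card]
  rw [← h1, ← h2, ← h3, ← card_prod, ← card_prod]
  symm
  refine card_congr (ofBijective (fun p => ⟨LinearEquiv.skewProd p.1.2 p.1.1 p.2, fun x => ?_⟩) ⟨?_, ?_⟩)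
  · rw [skewProd_apply]
    exact (LinearEquiv.map_eq_zero_iff _).symm
  · rintro ⟨⟨a, b⟩, f⟩ ⟨⟨a', b'⟩, f'⟩ h
    have h4 : ∀ x y, (b x, a y + f x) = (b' x, a' y + f' x) := fun x y => by
      have := LinearEquiv.congr_fun (congrArg val h) (x, y)
      rw [skewProd_apply, skewProd_apply] at this
      exact this
    have h5 : b = b' := LinearEquiv.ext fun x => congrArg Prod.fst (h4 x 0)
    have h6 : a = a' := LinearEquiv.ext fun y => by simpa using congrArg Prod.snd (h4 0 y)
    have h7 : f = f' := LinearMap.ext fun x => by simpa using congrArg Prod.snd (h4 x 0)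
    rw [h5, h6, h7]
  · rintro ⟨e, he⟩
    have ha : Injective (((snd K _ _).comp e.toLinearMap).comp (inr K (Fin d → K) (Fin m → K))) := by
      rw [injective_iff_map_eq_zero]
      intro y hy
      have h4 : (e (0, y)).1 = 0 := (he _).1 rfl
      have h5 : e (0, y) = 0 := Prod.ext h4 hy
      exact congrArg Prod.snd ((LinearEquiv.map_eq_zero_iff e).1 h5)
    have hb : Injective (((fst K _ _).comp e.toLinearMap).comp (inl K (Fin d → K) (Fin m → K))) := by
      rw [injective_iff_map_eq_zero]
      intro x hx
      exact (he (x, 0)).2 hx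
    refine ⟨⟨⟨ofInjectiveEndo _ ha, ofInjectiveEndo _ hb⟩, ((snd K _ _).comp e.toLinearMap).comp (inl K (Fin d → K) (Fin m → K))⟩, ?_⟩
    apply Subtype.ext
    refine LinearEquiv.ext fun x => ?_
    obtain ⟨x, y⟩ := x
    have h6 : e (x, y) = e (x, 0) + e (0, y) := by rw [← map_add]; simp
    have h4 : (e (0, y)).1 = 0 := (he _).1 rfl
    show ((e (x, 0)).1, (e (0, y)).2 + (e (x, 0)).2) = e (x, y)
    rw [h6]
    refine Prod.ext ?_ ?_
    · rw [Prod.fst_add, h4, add_zero]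
    · rw [Prod.snd_add, add_comm]

lemma card_flag {A B : Type} [AddCommGroup A] [Module K A] [AddCommGroup B] [Module K B] [FiniteDimensional K A] [FiniteDimensional K B]
    (M : Submodule K A) (L : Submodule K B) {m d : ℕ} (hA : finrank K A = m + d) (hB : finrank K B = m + d)
    (hM : finrank K M = m) (hL : finrank K L = m) : Nat.card {e : A ≃ₗ[K] B // M.map e.toLinearMap = L} =
    Nat.card (GeneralLinearGroup (Fin m) K) * Nat.card (GeneralLinearGroup (Fin d) K) * Fintype.card K ^ (m * d) := by
  obtain ⟨a, ha⟩ := exists_coord M hA hM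
  obtain ⟨b, hb⟩ := exists_coord L hB hL
  have key : ∀ e : A ≃ₗ[K] B, M.map e.toLinearMap = L ↔ ∀ x, x ∈ M ↔ e x ∈ L := by
    intro e
    constructor
    · rintro rfl x
      constructor
      · intro h; exact ⟨x, h, rfl⟩
      · rintro ⟨y, hy, h⟩
        rw [← e.injective h]; exact hy
    · intro h
      ext y
      constructor
      · rintro ⟨x, hx, rfl⟩; exact (h x).1 hx
      · intro hy
        obtain ⟨x, rfl⟩ := e.surjective y
        exact ⟨x, (h x).2 hy, rfl⟩
  rw [← card_skew]
  refine card_congr ⟨fun e => ⟨(a.symm.trans e.1).trans b, fun x => ?_⟩, fun e => ⟨(a.trans e.1).trans b.symm, (key _).2 fun x => ?_⟩, fun e => ?_, fun e => ?_⟩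
  · have h1 := (key _).1 e.2 (a.symm x)
    rw [ha, hb, apply_symm_apply] at h1
    exact h1
  · have h1 := e.2 (a x)
    rw [ha, hb]
    simpa using h1
  · refine Subtype.ext (LinearEquiv.ext fun x => ?_)
    simp
  · refine Subtype.ext (LinearEquiv.ext fun x => ?_)
    simp
end T5
open QRep
section T6
variable {Q : FinQuiver} {K : Type} [Field K] [Fintype K] {Ω : Type} [Fintype Ω] {v : Ω → Q.V} {rk : Ω → ℕ}

lemma mulVec_ne {z : Matrix Ω Ω K} {x : Ω → K} {j : Ω} (h : z.mulVec x j ≠ 0) : ∃ i, z j i ≠ 0 ∧ x i ≠ 0 := by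
  obtain ⟨i, _, hi⟩ := exists_ne_zero_of_sum_ne_zero (show ∑ i, z j i * x i ≠ 0 from h)
  grind

/-- the representation defined by a strictly block triangular matrix -/
def repZ (z : Q.A → Matrix Ω Ω K) (hz : Su v rk Q.src Q.tgt univ univ z) : QRep Q K where
  space := fun w => Sp v K univ w
  acg := fun _ => inferInstance
  mod := fun _ => inferInstance
  fd := fun _ => inferInstance
  map := fun a => ((z a).mulVecLin).restrict (fun x hx j hj => by
    obtain ⟨i, hi, _⟩ := mulVec_ne hj
    exact ⟨mem_univ _, (hz a j i hi).2.2.2.1⟩)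

lemma fc_iff (z : Q.A → Matrix Ω Ω K) (hz : Su v rk Q.src Q.tgt univ univ z) (θ : Q.V → ℤ) :
    FC v Q.src Q.tgt θ univ z ↔ ∀ L : SubRep (repZ z hz), 0 ≤ ∑ w, θ w * L.dim w := by
  constructor
  · intro h L
    have h1 := h (fun w => (show Submodule K (Sp v K univ w) from L.sub w).map (Sp v K univ w).subtype)
      (fun w => Submodule.map_subtype_le _ _) (by
        rintro a _ ⟨x, hx, rfl⟩
        exact ⟨_, L.stable a x hx, rfl⟩)
    refine le_of_le_of_eq h1 (sum_congr rfl fun w _ => ?_)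
    have : finrank K ((show Submodule K (Sp v K univ w) from L.sub w).map (Sp v K univ w).subtype) = L.dim w := finrank_map_subtype_eq _ _
    rw [this]
  · intro h W hW hst
    have h1 := h ⟨fun w => (W w).comap (Sp v K univ w).subtype, fun a x hx => hst a x.1 hx⟩
    refine le_of_le_of_eq h1 (sum_congr rfl fun w _ => ?_)
    congr 2
    show finrank K ((W w).comap (Sp v K univ w).subtype) = _
    rw [← finrank_map_subtype_eq, Submodule.map_comap_subtype, inf_eq_right.2 (hW w)]

/-- the distinguished subspaces -/
def Mw (K : Type) [Field K] (v : Ω → Q.V) (Y : Finset Ω) (w : Q.V) : Submodule K (Sp v K univ w) :=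
  (Sp v K Y w).comap (Sp v K univ w).subtype

lemma finrank_Mw (Y : Finset Ω) (w : Q.V) : finrank K (Mw K v Y w) = (Y.filter fun i => v i = w).card := by
  rw [← finrank_Sp (K := K), Mw, ← finrank_map_subtype_eq, Submodule.map_comap_subtype, inf_eq_right.2]
  intro x hx i hi
  exact ⟨mem_univ _, (hx i hi).2⟩

/-- projection -/
noncomputable def prw (K : Type) [Field K] (v : Ω → Q.V) (w : Q.V) : (Ω → K) →ₗ[K] Sp v K univ w where
  toFun := fun x => ⟨fun i => if v i = w then x i else 0, fun i hi => ⟨mem_univ _, by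
    by_contra h; exact hi (if_neg h)⟩⟩
  map_add' := fun x y => Subtype.ext (funext fun i => by
    aesop)
  map_smul' := fun c x => Subtype.ext (funext fun i => by
    simp_all)

lemma prw_coe {w : Q.V} (x : Sp v K univ w) : prw K v w x.1 = x := by
  refine Subtype.ext (funext fun i => ?_)
  show (if v i = w then x.1 i else 0) = x.1 i
  split_ifs with h
  · rfl
  · by_contra h1
    exact h (x.2 i (fun h2 => h1 h2.symm)).2

/-- adapted framings -/
def JJ (v : Ω → Q.V) (Y : Finset Ω) (T : QRep Q K) : Type :=
  {f : ∀ w, Sp v K univ w ≃ₗ[K] T.space w // ∀ a x, x ∈ (Mw K v Y (Q.src a)).map (f (Q.src a)).toLinearMap → T.map a x ∈ (Mw K v Y (Q.tgt a)).map (f (Q.tgt a)).toLinearMap}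

lemma finite_iso_space {A B : Type} [AddCommGroup A] [Module K A] [AddCommGroup B] [Module K B] [FiniteDimensional K A] [FiniteDimensional K B] : Finite (A ≃ₗ[K] B) := by
  haveI : Finite A := fin_of_fd (K := K)
  haveI : Finite B := fin_of_fd (K := K)
  exact Finite.of_injective (fun e : A ≃ₗ[K] B => (e : A → B)) DFunLike.coe_injective

lemma card_J1 {T : QRep Q K} (hs : Surjective (cb T T)) (h1 : eulerFormN Q T.dimVec T.dimVec = 1)
    (hv : ∀ w, (univ.filter fun i => v i = w).card = T.dimVec w) (Y : Finset Ω)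
    (hY : ∀ a i j, v i = Q.src a → v j = Q.tgt a → (rk j < rk i ↔ ¬ (i ∈ Y ∧ j ∉ Y))) :
    nF v rk Q.src Q.tgt K (thQ Q T.dimVec) univ * (Fintype.card K - 1) = Nat.card (JJ v Y T) := by
  have hiso : ∀ z (hz : Su v rk Q.src Q.tgt univ univ z), FC v Q.src Q.tgt (thQ Q T.dimVec) univ z ↔ IsIsomorphic (repZ (rk := rk) z hz) T := by
    intro z hz
    rw [fc_iff z hz]
    constructor
    · intro h
      refine iso_of_semi hs h1 _ ?_ (fun L => ?_)
      · funext w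
        rw [← hv w]
        exact finrank_Sp (K := K) univ w
      · rw [← th_sum]; exact h L
    · intro h L
      rw [th_sum]; exact semi_of_iso hs h1 _ h L
  let Z := {z : Q.A → Matrix Ω Ω K // Su v rk Q.src Q.tgt univ univ z ∧ FC v Q.src Q.tgt (thQ Q T.dimVec) univ z}
  have hfin : ∀ z : Z, Finite (Iso (repZ z.1 z.2.1) T) := by
    intro z
    haveI : ∀ w, Finite ((repZ z.1 z.2.1).space w ≃ₗ[K] T.space w) := fun w => finite_iso_space
    refine Finite.of_injective (fun φ : Iso (repZ z.1 z.2.1) T => φ.app) ?_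
    rintro ⟨φ, _⟩ ⟨φ', _⟩ h
    congr
  have e1 : nF v rk Q.src Q.tgt K (thQ Q T.dimVec) univ * (Fintype.card K - 1) = Nat.card (Σ z : Z, Iso (repZ z.1 z.2.1) T) := by
    haveI : Fintype Z := ofFinite _
    rw [Nat.card_sigma, sum_congr rfl (fun z _ => card_iso hs h1 _ ((hiso z.1 z.2.1).1 z.2.2)), sum_const, card_univ, ← Nat.card_eq_fintype_card (α := Z), smul_eq_mul]
    rfl
  rw [e1]
  have hmem : ∀ (z : Q.A → Matrix Ω Ω K) (hz : Su v rk Q.src Q.tgt univ univ z) a (y : Sp v K univ (Q.src a)),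
      y ∈ Mw K v Y (Q.src a) → (repZ z hz).map a y ∈ Mw K v Y (Q.tgt a) := by
    intro z hz a y hy j hj
    obtain ⟨i, hi, hyi⟩ := mulVec_ne (show (z a).mulVec y.1 j ≠ 0 from hj)
    have h2 := hy i hyi
    have h3 := hz a j i hi
    have h4 := (hY a i j h3.2.2.1 h3.2.2.2.1).1 h3.2.2.2.2
    refine ⟨?_, h3.2.2.2.1⟩
    by_contra h5
    exact h4 ⟨h2.1, h5⟩
  refine card_congr (ofBijective (fun p : (Σ z : Z, Iso (repZ z.1 z.2.1) T) => (⟨p.2.app, ?_⟩ : JJ v Y T)) ⟨?_, ?_⟩)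
  · rintro a _ ⟨y, hy, rfl⟩
    exact ⟨_, hmem p.1.1 p.1.2.1 a y hy, p.2.comm a y⟩
  · rintro ⟨z, φ⟩ ⟨z', φ'⟩ h
    have ha : ∀ w (x : Sp v K univ w), φ.app w x = φ'.app w x := fun w x =>
      LinearEquiv.congr_fun (congrFun (congrArg val h) w) x
    have hzz : z = z' := by
      apply Subtype.ext
      funext a
      ext j i
      by_cases hi : v i = Q.src a
      · have hm : Pi.single i (1:K) ∈ Sp v K univ (Q.src a) := by
          intro i' hi'
          refine ⟨mem_univ _, ?_⟩
          by_cases hii : i' = i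
          · rw [hii, hi]
          · rw [Pi.single_eq_of_ne hii] at hi'; exact absurd rfl hi'
        have h2 : (repZ z.1 z.2.1).map a (⟨_, hm⟩ : Sp v K univ (Q.src a)) = (repZ z'.1 z'.2.1).map a (⟨_, hm⟩ : Sp v K univ (Q.src a)) := by
          apply (φ.app _).injective
          refine (φ.comm a _).trans ?_
          refine Eq.trans ?_ (ha _ _).symm
          refine Eq.trans ?_ (φ'.comm a _).symm
          exact congrArg (T.map a) (ha _ _)
        have h3 : (z.1 a).mulVec (Pi.single i 1) j = (z'.1 a).mulVec (Pi.single i 1) j := congrFun (congrArg val h2) j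
        rw [Matrix.mulVec_single_one, Matrix.mulVec_single_one] at h3
        exact h3
      · have h2 : ∀ z : Z, z.1 a j i = 0 := fun z => by
          by_contra h3
          exact hi (z.2.1 a j i h3).2.2.1
        rw [h2, h2]
    subst hzz
    congr 1
    rcases φ with ⟨φ, hφ⟩
    rcases φ' with ⟨φ', hφ'⟩
    congr 1
    funext w
    exact LinearEquiv.ext fun x => ha w x
  · rintro ⟨f, hf⟩
    let g : ∀ a, Sp v K univ (Q.src a) →ₗ[K] Sp v K univ (Q.tgt a) := fun a =>
      (f (Q.tgt a)).symm.toLinearMap.comp ((T.map a).comp (f (Q.src a)).toLinearMap)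
    have hgf : ∀ a x, f (Q.tgt a) (g a x) = T.map a (f (Q.src a) x) := fun a x => (f (Q.tgt a)).apply_symm_apply _
    let z : Q.A → Matrix Ω Ω K := fun a => toMatrix' ((Sp v K univ (Q.tgt a)).subtype.comp ((g a).comp (prw K v (Q.src a))))
    have hzm : ∀ a x, (z a).mulVec x = (g a (prw K v (Q.src a) x)).1 := fun a x => LinearMap.toMatrix'_mulVec _ _
    have hzi : ∀ a j i, z a j i = (g a (prw K v (Q.src a) (Pi.single i 1))).1 j := fun a j i => by
      rw [← hzm, Matrix.mulVec_single_one]; rfl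
    have hgM : ∀ a y, y ∈ Mw K v Y (Q.src a) → g a y ∈ Mw K v Y (Q.tgt a) := by
      intro a y hy
      obtain ⟨x, hx, hxy⟩ := hf a _ ⟨y, hy, rfl⟩
      have : x = g a y := (f (Q.tgt a)).injective (by rw [hgf]; exact hxy)
      rw [← this]; exact hx
    have hz : Su v rk Q.src Q.tgt univ univ z := by
      intro a j i hne
      rw [hzi] at hne
      have hj : v j = Q.tgt a := ((g a (prw K v (Q.src a) (Pi.single i 1))).2 j hne).2
      have hi : v i = Q.src a := by
        by_contra hi
        apply hne
        have : prw K v (Q.src a) (Pi.single i 1) = 0 := by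
          refine Subtype.ext (funext fun i' => ?_)
          show (if v i' = Q.src a then (Pi.single i 1 : Ω → K) i' else 0) = 0
          by_cases hii : i' = i
          · rw [hii, if_neg hi]
          · rw [Pi.single_eq_of_ne hii, ite_self]
        rw [this, map_zero]; rfl
      refine ⟨mem_univ _, mem_univ _, hi, hj, (hY a i j hi hj).2 ?_⟩
      rintro ⟨hiY, hjY⟩
      apply hjY
      refine (hgM a _ ?_ j hne).1
      intro i' hi'
      replace hi' : (if v i' = Q.src a then (Pi.single i 1 : Ω → K) i' else 0) ≠ 0 := hi'
      by_cases hii : i' = i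
      · rw [hii]; exact ⟨hiY, hi⟩
      · rw [Pi.single_eq_of_ne hii, ite_self] at hi'; exact absurd rfl hi'
    have hcomm : ∀ a (x : Sp v K univ (Q.src a)), f (Q.tgt a) ((repZ z hz).map a x) = T.map a (f (Q.src a) x) := by
      intro a x
      rw [← hgf]
      refine congrArg (f (Q.tgt a)) (Subtype.ext ?_)
      show (z a).mulVec x.1 = _
      rw [hzm, prw_coe]
    let φ : Iso (repZ z hz) T := ⟨f, hcomm⟩
    exact ⟨⟨⟨z, hz, (hiso z hz).2 ⟨φ⟩⟩, φ⟩, rfl⟩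

lemma card_J2 (T : QRep Q K) (hv : ∀ w, (univ.filter fun i => v i = w).card = T.dimVec w) (Y : Finset Ω) (γ : Q.V → ℕ)
    (hγ : ∀ w, (Y.filter fun i => v i = w).card = γ w) (hle : γ ≤ T.dimVec) :
    Nat.card (JJ v Y T) = grCard γ T * ∏ w, (Nat.card (GeneralLinearGroup (Fin (γ w)) K) * Nat.card (GeneralLinearGroup (Fin (T.dimVec w - γ w)) K) * Fintype.card K ^ (γ w * (T.dimVec w - γ w))) := by
  let G := {L : SubRep T // L.dim = γ}
  haveI : Finite G := by
    haveI : ∀ w, Finite (T.space w) := fun w => fin_of_fd (K := K)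
    haveI : ∀ w, Finite (Submodule K (T.space w)) := fun w => Finite.of_injective (fun S : Submodule K (T.space w) => (S : Set (T.space w))) SetLike.coe_injective
    refine Finite.of_injective (fun L : G => L.1.sub) ?_
    rintro ⟨⟨L, _⟩, _⟩ ⟨⟨L', _⟩, _⟩ h
    congr
  haveI : Fintype G := ofFinite _
  haveI : ∀ w, Finite (Sp v K univ w ≃ₗ[K] T.space w) := fun w => finite_iso_space
  have h1 : ∀ L : G, Nat.card (∀ w, {e : Sp v K univ w ≃ₗ[K] T.space w // (Mw K v Y w).map e.toLinearMap = L.1.sub w}) =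
      ∏ w, (Nat.card (GeneralLinearGroup (Fin (γ w)) K) * Nat.card (GeneralLinearGroup (Fin (T.dimVec w - γ w)) K) * Fintype.card K ^ (γ w * (T.dimVec w - γ w))) := by
    intro L
    rw [Nat.card_pi]
    refine prod_congr rfl fun w _ => card_flag _ _ ?_ ?_ ?_ ?_
    · rw [finrank_Sp, hv, Nat.add_sub_cancel' (hle w)]
    · exact (Nat.add_sub_cancel' (hle w)).symm
    · rw [finrank_Mw, hγ]
    · exact congrFun L.2 w
  have h2 : grCard γ T * ∏ w, (Nat.card (GeneralLinearGroup (Fin (γ w)) K) * Nat.card (GeneralLinearGroup (Fin (T.dimVec w - γ w)) K) * Fintype.card K ^ (γ w * (T.dimVec w - γ w))) =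
      Nat.card (Σ L : G, ∀ w, {e : Sp v K univ w ≃ₗ[K] T.space w // (Mw K v Y w).map e.toLinearMap = L.1.sub w}) := by
    rw [Nat.card_sigma, sum_congr rfl (fun L _ => h1 L), sum_const, card_univ, ← Nat.card_eq_fintype_card (α := G), smul_eq_mul]
    rfl
  rw [h2]
  symm
  refine card_congr (ofBijective (fun p => (⟨fun w => (p.2 w).1, ?_⟩ : JJ v Y T)) ⟨?_, ?_⟩)
  · intro a x hx
    rw [(p.2 _).2] at hx ⊢
    exact p.1.1.stable a x hx
  · rintro ⟨L, f⟩ ⟨L', f'⟩ h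
    have hw : ∀ w, (f w).1 = (f' w).1 := fun w => congrFun (congrArg val h) w
    have hL : L = L' := by
      have : L.1.sub = L'.1.sub := by
        funext w
        rw [← (f w).2, ← (f' w).2, hw]
      rcases L with ⟨⟨L, _⟩, _⟩
      rcases L' with ⟨⟨L', _⟩, _⟩
      congr
    subst hL
    congr 1
    funext w
    exact Subtype.ext (hw w)
  · rintro ⟨f, hf⟩
    refine ⟨⟨⟨⟨fun w => (Mw K v Y w).map (f w).toLinearMap, hf⟩, ?_⟩, fun w => ⟨f w, rfl⟩⟩, rfl⟩
    funext w
    show finrank K ((Mw K v Y w).map (f w).toLinearMap) = _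
    rw [finrank_map_eq, finrank_Mw, hγ]

end T6
open QRep
section T7
variable {Q : FinQuiver} {Ω : Type} [Fintype Ω] {v : Ω → Q.V} {rk : Ω → ℕ}

lemma ar_eq (α γ : Q.V → ℕ) (hv : ∀ w, (univ.filter fun i => v i = w).card = α w) (Y : Finset Ω)
    (hγ : ∀ w, (Y.filter fun i => v i = w).card = γ w)
    (hY : ∀ a i j, v i = Q.src a → v j = Q.tgt a → (rk j < rk i ↔ ¬ (i ∈ Y ∧ j ∉ Y))) :
    ar v (ea Q.src Q.tgt) rk univ univ + ∑ a, γ (Q.src a) * (α (Q.tgt a) - γ (Q.tgt a)) = ∑ a, α (Q.src a) * α (Q.tgt a) := by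
  have h1 : ar v (ea Q.src Q.tgt) rk univ univ = ∑ a : Q.A, ((univ : Finset (Ω × Ω)).filter fun p => (v p.1 = Q.src a ∧ v p.2 = Q.tgt a) ∧ rk p.2 < rk p.1).card := by
    simp only [card_filter]
    rw [sum_comm]
    unfold ar
    rw [Finset.univ_product_univ]
    refine sum_congr rfl fun p _ => ?_
    by_cases h : rk p.2 < rk p.1
    · rw [if_pos h]
      unfold ea
      rw [card_filter]
      grind
    · rw [if_neg h]
      symm
      simp_all
  rw [h1, ← sum_add_distrib]
  refine sum_congr rfl fun a _ => ?_
  have h2 : α (Q.tgt a) - γ (Q.tgt a) = ((univ.filter fun i => v i = Q.tgt a) \ (Y.filter fun i => v i = Q.tgt a)).card := by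
    rw [Finset.card_sdiff_of_subset (Finset.filter_subset_filter _ (subset_univ _)), hv, hγ]
  rw [h2, ← hγ, ← hv, ← hv, ← Finset.card_product, ← Finset.card_product, ← card_union_of_disjoint]
  · congr 1
    grind
  · rw [disjoint_left]
    grind

lemma qi_real {t : ℝ} (ht : 0 ≤ t) (n : ℕ) : (qi n (ofReal t)).toReal = ∑ j ∈ range n, t ^ j := by
  unfold qi
  rw [toReal_sum (fun j _ => pow_ne_top ofReal_ne_top)]
  simp_all

lemma qf_pos {t : ℝ} (ht : 0 ≤ t) (n : ℕ) : 0 < (qf n (ofReal t)).toReal := by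
  unfold qf
  rw [toReal_prod]
  refine prod_pos fun m _ => ?_
  rw [qi_real ht, Finset.sum_range_succ']
  have : 0 ≤ ∑ k ∈ range m, t ^ (k + 1) := sum_nonneg fun _ _ => by positivity
  rw [pow_zero]; linarith

lemma gl_real (K : Type) [Field K] [Fintype K] (n : ℕ) : (Nat.card (GeneralLinearGroup (Fin n) K) : ℝ) =
    (Fintype.card K : ℝ) ^ (n * n) * (1 - (Fintype.card K : ℝ)⁻¹) ^ n * (qf n (ofReal (Fintype.card K : ℝ)⁻¹)).toReal := by
  have hq : 0 < (Fintype.card K : ℝ) := by exact_mod_cast card_pos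
  have hq1 : 1 ≤ Fintype.card K := card_pos
  rw [Matrix.card_GL_field, Nat.cast_prod, Fin.prod_univ_eq_prod_range (fun i => ((Fintype.card K ^ n - Fintype.card K ^ i : ℕ) : ℝ)) n, ← Finset.prod_range_reflect]
  unfold qf
  rw [toReal_prod, pow_mul]
  have e1 : ((Fintype.card K : ℝ) ^ n) ^ n = ∏ m ∈ range n, (Fintype.card K : ℝ) ^ n := by rw [Finset.prod_const, card_range]
  have e2 : (1 - (Fintype.card K : ℝ)⁻¹) ^ n = ∏ m ∈ range n, (1 - (Fintype.card K : ℝ)⁻¹) := by rw [Finset.prod_const, card_range]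
  rw [e1, e2, ← prod_mul_distrib, ← prod_mul_distrib]
  refine prod_congr rfl fun m hm => ?_
  have hm := mem_range.1 hm
  rw [qi_real (by positivity), mul_assoc, mul_neg_geom_sum, Nat.cast_sub (Nat.pow_le_pow_right hq1 (by omega))]
  push_cast
  rw [mul_sub, mul_one, inv_pow]
  congr 1
  rw [← div_eq_mul_inv, eq_div_iff (by positivity), ← pow_add]
  congr 1
  omega

lemma grass_eq (hQ : NoCycles Q) (α γ : Q.V → ℕ) (hγα : γ ≤ α) (h1 : eulerFormN Q α α = 1) :
    ∃ r : ℕ → ℕ, ∀ (K : Type) [Field K] [Fintype K] (T : QRep Q K), T.dimVec = α → Surjective (cb T T) →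
      HS r (ofReal (Fintype.card K : ℝ)⁻¹) ≠ ⊤ ∧
      (grCard γ T : ℝ) = (Fintype.card K : ℝ) ^ (∑ w, γ w * (α w - γ w)) * (HS r (ofReal (Fintype.card K : ℝ)⁻¹)).toReal := by
  have hα : ∃ w, α w ≠ 0 := by
    by_contra h
    push Not at h
    simp [eulerFormN, eulerForm, h] at h1
  obtain ⟨Ω, _, _, v, rk, Y, hrk, hv, hY, hYr, P, p1, p2, p3, p4⟩ := exists_data hQ α γ hγα hα
  have he : ∀ w, ea Q.src Q.tgt w w = 0 := by
    intro w
    unfold ea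
    rw [card_eq_zero, Finset.filter_eq_empty_iff]
    intro a _ h
    exact src_ne_tgt hQ a (h.1.trans h.2.symm)
  obtain ⟨r, hr⟩ := main_HS he hrk (thQ Q α) P (bn α γ) p1 p2 p3 p4
  refine ⟨fun n => if (∑ a, γ (Q.src a) * (α (Q.tgt a) - γ (Q.tgt a))) ≤ n then r (n - (∑ a, γ (Q.src a) * (α (Q.tgt a) - γ (Q.tgt a)))) else 0, ?_⟩
  intro K _ _ T hT hsj
  rw [HS_shift]
  have har := ar_eq α γ hv Y hY hYr
  have hc := hR_count (K := K) (v := v) (src_ne_tgt hQ) hrk (thQ Q α) univ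
  have hJ1 := card_J1 hsj (by rw [hT]; exact h1) (by rw [hT]; exact hv) Y hYr
  have hJ2 := card_J2 T (by rw [hT]; exact hv) Y γ hY (by rw [hT]; exact hγα)
  rw [hJ2, hT] at hJ1
  have hcard : (univ : Finset Ω).card = ∑ w, α w := by
    rw [Finset.card_eq_sum_card_fiberwise (f := v) (t := univ) (fun _ _ => mem_univ _)]
    exact sum_congr rfl fun w _ => hv w
  have hpos : 0 < (univ : Finset Ω).card := Finset.card_pos.2 Finset.univ_nonempty
  rw [hcard] at hc hpos
  have hq2 : 1 < Fintype.card K := Fintype.one_lt_card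
  have hqr : (1:ℝ) < Fintype.card K := by exact_mod_cast hq2
  have hq0 : (0:ℝ) < Fintype.card K := by linarith
  have ht0 : 0 < (Fintype.card K : ℝ)⁻¹ := by positivity
  have ht1 : (Fintype.card K : ℝ)⁻¹ < 1 := inv_lt_one_of_one_lt₀ hqr
  obtain ⟨m1, m2, m3⟩ := hr (ofReal (Fintype.card K : ℝ)⁻¹) (ENNReal.ofReal_lt_one.2 ht1)
  refine ⟨mul_ne_top (pow_ne_top ofReal_ne_top) m1, ?_⟩
  rw [toReal_mul, toReal_pow, toReal_ofReal ht0.le]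
  unfold hR at hc
  have hqfT : ∀ n, qf n (ofReal (Fintype.card K : ℝ)⁻¹) ≠ ⊤ := fun n h => by
    have := qf_pos ht0.le n
    rw [h] at this
    simp at this
  have m4 := congrArg toReal m3
  rw [ENNReal.toReal_add (mul_ne_top (ENNReal.prod_ne_top fun c _ => hqfT _) m1) (mul_ne_top ofReal_ne_top m2), toReal_mul, toReal_mul, toReal_prod, toReal_ofReal ht0.le] at m4
  have hJr : (nF v rk Q.src Q.tgt K (thQ Q α) univ : ℝ) * ((Fintype.card K : ℝ) - 1) = grCard γ T * ∏ w, ((Nat.card (GeneralLinearGroup (Fin (γ w)) K) : ℝ) * Nat.card (GeneralLinearGroup (Fin (α w - γ w)) K) * (Fintype.card K : ℝ) ^ (γ w * (α w - γ w))) := by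
    have := congrArg (Nat.cast (R := ℝ)) hJ1
    push_cast [Nat.cast_sub hq2.le] at this
    exact this
  have hprod : ∏ c, (qf (bn α γ c) (ofReal (Fintype.card K : ℝ)⁻¹)).toReal = ∏ w, ((qf (γ w) (ofReal (Fintype.card K : ℝ)⁻¹)).toReal * (qf (α w - γ w) (ofReal (Fintype.card K : ℝ)⁻¹)).toReal) := by
    rw [Fintype.prod_prod_type]
    refine prod_congr rfl fun w _ => ?_
    rw [Fintype.prod_bool]
    simp [bn]
  have hgl : ∏ w, ((Nat.card (GeneralLinearGroup (Fin (γ w)) K) : ℝ) * Nat.card (GeneralLinearGroup (Fin (α w - γ w)) K) * (Fintype.card K : ℝ) ^ (γ w * (α w - γ w))) =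
      (Fintype.card K : ℝ) ^ (∑ w, (γ w * γ w + (α w - γ w) * (α w - γ w) + γ w * (α w - γ w))) * (1 - (Fintype.card K : ℝ)⁻¹) ^ (∑ w, α w) * ∏ c, (qf (bn α γ c) (ofReal (Fintype.card K : ℝ)⁻¹)).toReal := by
    rw [hprod, ← Finset.prod_pow_eq_pow_sum, ← Finset.prod_pow_eq_pow_sum, ← prod_mul_distrib, ← prod_mul_distrib]
    refine prod_congr rfl fun w _ => ?_
    rw [gl_real, gl_real]
    have : (1 - (Fintype.card K : ℝ)⁻¹) ^ α w = (1 - (Fintype.card K : ℝ)⁻¹) ^ γ w * (1 - (Fintype.card K : ℝ)⁻¹) ^ (α w - γ w) := by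
      rw [← pow_add, Nat.add_sub_cancel' (hγα w)]
    rw [this, pow_add, pow_add]
    ring
  rw [hgl] at hJr
  have hF0 : 0 < ∏ c, (qf (bn α γ c) (ofReal (Fintype.card K : ℝ)⁻¹)).toReal := prod_pos fun c _ => qf_pos ht0.le _
  have hexp : ar v (ea Q.src Q.tgt) rk univ univ + 1 + ∑ a, γ (Q.src a) * (α (Q.tgt a) - γ (Q.tgt a)) = (∑ w, (γ w * γ w + (α w - γ w) * (α w - γ w) + γ w * (α w - γ w))) + ∑ w, γ w * (α w - γ w) := by
    have e1 : (∑ w, (γ w * γ w + (α w - γ w) * (α w - γ w) + γ w * (α w - γ w))) + ∑ w, γ w * (α w - γ w) = ∑ w, α w * α w := by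
      rw [← sum_add_distrib]
      refine sum_congr rfl fun w _ => ?_
      obtain ⟨d, hd⟩ := Nat.exists_eq_add_of_le (hγα w)
      rw [hd, Nat.add_sub_cancel_left]; ring
    rw [e1]
    unfold eulerFormN eulerForm at h1
    zify at har ⊢
    linarith
  generalize ∏ c, (qf (bn α γ c) (ofReal (Fintype.card K : ℝ)⁻¹)).toReal = F at *
  generalize (HallPaper.hs (stF v (ea Q.src Q.tgt) rk (thQ Q α) univ) (ofReal (Fintype.card K : ℝ)⁻¹)).toReal = H at *
  generalize (HS r (ofReal (Fintype.card K : ℝ)⁻¹)).toReal = R at *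
  generalize ar v (ea Q.src Q.tgt) rk univ univ = N at *
  generalize (∑ w, (γ w * γ w + (α w - γ w) * (α w - γ w) + γ w * (α w - γ w))) = S at *
  generalize ∑ w, γ w * (α w - γ w) = B at *
  generalize ∑ a, γ (Q.src a) * (α (Q.tgt a) - γ (Q.tgt a)) = A at *
  generalize (nF v rk Q.src Q.tgt K (thQ Q α) univ : ℝ) = nf at *
  generalize (grCard γ T : ℝ) = g at *
  obtain ⟨n, hn⟩ := Nat.exists_eq_succ_of_ne_zero hpos.ne'
  rw [hn] at hc hJr
  generalize (Fintype.card K : ℝ) = q at *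
  have ht : 1 - q⁻¹ ≠ 0 := by linarith
  have k1 : H * (1 - q⁻¹) = F * R := by linarith
  have k2 : nf = q ^ N * (F * R * (1 - q⁻¹) ^ n) := by
    rw [← k1, inv_pow] at *
    rw [pow_succ] at hc
    field_simp at hc ⊢
    linarith
  have k3 : q - 1 = q * (1 - q⁻¹) := by field_simp
  rw [k2, k3] at hJr
  have k4 : q ^ (N + 1) * R = g * q ^ S := by
    have hne : F * (1 - q⁻¹) ^ (n + 1) ≠ 0 := mul_ne_zero hF0.ne' (pow_ne_zero _ ht)
    apply mul_right_cancel₀ hne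
    rw [pow_succ, pow_succ] at *
    linear_combination hJr
  have k5 : g * q ^ A * q ^ S = q ^ B * R * q ^ S := by
    have : q ^ (N + 1) * q ^ A = q ^ S * q ^ B := by rw [← pow_add, ← pow_add, hexp]
    linear_combination R * this - q ^ A * k4
  have k6 := mul_right_cancel₀ (pow_ne_zero S hq0.ne') k5
  rw [inv_pow]
  have hqA : q ^ A ≠ 0 := pow_ne_zero _ hq0.ne'
  field_simp
  linear_combination k6
end T7
open QRep
section T8
variable {Q : FinQuiver}

lemma HS_real {r : ℕ → ℕ} {t : ℝ} (ht : 0 ≤ t) (h : HS r (ofReal t) ≠ ⊤) :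
    HasSum (fun n => (r n : ℝ) * t ^ n) (HS r (ofReal t)).toReal := by
  have := ENNReal.hasSum_toReal h
  unfold HS
  rw [ENNReal.tsum_toReal_eq (fun n => ENNReal.ne_top_of_tsum_ne_top h n)]
  convert this using 2 with n
  rw [toReal_mul, toReal_pow, toReal_ofReal ht, ENNReal.toReal_natCast]

lemma deg_bound {r : ℕ → ℕ} {q0 B : ℕ} (h0 : 0 < q0) (hC : HS r (ofReal (q0 : ℝ)⁻¹) ≠ ⊤)
    (hl : ∀ N : ℕ, ∃ q g : ℕ, N ≤ q ∧ HS r (ofReal (q : ℝ)⁻¹) ≠ ⊤ ∧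
      (g : ℝ) = (q : ℝ) ^ B * (HS r (ofReal (q : ℝ)⁻¹)).toReal) (m : ℕ) (hm : B < m) : r m = 0 := by
  by_contra hne
  have hq0 : (0 : ℝ) < q0 := by exact_mod_cast h0
  have s0 := HS_real (by positivity) hC
  set C := (HS r (ofReal (q0 : ℝ)⁻¹)).toReal with hCd
  have hC0 : 0 ≤ C := ENNReal.toReal_nonneg
  obtain ⟨N, hN⟩ := exists_nat_gt (C * (q0 : ℝ) ^ (B + 1))
  obtain ⟨q, g, hq, h1, h2⟩ := hl (N + q0)
  have hqr : (0 : ℝ) < q := by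
    have : 0 < q := by omega
    exact_mod_cast this
  have hqq : (q0 : ℝ) ≤ q := by
    have : q0 ≤ q := by omega
    exact_mod_cast this
  have hqN : (N : ℝ) ≤ q := by
    have : N ≤ q := by omega
    exact_mod_cast this
  have s1 := (HS_real (by positivity) h1).mul_left ((q : ℝ) ^ B)
  rw [← h2] at s1
  have s2 := (hasSum_nat_add_iff' (B + 1)).2 s1
  have h_intz : ∃ z : ℤ, (z : ℝ) = (g : ℝ) - ∑ i ∈ range (B + 1), (q : ℝ) ^ B * ((r i : ℝ) * (q : ℝ)⁻¹ ^ i) := by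
    refine ⟨(g : ℤ) - ∑ i ∈ range (B + 1), (r i : ℤ) * (q : ℤ) ^ (B - i), ?_⟩
    push_cast
    congr 1
    refine sum_congr rfl fun i hi => ?_
    have hi := mem_range.1 hi
    have : (q : ℝ) ^ B = (q : ℝ) ^ (B - i) * (q : ℝ) ^ i := by rw [← pow_add]; congr 1; omega
    rw [this, inv_pow]
    field_simp
  obtain ⟨z, hz⟩ := h_intz
  rw [← hz] at s2
  have hpos : (0 : ℝ) < z := by
    have := le_hasSum s2 (m - (B + 1)) (fun j _ => by positivity)
    refine lt_of_lt_of_le ?_ this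
    rw [show m - (B + 1) + (B + 1) = m by omega]
    have : 0 < r m := Nat.pos_of_ne_zero hne
    have : (0 : ℝ) < r m := by exact_mod_cast this
    positivity
  have s3 := ((hasSum_nat_add_iff' (B + 1)).2 s0).mul_left ((q0 : ℝ) ^ (B + 1) * (q : ℝ)⁻¹)
  have hle := hasSum_le (fun n => ?_) s2 s3
  · have h5 : (0 : ℝ) ≤ ∑ i ∈ range (B + 1), (r i : ℝ) * (q0 : ℝ)⁻¹ ^ i := sum_nonneg fun i _ => by positivity
    have h6 : (q0 : ℝ) ^ (B + 1) * (q : ℝ)⁻¹ * (C - ∑ i ∈ range (B + 1), (r i : ℝ) * (q0 : ℝ)⁻¹ ^ i) ≤ (q0 : ℝ) ^ (B + 1) * (q : ℝ)⁻¹ * C :=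
      mul_le_mul_of_nonneg_left (by linarith) (by positivity)
    have h7 : (q0 : ℝ) ^ (B + 1) * (q : ℝ)⁻¹ * C < 1 := by
      rw [mul_right_comm, ← div_eq_mul_inv, div_lt_one hqr]
      linarith
    have h8 : (z : ℝ) < 1 := by linarith
    have h9 : z < 1 := by exact_mod_cast h8
    have h10 : 0 < z := by exact_mod_cast hpos
    omega
  · have e1 : (q : ℝ) ^ B * ((r (n + (B + 1)) : ℝ) * (q : ℝ)⁻¹ ^ (n + (B + 1))) = (r (n + (B + 1)) : ℝ) * ((q : ℝ)⁻¹ * (q : ℝ)⁻¹ ^ n) := by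
      rw [pow_add, pow_add, pow_one]
      have : (q : ℝ) ^ B * (q : ℝ)⁻¹ ^ B = 1 := by rw [← mul_pow, mul_inv_cancel₀ hqr.ne', one_pow]
      linear_combination ((r (n + (B + 1)) : ℝ) * ((q : ℝ)⁻¹ * (q : ℝ)⁻¹ ^ n)) * this
    have e2 : (q0 : ℝ) ^ (B + 1) * (q : ℝ)⁻¹ * ((r (n + (B + 1)) : ℝ) * (q0 : ℝ)⁻¹ ^ (n + (B + 1))) = (r (n + (B + 1)) : ℝ) * ((q : ℝ)⁻¹ * (q0 : ℝ)⁻¹ ^ n) := by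
      rw [pow_add (q0 : ℝ)⁻¹]
      have : (q0 : ℝ) ^ (B + 1) * (q0 : ℝ)⁻¹ ^ (B + 1) = 1 := by rw [← mul_pow, mul_inv_cancel₀ hq0.ne', one_pow]
      linear_combination ((r (n + (B + 1)) : ℝ) * ((q : ℝ)⁻¹ * (q0 : ℝ)⁻¹ ^ n)) * this
    rw [e1, e2]
    gcongr

lemma exists_large (k : Type) [Field k] [Fintype k] (N : ℕ) : ∃ (K : Type) (_ : Field K) (_ : Fintype K) (_ : Algebra k K), N ≤ Fintype.card K := by
  have hinf : Infinite (AlgebraicClosure k) := IsAlgClosed.instInfinite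
  obtain ⟨S, hS⟩ := Infinite.exists_subset_card_eq (AlgebraicClosure k) N
  have hfd : FiniteDimensional k (IntermediateField.adjoin k (S : Set (AlgebraicClosure k))) :=
    IntermediateField.finiteDimensional_adjoin (fun x _ => Algebra.IsIntegral.isIntegral x)
  have hfin : Finite (IntermediateField.adjoin k (S : Set (AlgebraicClosure k))) := Module.finite_of_finite k
  letI := ofFinite (IntermediateField.adjoin k (S : Set (AlgebraicClosure k)))
  refine ⟨IntermediateField.adjoin k (S : Set (AlgebraicClosure k)), inferInstance, inferInstance, inferInstance, ?_⟩
  rw [← hS, ← card_coe]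
  refine Fintype.card_le_of_injective (fun x : S => (⟨x.1, IntermediateField.subset_adjoin k _ x.2⟩ : IntermediateField.adjoin k (S : Set (AlgebraicClosure k)))) ?_
  intro x y h
  exact Subtype.ext (mk.inj h)

lemma base_change {k : Type} [Field k] (T : QRep Q k) (hs : Surjective (cb T T)) (K : Type) [Field K] [Algebra k K] :
    ∃ T' : QRep Q K, T'.dimVec = T.dimVec ∧ Surjective (cb T' T') := by
  let b : ∀ w, Basis (Fin (T.dimVec w)) k (T.space w) := fun w => Module.finBasis k (T.space w)
  let W : ∀ a, Matrix (Fin (T.dimVec (Q.tgt a))) (Fin (T.dimVec (Q.src a))) k := fun a => toMatrix (b _) (b _) (T.map a)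
  have key : ∀ Z : ∀ a, Matrix (Fin (T.dimVec (Q.tgt a))) (Fin (T.dimVec (Q.src a))) k,
      ∃ X : ∀ w, Matrix (Fin (T.dimVec w)) (Fin (T.dimVec w)) k, ∀ a, W a * X (Q.src a) - X (Q.tgt a) * W a = Z a := by
    intro Z
    obtain ⟨f, hf⟩ := hs (fun a => Matrix.toLin (b _) (b _) (Z a))
    refine ⟨fun w => toMatrix (b w) (b w) (f w), fun a => ?_⟩
    have := congrArg (toMatrix (b _) (b _)) (congrFun hf a)
    beta_reduce at this
    rw [LinearMap.toMatrix_toLin] at this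
    rw [← this]
    show _ = toMatrix (b _) (b _) ((T.map a).comp (f (Q.src a)) - (f (Q.tgt a)).comp (T.map a))
    rw [map_sub, toMatrix_comp (b _) (b _) (b _), toMatrix_comp (b _) (b _) (b _)]
  let φ := algebraMap k K
  let W' : StdRep Q K T.dimVec := fun a => (W a).map φ
  have key2 : ∀ Z : ∀ a, Matrix (Fin (T.dimVec (Q.tgt a))) (Fin (T.dimVec (Q.src a))) K,
      ∃ X : ∀ w, Matrix (Fin (T.dimVec w)) (Fin (T.dimVec w)) K, ∀ a, (W a).map φ * X (Q.src a) - X (Q.tgt a) * (W a).map φ = Z a := by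
    intro Z
    choose X hX using fun p : (Σ a, Fin (T.dimVec (Q.tgt a)) × Fin (T.dimVec (Q.src a))) =>
      key (fun a i j => if (⟨a, i, j⟩ : (Σ a, Fin (T.dimVec (Q.tgt a)) × Fin (T.dimVec (Q.src a)))) = p then 1 else 0)
    refine ⟨fun w => ∑ p : (Σ a, Fin (T.dimVec (Q.tgt a)) × Fin (T.dimVec (Q.src a))), Z p.1 p.2.1 p.2.2 • (X p w).map φ, fun a => ?_⟩
    rw [Matrix.mul_sum, Matrix.sum_mul, ← sum_sub_distrib]
    have e : ∀ p, (W a).map φ * Z p.1 p.2.1 p.2.2 • (X p (Q.src a)).map φ - (Z p.1 p.2.1 p.2.2 • (X p (Q.tgt a)).map φ) * (W a).map φ =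
        Z p.1 p.2.1 p.2.2 • (W a * X p (Q.src a) - X p (Q.tgt a) * W a).map φ := by
      intro p
      rw [Matrix.mul_smul, Matrix.smul_mul, ← smul_sub, Matrix.map_sub _ (map_sub φ), Matrix.map_mul, Matrix.map_mul]
    rw [sum_congr rfl fun p _ => e p]
    ext i j
    rw [Matrix.sum_apply, Finset.sum_eq_single (⟨a, i, j⟩ : (Σ a, Fin (T.dimVec (Q.tgt a)) × Fin (T.dimVec (Q.src a))))]
    · rw [hX]
      show Z a i j * φ (if (⟨a, i, j⟩ : (Σ a, Fin (T.dimVec (Q.tgt a)) × Fin (T.dimVec (Q.src a)))) = ⟨a, i, j⟩ then 1 else 0) = Z a i j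
      rw [if_pos rfl, map_one, mul_one]
    · intro p _ hp
      rw [hX]
      show Z p.1 p.2.1 p.2.2 * φ (if (⟨a, i, j⟩ : (Σ a, Fin (T.dimVec (Q.tgt a)) × Fin (T.dimVec (Q.src a)))) = p then 1 else 0) = 0
      grind
    · grind
  refine ⟨W'.toQRep, ?_, ?_⟩
  · funext w
    exact (finrank_fin_fun K)
  · intro z
    obtain ⟨X, hX⟩ := key2 (fun a => toMatrix' (z a))
    refine ⟨fun w => mulVecLin (X w), ?_⟩
    funext a
    show (mulVecLin (W' a)).comp (mulVecLin (X (Q.src a))) - (mulVecLin (X (Q.tgt a))).comp (mulVecLin (W' a)) = z a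
    have h := hX a
    have h2 : mulVecLin (toMatrix' (z a)) = z a := Matrix.toLin'_toMatrix' (z a)
    rw [← h2, ← h]
    rw [← Matrix.mulVecLin_mul, ← Matrix.mulVecLin_mul]
    grind

end T8
open QRep
/-- positivity for quiver Grassmannians of rigid modules:
for `Q` without oriented cycles and `T` indecomposable rigid of dimension
vector `α`, for every `γ` there is a polynomial `P ∈ ℤ[t]` with non-negative
coefficients such that over every finite field, `P(q')` is the number of
points of `Gr_γ(T')` for the unique indecomposable rigid representation `T'`
of dimension vector `α`; in particular `|Gr_γ(T)| = P(q)`. -/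
theorem statement9 (Q : FinQuiver) (hQ : NoCycles Q)
    (k : Type) [Field k] [Fintype k] (T : QRep Q k) (α : Q.V → ℕ)
    (hdim : T.dimVec = α) (hind : Indecomposable T) (hrig : IsRigid T)
    (γ : Q.V → ℕ) :
    ∃ P : Polynomial ℤ,
      (∀ n, 0 ≤ P.coeff n) ∧
      (∀ (k' : Type) [Field k'] [Fintype k'] (T' : QRep Q k'),
        Indecomposable T' → IsRigid T' → T'.dimVec = α →
          P.eval (Fintype.card k' : ℤ) = (grCard γ T' : ℤ)) ∧
      P.eval (Fintype.card k : ℤ) = (grCard γ T : ℤ) := by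
  by_cases hγα : γ ≤ α
  · have h1 : eulerFormN Q α α = 1 := by
      rw [← hdim]
      exact euler_one hind hrig
    obtain ⟨r, hr⟩ := grass_eq hQ α γ hγα h1
    have hz := deg_bound (card_pos (α := k)) (hr k T hdim (rigid_surj hrig)).1 (fun N => by
      obtain ⟨K, _, _, _, hK⟩ := exists_large k N
      obtain ⟨T', h2, h3⟩ := base_change T (rigid_surj hrig) K
      exact ⟨Fintype.card K, grCard γ T', hK, hr K T' (h2.trans hdim) h3⟩)
    have hP : ∀ (k' : Type) [Field k'] [Fintype k'] (T' : QRep Q k'), Indecomposable T' → IsRigid T' → T'.dimVec = α →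
        (∑ n ∈ range ((∑ w, γ w * (α w - γ w)) + 1), Polynomial.monomial ((∑ w, γ w * (α w - γ w)) - n) (r n : ℤ)).eval (Fintype.card k' : ℤ) = (grCard γ T' : ℤ) := by
      intro k' _ _ T' _ hr' hd'
      obtain ⟨h4, h5⟩ := hr k' T' hd' (rigid_surj hr')
      have hq : (0 : ℝ) < Fintype.card k' := by exact_mod_cast card_pos (α := k')
      have s1 := HS_real (by positivity) h4
      have s2 := hasSum_sum_of_ne_finset_zero (L := SummationFilter.unconditional ℕ) (f := fun n => (r n : ℝ) * ((Fintype.card k' : ℝ)⁻¹) ^ n) (s := range ((∑ w, γ w * (α w - γ w)) + 1)) (fun n hn => by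
        rw [mem_range] at hn
        rw [hz n (by omega)]
        simp)
      rw [s1.unique s2, mul_sum] at h5
      have h6 : (((∑ n ∈ range ((∑ w, γ w * (α w - γ w)) + 1), Polynomial.monomial ((∑ w, γ w * (α w - γ w)) - n) (r n : ℤ)).eval (Fintype.card k' : ℤ) : ℤ) : ℝ) = ((grCard γ T' : ℤ) : ℝ) := by
        rw [Polynomial.eval_finset_sum, Int.cast_natCast, h5, Int.cast_sum]
        refine sum_congr rfl fun n hn => ?_
        have hn := mem_range.1 hn
        rw [Polynomial.eval_monomial]
        push_cast
        have : (Fintype.card k' : ℝ) ^ (∑ w, γ w * (α w - γ w)) = (Fintype.card k' : ℝ) ^ ((∑ w, γ w * (α w - γ w)) - n) * (Fintype.card k' : ℝ) ^ n := by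
          rw [← pow_add]; congr 1; omega
        rw [this, inv_pow]
        field_simp
      exact_mod_cast h6
    refine ⟨_, ?_, hP, hP k T hind hrig hdim⟩
    intro n
    rw [Polynomial.finset_sum_coeff]
    refine sum_nonneg fun i _ => ?_
    rw [Polynomial.coeff_monomial]
    split_ifs
    · exact Int.natCast_nonneg _
    · exact le_rfl
  · have hP : ∀ (k' : Type) [Field k'] [Fintype k'] (T' : QRep Q k'), T'.dimVec = α → grCard γ T' = 0 := by
      intro k' _ _ T' hd'
      unfold grCard
      have : IsEmpty {L : SubRep T' // L.dim = γ} := by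
        refine ⟨fun L => hγα fun w => ?_⟩
        rw [← L.2, ← hd']
        exact finrank_le _
      exact Nat.card_of_isEmpty
    refine ⟨0, fun n => by simp, fun k' _ _ T' _ _ hd' => ?_, ?_⟩
    · rw [hP k' T' hd']; simp
    · rw [hP k T hdim]; simp

end HallPaper
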